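/- Fix a real α with 1 < α < 9/4 and a real ϑ with 0 < ϑ < Φ(α), where Φ(α) = 3α/(10α−4) for 1 < α < 26/23, Φ(α) = 13/28 for 26/23 ≤ α < 2, Φ(α) = 13α/(34α−12) for 2 ≤ α < 23/11, and Φ(α) = 7α/(20α−10) for 23/11 ≤ α < 9/4. Then there are infinitely many primes p such that PS_α(p−1) ≥ p^ϑ. -/

import Mathlib

open scoped BigOperators Classical

/-- `PS_α(n)`, the largest divisor of `n` of the form `⌊j^α⌋` with `j ∈ ℕ`. -/
noncomputable def PSdivisor (α : ℝ) (n : ℕ) : ℕ :=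
  ((n.divisors).filter (fun d => ∃ j : ℕ, d = Nat.floor ((j : ℝ) ^ α))).sup id

/-- The level-of-distribution exponent `Φ(α)`. -/
noncomputable def PhiLevel (α : ℝ) : ℝ :=
  if α < 26 / 23 then 3 * α / (10 * α - 4)
  else if α < 2 then 13 / 28
  else if α < 23 / 11 then 13 * α / (34 * α - 12)
  else 7 * α / (20 * α - 10)

section
namespace PS

/-- additive character -/
noncomputable def e (t : ℝ) : ℂ := Complex.exp ((2 * Real.pi * t : ℝ) * Complex.I)

/-- distance to nearest integer -/
noncomputable def nd (t : ℝ) : ℝ := |t - round t|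

lemma e_add (s t : ℝ) : e (s + t) = e s * e t := by
  unfold e; rw [← Complex.exp_add]; congr 1; push_cast; ring

lemma norm_e (t : ℝ) : ‖e t‖ = 1 := by
  unfold e; exact Complex.norm_exp_ofReal_mul_I _

lemma e_zero : e 0 = 1 := by simp [e]

lemma e_neg (t : ℝ) : e (-t) = (starRingEnd ℂ) (e t) := by
  unfold e; rw [← Complex.exp_conj, map_mul, Complex.conj_ofReal, Complex.conj_I]; congr 1
  push_cast; ring

lemma e_int (n : ℤ) : e n = 1 := by
  unfold e
  rw [Complex.exp_eq_one_iff]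
  exact ⟨n, by push_cast; ring⟩

lemma e_add_int (t : ℝ) (n : ℤ) : e (t + n) = e t := by rw [e_add, e_int, mul_one]

lemma e_nat_mul (n : ℕ) (t : ℝ) : e (n * t) = e t ^ n := by
  unfold e; rw [← Complex.exp_nat_mul]; congr 1; push_cast; ring

lemma e_sub (s t : ℝ) : e (s - t) = e s * (starRingEnd ℂ) (e t) := by
  rw [sub_eq_add_neg, e_add, e_neg]

lemma e_eq (t : ℝ) : e t = Real.cos (2 * Real.pi * t) + Real.sin (2 * Real.pi * t) * Complex.I := by
  unfold e; rw [Complex.exp_mul_I]; push_cast; rfl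

lemma e_re (t : ℝ) : (e t).re = Real.cos (2 * Real.pi * t) := by
  unfold e; rw [Complex.exp_ofReal_mul_I_re]

lemma e_eq_one_iff (t : ℝ) : e t = 1 ↔ ∃ n : ℤ, t = n := by
  constructor
  · intro h
    unfold e at h
    rw [Complex.exp_eq_one_iff] at h
    obtain ⟨n, hn⟩ := h
    refine ⟨n, ?_⟩
    have h2 : ((2 * Real.pi * t : ℝ) : ℂ) * Complex.I = ((2 * Real.pi * n : ℝ) : ℂ) * Complex.I := by
      rw [hn]; push_cast; ring
    have h3 := mul_right_cancel₀ Complex.I_ne_zero h2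
    have h4 : 2 * Real.pi * t = 2 * Real.pi * n := by exact_mod_cast h3
    exact mul_left_cancel₀ (by positivity) h4
  · rintro ⟨n, rfl⟩; exact e_int n

lemma norm_one_sub_e (t : ℝ) : ‖1 - e t‖ = 2 * |Real.sin (Real.pi * t)| := by
  have h : ‖1 - e t‖ ^ 2 = (2 * |Real.sin (Real.pi * t)|) ^ 2 := by
    rw [← Complex.normSq_eq_norm_sq, Complex.normSq_apply, e_eq]
    simp only [Complex.sub_re, Complex.one_re, Complex.add_re, Complex.ofReal_re, Complex.mul_re,
      Complex.I_re, Complex.ofReal_im, Complex.I_im, Complex.sub_im, Complex.one_im, Complex.add_im,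
      Complex.mul_im]
    rw [mul_pow, sq_abs, Real.sin_sq_eq_half_sub]
    have := Real.sin_sq_add_cos_sq (2 * Real.pi * t)
    rw [show 2 * (Real.pi * t) = 2 * Real.pi * t by ring]
    nlinarith
  exact (pow_left_inj₀ (norm_nonneg _) (by positivity) two_ne_zero).1 h

lemma nd_nonneg (t : ℝ) : 0 ≤ nd t := abs_nonneg _
lemma nd_le_half (t : ℝ) : nd t ≤ 1 / 2 := abs_sub_round t

lemma nd_add_int (t : ℝ) (n : ℤ) : nd (t + n) = nd t := by
  unfold nd; rw [round_add_intCast]; push_cast; congr 1; ring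

lemma nd_le (t : ℝ) (n : ℤ) : nd t ≤ |t - n| := round_le t n

lemma four_nd_le (t : ℝ) : 4 * nd t ≤ ‖1 - e t‖ := by
  have h1 : ‖1 - e t‖ = ‖1 - e (t - round t)‖ := by
    rw [show e (t - round t) = e t by
      have := e_add_int t (-(round t)); push_cast at this; rw [sub_eq_add_neg]; exact this]
  rw [h1, norm_one_sub_e]
  set s := t - round t with hs
  have hs2 : |s| ≤ 1 / 2 := abs_sub_round t
  have h3 : nd t = |s| := rfl
  rw [h3]
  have h4 : |Real.sin (Real.pi * s)| = Real.sin (Real.pi * |s|) := by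
    rw [Real.abs_sin_eq_sin_abs_of_abs_le_pi, abs_mul, abs_of_pos Real.pi_pos]
    rw [abs_mul, abs_of_pos Real.pi_pos]; nlinarith [Real.pi_pos]
  have h5 := Real.mul_le_sin (x := Real.pi * |s|) (by positivity) (by nlinarith [Real.pi_pos])
  rw [h4]
  have : 2 / Real.pi * (Real.pi * |s|) = 2 * |s| := by field_simp
  linarith

/-- geometric sum bound -/
lemma geom_bound (n : ℕ) (t : ℝ) : ‖∑ k ∈ Finset.range n, e (k * t)‖ * nd t ≤ 1 / 2 := by
  have h : (∑ k ∈ Finset.range n, e (k * t)) * (1 - e t) = 1 - e (n * t) := by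
    simp_rw [e_nat_mul]
    have := geom_sum_mul (e t) n
    linear_combination -this
  have h2 : ‖∑ k ∈ Finset.range n, e (k * t)‖ * ‖1 - e t‖ ≤ 2 := by
    rw [← norm_mul, h]
    calc _ ≤ ‖(1:ℂ)‖ + ‖e (n * t)‖ := norm_sub_le _ _
      _ = 2 := by rw [norm_e]; norm_num
  have h3 := mul_le_mul_of_nonneg_left (four_nd_le t) (norm_nonneg (∑ k ∈ Finset.range n, e (k * t)))
  linarith

lemma geom_triv (n : ℕ) (t : ℝ) : ‖∑ k ∈ Finset.range n, e (k * t)‖ ≤ n := by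
  calc _ ≤ ∑ k ∈ Finset.range n, ‖e (k * t)‖ := norm_sum_le _ _
    _ = n := by simp [norm_e]

/-- cotangent of `π x` -/
noncomputable def kot (x : ℝ) : ℝ := Real.cos (Real.pi * x) / Real.sin (Real.pi * x)

lemma sin_pos_of {x : ℝ} (h0 : 0 < x) (h1 : x < 1) : 0 < Real.sin (Real.pi * x) :=
  Real.sin_pos_of_pos_of_lt_pi (by positivity) (by nlinarith [Real.pi_pos])

lemma kot_anti {x y : ℝ} (h0 : 0 < x) (hxy : x ≤ y) (h1 : y < 1) : kot y ≤ kot x := by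
  have hx := sin_pos_of h0 (lt_of_le_of_lt hxy h1)
  have hy := sin_pos_of (lt_of_lt_of_le h0 hxy) h1
  have h : 0 ≤ Real.sin (Real.pi * y - Real.pi * x) :=
    Real.sin_nonneg_of_nonneg_of_le_pi (by nlinarith [Real.pi_pos]) (by nlinarith [Real.pi_pos])
  rw [Real.sin_sub] at h
  unfold kot
  rw [div_le_div_iff₀ hy hx]
  linarith

lemma sin_ge {x ρ : ℝ} (hρ : 0 < ρ) (h0 : ρ ≤ x) (h1 : x ≤ 1 - ρ) : 2 * ρ ≤ Real.sin (Real.pi * x) := by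
  have key : ∀ y : ℝ, ρ ≤ y → y ≤ 1 / 2 → 2 * ρ ≤ Real.sin (Real.pi * y) := by
    intro y hy hy2
    have h5 := Real.mul_le_sin (x := Real.pi * y) (by have := Real.pi_pos; nlinarith) (by nlinarith [Real.pi_pos])
    have : 2 / Real.pi * (Real.pi * y) = 2 * y := by field_simp
    linarith
  rcases le_total x (1/2) with h | h
  · exact key x h0 h
  · have := key (1 - x) (by linarith) (by linarith)
    rwa [show Real.pi * (1 - x) = Real.pi - Real.pi * x by ring, Real.sin_pi_sub] at this

lemma abs_kot_le {x ρ : ℝ} (hρ : 0 < ρ) (h0 : ρ ≤ x) (h1 : x ≤ 1 - ρ) : |kot x| ≤ 1 / (2 * ρ) := by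
  have h := sin_ge hρ h0 h1
  unfold kot
  rw [abs_div, abs_of_pos (lt_of_lt_of_le (by positivity) h)]
  calc _ ≤ 1 / Real.sin (Real.pi * x) := by
        apply div_le_div_of_nonneg_right (Real.abs_cos_le_one _) (by linarith)
    _ ≤ _ := one_div_le_one_div_of_le (by positivity) h

/-- `1/(1-e(x)) = (1 + i cot πx)/2` -/
lemma inv_one_sub_e {x : ℝ} (h0 : 0 < x) (h1 : x < 1) :
    (1 - e x) * ((1 + kot x * Complex.I) / 2) = 1 := by
  have hx := sin_pos_of h0 h1
  have hs : (Real.sin (Real.pi * x) : ℂ) ≠ 0 := by exact_mod_cast hx.ne'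
  rw [e_eq, show 2 * Real.pi * x = 2 * (Real.pi * x) by ring, Real.cos_two_mul', Real.sin_two_mul]
  unfold kot
  push_cast
  have h2 : (Complex.cos (Real.pi * x)) ^ 2 = 1 - Complex.sin (Real.pi * x) ^ 2 := by
    rw [← Complex.sin_sq_add_cos_sq (Real.pi * x)]; ring
  push_cast at hs
  field_simp
  ring_nf
  rw [Complex.I_sq, h2]
  linear_combination (-(Complex.cos (Real.pi * x) * Complex.I)) * h2

/-- Kusmin–Landau -/
lemma kusmin_landau (φ : ℕ → ℝ) (N : ℕ) (m : ℤ) (ρ : ℝ) (hρ : 0 < ρ)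
    (hmono : ∀ n, n + 1 < N → φ (n + 1) - φ n ≤ φ (n + 2) - φ (n + 1))
    (hlo : ∀ n, n < N → m + ρ ≤ φ (n + 1) - φ n)
    (hhi : ∀ n, n < N → φ (n + 1) - φ n ≤ m + 1 - ρ) :
    ‖∑ n ∈ Finset.range N, e (φ n)‖ ≤ 2 / ρ := by
  rcases Nat.eq_zero_or_pos N with rfl | hN
  · simp; positivity
  set d : ℕ → ℝ := fun n => φ (n + 1) - φ n - m with hd
  set c : ℕ → ℂ := fun n => (1 + kot (d n) * Complex.I) / 2 with hc
  have hd0 : ∀ n, n < N → ρ ≤ d n := fun n hn => by simp only [hd]; linarith [hlo n hn]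
  have hd1 : ∀ n, n < N → d n ≤ 1 - ρ := fun n hn => by simp only [hd]; linarith [hhi n hn]
  have hz : ∀ n, n < N → e (φ n) = (e (φ n) - e (φ (n + 1))) * c n := by
    intro n hn
    have h1 : e (φ (n + 1)) = e (φ n) * e (d n) := by
      rw [← e_add, ← e_add_int (φ n + d n) m]; congr 1; simp only [hd]; ring
    have h2 := inv_one_sub_e (x := d n) (by linarith [hd0 n hn]) (by linarith [hd1 n hn])
    rw [h1, show (e (φ n) - e (φ n) * e (d n)) * c n = e (φ n) * ((1 - e (d n)) * c n) by ring]
    simp only [hc]; rw [h2, mul_one]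
  -- partial summation, by induction
  have hab : ∀ K, K < N → ∑ n ∈ Finset.range (K + 1), e (φ n)
      = e (φ 0) * c 0 - e (φ (K + 1)) * c K + ∑ n ∈ Finset.range K, e (φ (n + 1)) * (c (n + 1) - c n) := by
    intro K
    induction K with
    | zero => intro h; simp only [zero_add, Finset.sum_range_one, Finset.sum_range_zero, add_zero]; linear_combination hz 0 h
    | succ K ih =>
      intro h
      rw [Finset.sum_range_succ, ih (by omega), Finset.sum_range_succ (fun n => e (φ (n + 1)) * (c (n + 1) - c n)) K]
      have := hz (K + 1) h
      linear_combination this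
  have hcn : ∀ n, n < N → ‖c n‖ ≤ 1 / (2 * ρ) := by
    intro n hn
    have h1 := abs_kot_le hρ (hd0 n hn) (hd1 n hn)
    have h2 : ρ ≤ 1 / 2 := by linarith [hd0 n hn, hd1 n hn]
    have h3 : ‖(kot (d n) : ℂ) * Complex.I‖ = |kot (d n)| := by
      rw [norm_mul, Complex.norm_I, mul_one, Complex.norm_real, Real.norm_eq_abs]
    have h4 : ‖c n‖ ≤ (1 + |kot (d n)|) / 2 := by
      simp only [hc]; rw [norm_div, Complex.norm_ofNat]
      apply div_le_div_of_nonneg_right _ (by norm_num)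
      calc _ ≤ ‖(1:ℂ)‖ + _ := norm_add_le _ _
        _ = _ := by rw [h3, norm_one]
    have h5 : 1 ≤ 1 / (2 * ρ) := by rw [le_div_iff₀ (by positivity)]; linarith
    linarith
  have hdiff : ∀ n, n + 1 < N → ‖c (n + 1) - c n‖ = (kot (d n) - kot (d (n + 1))) / 2 := by
    intro n hn
    have h1 : c (n + 1) - c n = (((kot (d (n + 1)) - kot (d n)) / 2 : ℝ) : ℂ) * Complex.I := by
      simp only [hc]; push_cast; ring
    rw [h1, norm_mul, Complex.norm_I, mul_one, Complex.norm_real, Real.norm_eq_abs, abs_of_nonpos]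
    · ring
    · have := kot_anti (x := d n) (y := d (n + 1)) (by linarith [hd0 n (by omega)])
        (by simp only [hd]; have := hmono n hn; simp only [add_assoc] at *; norm_num at *; linarith)
        (by linarith [hd1 (n + 1) hn])
      linarith
  have htel : ∀ K, K < N → ∑ n ∈ Finset.range K, ‖c (n + 1) - c n‖ = (kot (d 0) - kot (d K)) / 2 := by
    intro K
    induction K with
    | zero => simp
    | succ K ih =>
      intro h
      rw [Finset.sum_range_succ, ih (by omega), hdiff K h]; ring
  obtain ⟨K, rfl⟩ : ∃ K, N = K + 1 := ⟨N - 1, by omega⟩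
  rw [hab K (by omega)]
  have h1 := hcn 0 (by omega)
  have h2 := hcn K (by omega)
  have h3 := htel K (by omega)
  have h4 := abs_kot_le hρ (hd0 0 (by omega)) (hd1 0 (by omega))
  have h5 := abs_kot_le hρ (hd0 K (by omega)) (hd1 K (by omega))
  have h6 : ‖∑ n ∈ Finset.range K, e (φ (n + 1)) * (c (n + 1) - c n)‖ ≤ 1 / (2 * ρ) := by
    calc _ ≤ ∑ n ∈ Finset.range K, ‖e (φ (n + 1)) * (c (n + 1) - c n)‖ := norm_sum_le _ _
      _ = ∑ n ∈ Finset.range K, ‖c (n + 1) - c n‖ := by simp only [norm_mul, norm_e, one_mul]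
      _ ≤ _ := by rw [h3]; linarith [le_abs_self (kot (d 0)), neg_abs_le (kot (d K))]
  calc _ ≤ ‖e (φ 0) * c 0 - e (φ (K + 1)) * c K‖ + _ := norm_add_le _ _
    _ ≤ ‖e (φ 0) * c 0‖ + ‖e (φ (K + 1)) * c K‖ + _ := by gcongr; exact norm_sub_le _ _
    _ ≤ 1 / (2 * ρ) + 1 / (2 * ρ) + 1 / (2 * ρ) := by
        rw [norm_mul, norm_mul, norm_e, norm_e, one_mul, one_mul]; gcongr
    _ ≤ 2 / ρ := by
        rw [show 1 / (2 * ρ) = (1 / ρ) / 2 by field_simp, show 2 / ρ = 2 * (1 / ρ) by ring]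
        have : 0 < 1 / ρ := by positivity
        linarith

lemma ordConn_eq_Icc (s : Finset ℕ) (hs : s.Nonempty)
    (h : ∀ a ∈ s, ∀ b ∈ s, ∀ c, a ≤ c → c ≤ b → c ∈ s) : s = Finset.Icc (s.min' hs) (s.max' hs) := by
  ext c
  rw [Finset.mem_Icc]
  constructor
  · intro hc; exact ⟨Finset.min'_le _ _ hc, Finset.le_max' _ _ hc⟩
  · rintro ⟨h1, h2⟩; exact h _ (Finset.min'_mem _ _) _ (Finset.max'_mem _ _) c h1 h2

lemma second_test_aux (φ : ℕ → ℝ) (N : ℕ) (lam C : ℝ) (hl : 0 < lam) (hl1 : lam ≤ 1 / 16) (hC : 1 ≤ C)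
    (hlo : ∀ n, n < N → lam ≤ φ (n + 2) - 2 * φ (n + 1) + φ n)
    (hhi : ∀ n, n < N → φ (n + 2) - 2 * φ (n + 1) + φ n ≤ C * lam) :
    ‖∑ n ∈ Finset.range N, e (φ n)‖ ≤ 5 * C * N * √lam + 10 / √lam := by
  rcases Nat.eq_zero_or_pos N with rfl | hN
  · simp; positivity
  set ρ := √lam with hρ
  have hρ0 : 0 < ρ := Real.sqrt_pos.2 hl
  have hρ2 : ρ * ρ = lam := Real.mul_self_sqrt hl.le
  have hρ4 : ρ ≤ 1 / 4 := by nlinarith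
  set δ : ℕ → ℝ := fun n => φ (n + 1) - φ n with hδ
  have hstep : ∀ n, n < N → lam ≤ δ (n + 1) - δ n ∧ δ (n + 1) - δ n ≤ C * lam := by
    intro n hn
    have h1 := hlo n hn
    have h2 := hhi n hn
    simp only [hδ, add_assoc] at *
    norm_num at *
    constructor <;> linarith
  have hgap : ∀ k a, a + k ≤ N → lam * k ≤ δ (a + k) - δ a ∧ δ (a + k) - δ a ≤ C * lam * k := by
    intro k a
    induction k with
    | zero => intro _; simp
    | succ k ih =>
      intro h
      have h1 := ih (by omega)
      have h2 := hstep (a + k) (by omega)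
      push_cast
      rw [← add_assoc a k 1]
      constructor
      · nlinarith [h1.1, h2.1]
      · nlinarith [h1.2, h2.2]
  have hgap' : ∀ a b, a ≤ b → b ≤ N → lam * ((b : ℝ) - a) ≤ δ b - δ a ∧ δ b - δ a ≤ C * lam * ((b:ℝ) - a) := by
    intro a b hab hb
    have := hgap (b - a) a (by omega)
    rw [show a + (b - a) = b by omega, Nat.cast_sub hab] at this
    exact this
  have hmono : ∀ a b, a ≤ b → b ≤ N → δ a ≤ δ b := by
    intro a b hab hb
    have h1 := (hgap' a b hab hb).1
    have h2 : (a:ℝ) ≤ b := by exact_mod_cast hab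
    nlinarith [mul_nonneg hl.le (sub_nonneg.2 h2)]
  -- the fibers
  set m : ℕ → ℤ := fun n => ⌊δ n + ρ⌋ with hm
  set I := Finset.Icc (m 0) (m (N - 1)) with hI
  have hmaps : ∀ n ∈ Finset.range N, m n ∈ I := by
    intro n hn
    rw [Finset.mem_range] at hn
    rw [hI, Finset.mem_Icc]
    exact ⟨Int.floor_mono (by linarith [hmono 0 n (by omega) (by omega)]),
      Int.floor_mono (by linarith [hmono n (N - 1) (by omega) (by omega)])⟩
  have hsplit : ∑ n ∈ Finset.range N, e (φ n)
      = ∑ k ∈ I, ∑ n ∈ (Finset.range N).filter (fun n => m n = k), e (φ n) :=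
    (Finset.sum_fiberwise_of_maps_to hmaps _).symm
  have hIcard : (I.card : ℝ) ≤ C * lam * N + 2 := by
    have h1 : m 0 ≤ m (N - 1) := (Finset.mem_Icc.1 (hmaps 0 (by simpa using hN))).2
    rw [hI, Int.card_Icc]
    have h2 : ((m (N - 1) + 1 - m 0).toNat : ℝ) = (m (N - 1) : ℝ) + 1 - m 0 := by
      have : (((m (N - 1) + 1 - m 0).toNat : ℤ) : ℝ) = ((m (N - 1) + 1 - m 0 : ℤ) : ℝ) := by
        rw [Int.toNat_of_nonneg (by omega)]
      push_cast at this; exact_mod_cast this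
    rw [h2]
    have h3 : (m (N - 1) : ℝ) ≤ δ (N - 1) + ρ := Int.floor_le _
    have h4 : δ 0 + ρ < m 0 + 1 := Int.lt_floor_add_one _
    have h5 := (hgap' 0 (N - 1) (by omega) (by omega)).2
    have h6 : ((N - 1 : ℕ) : ℝ) ≤ N := by exact_mod_cast Nat.sub_le _ _
    have h7 : C * lam * (((N - 1 : ℕ) : ℝ) - (0:ℕ)) ≤ C * lam * N := by
      rw [Nat.cast_zero, sub_zero]; gcongr
    linarith
  have hfib : ∀ k ∈ I, ‖∑ n ∈ (Finset.range N).filter (fun n => m n = k), e (φ n)‖ ≤ 5 / ρ := by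
    intro k _
    set s := (Finset.range N).filter (fun n => m n = k) with hs
    have hsk : ∀ n ∈ s, n < N ∧ (k : ℝ) - ρ ≤ δ n ∧ δ n < k + 1 - ρ := by
      intro n hn
      rw [hs, Finset.mem_filter, Finset.mem_range] at hn
      have h1 : (k:ℝ) ≤ δ n + ρ := by rw [← hn.2]; exact Int.floor_le _
      have h2 : δ n + ρ < k + 1 := by rw [← hn.2]; exact Int.lt_floor_add_one _
      exact ⟨hn.1, by linarith, by linarith⟩
    have hks : ∀ n, n < N → (k : ℝ) - ρ ≤ δ n → δ n < k + 1 - ρ → n ∈ s := by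
      intro n h1 h2 h3
      rw [hs, Finset.mem_filter, Finset.mem_range]
      exact ⟨h1, Int.floor_eq_iff.2 ⟨by linarith, by linarith⟩⟩
    rw [← Finset.sum_filter_add_sum_filter_not s (fun n => δ n < k + ρ)]
    have hbad : ‖∑ n ∈ s.filter (fun n => δ n < k + ρ), e (φ n)‖ ≤ 3 / ρ := by
      set b := s.filter (fun n => δ n < k + ρ) with hb
      have h1 : ‖∑ n ∈ b, e (φ n)‖ ≤ b.card := by
        calc _ ≤ ∑ n ∈ b, ‖e (φ n)‖ := norm_sum_le _ _
          _ = _ := by simp [norm_e]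
      refine h1.trans ?_
      rcases b.eq_empty_or_nonempty with h | h
      · rw [h]; simp; positivity
      have h2 : b.card ≤ b.max' h + 1 - b.min' h := by
        rw [← Nat.card_Icc]
        apply Finset.card_le_card
        intro c hc; rw [Finset.mem_Icc]; exact ⟨Finset.min'_le _ _ hc, Finset.le_max' _ _ hc⟩
      have h3 := b.min'_mem h
      have h4 := b.max'_mem h
      have h5 : b.min' h ≤ b.max' h := Finset.min'_le _ _ h4
      replace h3 := Finset.mem_filter.1 h3
      replace h4 := Finset.mem_filter.1 h4
      have h6 := hgap' _ _ h5 (by have := (hsk _ h4.1).1; omega)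
      have h7 : (b.card : ℝ) ≤ (b.max' h : ℝ) + 1 - b.min' h := by
        have : (b.card : ℝ) ≤ ((b.max' h + 1 - b.min' h : ℕ) : ℝ) := by exact_mod_cast h2
        rw [Nat.cast_sub (by omega)] at this; push_cast at this; exact this
      have h8 := (hsk _ h3.1).2.1
      have h9 : lam * ((b.max' h : ℝ) - b.min' h) ≤ 2 * ρ := by linarith [h6.1, h4.2]
      have h10 : ((b.max' h : ℝ) - b.min' h) ≤ 2 / ρ := by
        rw [le_div_iff₀ hρ0]
        rw [← hρ2] at h9
        nlinarith
      have h11 : 1 ≤ 1 / ρ := by rw [le_div_iff₀ hρ0]; linarith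
      have : 3 / ρ = 2 / ρ + 1 / ρ := by ring
      linarith
    have hgood : ‖∑ n ∈ s.filter (fun n => ¬ δ n < k + ρ), e (φ n)‖ ≤ 2 / ρ := by
      set g := s.filter (fun n => ¬ δ n < k + ρ) with hg
      rcases g.eq_empty_or_nonempty with h | h
      · rw [h]; simp; positivity
      have hgm : ∀ n ∈ g, n < N ∧ (k : ℝ) + ρ ≤ δ n ∧ δ n < k + 1 - ρ := by
        intro n hn; rw [hg, Finset.mem_filter] at hn
        exact ⟨(hsk n hn.1).1, not_lt.1 hn.2, (hsk n hn.1).2.2⟩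
      have hoc : ∀ a ∈ g, ∀ b ∈ g, ∀ c, a ≤ c → c ≤ b → c ∈ g := by
        intro a ha b hb c hac hcb
        have h1 := hgm a ha
        have h2 := hgm b hb
        have h3 := hmono a c hac (by omega)
        have h4 := hmono c b hcb (by omega)
        rw [hg, Finset.mem_filter]
        exact ⟨hks c (by omega) (by linarith) (by linarith), by linarith⟩
      have heq := ordConn_eq_Icc g h hoc
      set a := g.min' h
      set b := g.max' h
      have ha : a ∈ g := g.min'_mem h
      have hb : b ∈ g := g.max'_mem h
      have hab : a ≤ b := Finset.min'_le _ _ hb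
      have hsum : ∑ n ∈ g, e (φ n) = ∑ n ∈ Finset.range (b + 1 - a), e (φ (a + n)) := by
        rw [heq, show Finset.Icc a b = Finset.Ico a (b + 1) by
          ext c; rw [Finset.mem_Icc, Finset.mem_Ico]; omega]
        exact Finset.sum_Ico_eq_sum_range (fun n => e (φ n)) a (b + 1)
      rw [hsum]
      have hin : ∀ n, n < b + 1 - a → a + n ∈ g := by
        intro n hn; exact hoc a ha b hb _ (by omega) (by omega)
      apply kusmin_landau (fun n => φ (a + n)) (b + 1 - a) k ρ hρ0
      · intro n hn
        have h1 := hmono (a + n) (a + n + 1) (by omega) (by have := (hgm _ (hin (n+1) hn)).1; omega)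
        exact h1
      · intro n hn
        exact (hgm _ (hin n hn)).2.1
      · intro n hn
        exact (hgm _ (hin n hn)).2.2.le
    calc _ ≤ _ + _ := norm_add_le _ _
      _ ≤ 3 / ρ + 2 / ρ := add_le_add hbad hgood
      _ = 5 / ρ := by ring
  rw [hsplit]
  calc _ ≤ ∑ k ∈ I, ‖∑ n ∈ (Finset.range N).filter (fun n => m n = k), e (φ n)‖ := norm_sum_le _ _
    _ ≤ ∑ k ∈ I, 5 / ρ := Finset.sum_le_sum hfib
    _ = I.card * (5 / ρ) := by rw [Finset.sum_const, nsmul_eq_mul]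
    _ ≤ (C * lam * N + 2) * (5 / ρ) := by gcongr
    _ = 5 * C * N * ρ + 10 / ρ := by rw [← hρ2]; field_simp; ring

lemma second_test (φ : ℕ → ℝ) (N : ℕ) (lam C : ℝ) (hl : 0 < lam) (hC : 1 ≤ C)
    (hlo : ∀ n, n < N → lam ≤ φ (n + 2) - 2 * φ (n + 1) + φ n)
    (hhi : ∀ n, n < N → φ (n + 2) - 2 * φ (n + 1) + φ n ≤ C * lam) :
    ‖∑ n ∈ Finset.range N, e (φ n)‖ ≤ 5 * C * N * √lam + 10 / √lam := by
  rcases le_or_gt lam (1 / 16) with h | h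
  · exact second_test_aux φ N lam C hl h hC hlo hhi
  · have h1 : ‖∑ n ∈ Finset.range N, e (φ n)‖ ≤ N := by
      calc _ ≤ ∑ n ∈ Finset.range N, ‖e (φ n)‖ := norm_sum_le _ _
        _ = _ := by simp [norm_e]
    have h2 : 1 / 4 ≤ √lam := Real.le_sqrt_of_sq_le (by norm_num; linarith)
    have h3 : 0 ≤ 10 / √lam := by positivity
    have h4 : (N:ℝ) ≤ 5 * C * N * √lam := by
      have : 1 ≤ 5 * C * √lam := by nlinarith
      nlinarith [Nat.cast_nonneg (α := ℝ) N]
    linarith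

lemma norm_sum_e_neg (φ : ℕ → ℝ) (s : Finset ℕ) : ‖∑ n ∈ s, e (-φ n)‖ = ‖∑ n ∈ s, e (φ n)‖ := by
  simp_rw [e_neg]; rw [← map_sum, Complex.norm_conj]

lemma vdc (z : ℕ → ℂ) (hz : ∀ n, ‖z n‖ ≤ 1) (N T : ℕ) (hT : 1 ≤ T) (hTN : T ≤ N) (B : ℝ)
    (hB : ∀ t, 1 ≤ t → t < T → ‖∑ n ∈ Finset.range (N - t), z (n + t) * (starRingEnd ℂ) (z n)‖ ≤ B)
    (hB0 : 0 ≤ B) :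
    ‖∑ n ∈ Finset.range N, z n‖ ^ 2 ≤ 2 * N ^ 2 / T + 2 * N * B := by
  set S := ∑ n ∈ Finset.range N, z n with hS
  set v : ℕ → ℕ → ℂ := fun k i => if i ≤ k ∧ k - i < N then z (k - i) else 0 with hv
  have h1 : ∀ i ∈ Finset.range T, ∑ k ∈ Finset.range (N + T), v k i = S := by
    intro i hi
    rw [Finset.mem_range] at hi
    rw [← Finset.sum_subset (s₁ := Finset.Ico i (i + N))]
    · rw [Finset.sum_Ico_eq_sum_range, show i + N - i = N by omega, hS]
      apply Finset.sum_congr rfl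
      intro n hn
      rw [Finset.mem_range] at hn
      simp only [hv]
      rw [if_pos (by omega), show i + n - i = n by omega]
    · intro k hk; rw [Finset.mem_Ico] at hk; rw [Finset.mem_range]; omega
    · intro k _ hk; rw [Finset.mem_Ico] at hk; simp only [hv]; rw [if_neg]; omega
  have h2 : ∀ i ∈ Finset.range T, ∀ i' ∈ Finset.range T, i < i' →
      ‖∑ k ∈ Finset.range (N + T), v k i * (starRingEnd ℂ) (v k i')‖ ≤ B := by
    intro i hi i' hi' hlt
    rw [Finset.mem_range] at hi hi'
    have : ∑ k ∈ Finset.range (N + T), v k i * (starRingEnd ℂ) (v k i')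
        = ∑ n ∈ Finset.range (N - (i' - i)), z (n + (i' - i)) * (starRingEnd ℂ) (z n) := by
      rw [← Finset.sum_subset (s₁ := Finset.Ico i' (i + N))]
      · rw [Finset.sum_Ico_eq_sum_range, show i + N - i' = N - (i' - i) by omega]
        apply Finset.sum_congr rfl
        intro n hn
        rw [Finset.mem_range] at hn
        simp only [hv]
        rw [if_pos (by omega), if_pos (by omega), show i' + n - i = n + (i' - i) by omega,
          show i' + n - i' = n by omega]
      · intro k hk; rw [Finset.mem_Ico] at hk; rw [Finset.mem_range]; omega
      · intro k _ hk
        rw [Finset.mem_Ico] at hk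
        simp only [hv]
        by_cases h : i' ≤ k ∧ k - i' < N
        · rw [if_neg (c := i ≤ k ∧ k - i < N) (by omega), zero_mul]
        · rw [if_neg h, map_zero, mul_zero]
    rw [this]
    exact hB _ (by omega) (by omega)
  have h2' : ∀ i ∈ Finset.range T, ∀ i' ∈ Finset.range T,
      ‖∑ k ∈ Finset.range (N + T), v k i * (starRingEnd ℂ) (v k i')‖ ≤ B + if i = i' then (N:ℝ) else 0 := by
    intro i hi i' hi'
    rcases lt_trichotomy i i' with h | h | h
    · rw [if_neg h.ne, add_zero]; exact h2 i hi i' hi' h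
    · subst h
      rw [if_pos rfl]
      rw [Finset.mem_range] at hi
      have h3 : ‖∑ k ∈ Finset.range (N + T), v k i * (starRingEnd ℂ) (v k i)‖ ≤ N := by
        rw [← Finset.sum_subset (s₁ := Finset.Ico i (i + N))]
        · calc _ ≤ ∑ k ∈ Finset.Ico i (i + N), ‖v k i * (starRingEnd ℂ) (v k i)‖ := norm_sum_le _ _
            _ ≤ ∑ k ∈ Finset.Ico i (i + N), (1:ℝ) := by
                apply Finset.sum_le_sum
                intro k _
                rw [norm_mul, Complex.norm_conj]
                have : ‖v k i‖ ≤ 1 := by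
                  simp only [hv]; split_ifs
                  · exact hz _
                  · simp
                nlinarith [norm_nonneg (v k i)]
            _ = N := by simp
        · intro k hk; rw [Finset.mem_Ico] at hk; rw [Finset.mem_range]; omega
        · intro k _ hk; rw [Finset.mem_Ico] at hk; simp only [hv]; rw [if_neg, zero_mul]; omega
      linarith
    · rw [if_neg (by omega), add_zero]
      have := h2 i' hi' i hi h
      rw [← Complex.norm_conj, map_sum]
      simp only [map_mul, Complex.conj_conj]
      simpa only [mul_comm] using this
  have h3 : (T : ℂ) * S = ∑ k ∈ Finset.range (N + T), ∑ i ∈ Finset.range T, v k i := by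
    rw [Finset.sum_comm, Finset.sum_congr rfl h1]; simp
  have h4 : ‖(T:ℂ) * S‖ ^ 2 ≤ (N + T) * ∑ k ∈ Finset.range (N + T), ‖∑ i ∈ Finset.range T, v k i‖ ^ 2 := by
    rw [h3]
    calc _ ≤ (∑ k ∈ Finset.range (N + T), ‖∑ i ∈ Finset.range T, v k i‖) ^ 2 := by
          gcongr; exact norm_sum_le _ _
      _ ≤ (Finset.range (N + T)).card * ∑ k ∈ Finset.range (N + T), ‖∑ i ∈ Finset.range T, v k i‖ ^ 2 :=
          sq_sum_le_card_mul_sum_sq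
      _ = _ := by rw [Finset.card_range]; push_cast; rfl
  have h5 : ∑ k ∈ Finset.range (N + T), ‖∑ i ∈ Finset.range T, v k i‖ ^ 2
      ≤ ∑ i ∈ Finset.range T, ∑ i' ∈ Finset.range T, (B + if i = i' then (N:ℝ) else 0) := by
    have : ((∑ k ∈ Finset.range (N + T), ‖∑ i ∈ Finset.range T, v k i‖ ^ 2 : ℝ) : ℂ)
        = ∑ i ∈ Finset.range T, ∑ i' ∈ Finset.range T, ∑ k ∈ Finset.range (N + T), v k i * (starRingEnd ℂ) (v k i') := by
      push_cast
      rw [Finset.sum_congr rfl (fun i _ => Finset.sum_comm), Finset.sum_comm]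
      apply Finset.sum_congr rfl
      intro k _
      rw [← Complex.mul_conj', map_sum, Finset.sum_mul_sum]
    have h6 : (∑ k ∈ Finset.range (N + T), ‖∑ i ∈ Finset.range T, v k i‖ ^ 2 : ℝ)
        = ‖∑ i ∈ Finset.range T, ∑ i' ∈ Finset.range T, ∑ k ∈ Finset.range (N + T), v k i * (starRingEnd ℂ) (v k i')‖ := by
      rw [← this, Complex.norm_real, Real.norm_of_nonneg (Finset.sum_nonneg fun _ _ => by positivity)]
    rw [h6]
    refine (norm_sum_le _ _).trans (Finset.sum_le_sum fun i hi => ?_)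
    exact (norm_sum_le _ _).trans (Finset.sum_le_sum fun i' hi' => h2' i hi i' hi')
  have h6 : ∑ i ∈ Finset.range T, ∑ i' ∈ Finset.range T, (B + if i = i' then (N:ℝ) else 0) = T ^ 2 * B + T * N := by
    simp only [Finset.sum_add_distrib, Finset.sum_ite_eq, Finset.sum_const, Finset.card_range, nsmul_eq_mul]
    rw [Finset.sum_congr rfl (fun i hi => if_pos hi)]
    simp; ring
  have hT0 : (0:ℝ) < T := by exact_mod_cast hT
  have hTN' : (T:ℝ) ≤ N := by exact_mod_cast hTN
  rw [norm_mul, mul_pow, Complex.norm_natCast] at h4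
  have h7 : (T:ℝ) ^ 2 * ‖S‖ ^ 2 ≤ (N + N) * (T ^ 2 * B + T * N) := by
    refine h4.trans ?_
    rw [← h6]
    gcongr
  have h8 : ‖S‖ ^ 2 ≤ ((N + N) * (T ^ 2 * B + T * N)) / T ^ 2 := by
    rw [le_div_iff₀ (by positivity)]; linarith
  refine h8.trans (le_of_eq ?_)
  field_simp
  ring

/-- the exponential sum over a dyadic block -/
noncomputable def ES (α θ : ℝ) (J : ℕ) : ℂ := ∑ n ∈ Finset.range J, e (θ * ((J + n : ℕ) : ℝ) ^ α)

lemma second_diff_mvt (F F' F'' : ℝ → ℝ) (a : ℝ)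
    (h1 : ∀ u, a ≤ u → HasDerivAt F (F' u) u) (h2 : ∀ u, a ≤ u → HasDerivAt F' (F'' u) u) :
    ∃ ζ, a ≤ ζ ∧ ζ ≤ a + 2 ∧ F (a + 2) - 2 * F (a + 1) + F a = F'' ζ := by
  obtain ⟨ξ, hξ, hξ2⟩ := exists_hasDerivAt_eq_slope (fun u => F (u + 1) - F u) (fun u => F' (u + 1) - F' u)
    (show a < a + 1 by linarith)
    (fun u hu => by
      have e1 := (h1 (u + 1) (by linarith [hu.1])).comp_add_const u 1
      exact (e1.sub (h1 u hu.1)).continuousAt.continuousWithinAt)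
    (fun u hu => by
      have e1 := (h1 (u + 1) (by linarith [hu.1])).comp_add_const u 1
      exact e1.sub (h1 u hu.1.le))
  obtain ⟨ζ, hζ, hζ2⟩ := exists_hasDerivAt_eq_slope F' F'' (show ξ < ξ + 1 by linarith)
    (fun u hu => (h2 u (by linarith [hξ.1, hu.1])).continuousAt.continuousWithinAt)
    (fun u hu => h2 u (by linarith [hξ.1, hu.1]))
  refine ⟨ζ, by linarith [hξ.1, hζ.1], by linarith [hξ.2, hζ.2], ?_⟩
  rw [hζ2]
  have : ξ + 1 - ξ = 1 := by ring
  rw [this, div_one, hξ2]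
  have : a + 1 - a = 1 := by ring
  rw [this, div_one]
  rw [show a + 1 + 1 = a + 2 by ring]
  ring

lemma rpow_between {J u β : ℝ} (hJ : 0 < J) (h1 : J ≤ u) (h2 : u ≤ 3 * J) (hβ : -3 ≤ β) (hβ' : β ≤ 3) :
    J ^ β / 27 ≤ u ^ β ∧ u ^ β ≤ 27 * J ^ β := by
  have hv : u = J * (u / J) := by field_simp
  have hv1 : 1 ≤ u / J := by rw [le_div_iff₀ hJ]; linarith
  have hv3 : u / J ≤ 3 := by rw [div_le_iff₀ hJ]; linarith
  have hp : (u / J) ^ β ≤ 27 := by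
    calc (u / J) ^ β ≤ (u / J) ^ (3:ℝ) := Real.rpow_le_rpow_of_exponent_le hv1 hβ'
      _ ≤ 3 ^ (3:ℝ) := Real.rpow_le_rpow (by linarith) hv3 (by norm_num)
      _ = 27 := by norm_num
  have hm : 1 / 27 ≤ (u / J) ^ β := by
    calc (1:ℝ) / 27 = 3 ^ (-3:ℝ) := by rw [Real.rpow_neg (by norm_num)]; norm_num
      _ ≤ (u / J) ^ (-3:ℝ) := Real.rpow_le_rpow_of_nonpos (by linarith) hv3 (by norm_num)
      _ ≤ _ := Real.rpow_le_rpow_of_exponent_le hv1 hβ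
  rw [hv, Real.mul_rpow hJ.le (by linarith)]
  have hJβ : 0 < J ^ β := Real.rpow_pos_of_pos hJ _
  constructor <;> nlinarith

lemma hasDerivAt_pow2 (θ α u : ℝ) (hu : 0 < u) :
    HasDerivAt (fun u => θ * u ^ α) (θ * α * u ^ (α - 1)) u := by
  have := (Real.hasDerivAt_rpow_const (x := u) (p := α) (Or.inl hu.ne')).const_mul θ
  rw [← mul_assoc] at this; exact this

/-- bounds for second differences of `θ u^α` -/
lemma second_diff_pow {α θ : ℝ} (hα : 1 < α) (hα' : α < 9 / 4) (hθ : 0 < θ) {J : ℕ} (hJ : 1 ≤ J) (n : ℕ) (hn : n < J) :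
    θ * α * (α - 1) * (J:ℝ) ^ (α - 2) / 27 ≤ θ * ((J + (n + 2) : ℕ) : ℝ) ^ α - 2 * (θ * ((J + (n + 1) : ℕ) : ℝ) ^ α) + θ * ((J + n : ℕ) : ℝ) ^ α
    ∧ θ * ((J + (n + 2) : ℕ) : ℝ) ^ α - 2 * (θ * ((J + (n + 1) : ℕ) : ℝ) ^ α) + θ * ((J + n : ℕ) : ℝ) ^ α ≤ 729 * (θ * α * (α - 1) * (J:ℝ) ^ (α - 2) / 27) := by
  have hJ0 : (1:ℝ) ≤ J := by exact_mod_cast hJ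
  have hn' : (n:ℝ) + 1 ≤ J := by exact_mod_cast hn
  obtain ⟨ζ, h1, h2, h3⟩ := second_diff_mvt (fun u => θ * u ^ α) (fun u => θ * α * u ^ (α - 1))
    (fun u => θ * α * (α - 1) * u ^ (α - 1 - 1)) ((J:ℝ) + n)
    (fun u hu => hasDerivAt_pow2 _ _ _ (by have := Nat.cast_nonneg (α := ℝ) n; linarith))
    (fun u hu => hasDerivAt_pow2 _ _ _ (by have := Nat.cast_nonneg (α := ℝ) n; linarith))
  push_cast
  rw [show (J:ℝ) + (n + 2) = J + n + 2 by ring, show (J:ℝ) + (n + 1) = J + n + 1 by ring, h3]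
  have hn0 := Nat.cast_nonneg (α := ℝ) n
  have h4 := rpow_between (J := J) (u := ζ) (β := α - 2) (by linarith) (by linarith) (by linarith) (by linarith) (by linarith)
  rw [show α - 1 - 1 = α - 2 by ring]
  have hc : 0 < θ * α * (α - 1) := by have : 0 < α - 1 := by linarith
                                      positivity
  constructor <;> nlinarith [h4.1, h4.2]

lemma ES_second {α : ℝ} (hα : 1 < α) (hα' : α < 9 / 4) : ∃ C : ℝ, 0 < C ∧ ∀ (J : ℕ) (θ : ℝ), 1 ≤ J → 0 < θ →
    ‖ES α θ J‖ ≤ C * (J * √(θ * (J:ℝ) ^ (α - 2)) + 1 / √(θ * (J:ℝ) ^ (α - 2))) := by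
  set κ := √(α * (α - 1) / 27) with hκ
  have hκ0 : 0 < κ := Real.sqrt_pos.2 (by have : 0 < α - 1 := by linarith
                                          positivity)
  refine ⟨5 * 729 * κ + 10 / κ, by positivity, fun J θ hJ hθ => ?_⟩
  have hJ0 : (0:ℝ) < J := by exact_mod_cast hJ
  set lam := θ * α * (α - 1) * (J:ℝ) ^ (α - 2) / 27 with hl
  have hl0 : 0 < lam := by have : 0 < α - 1 := by linarith
                           positivity
  have h := second_test (fun n => θ * ((J + n : ℕ) : ℝ) ^ α) J lam 729 hl0 (by norm_num)
    (fun n hn => (second_diff_pow hα hα' hθ hJ n hn).1) (fun n hn => (second_diff_pow hα hα' hθ hJ n hn).2)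
  have hs : √lam = κ * √(θ * (J:ℝ) ^ (α - 2)) := by
    rw [hκ, ← Real.sqrt_mul' _ (by positivity)]; congr 1; rw [hl]; ring
  have hq : 0 < √(θ * (J:ℝ) ^ (α - 2)) := Real.sqrt_pos.2 (by positivity)
  refine h.trans ?_
  rw [hs]
  set s := √(θ * (J:ℝ) ^ (α - 2))
  have e1 : 0 ≤ 5 * 729 * κ * (1 / s) := by positivity
  have e2 : 0 ≤ 10 / κ * (J * s) := by positivity
  have e3 : 10 / (κ * s) = 10 / κ * (1 / s) := by field_simp
  rw [e3]; nlinarith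

lemma ES_KL {α : ℝ} (hα : 1 < α) (hα' : α < 9 / 4) (J : ℕ) (θ : ℝ) (hJ : 1 ≤ J) (hθ : 0 < θ)
    (hθ1 : 54 * α * θ * (J:ℝ) ^ (α - 1) ≤ 1) : ‖ES α θ J‖ ≤ 54 * ((J:ℝ) ^ (1 - α) / θ) := by
  have hJ0 : (0:ℝ) < J := by exact_mod_cast hJ
  set ρ := θ * α * (J:ℝ) ^ (α - 1) / 27 with hρ
  have hJp : 0 < (J:ℝ) ^ (α - 1) := by positivity
  have hρ0 : 0 < ρ := by positivity
  have hfd : ∀ n, n < J → ρ ≤ θ * ((J + (n + 1) : ℕ) : ℝ) ^ α - θ * ((J + n : ℕ) : ℝ) ^ α ∧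
      θ * ((J + (n + 1) : ℕ) : ℝ) ^ α - θ * ((J + n : ℕ) : ℝ) ^ α ≤ 27 * (θ * α * (J:ℝ) ^ (α - 1)) := by
    intro n hn
    have hn0 := Nat.cast_nonneg (α := ℝ) n
    have hn' : (n:ℝ) + 1 ≤ J := by exact_mod_cast hn
    have hd : ∀ u : ℝ, (J:ℝ) + n ≤ u → HasDerivAt (fun u => θ * u ^ α) (θ * α * u ^ (α - 1)) u :=
      fun u hu => hasDerivAt_pow2 _ _ _ (by linarith)
    obtain ⟨ζ, hζ, hζ2⟩ := exists_hasDerivAt_eq_slope (fun u => θ * u ^ α) (fun u => θ * α * u ^ (α - 1))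
      (show (J:ℝ) + n < J + n + 1 by linarith)
      (fun u hu => (hd u hu.1).continuousAt.continuousWithinAt) (fun u hu => hd u hu.1.le)
    rw [show (J:ℝ) + n + 1 - (J + n) = 1 by ring, div_one] at hζ2
    push_cast
    rw [show (J:ℝ) + (n + 1) = J + n + 1 by ring, ← hζ2]
    have h4 := rpow_between (J := J) (u := ζ) (β := α - 1) hJ0 (by linarith [hζ.1]) (by linarith [hζ.2]) (by linarith) (by linarith)
    have hc : 0 < θ * α := by positivity
    rw [hρ]
    constructor <;> nlinarith [h4.1, h4.2]
  have h27 : 27 * (θ * α * (J:ℝ) ^ (α - 1)) ≤ 1 / 2 := by nlinarith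
  have hρs : ρ ≤ 1 / 2 := by rw [hρ]; nlinarith
  have h := kusmin_landau (fun n => θ * ((J + n : ℕ) : ℝ) ^ α) J 0 ρ hρ0
    (fun n hn => by
      have := (second_diff_pow hα hα' hθ hJ n (by omega)).1
      have h0 : 0 ≤ θ * α * (α - 1) * (J:ℝ) ^ (α - 2) / 27 := by
        have : 0 < α - 1 := by linarith
        positivity
      linarith)
    (fun n hn => by simp only [Int.cast_zero]; linarith [(hfd n hn).1])
    (fun n hn => by simp only [Int.cast_zero]; linarith [(hfd n hn).2])
  refine h.trans ?_
  have e1 : (J:ℝ) ^ (1 - α) = 1 / (J:ℝ) ^ (α - 1) := by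
    rw [show 1 - α = -(α - 1) by ring, Real.rpow_neg hJ0.le, one_div]
  rw [e1, hρ]
  set P := (J:ℝ) ^ (α - 1)
  rw [show 2 / (θ * α * P / 27) = 54 * (1 / P / θ) / α by field_simp; ring]
  exact div_le_self (by positivity) hα.le

lemma third_diff_pow {α θ s : ℝ} (hα : 1 < α) (hα' : α < 9 / 4) (hs : s * (α - 2) = |α - 2|)
    (hθ : 0 < θ) {J : ℕ} (hJ : 1 ≤ J) (t n : ℕ) (ht : 1 ≤ t) (hn : n < J - t)
    (φ : ℕ → ℝ) (hφ : ∀ n, φ n = s * (θ * ((J + (n + t) : ℕ) : ℝ) ^ α - θ * ((J + n : ℕ) : ℝ) ^ α)) :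
    t * (θ * α * (α - 1) * |α - 2| * (J:ℝ) ^ (α - 3) / 27) ≤ φ (n + 2) - 2 * φ (n + 1) + φ n
    ∧ φ (n + 2) - 2 * φ (n + 1) + φ n ≤ 729 * (t * (θ * α * (α - 1) * |α - 2| * (J:ℝ) ^ (α - 3) / 27)) := by
  have hJ0 : (1:ℝ) ≤ J := by exact_mod_cast hJ
  have ht0 : (1:ℝ) ≤ t := by exact_mod_cast ht
  have hn' : (n:ℝ) + t + 1 ≤ J := by
    have : n + t + 1 ≤ J := by omega
    exact_mod_cast this
  have hn0 := Nat.cast_nonneg (α := ℝ) n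
  obtain ⟨ζ, h1, h2, h3⟩ := second_diff_mvt (fun u => θ * (u + t) ^ α - θ * u ^ α)
    (fun u => θ * α * (u + t) ^ (α - 1) - θ * α * u ^ (α - 1))
    (fun u => θ * α * (α - 1) * (u + t) ^ (α - 1 - 1) - θ * α * (α - 1) * u ^ (α - 1 - 1)) ((J:ℝ) + n)
    (fun u hu => ((hasDerivAt_pow2 θ α (u + t) (by linarith)).comp_add_const u t).sub (hasDerivAt_pow2 _ _ _ (by linarith)))
    (fun u hu => ((hasDerivAt_pow2 (θ * α) (α - 1) (u + t) (by linarith)).comp_add_const u t).sub (hasDerivAt_pow2 _ _ _ (by linarith)))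
  have hd : ∀ u : ℝ, ζ ≤ u → HasDerivAt (fun u => θ * α * (α - 1) * u ^ (α - 2)) (θ * α * (α - 1) * (α - 2) * u ^ (α - 2 - 1)) u :=
    fun u hu => hasDerivAt_pow2 _ _ _ (by linarith)
  obtain ⟨w, hw, hw2⟩ := exists_hasDerivAt_eq_slope (fun u => θ * α * (α - 1) * u ^ (α - 2))
    (fun u => θ * α * (α - 1) * (α - 2) * u ^ (α - 2 - 1))
    (show ζ < ζ + t by linarith)
    (fun u hu => (hd u hu.1).continuousAt.continuousWithinAt) (fun u hu => hd u hu.1.le)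
  rw [show ζ + t - ζ = t by ring, eq_div_iff (by linarith)] at hw2
  have key : φ (n + 2) - 2 * φ (n + 1) + φ n = t * (θ * α * (α - 1) * |α - 2| * w ^ (α - 3)) := by
    rw [hφ, hφ, hφ]
    push_cast
    rw [show (J:ℝ) + (n + 2 + t) = J + n + 2 + t by ring, show (J:ℝ) + (n + 1 + t) = J + n + 1 + t by ring,
      show (J:ℝ) + (n + 2) = J + n + 2 by ring, show (J:ℝ) + (n + 1) = J + n + 1 by ring,
      show (J:ℝ) + (n + t) = J + n + t by ring]
    simp only [show α - 1 - 1 = α - 2 by ring, show α - 2 - 1 = α - 3 by ring] at h3 hw2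
    rw [← hs]
    linear_combination s * h3 - s * hw2
  have h4 := rpow_between (J := J) (u := w) (β := α - 3) (by linarith) (by linarith [hw.1]) (by linarith [hw.2]) (by linarith) (by linarith)
  rw [key]
  have hc : 0 ≤ t * (θ * α * (α - 1) * |α - 2|) := by
    have : 0 < α - 1 := by linarith
    positivity
  constructor <;> nlinarith [h4.1, h4.2]

lemma ES_third_aux {α : ℝ} (hα : 1 < α) (hα' : α < 9 / 4) (h2 : α ≠ 2) : ∃ C : ℝ, 0 < C ∧
    ∀ (J T : ℕ) (θ : ℝ), 1 ≤ T → T ≤ J → 0 < θ →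
    ‖ES α θ J‖ ^ 2 ≤ C * ((J:ℝ) ^ 2 / T + J * (J * √(T * (θ * (J:ℝ) ^ (α - 3))) + 1 / √(θ * (J:ℝ) ^ (α - 3)))) := by
  have ha2 : 0 < |α - 2| := abs_pos.2 (sub_ne_zero.2 h2)
  have ha1 : 0 < α - 1 := by linarith
  obtain ⟨s, hs, hs1⟩ : ∃ s : ℝ, s * (α - 2) = |α - 2| ∧ (s = 1 ∨ s = -1) := by
    rcases le_total 0 (α - 2) with h | h
    · exact ⟨1, by rw [abs_of_nonneg h, one_mul], Or.inl rfl⟩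
    · exact ⟨-1, by rw [abs_of_nonpos h]; ring, Or.inr rfl⟩
  set κ := √(α * (α - 1) * |α - 2| / 27) with hκ
  have hκ0 : 0 < κ := Real.sqrt_pos.2 (by positivity)
  set C := 5 * 729 * κ + 10 / κ with hC
  have hC0 : 0 < C := by positivity
  refine ⟨2 + 2 * C, by positivity, fun J T θ hT hTJ hθ => ?_⟩
  have hJ : 1 ≤ J := hT.trans hTJ
  have hJ0 : (0:ℝ) < J := by exact_mod_cast hJ
  have hT0 : (0:ℝ) < T := by exact_mod_cast hT
  set L := θ * (J:ℝ) ^ (α - 3) with hL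
  have hL0 : 0 < L := by positivity
  set B := C * (J * √(T * L) + 1 / √L) with hB
  have hsL : 0 < √L := Real.sqrt_pos.2 hL0
  have hB0 : 0 ≤ B := by positivity
  have hv := vdc (fun n => e (θ * ((J + n : ℕ) : ℝ) ^ α)) (fun n => (norm_e _).le) J T hT hTJ B ?_ hB0
  · refine hv.trans ?_
    have : 2 * (J:ℝ) ^ 2 / T = 2 * ((J:ℝ) ^ 2 / T) := by ring
    rw [this, hB]
    have e1 : 0 ≤ (J:ℝ) ^ 2 / T := by positivity
    have e2 : 0 ≤ J * (J * √(T * L) + 1 / √L) := by positivity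
    nlinarith
  · intro t ht htT
    have ht0 : (1:ℝ) ≤ t := by exact_mod_cast ht
    set φ : ℕ → ℝ := fun n => s * (θ * ((J + (n + t) : ℕ) : ℝ) ^ α - θ * ((J + n : ℕ) : ℝ) ^ α) with hφ
    have heq : ‖∑ n ∈ Finset.range (J - t), e (θ * ((J + (n + t) : ℕ) : ℝ) ^ α) * (starRingEnd ℂ) (e (θ * ((J + n : ℕ) : ℝ) ^ α))‖
        = ‖∑ n ∈ Finset.range (J - t), e (φ n)‖ := by
      simp_rw [← e_sub, hφ]
      rcases hs1 with rfl | rfl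
      · simp only [one_mul]
      · simp only [neg_one_mul]
        rw [norm_sum_e_neg (fun n => θ * ((J + (n + t) : ℕ) : ℝ) ^ α - θ * ((J + n : ℕ) : ℝ) ^ α)]
    rw [heq]
    set lam := t * (θ * α * (α - 1) * |α - 2| * (J:ℝ) ^ (α - 3) / 27) with hl
    have hl0 : 0 < lam := by positivity
    have hst := second_test φ (J - t) lam 729 hl0 (by norm_num)
      (fun n hn => (third_diff_pow hα hα' hs hθ hJ t n ht hn φ (fun _ => rfl)).1)
      (fun n hn => (third_diff_pow hα hα' hs hθ hJ t n ht hn φ (fun _ => rfl)).2)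
    have hsl : √lam = κ * √(t * L) := by
      rw [hκ, ← Real.sqrt_mul' _ (by positivity)]; congr 1; rw [hl, hL]; ring
    refine hst.trans ?_
    rw [hsl]
    have f1 : √(t * L) ≤ √(T * L) := by
      apply Real.sqrt_le_sqrt
      have : (t:ℝ) ≤ T := by exact_mod_cast htT.le
      gcongr
    have f2 : √L ≤ √(t * L) := Real.sqrt_le_sqrt (by nlinarith)
    have f3 : ((J - t : ℕ) : ℝ) ≤ J := by exact_mod_cast Nat.sub_le _ _
    have f4 : 10 / (κ * √(t * L)) ≤ 10 / κ * (1 / √L) := by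
      rw [show 10 / (κ * √(t * L)) = 10 / κ * (1 / √(t * L)) by field_simp]
      gcongr
    have f5 : 5 * 729 * ((J - t : ℕ) : ℝ) * (κ * √(t * L)) ≤ 5 * 729 * J * (κ * √(T * L)) := by gcongr
    have e1 : 0 ≤ 5 * 729 * κ * (1 / √L) := by positivity
    have e2 : 0 ≤ 10 / κ * (J * √(T * L)) := by positivity
    rw [hB, hC]; nlinarith

/-- Lemma E -/
lemma ES_bound {α σ ε : ℝ} (hα : 1 < α) (hα' : α < 9 / 4) (h2 : α ≠ 2) (hσ0 : 0 < σ) (hσ : σ ≤ 1 / 6)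
    (hσ' : 6 * σ ≤ 3 - α - ε) : ∃ C : ℝ, 0 < C ∧
    ∀ (J : ℕ) (θ : ℝ), 1 ≤ J → 0 < θ → θ ≤ (J:ℝ) ^ ε →
    ‖ES α θ J‖ ≤ C * ((J:ℝ) ^ (1 - α) / θ + (J:ℝ) ^ (1 - σ)) := by
  obtain ⟨C2, hC2, hE2⟩ := ES_second hα hα'
  obtain ⟨C3, hC3, hE3⟩ := ES_third_aux hα hα' h2
  refine ⟨54 + C2 * (1 + √(54 * α)) + (1 + 10 * C3), by positivity, fun J θ hJ hθ hθε => ?_⟩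
  have hJ1 : (1:ℝ) ≤ J := by exact_mod_cast hJ
  have hJ0 : (0:ℝ) < J := by linarith
  have hp1 : 0 ≤ (J:ℝ) ^ (1 - α) / θ := by positivity
  have hp2 : 0 < (J:ℝ) ^ (1 - σ) := by positivity
  rcases le_or_gt (54 * α * θ * (J:ℝ) ^ (α - 1)) 1 with hc | hc
  · have h := ES_KL hα hα' J θ hJ hθ hc
    refine h.trans ?_
    have : 0 ≤ C2 * (1 + √(54 * α)) + (1 + 10 * C3) := by positivity
    nlinarith
  rcases le_or_gt θ ((J:ℝ) ^ (2 - α - 2 * σ)) with hc2 | hc2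
  · have h := hE2 J θ hJ hθ
    set lam := θ * (J:ℝ) ^ (α - 2) with hl
    have hl0 : 0 < lam := by positivity
    have h1 : √lam ≤ (J:ℝ) ^ (-σ) := by
      apply Real.sqrt_le_iff.2 ⟨by positivity, ?_⟩
      rw [← Real.rpow_natCast, ← Real.rpow_mul hJ0.le, hl]
      calc _ ≤ (J:ℝ) ^ (2 - α - 2 * σ) * (J:ℝ) ^ (α - 2) := by gcongr
        _ = _ := by rw [← Real.rpow_add hJ0]; congr 1; push_cast; ring
    have h3 : 1 / √lam ≤ √(54 * α) * (J:ℝ) ^ (1 / 2 : ℝ) := by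
      rw [← Real.sqrt_eq_rpow, ← Real.sqrt_mul (by positivity), one_div, ← Real.sqrt_inv]
      apply Real.sqrt_le_sqrt
      rw [inv_le_iff_one_le_mul₀ hl0]
      have : (J:ℝ) ^ (α - 1) = J * (J:ℝ) ^ (α - 2) := by
        rw [show α - 1 = 1 + (α - 2) by ring, Real.rpow_add hJ0, Real.rpow_one]
      rw [this] at hc
      rw [hl]; nlinarith
    have h4 : (J:ℝ) ^ (1 / 2 : ℝ) ≤ (J:ℝ) ^ (1 - σ) := Real.rpow_le_rpow_of_exponent_le hJ1 (by linarith)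
    have h5 : (J:ℝ) * (J:ℝ) ^ (-σ) = (J:ℝ) ^ (1 - σ) := by
      rw [show 1 - σ = 1 + -σ by ring, Real.rpow_add hJ0, Real.rpow_one]
    have h6 : (J:ℝ) * √lam + 1 / √lam ≤ (1 + √(54 * α)) * (J:ℝ) ^ (1 - σ) := by
      have : (J:ℝ) * √lam ≤ (J:ℝ) ^ (1 - σ) := by rw [← h5]; gcongr
      have : √(54 * α) * (J:ℝ) ^ (1 / 2 : ℝ) ≤ √(54 * α) * (J:ℝ) ^ (1 - σ) := by gcongr
      linarith
    calc _ ≤ C2 * ((1 + √(54 * α)) * (J:ℝ) ^ (1 - σ)) := h.trans (by gcongr)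
      _ = C2 * (1 + √(54 * α)) * (J:ℝ) ^ (1 - σ) := by ring
      _ ≤ (54 + C2 * (1 + √(54 * α)) + (1 + 10 * C3)) * (J:ℝ) ^ (1 - σ) := by gcongr; linarith
      _ ≤ _ := by gcongr; linarith
  · set L := θ * (J:ℝ) ^ (α - 3) with hL
    have hL0 : 0 < L := by positivity
    have hLlo : (J:ℝ) ^ (-1 - 2 * σ) ≤ L := by
      calc _ = (J:ℝ) ^ (2 - α - 2 * σ) * (J:ℝ) ^ (α - 3) := by rw [← Real.rpow_add hJ0]; congr 1; ring
        _ ≤ _ := by rw [hL]; gcongr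
    have hLhi : L ≤ (J:ℝ) ^ (-6 * σ) := by
      calc L ≤ (J:ℝ) ^ ε * (J:ℝ) ^ (α - 3) := by rw [hL]; gcongr
        _ = (J:ℝ) ^ (ε + (α - 3)) := by rw [← Real.rpow_add hJ0]
        _ ≤ _ := Real.rpow_le_rpow_of_exponent_le hJ1 (by linarith)
    have hL1 : L ≤ 1 := hLhi.trans (Real.rpow_le_one_of_one_le_of_nonpos hJ1 (by linarith))
    set R := L ^ (-(1/3) : ℝ) with hR
    have hR1 : 1 ≤ R := Real.one_le_rpow_of_pos_of_le_one_of_nonpos hL0 hL1 (by norm_num)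
    have hRJ : R ≤ J := by
      calc R ≤ ((J:ℝ) ^ (-1 - 2 * σ)) ^ (-(1/3) : ℝ) := Real.rpow_le_rpow_of_nonpos (by positivity) hLlo (by norm_num)
        _ = (J:ℝ) ^ ((1 + 2 * σ) / 3) := by rw [← Real.rpow_mul hJ0.le]; congr 1; ring
        _ ≤ (J:ℝ) ^ (1:ℝ) := Real.rpow_le_rpow_of_exponent_le hJ1 (by linarith)
        _ = J := Real.rpow_one _
    set T := ⌈R⌉₊ with hT
    have hTR : R ≤ T := Nat.le_ceil R
    have hT1 : 1 ≤ T := by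
      have : (1:ℝ) ≤ T := hR1.trans hTR
      exact_mod_cast this
    have hTJ : T ≤ J := Nat.ceil_le.2 hRJ
    have hT2 : (T:ℝ) ≤ 2 * R := by have := Nat.ceil_lt_add_one (show 0 ≤ R by linarith); linarith
    have h := hE3 J T θ hT1 hTJ hθ
    -- each of three terms is ≤ 2 J^(2-2σ)
    have hL13 : L ^ (1/3 : ℝ) ≤ (J:ℝ) ^ (-2 * σ) := by
      calc _ ≤ ((J:ℝ) ^ (-6 * σ)) ^ (1/3 : ℝ) := Real.rpow_le_rpow hL0.le hLhi (by norm_num)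
        _ = _ := by rw [← Real.rpow_mul hJ0.le]; congr 1; ring
    have hsq : ((J:ℝ) ^ (1 - σ)) ^ 2 = (J:ℝ) ^ (2:ℝ) * (J:ℝ) ^ (-2 * σ) := by
      rw [← Real.rpow_natCast, ← Real.rpow_mul hJ0.le, ← Real.rpow_add hJ0]; congr 1; push_cast; ring
    have hJ2 : (J:ℝ) ^ (2:ℝ) = (J:ℝ) ^ 2 := by rw [← Real.rpow_natCast]; norm_num
    rw [hJ2] at hsq
    have t1 : (J:ℝ) ^ 2 / T ≤ ((J:ℝ) ^ (1 - σ)) ^ 2 := by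
      have : 1 / (T:ℝ) ≤ L ^ (1/3 : ℝ) := by
        calc 1 / (T:ℝ) ≤ 1 / R := by gcongr
          _ = _ := by rw [hR, Real.rpow_neg hL0.le, one_div, inv_inv]
      rw [hsq, div_eq_mul_one_div]; gcongr; linarith
    have t2 : √(T * L) ≤ 2 * (J:ℝ) ^ (-2 * σ) := by
      calc √(T * L) ≤ √(4 * (L ^ (1/3 : ℝ)) ^ 2) := by
            apply Real.sqrt_le_sqrt
            have : R * L = (L ^ (1/3 : ℝ)) ^ 2 := by
              rw [← Real.rpow_natCast, ← Real.rpow_mul hL0.le, hR]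
              nth_rw 2 [← Real.rpow_one L]
              rw [← Real.rpow_add hL0]; congr 1; norm_num
            nlinarith [sq_nonneg (L ^ (1/3 : ℝ))]
        _ = 2 * L ^ (1/3 : ℝ) := by
            rw [show 4 * (L ^ (1/3 : ℝ)) ^ 2 = (2 * L ^ (1/3 : ℝ)) ^ 2 by ring, Real.sqrt_sq (by positivity)]
        _ ≤ _ := by gcongr
    have t3 : J * (1 / √L) ≤ ((J:ℝ) ^ (1 - σ)) ^ 2 := by
      have : 1 / √L ≤ (J:ℝ) ^ ((1 + 2 * σ) / 2) := by
        rw [Real.sqrt_eq_rpow, one_div, ← Real.rpow_neg hL0.le]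
        calc _ ≤ ((J:ℝ) ^ (-1 - 2 * σ)) ^ (-(1/2) : ℝ) := Real.rpow_le_rpow_of_nonpos (by positivity) hLlo (by norm_num)
          _ = _ := by rw [← Real.rpow_mul hJ0.le]; congr 1; ring
      calc J * (1 / √L) ≤ J * (J:ℝ) ^ ((1 + 2 * σ) / 2) := by gcongr
        _ = (J:ℝ) ^ (1 + (1 + 2 * σ) / 2) := by rw [Real.rpow_add hJ0, Real.rpow_one]
        _ ≤ (J:ℝ) ^ (2 * (1 - σ)) := Real.rpow_le_rpow_of_exponent_le hJ1 (by linarith)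
        _ = _ := by rw [← Real.rpow_natCast, ← Real.rpow_mul hJ0.le]; congr 1; push_cast; ring
    have h5 : ‖ES α θ J‖ ^ 2 ≤ ((1 + 10 * C3) * (J:ℝ) ^ (1 - σ)) ^ 2 := by
      have h6 : J * (J * √(T * L)) ≤ 2 * ((J:ℝ) ^ (1 - σ)) ^ 2 := by
        rw [hsq]; calc J * (J * √(T * L)) ≤ J * (J * (2 * (J:ℝ) ^ (-2 * σ))) := by gcongr
          _ = _ := by ring
      have h7 : (J:ℝ) ^ 2 / T + J * (J * √(T * L) + 1 / √L) ≤ 4 * ((J:ℝ) ^ (1 - σ)) ^ 2 := by linarith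
      calc _ ≤ C3 * (4 * ((J:ℝ) ^ (1 - σ)) ^ 2) := h.trans (by gcongr)
        _ = 4 * C3 * ((J:ℝ) ^ (1 - σ)) ^ 2 := by ring
        _ ≤ (1 + 10 * C3) ^ 2 * ((J:ℝ) ^ (1 - σ)) ^ 2 := by gcongr; nlinarith
        _ = _ := by ring
    have h8 := abs_le_of_sq_le_sq h5 (by positivity)
    have h9 := (le_abs_self _).trans h8
    have hp0 : 0 ≤ (J:ℝ) ^ (1 - α) / θ := by positivity
    have hp1 : 0 ≤ (J:ℝ) ^ (1 - σ) := by positivity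
    have hp2 : 0 ≤ C2 * (1 + √(54 * α)) := by positivity
    calc _ ≤ _ := h9
      _ ≤ (54 + C2 * (1 + √(54 * α)) + (1 + 10 * C3)) * (J:ℝ) ^ (1 - σ) :=
          mul_le_mul_of_nonneg_right (by linarith) hp1
      _ ≤ _ := by gcongr; linarith

/-- Dirichlet kernel. -/
noncomputable def DK (n : ℕ) (θ : ℝ) : ℂ := ∑ l ∈ Finset.range n, e (l * θ)

lemma DK_neg (n : ℕ) (θ : ℝ) : ‖DK n (-θ)‖ = ‖DK n θ‖ := by
  have : DK n (-θ) = (starRingEnd ℂ) (DK n θ) := by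
    unfold DK; rw [map_sum]; refine Finset.sum_congr rfl fun l _ => ?_
    rw [← e_neg]; congr 1; ring
  rw [this, Complex.norm_conj]

lemma norm_sq_expand {ι : Type*} (s : Finset ι) (f : ι → ℂ) :
    ((‖∑ i ∈ s, f i‖ ^ 2 : ℝ) : ℂ) = ∑ i ∈ s, ∑ j ∈ s, f i * (starRingEnd ℂ) (f j) := by
  rw [← Complex.normSq_eq_norm_sq, Complex.normSq_eq_conj_mul_self, map_sum, Finset.sum_mul_sum,
    Finset.sum_comm]
  refine Finset.sum_congr rfl fun i _ => Finset.sum_congr rfl fun j _ => by ring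

lemma dual_ls_aux {ι : Type*} (s : Finset ι) (β : ι → ℝ) (y : ι → ℂ) (n : ℕ) :
    ∑ l ∈ Finset.range n, ∑ l' ∈ Finset.range n, ‖∑ i ∈ s, y i * e (((l:ℝ) - l') * β i)‖ ^ 2
      ≤ ∑ i ∈ s, ∑ i' ∈ s, ‖y i‖ * ‖y i'‖ * ‖DK n (β i - β i')‖ ^ 2 := by
  have h : ((∑ l ∈ Finset.range n, ∑ l' ∈ Finset.range n, ‖∑ i ∈ s, y i * e (((l:ℝ) - l') * β i)‖ ^ 2 : ℝ) : ℂ)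
      = ∑ i ∈ s, ∑ i' ∈ s, y i * (starRingEnd ℂ) (y i') * ((‖DK n (β i - β i')‖ ^ 2 : ℝ) : ℂ) := by
    rw [Complex.ofReal_sum]
    simp_rw [Complex.ofReal_sum, norm_sq_expand]
    unfold DK
    simp_rw [norm_sq_expand, Finset.mul_sum]
    rw [Finset.sum_congr rfl fun l _ => Finset.sum_comm]
    rw [Finset.sum_comm]
    refine Finset.sum_congr rfl fun i _ => ?_
    rw [Finset.sum_congr rfl fun l _ => Finset.sum_comm]
    rw [Finset.sum_comm]
    refine Finset.sum_congr rfl fun i' _ => ?_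
    refine Finset.sum_congr rfl fun l _ => Finset.sum_congr rfl fun l' _ => ?_
    rw [← e_neg, ← e_add, map_mul, ← e_neg, mul_mul_mul_comm, ← e_add]
    congr 2; ring
  have h2 : (∑ l ∈ Finset.range n, ∑ l' ∈ Finset.range n, ‖∑ i ∈ s, y i * e (((l:ℝ) - l') * β i)‖ ^ 2 : ℝ)
      = ‖((∑ l ∈ Finset.range n, ∑ l' ∈ Finset.range n, ‖∑ i ∈ s, y i * e (((l:ℝ) - l') * β i)‖ ^ 2 : ℝ) : ℂ)‖ := by
    rw [Complex.norm_real, Real.norm_of_nonneg]; positivity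
  rw [h2, h]
  refine (norm_sum_le _ _).trans (Finset.sum_le_sum fun i _ => (norm_sum_le _ _).trans (Finset.sum_le_sum fun i' _ => ?_))
  rw [norm_mul, norm_mul, Complex.norm_conj, Complex.norm_real, Real.norm_of_nonneg (by positivity)]

lemma dual_ls {ι : Type*} (s : Finset ι) (β : ι → ℝ) (N : ℕ) (hN : 1 ≤ N) (b : ℕ → ℂ) (K : ℝ)
    (hK0 : 0 ≤ K)
    (hK : ∀ i ∈ s, ∑ i' ∈ s, ‖DK (2 * N) (β i - β i')‖ ^ 2 ≤ K * N) :
    ∑ i ∈ s, ‖∑ n ∈ Finset.range N, b n * e (n * β i)‖ ^ 2 ≤ K * ∑ n ∈ Finset.range N, ‖b n‖ ^ 2 := by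
  set B : ι → ℂ := fun i => ∑ n ∈ Finset.range N, b n * e (n * β i) with hB
  set y : ι → ℂ := fun i => (starRingEnd ℂ) (B i) with hy
  set c : ℝ → ℂ := fun u => ∑ i ∈ s, y i * e (u * β i) with hc
  set S : ℝ := ∑ i ∈ s, ‖B i‖ ^ 2 with hS
  have hS0 : 0 ≤ S := Finset.sum_nonneg fun _ _ => by positivity
  have hN0 : (0:ℝ) < N := by exact_mod_cast hN
  have h1 : (S : ℂ) = ∑ n ∈ Finset.range N, b n * c n := by
    rw [hS, Complex.ofReal_sum]
    simp_rw [hc, Finset.mul_sum]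
    rw [Finset.sum_comm]
    refine Finset.sum_congr rfl fun i _ => ?_
    rw [← Complex.normSq_eq_norm_sq, Complex.normSq_eq_conj_mul_self]
    change y i * B i = _
    rw [hB, Finset.mul_sum]
    refine Finset.sum_congr rfl fun n _ => by ring
  have h2 : S ≤ ∑ n ∈ Finset.range N, ‖b n‖ * ‖c n‖ := by
    calc S = ‖(S:ℂ)‖ := by rw [Complex.norm_real, Real.norm_of_nonneg hS0]
      _ ≤ _ := by
        rw [h1]; refine (norm_sum_le _ _).trans (Finset.sum_le_sum fun n _ => by rw [norm_mul])
  have h3 : S ^ 2 ≤ (∑ n ∈ Finset.range N, ‖b n‖ ^ 2) * ∑ n ∈ Finset.range N, ‖c n‖ ^ 2 :=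
    (pow_le_pow_left₀ hS0 h2 2).trans (Finset.sum_mul_sq_le_sq_mul_sq _ _ _)
  have h4 : N * ∑ n ∈ Finset.range N, ‖c n‖ ^ 2 ≤
      ∑ l ∈ Finset.range (2 * N), ∑ l' ∈ Finset.range (2 * N), ‖c ((l:ℝ) - l')‖ ^ 2 := by
    rw [Finset.sum_comm]
    calc (N:ℝ) * ∑ n ∈ Finset.range N, ‖c n‖ ^ 2
        = ∑ l' ∈ Finset.range N, ∑ n ∈ Finset.range N, ‖c n‖ ^ 2 := by
          rw [Finset.sum_const, Finset.card_range, nsmul_eq_mul]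
      _ ≤ ∑ l' ∈ Finset.range N, ∑ l ∈ Finset.range (2 * N), ‖c ((l:ℝ) - l')‖ ^ 2 := by
          refine Finset.sum_le_sum fun l' hl' => ?_
          have : ∑ n ∈ Finset.range N, ‖c n‖ ^ 2
              = ∑ l ∈ (Finset.range N).image (fun n => n + l'), ‖c ((l:ℝ) - l')‖ ^ 2 := by
            rw [Finset.sum_image (fun a _ b _ h => by simpa using h)]
            refine Finset.sum_congr rfl fun n _ => by push_cast; simp
          rw [this]
          refine Finset.sum_le_sum_of_subset_of_nonneg ?_ fun _ _ _ => by positivity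
          intro l hl
          simp only [Finset.mem_image, Finset.mem_range] at hl hl' ⊢
          obtain ⟨a, ha, rfl⟩ := hl; omega
      _ ≤ _ := by
          refine Finset.sum_le_sum_of_subset_of_nonneg ?_ fun _ _ _ => by positivity
          intro l hl; simp only [Finset.mem_range] at hl ⊢; omega
  have h5 : ∑ i ∈ s, ∑ i' ∈ s, ‖y i‖ * ‖y i'‖ * ‖DK (2 * N) (β i - β i')‖ ^ 2 ≤ K * N * S := by
    have hs : ∑ i ∈ s, ∑ i' ∈ s, ‖y i‖ ^ 2 * ‖DK (2 * N) (β i - β i')‖ ^ 2 ≤ K * N * S := by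
      rw [hS, Finset.mul_sum]
      refine Finset.sum_le_sum fun i hi => ?_
      rw [← Finset.mul_sum, mul_comm, hy]; simp only [Complex.norm_conj]
      exact mul_le_mul_of_nonneg_right (hK i hi) (by positivity)
    have hs' : ∑ i ∈ s, ∑ i' ∈ s, ‖y i'‖ ^ 2 * ‖DK (2 * N) (β i - β i')‖ ^ 2 ≤ K * N * S := by
      rw [Finset.sum_comm]
      refine le_trans (le_of_eq ?_) hs
      refine Finset.sum_congr rfl fun i _ => Finset.sum_congr rfl fun i' _ => ?_
      rw [← DK_neg, neg_sub]
    have : ∑ i ∈ s, ∑ i' ∈ s, ‖y i‖ * ‖y i'‖ * ‖DK (2 * N) (β i - β i')‖ ^ 2 ≤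
      (1/2) * (∑ i ∈ s, ∑ i' ∈ s, ‖y i‖ ^ 2 * ‖DK (2 * N) (β i - β i')‖ ^ 2)
      + (1/2) * ∑ i ∈ s, ∑ i' ∈ s, ‖y i'‖ ^ 2 * ‖DK (2 * N) (β i - β i')‖ ^ 2 := by
      rw [Finset.mul_sum, Finset.mul_sum, ← Finset.sum_add_distrib]
      refine Finset.sum_le_sum fun i _ => ?_
      rw [Finset.mul_sum, Finset.mul_sum, ← Finset.sum_add_distrib]
      refine Finset.sum_le_sum fun i' _ => ?_
      have : ‖y i‖ * ‖y i'‖ ≤ 1/2 * ‖y i‖^2 + 1/2 * ‖y i'‖^2 := by nlinarith [sq_nonneg (‖y i‖ - ‖y i'‖)]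
      nlinarith [sq_nonneg (‖DK (2 * N) (β i - β i')‖)]
    linarith
  have h6 := h4.trans ((dual_ls_aux s β y (2 * N)).trans h5)
  have h7 : ∑ n ∈ Finset.range N, ‖c n‖ ^ 2 ≤ K * S := by
    have : (N:ℝ) * ∑ n ∈ Finset.range N, ‖c n‖ ^ 2 ≤ N * (K * S) := by linarith
    exact le_of_mul_le_mul_left this hN0
  set b2 := ∑ n ∈ Finset.range N, ‖b n‖ ^ 2 with hb2
  have hb0 : 0 ≤ b2 := Finset.sum_nonneg fun _ _ => by positivity
  rcases hS0.eq_or_lt with h0 | h0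
  · rw [← h0]; positivity
  · have : S * S ≤ S * (K * b2) := by
      calc S * S = S ^ 2 := by ring
        _ ≤ b2 * (K * S) := h3.trans (mul_le_mul_of_nonneg_left h7 hb0)
        _ = _ := by ring
    exact le_of_mul_le_mul_left this h0

lemma sum_e_mod (q : ℕ) (hq : 0 < q) (c : ℤ) :
    ∑ k ∈ Finset.range q, e (k * (c / q)) = if (q:ℤ) ∣ c then (q:ℂ) else 0 := by
  have hq0 : (q:ℝ) ≠ 0 := by positivity
  split_ifs with h
  · obtain ⟨d, rfl⟩ := h
    have : ∀ k ∈ Finset.range q, e (k * (((q * d : ℤ) : ℝ) / q)) = 1 := by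
      intro k _
      rw [show (k:ℝ) * (((q * d : ℤ) : ℝ) / q) = ((k * d : ℤ) : ℝ) by push_cast; field_simp]
      exact e_int _
    rw [Finset.sum_congr rfl this]; simp
  · have hne : e ((c:ℝ) / q) ≠ 1 := by
      rw [Ne, e_eq_one_iff]
      rintro ⟨n, hn⟩
      apply h
      refine ⟨n, ?_⟩
      rw [div_eq_iff hq0] at hn
      have : (c:ℝ) = ((q * n : ℤ) : ℝ) := by push_cast; linarith
      exact_mod_cast this
    simp_rw [e_nat_mul]
    rw [geom_sum_eq hne, ← e_nat_mul, show (q:ℝ) * (c / q) = c by field_simp, e_int]; simp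

lemma sum_fiber (q : ℕ) (hq : 0 < q) (u : ℤ) (a : ℂ) :
    ∑ c ∈ Finset.range q, (if (q:ℤ) ∣ u - c then a else 0) = a := by
  have hq' : (0:ℤ) < q := by exact_mod_cast hq
  rw [Finset.sum_eq_single (u % q).toNat]
  · rw [if_pos]
    rw [Int.toNat_of_nonneg (Int.emod_nonneg _ hq'.ne')]
    exact Int.dvd_self_sub_emod
  · intro c hc hne
    rw [if_neg]
    intro hd
    apply hne
    have h1 : u % q = (c:ℤ) % q := Int.emod_eq_emod_iff_emod_sub_eq_zero.2 (Int.emod_eq_zero_of_dvd hd)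
    rw [h1, Int.emod_eq_of_lt (by positivity) (by exact_mod_cast Finset.mem_range.1 hc)]; simp
  · intro hn
    exfalso; apply hn
    rw [Finset.mem_range]
    have := Int.emod_lt_of_pos u hq'
    have := Int.emod_nonneg u hq'.ne'
    omega

lemma parseval_q {ι : Type*} (q : ℕ) (hq : 0 < q) (s : Finset ι) (f : ι → ℂ) (g : ι → ℤ) :
    ∑ k ∈ Finset.range q, ‖∑ i ∈ s, f i * e (k * (g i / q))‖ ^ 2
      = q * ∑ c ∈ Finset.range q, ‖∑ i ∈ s with (q:ℤ) ∣ g i - c, f i‖ ^ 2 := by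
  have hL : ((∑ k ∈ Finset.range q, ‖∑ i ∈ s, f i * e (k * (g i / q))‖ ^ 2 : ℝ) : ℂ)
      = ∑ i ∈ s, ∑ i' ∈ s, f i * (starRingEnd ℂ) (f i') * (if (q:ℤ) ∣ g i - g i' then (q:ℂ) else 0) := by
    rw [Complex.ofReal_sum]
    simp_rw [norm_sq_expand]
    rw [Finset.sum_comm]
    refine Finset.sum_congr rfl fun i _ => ?_
    rw [Finset.sum_comm]
    refine Finset.sum_congr rfl fun i' _ => ?_
    rw [← sum_e_mod q hq, Finset.mul_sum]
    refine Finset.sum_congr rfl fun k _ => ?_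
    rw [map_mul, ← e_neg, mul_mul_mul_comm, ← e_add]
    congr 2; push_cast; ring
  have hR : ((q * ∑ c ∈ Finset.range q, ‖∑ i ∈ s with (q:ℤ) ∣ g i - c, f i‖ ^ 2 : ℝ) : ℂ)
      = ∑ i ∈ s, ∑ i' ∈ s, f i * (starRingEnd ℂ) (f i') * (if (q:ℤ) ∣ g i - g i' then (q:ℂ) else 0) := by
    rw [Complex.ofReal_mul, Complex.ofReal_sum]
    simp_rw [norm_sq_expand, Finset.sum_filter]
    rw [Finset.sum_comm, Finset.mul_sum]
    refine Finset.sum_congr rfl fun i _ => ?_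
    simp_rw [← Finset.sum_filter]
    simp_rw [Finset.sum_filter]
    have : ∀ c ∈ Finset.range q, (if (q:ℤ) ∣ g i - c then ∑ a ∈ s, (if (q:ℤ) ∣ g a - c then f i * (starRingEnd ℂ) (f a) else 0) else 0)
      = ∑ a ∈ s, if (q:ℤ) ∣ g i - c then (if (q:ℤ) ∣ g i - g a then f i * (starRingEnd ℂ) (f a) else 0) else 0 := by
      intro c _
      split_ifs with h
      · refine Finset.sum_congr rfl fun a _ => ?_
        have : (q:ℤ) ∣ g a - c ↔ (q:ℤ) ∣ g i - g a := by
          constructor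
          · intro h'; have := dvd_sub h h'; simpa using this
          · intro h'; have := dvd_sub h h'; simpa using this
        simp only [this]
      · simp
    rw [Finset.sum_congr rfl this, Finset.sum_comm, Finset.mul_sum]
    refine Finset.sum_congr rfl fun a _ => ?_
    rw [sum_fiber q hq]
    split_ifs <;> simp [mul_comm]
  exact_mod_cast hL.trans hR.symm

lemma card_mod (q M : ℕ) (hq : 0 < q) (S : Finset ℕ) (hS : ∀ m ∈ S, m < M)
    (h : ∀ m ∈ S, ∀ m' ∈ S, (q:ℤ) ∣ (m:ℤ) - m') : (S.card : ℝ) ≤ M / q + 1 := by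
  have h1 : S.card ≤ (Finset.range (M / q + 1)).card := by
    apply Finset.card_le_card_of_injOn (fun m => m / q)
    · intro m hm
      simp only [Finset.coe_range, Set.mem_Iio]
      exact Nat.lt_succ_of_le (Nat.div_le_div_right (hS m hm).le)
    · intro m hm m' hm' heq
      simp only at heq
      have h2 : m % q = m' % q := by
        have h3 : ((m % q : ℕ):ℤ) = ((m' % q : ℕ) : ℤ) := by
          push_cast
          exact Int.emod_eq_emod_iff_emod_sub_eq_zero.2 (Int.emod_eq_zero_of_dvd (h m hm m' hm'))
        exact_mod_cast h3
      rw [← Nat.div_add_mod m q, ← Nat.div_add_mod m' q, heq, h2]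
  rw [Finset.card_range] at h1
  calc (S.card:ℝ) ≤ ((M / q + 1 : ℕ) : ℝ) := by exact_mod_cast h1
    _ ≤ _ := by push_cast; gcongr; exact Nat.cast_div_le

lemma norm_sum_sq_le {ι : Type*} (s : Finset ι) (f : ι → ℂ) :
    ‖∑ i ∈ s, f i‖ ^ 2 ≤ s.card * ∑ i ∈ s, ‖f i‖ ^ 2 := by
  calc _ ≤ (∑ i ∈ s, ‖f i‖) ^ 2 := pow_le_pow_left₀ (norm_nonneg _) (norm_sum_le _ _) 2
    _ ≤ _ := sq_sum_le_card_mul_sum_sq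

lemma parseval_le {ι : Type*} (q : ℕ) (hq : 0 < q) (s : Finset ι) (f : ι → ℂ) (g : ι → ℤ) (R : ℝ)
    (hR : ∀ c < q, ((s.filter (fun i => (q:ℤ) ∣ g i - c)).card : ℝ) ≤ R) :
    ∑ k ∈ Finset.range q, ‖∑ i ∈ s, f i * e (k * (g i / q))‖ ^ 2 ≤ q * (R * ∑ i ∈ s, ‖f i‖ ^ 2) := by
  rw [parseval_q q hq]
  gcongr
  calc _ ≤ ∑ c ∈ Finset.range q, R * ∑ i ∈ s with (q:ℤ) ∣ g i - c, ‖f i‖ ^ 2 := by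
        refine Finset.sum_le_sum fun c hc => (norm_sum_sq_le _ _).trans ?_
        gcongr
        exact hR c (Finset.mem_range.1 hc)
    _ = R * ∑ i ∈ s, ‖f i‖ ^ 2 := by
        rw [← Finset.mul_sum]; congr 1
        simp_rw [Finset.sum_filter]
        rw [Finset.sum_comm]
        refine Finset.sum_congr rfl fun i _ => ?_
        have := sum_fiber q hq (g i) ((‖f i‖^2 : ℝ) : ℂ)
        have h2 : ((∑ c ∈ Finset.range q, (if (q:ℤ) ∣ g i - c then ‖f i‖^2 else 0) : ℝ) : ℂ) = ((‖f i‖^2 : ℝ) : ℂ) := by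
          rw [← this, Complex.ofReal_sum]
          refine Finset.sum_congr rfl fun c _ => ?_
          split_ifs <;> simp
        exact_mod_cast h2

/-- Sum of Dirichlet kernels over a full set of fractions. -/
lemma DK_sum (q n : ℕ) (hq : 0 < q) (β : ℝ) :
    ∑ k ∈ Finset.range q, ‖DK n (β - k / q)‖ ^ 2 ≤ (q:ℝ) ^ 2 * ((n:ℝ) / q + 1) ^ 2 ∧
    (∑ k ∈ Finset.range q, ‖DK n (β - k / q)‖ ^ 2) * nd (q * β) ^ 2 ≤ (q:ℝ) ^ 2 * (1 / 4) := by
  have h0 : ∑ k ∈ Finset.range q, ‖DK n (β - k / q)‖ ^ 2 =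
      q * ∑ c ∈ Finset.range q, ‖∑ l ∈ (Finset.range n).filter (fun l : ℕ => (q:ℤ) ∣ -(l:ℤ) - c), e (l * β)‖ ^ 2 := by
    rw [← parseval_q q hq (Finset.range n) (fun l => e (l * β)) (fun l => -(l:ℤ))]
    refine Finset.sum_congr rfl fun k _ => ?_
    unfold DK
    congr 2
    refine Finset.sum_congr rfl fun l _ => ?_
    rw [← e_add]; congr 1; push_cast; ring
  -- each class is an arithmetic progression
  have hcl : ∀ c ∈ Finset.range q, ∃ m : ℕ, (m:ℝ) ≤ (n:ℝ) / q + 1 ∧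
      ‖∑ l ∈ (Finset.range n).filter (fun l : ℕ => (q:ℤ) ∣ -(l:ℤ) - c), e (l * β)‖ = ‖∑ k ∈ Finset.range m, e (k * (q * β))‖ := by
    intro c hc
    set S := (Finset.range n).filter (fun l : ℕ => (q:ℤ) ∣ -(l:ℤ) - c) with hS
    have hcard : (S.card : ℝ) ≤ n / q + 1 := by
      apply card_mod q n hq S (fun m hm => Finset.mem_range.1 (Finset.mem_filter.1 hm).1)
      intro m hm m' hm'
      have h1 := (Finset.mem_filter.1 hm).2
      have h2 := (Finset.mem_filter.1 hm').2
      have := dvd_sub h2 h1; rw [show -(m':ℤ) - c - (-(m:ℤ) - c) = m - m' by ring] at this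
      exact this
    rcases S.eq_empty_or_nonempty with hE | hE
    · exact ⟨0, by simp; positivity, by rw [hE]; simp⟩
    set a := S.min' hE with ha
    have haS : a ∈ S := S.min'_mem hE
    have han : a < n := Finset.mem_range.1 (Finset.mem_filter.1 haS).1
    have haq := (Finset.mem_filter.1 haS).2
    set m := (n - 1 - a) / q + 1 with hm
    have hSi : S = (Finset.range m).image (fun k => a + k * q) := by
      ext l
      simp only [Finset.mem_image, Finset.mem_range]
      constructor
      · intro hl
        have hle : a ≤ l := S.min'_le l hl
        have h1 := (Finset.mem_filter.1 hl).2
        have h2 : l < n := Finset.mem_range.1 (Finset.mem_filter.1 hl).1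
        have h3 := dvd_sub haq h1
        rw [show -(a:ℤ) - c - (-(l:ℤ) - c) = ((l - a : ℕ) : ℤ) by push_cast [hle]; ring] at h3
        obtain ⟨k, hk⟩ := Int.natCast_dvd_natCast.1 h3
        refine ⟨k, ?_, by rw [mul_comm]; omega⟩
        rw [hm]
        apply Nat.lt_succ_of_le
        rw [Nat.le_div_iff_mul_le hq, mul_comm]; omega
      · rintro ⟨k, hk, rfl⟩
        rw [hm] at hk
        have h1 := (Nat.le_div_iff_mul_le hq).1 (Nat.lt_succ_iff.1 hk)
        refine Finset.mem_filter.2 ⟨Finset.mem_range.2 (by omega), ?_⟩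
        have : -((a + k * q : ℕ):ℤ) - c = (-(a:ℤ) - c) - q * k := by push_cast; ring
        rw [this]
        exact dvd_sub haq (dvd_mul_right _ _)
    have hinj : Set.InjOn (fun k => a + k * q) (Finset.range m : Set ℕ) := by
      intro k _ k' _ h
      simp only [add_right_inj] at h
      exact Nat.eq_of_mul_eq_mul_right hq h
    refine ⟨m, ?_, ?_⟩
    · have : S.card = m := by rw [hSi, Finset.card_image_of_injOn hinj, Finset.card_range]
      rw [← this]; exact hcard
    · rw [hSi, Finset.sum_image hinj]
      have : ∀ k ∈ Finset.range m, e (((a + k * q : ℕ) : ℝ) * β) = e (a * β) * e (k * (q * β)) := by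
        intro k _; rw [← e_add]; congr 1; push_cast; ring
      rw [Finset.sum_congr rfl this, ← Finset.mul_sum, norm_mul, norm_e, one_mul]
  rw [h0]
  constructor
  · calc _ ≤ (q:ℝ) * ∑ c ∈ Finset.range q, ((n:ℝ) / q + 1) ^ 2 := by
          gcongr with c hc
          obtain ⟨m, hm, hm2⟩ := hcl c hc
          rw [hm2]; exact (geom_triv _ _).trans hm
      _ = _ := by rw [Finset.sum_const, Finset.card_range, nsmul_eq_mul]; ring
  · rw [mul_assoc, Finset.sum_mul]
    calc _ ≤ (q:ℝ) * ∑ c ∈ Finset.range q, (1 / 4 : ℝ) := by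
          gcongr with c hc
          obtain ⟨m, hm, hm2⟩ := hcl c hc
          rw [hm2, ← mul_pow]
          calc _ ≤ (1/2 : ℝ) ^ 2 := pow_le_pow_left₀ (mul_nonneg (norm_nonneg _) (nd_nonneg _)) (geom_bound _ _) 2
            _ = _ := by norm_num
      _ = _ := by rw [Finset.sum_const, Finset.card_range, nsmul_eq_mul]; ring

noncomputable def ainv (q m : ℕ) : ℤ := (((m : ZMod q)⁻¹).val : ℤ)

lemma ainv_spec (q m : ℕ) (hq : 0 < q) (h : m.Coprime q) : (q:ℤ) ∣ m * ainv q m - 1 := by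
  have : NeZero q := ⟨hq.ne'⟩
  rw [← ZMod.intCast_zmod_eq_zero_iff_dvd]
  unfold ainv
  push_cast
  rw [ZMod.natCast_zmod_val, ZMod.coe_mul_inv_eq_one m h, sub_self]

/-- The bilinear kernel. -/
noncomputable def Wq (q m n : ℕ) : ℝ :=
  (if (q:ℤ) ∣ (m:ℤ) * n - 1 then 1 else 0) - (if m.Coprime q then 1 / (q:ℝ) else 0)

lemma coprime_of_dvd_sub {q m n : ℕ} (h : (q:ℤ) ∣ (m:ℤ) * n - 1) : m.Coprime q := by
  rw [← Nat.isCoprime_iff_coprime]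
  obtain ⟨d, hd⟩ := h
  exact ⟨n, -d, by linarith⟩

lemma dvd_iff_ainv {q m : ℕ} (hq : 0 < q) (h : m.Coprime q) (n : ℕ) :
    (q:ℤ) ∣ (m:ℤ) * n - 1 ↔ (q:ℤ) ∣ (n:ℤ) - ainv q m := by
  have hs := ainv_spec q m hq h
  have hc : IsCoprime (q:ℤ) (m:ℤ) := (Nat.isCoprime_iff_coprime.2 h).symm
  constructor
  · intro h1
    have h2 := dvd_sub h1 hs
    rw [show (m:ℤ) * n - 1 - (m * ainv q m - 1) = m * (n - ainv q m) by ring] at h2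
    exact hc.dvd_of_dvd_mul_left h2
  · intro h1
    have := dvd_add (dvd_mul_of_dvd_right h1 (m:ℤ)) hs
    rwa [show (m:ℤ) * (n - ainv q m) + (m * ainv q m - 1) = m * n - 1 by ring] at this

lemma W_formula (q m n : ℕ) (hq : 0 < q) (h : m.Coprime q) :
    ((Wq q m n : ℝ) : ℂ) = (1 / (q:ℂ)) * ∑ k ∈ Finset.Ico 1 q, e (k * ((((n:ℤ) - ainv q m : ℤ) : ℝ) / q)) := by
  have hs := sum_e_mod q hq ((n:ℤ) - ainv q m)
  have hq0 : (q:ℂ) ≠ 0 := by exact_mod_cast hq.ne'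
  rw [Finset.range_eq_Ico, Finset.sum_eq_sum_Ico_succ_bot hq] at hs
  simp only [Nat.cast_zero, zero_mul, e_zero, zero_add] at hs
  have hs2 := eq_sub_of_add_eq' hs
  rw [hs2]
  unfold Wq
  rw [if_pos h]
  simp only [dvd_iff_ainv hq h]
  split_ifs
  · push_cast; field_simp
  · push_cast; field_simp; ring

noncomputable def Asum (q M : ℕ) (a : ℕ → ℝ) (k : ℕ) : ℂ :=
  ∑ m ∈ (Finset.range M).filter (fun m => m.Coprime q), (a m : ℂ) * e (k * (((-ainv q m : ℤ) : ℝ) / q))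
noncomputable def Bsum (N : ℕ) (b : ℕ → ℝ) (θ : ℝ) : ℂ :=
  ∑ n ∈ Finset.range N, (b n : ℂ) * e (n * θ)

lemma bil_formula (q M N : ℕ) (hq : 0 < q) (a b : ℕ → ℝ) :
    |∑ m ∈ Finset.range M, ∑ n ∈ Finset.range N, a m * b n * Wq q m n|
      ≤ (1 / (q:ℝ)) * ∑ k ∈ Finset.Ico 1 q, ‖Asum q M a k‖ * ‖Bsum N b (k / q)‖ := by
  have h : ((∑ m ∈ Finset.range M, ∑ n ∈ Finset.range N, a m * b n * Wq q m n : ℝ) : ℂ)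
      = (1 / (q:ℂ)) * ∑ k ∈ Finset.Ico 1 q, Asum q M a k * Bsum N b (k / q) := by
    have h1 : ∀ m ∈ Finset.range M, (∑ n ∈ Finset.range N, a m * b n * Wq q m n)
        = if m.Coprime q then (∑ n ∈ Finset.range N, a m * b n * Wq q m n) else 0 := by
      intro m _
      split_ifs with hc
      · rfl
      · apply Finset.sum_eq_zero
        intro n _
        unfold Wq
        rw [if_neg hc, if_neg (fun hd => hc (coprime_of_dvd_sub hd))]; simp
    rw [Finset.sum_congr rfl h1, ← Finset.sum_filter, Complex.ofReal_sum, Finset.mul_sum]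
    have h2 : ∀ k ∈ Finset.Ico 1 q, (1 / (q:ℂ)) * (Asum q M a k * Bsum N b (k / q))
      = ∑ m ∈ (Finset.range M).filter (fun m => m.Coprime q), ∑ n ∈ Finset.range N,
        (a m : ℂ) * b n * ((1 / (q:ℂ)) * e (k * ((((n:ℤ) - ainv q m : ℤ) : ℝ) / q))) := by
      intro k _
      unfold Asum Bsum
      rw [Finset.sum_mul_sum, Finset.mul_sum]
      refine Finset.sum_congr rfl fun m _ => ?_
      rw [Finset.mul_sum]
      refine Finset.sum_congr rfl fun n _ => ?_
      rw [show (k:ℝ) * ((((n:ℤ) - ainv q m : ℤ) : ℝ) / q) = (k * (((-ainv q m : ℤ) : ℝ) / q)) + n * (k / q) by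
        push_cast; ring, e_add]
      ring
    rw [Finset.sum_congr rfl h2, Finset.sum_comm]
    refine Finset.sum_congr rfl fun m hm => ?_
    rw [Finset.sum_comm, Complex.ofReal_sum]
    refine Finset.sum_congr rfl fun n _ => ?_
    rw [← Finset.mul_sum, ← Finset.mul_sum, ← W_formula q m n hq (Finset.mem_filter.1 hm).2]
    push_cast; ring
  rw [← Real.norm_eq_abs, ← Complex.norm_real, h, norm_mul]
  have : ‖(1 / (q:ℂ))‖ = 1 / (q:ℝ) := by simp
  rw [this]
  gcongr
  exact (norm_sum_le _ _).trans (Finset.sum_le_sum fun k _ => by rw [norm_mul])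

lemma A_parseval (q r M : ℕ) (hq : 0 < q) (hr : r ∣ q) (a : ℕ → ℝ) :
    ∑ k ∈ Finset.range r, ‖Asum q M a (k * (q / r))‖ ^ 2 ≤ ((M:ℝ) + r) * ∑ m ∈ Finset.range M, a m ^ 2 := by
  have hr0 : 0 < r := Nat.pos_of_dvd_of_pos hr hq
  have hr1 : (0:ℝ) < r := by exact_mod_cast hr0
  have h1 : ∀ k ∈ Finset.range r, ‖Asum q M a (k * (q / r))‖ ^ 2 =
    ‖∑ m ∈ (Finset.range M).filter (fun m => m.Coprime q), (a m : ℂ) * e (k * (((-ainv q m : ℤ) : ℝ) / r))‖ ^ 2 := by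
    intro k _
    unfold Asum
    congr 2
    refine Finset.sum_congr rfl fun m _ => ?_
    congr 2
    obtain ⟨d, rfl⟩ := hr
    have hd : 0 < d := Nat.pos_of_mul_pos_left hq
    rw [Nat.mul_div_cancel_left _ hr0]
    have : (0:ℝ) < d := by exact_mod_cast hd
    push_cast; field_simp
  rw [Finset.sum_congr rfl h1]
  refine (parseval_le r hr0 _ _ _ ((M:ℝ) / r + 1) ?_).trans ?_
  · intro c _
    apply card_mod r M hr0
    · intro m hm
      exact Finset.mem_range.1 (Finset.mem_filter.1 (Finset.mem_filter.1 hm).1).1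
    · intro m hm m' hm'
      have h2 := (Finset.mem_filter.1 hm)
      have h3 := (Finset.mem_filter.1 hm')
      have hs := (Int.natCast_dvd_natCast.2 hr).trans (ainv_spec q m hq (Finset.mem_filter.1 h2.1).2)
      have hs' := (Int.natCast_dvd_natCast.2 hr).trans (ainv_spec q m' hq (Finset.mem_filter.1 h3.1).2)
      have h4 := dvd_sub h2.2 h3.2
      -- m' * m * (inv m - inv m') = m' - m mod r
      have h5 := dvd_mul_of_dvd_right h4 ((m:ℤ) * m')
      have h6 := dvd_mul_of_dvd_right hs (m':ℤ)
      have h7 := dvd_mul_of_dvd_right hs' (m:ℤ)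
      have := dvd_sub (dvd_add h5 h6) h7
      have h8 : (m:ℤ) - m' = (m:ℤ) * m' * (-ainv q m - c - (-ainv q m' - c)) + m' * (m * ainv q m - 1)
          - m * (m' * ainv q m' - 1) := by ring
      rw [h8]; exact this
  · rw [← mul_assoc, mul_add, mul_div_cancel₀ _ hr1.ne', mul_one]
    gcongr
    calc _ ≤ ∑ m ∈ Finset.range M, ‖((a m : ℝ) : ℂ)‖ ^ 2 :=
          Finset.sum_le_sum_of_subset_of_nonneg (Finset.filter_subset _ _) fun _ _ _ => by positivity
      _ = _ := by simp

lemma bsum_sq (N : ℕ) (b : ℕ → ℝ) : ∑ n ∈ Finset.range N, ‖((b n : ℝ) : ℂ)‖ ^ 2 = ∑ n ∈ Finset.range N, b n ^ 2 := by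
  simp

/-- large denominators -/
lemma bil_large (𝒥 : Finset ℕ) (q : ℕ → ℕ) (Q : ℝ) (L M N : ℕ) (E : ℝ) (hQ : 0 < Q) (hE : 0 ≤ E)
    (hq : ∀ j ∈ 𝒥, Q ≤ q j ∧ (q j : ℝ) ≤ 64 * Q) (hN : Q ≤ N)
    (hA4 : ∀ j₀ ∈ 𝒥, ∀ k : ℕ, 0 < k → k < q j₀ → L < q j₀ / k.gcd (q j₀) →
      ∑ j ∈ 𝒥, 1 / (1 + (N * nd (q j * (k / q j₀)) / Q) ^ 2) ≤ E) (a b : ℕ → ℝ) :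
    ∑ j ∈ 𝒥, ∑ k ∈ (Finset.Ico 1 (q j)).filter (fun k => L < q j / k.gcd (q j)),
      ‖Asum (q j) M a k‖ * ‖Bsum N b (k / q j)‖
    ≤ √(𝒥.card * (M + 64 * Q) * (5380 * N * E)) * (√(∑ m ∈ Finset.range M, a m ^ 2) * √(∑ n ∈ Finset.range N, b n ^ 2)) := by
  have hN0 : (0:ℝ) < N := by linarith
  have hN1 : 1 ≤ N := by exact_mod_cast hN0
  have hqpos : ∀ j ∈ 𝒥, 0 < q j := fun j hj => by
    have := (hq j hj).1; exact_mod_cast (by linarith : (0:ℝ) < q j)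
  rw [Finset.sum_sigma']
  set s := 𝒥.sigma (fun j => (Finset.Ico 1 (q j)).filter (fun k => L < q j / k.gcd (q j))) with hs
  have hA : ∑ i ∈ s, ‖Asum (q i.1) M a i.2‖ ^ 2 ≤ 𝒥.card * (M + 64 * Q) * ∑ m ∈ Finset.range M, a m ^ 2 := by
    rw [hs, Finset.sum_sigma, mul_assoc, ← nsmul_eq_mul, ← Finset.sum_const]
    refine Finset.sum_le_sum fun j hj => ?_
    have h1 := A_parseval (q j) (q j) M (hqpos j hj) dvd_rfl a
    rw [Nat.div_self (hqpos j hj)] at h1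
    simp only [mul_one] at h1
    calc _ ≤ ∑ k ∈ Finset.range (q j), ‖Asum (q j) M a k‖ ^ 2 := by
          refine Finset.sum_le_sum_of_subset_of_nonneg ?_ fun _ _ _ => by positivity
          intro k hk
          simp only [Finset.mem_filter, Finset.mem_Ico] at hk
          exact Finset.mem_range.2 hk.1.2
      _ ≤ _ := h1.trans (by
          apply mul_le_mul_of_nonneg_right
          · linarith [(hq j hj).2]
          · exact Finset.sum_nonneg fun _ _ => sq_nonneg _)
  have hB : ∑ i ∈ s, ‖Bsum N b (i.2 / q i.1)‖ ^ 2 ≤ 5380 * N * E * ∑ n ∈ Finset.range N, b n ^ 2 := by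
    rw [← bsum_sq]
    unfold Bsum
    apply dual_ls s (fun i => (i.2 : ℝ) / q i.1) N hN1 (fun n => (b n : ℂ)) _ (by positivity)
    intro i hi
    simp only [hs, Finset.mem_sigma, Finset.mem_filter, Finset.mem_Ico] at hi
    rw [hs, Finset.sum_sigma]
    set β := (i.2 : ℝ) / q i.1 with hβ
    calc _ ≤ ∑ j ∈ 𝒥, 5380 * (N:ℝ) ^ 2 * (1 / (1 + (N * nd (q j * β) / Q) ^ 2)) := by
          refine Finset.sum_le_sum fun j hj => ?_
          simp only
          have h2 : ∑ k ∈ (Finset.Ico 1 (q j)).filter (fun k => L < q j / k.gcd (q j)), ‖DK (2 * N) (β - k / q j)‖ ^ 2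
            ≤ ∑ k ∈ Finset.range (q j), ‖DK (2 * N) (β - k / q j)‖ ^ 2 := by
            refine Finset.sum_le_sum_of_subset_of_nonneg ?_ fun _ _ _ => by positivity
            intro k hk
            simp only [Finset.mem_filter, Finset.mem_Ico] at hk
            exact Finset.mem_range.2 hk.1.2
          refine h2.trans ?_
          obtain ⟨h3, h4⟩ := DK_sum (q j) (2 * N) (hqpos j hj) β
          set X := ∑ k ∈ Finset.range (q j), ‖DK (2 * N) (β - k / q j)‖ ^ 2
          have hX : 0 ≤ X := Finset.sum_nonneg fun _ _ => by positivity
          have hq1 := (hq j hj).1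
          have hq2 := (hq j hj).2
          have hqp : (0:ℝ) < q j := by linarith
          rw [mul_one_div, le_div_iff₀ (by positivity)]
          have h5 : (q j : ℝ) ^ 2 * (((2 * N : ℕ) : ℝ) / q j + 1) ^ 2 = (2 * N + q j) ^ 2 := by
            rw [← mul_pow]; congr 1; push_cast; field_simp
          rw [h5] at h3
          have h6 : X * (1 + (N * nd (q j * β) / Q) ^ 2) = X + (N / Q) ^ 2 * (X * nd (q j * β) ^ 2) := by ring
          rw [h6]
          have h7 : (2 * N + (q j : ℝ)) ^ 2 ≤ (66 * N) ^ 2 := by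
            apply pow_le_pow_left₀ (by positivity); linarith
          have h8 : (N / Q) ^ 2 * (X * nd (q j * β) ^ 2) ≤ (N / Q) ^ 2 * ((64 * Q) ^ 2 * (1/4)) := by
            exact mul_le_mul_of_nonneg_left (h4.trans (by gcongr)) (by positivity)
          have h9 : ((N:ℝ) / Q) ^ 2 * ((64 * Q) ^ 2 * (1/4)) = 1024 * N ^ 2 := by field_simp; ring
          rw [h9] at h8
          nlinarith
      _ = 5380 * (N:ℝ) ^ 2 * ∑ j ∈ 𝒥, (1 / (1 + (N * nd (q j * β) / Q) ^ 2)) := by rw [Finset.mul_sum]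
      _ ≤ 5380 * (N:ℝ) ^ 2 * E := by
          gcongr
          exact hA4 i.1 hi.1 i.2 (by omega) hi.2.1.2 hi.2.2
      _ = _ := by ring
  calc _ ≤ √(∑ i ∈ s, ‖Asum (q i.1) M a i.2‖ ^ 2) * √(∑ i ∈ s, ‖Bsum N b (i.2 / q i.1)‖ ^ 2) :=
        Real.sum_mul_le_sqrt_mul_sqrt _ _ _
    _ ≤ √(𝒥.card * (M + 64 * Q) * ∑ m ∈ Finset.range M, a m ^ 2) * √(5380 * N * E * ∑ n ∈ Finset.range N, b n ^ 2) := by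
        gcongr
    _ = _ := by
        have e1 : √(𝒥.card * (M + 64 * Q) * ∑ m ∈ Finset.range M, a m ^ 2) =
          √(𝒥.card * (M + 64 * Q)) * √(∑ m ∈ Finset.range M, a m ^ 2) := Real.sqrt_mul (by positivity) _
        have e2 : √(5380 * N * E * ∑ n ∈ Finset.range N, b n ^ 2) =
          √(5380 * N * E) * √(∑ n ∈ Finset.range N, b n ^ 2) := Real.sqrt_mul (by positivity) _
        have e3 : √(𝒥.card * (M + 64 * Q) * (5380 * N * E)) =
          √(𝒥.card * (M + 64 * Q)) * √(5380 * N * E) := Real.sqrt_mul (by positivity) _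
        rw [e1, e2, e3]; ring

noncomputable def Tr (N : ℕ) (b : ℕ → ℝ) (r : ℕ) : ℝ :=
  ∑ k ∈ (Finset.range r).filter (fun k => k.Coprime r), ‖Bsum N b (k / r)‖ ^ 2

lemma farey_nd {r r' k k' L : ℕ} (hr : 0 < r) (hr' : 0 < r') (hrL : r ≤ L) (hrL' : r' ≤ L)
    (hk : k < r) (hk' : k' < r') (hc : k.Coprime r) (hc' : k'.Coprime r') (hne : ¬ (r = r' ∧ k = k')) :
    1 / (L:ℝ) ^ 2 ≤ nd ((k:ℝ) / r - k' / r') := by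
  have hr1 : (0:ℝ) < r := by exact_mod_cast hr
  have hr1' : (0:ℝ) < r' := by exact_mod_cast hr'
  unfold nd
  set g := round ((k:ℝ) / r - k' / r')
  have h1 : (k:ℝ) / r - k' / r' - g = ((k * r' - k' * r - g * (r * r') : ℤ) : ℝ) / (r * r') := by
    push_cast; field_simp
  rw [h1, abs_div, abs_of_pos (by positivity : (0:ℝ) < r * r')]
  have h2 : ((k:ℤ) * r' - k' * r - g * (r * r')) ≠ 0 := by
    intro h0
    have hrr : r ∣ r' := by
      have : (r:ℤ) ∣ k * r' := ⟨k' + g * r', by linarith⟩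
      have h3 : r ∣ k * r' := by exact_mod_cast this
      exact hc.symm.dvd_of_dvd_mul_left h3
    have hrr' : r' ∣ r := by
      have : (r':ℤ) ∣ k' * r := ⟨k - g * r, by linarith⟩
      have h3 : r' ∣ k' * r := by exact_mod_cast this
      exact hc'.symm.dvd_of_dvd_mul_left h3
    have hE := Nat.dvd_antisymm hrr hrr'
    subst hE
    apply hne
    refine ⟨rfl, ?_⟩
    have h4 : (r:ℤ) * (k - k' - g * r) = 0 := by linarith
    have h5 : (k:ℤ) - k' - g * r = 0 := by
      rcases mul_eq_zero.1 h4 with h | h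
      · exfalso; omega
      · exact h
    have : (k:ℤ) % r = k' % r := by
      rw [Int.emod_eq_emod_iff_emod_sub_eq_zero]
      exact Int.emod_eq_zero_of_dvd ⟨g, by linarith⟩
    have h6 : k % r = k' % r := by exact_mod_cast this
    rwa [Nat.mod_eq_of_lt hk, Nat.mod_eq_of_lt hk'] at h6
  have h3 : (1:ℝ) ≤ |((k * r' - k' * r - g * (r * r') : ℤ) : ℝ)| := by
    rw [← Int.cast_abs]; exact_mod_cast Int.one_le_abs h2
  have hLr : (r:ℝ) ≤ L := by exact_mod_cast hrL
  have hLr' : (r':ℝ) ≤ L := by exact_mod_cast hrL'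
  have hL0 : (0:ℝ) < L := by linarith
  rw [div_le_div_iff₀ (by positivity) (by positivity), one_mul]
  calc (r:ℝ) * r' ≤ L * L := by gcongr
    _ = 1 * (L:ℝ)^2 := by ring
    _ ≤ _ := by gcongr

lemma Tr_sum (L N : ℕ) (hN : 1 ≤ N) (hL : L ^ 3 ≤ N) (b : ℕ → ℝ) :
    ∑ r ∈ Finset.Icc 2 L, Tr N b r ≤ 5 * N * ∑ n ∈ Finset.range N, b n ^ 2 := by
  unfold Tr
  rw [Finset.sum_sigma', ← bsum_sq]
  unfold Bsum
  set s := (Finset.Icc 2 L).sigma (fun r => (Finset.range r).filter (fun k => k.Coprime r)) with hs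
  apply dual_ls s (fun i => (i.2 : ℝ) / i.1) N hN (fun n => (b n : ℂ)) _ (by positivity)
  intro i hi
  have hcard : (s.card : ℝ) ≤ L ^ 2 := by
    have : s.card ≤ L ^ 2 := by
      rw [hs, Finset.card_sigma]
      calc _ ≤ ∑ r ∈ Finset.Icc 2 L, L := by
            refine Finset.sum_le_sum fun r hr => ?_
            calc _ ≤ (Finset.range r).card := Finset.card_filter_le _ _
              _ ≤ L := by rw [Finset.card_range]; exact (Finset.mem_Icc.1 hr).2
        _ ≤ _ := by
            rw [Finset.sum_const, Nat.card_Icc, smul_eq_mul, sq]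
            gcongr; omega
    exact_mod_cast this
  have hmem : ∀ i ∈ s, (2 ≤ i.1 ∧ i.1 ≤ L) ∧ i.2 < i.1 ∧ i.2.Coprime i.1 := by
    intro i hi
    simpa [hs] using hi
  have hL3 : (L:ℝ) ^ 3 ≤ N := by exact_mod_cast hL
  have hL2 : 2 ≤ L := (hmem i hi).1.1.trans (hmem i hi).1.2
  have hL0 : (0:ℝ) < L := by exact_mod_cast (by omega : 0 < L)
  rw [← Finset.add_sum_erase s _ hi]
  have h1 : ‖DK (2 * N) ((i.2:ℝ) / i.1 - i.2 / i.1)‖ ^ 2 ≤ 4 * N ^ 2 := by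
    calc _ ≤ (((2 * N : ℕ)) : ℝ) ^ 2 := pow_le_pow_left₀ (norm_nonneg _) (geom_triv _ _) 2
      _ = _ := by push_cast; ring
  have h2 : ∑ i' ∈ s.erase i, ‖DK (2 * N) ((i.2:ℝ) / i.1 - i'.2 / i'.1)‖ ^ 2 ≤ L ^ 2 * (L ^ 4 / 4) := by
    calc _ ≤ ∑ i' ∈ s.erase i, ((L:ℝ) ^ 4 / 4) := by
          refine Finset.sum_le_sum fun i' hi' => ?_
          have hi1 := hmem i hi
          have hi2 := hmem i' (Finset.mem_of_mem_erase hi')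
          have h3 := farey_nd (by omega) (by omega) hi1.1.2 hi2.1.2 hi1.2.1 hi2.2.1 hi1.2.2 hi2.2.2
            (fun ⟨h, h'⟩ => (Finset.ne_of_mem_erase hi') (by
              rcases i with ⟨x, y⟩; rcases i' with ⟨x', y'⟩; simp only at h h'; rw [h, h']))
          have h4 := geom_bound (2 * N) ((i.2:ℝ) / i.1 - i'.2 / i'.1)
          change ‖DK _ _‖ * _ ≤ _ at h4
          set X := ‖DK (2 * N) ((i.2:ℝ) / i.1 - i'.2 / i'.1)‖
          have hX0 : 0 ≤ X := norm_nonneg _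
          have h5 : X * (1 / (L:ℝ)^2) ≤ 1/2 := (mul_le_mul_of_nonneg_left h3 hX0).trans h4
          have h6 : X ≤ L ^ 2 / 2 := by
            rw [mul_one_div, div_le_iff₀ (by positivity)] at h5; linarith
          calc X ^ 2 ≤ ((L:ℝ) ^ 2 / 2) ^ 2 := pow_le_pow_left₀ hX0 h6 2
            _ = _ := by ring
      _ = ((s.erase i).card : ℝ) * (L ^ 4 / 4) := by rw [Finset.sum_const, nsmul_eq_mul]
      _ ≤ _ := by
          gcongr
          refine le_trans ?_ hcard
          exact_mod_cast Finset.card_le_card (Finset.erase_subset _ _)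
  have h3 : (L:ℝ) ^ 2 * (L ^ 4 / 4) ≤ N ^ 2 := by
    have : ((L:ℝ) ^ 3) ^ 2 ≤ N ^ 2 := pow_le_pow_left₀ (by positivity) hL3 2
    nlinarith [sq_nonneg ((L:ℝ)^3)]
  calc _ ≤ 4 * (N:ℝ) ^ 2 + N ^ 2 := add_le_add h1 (h2.trans h3)
    _ = _ := by ring

lemma bil_small_inner (q r M N : ℕ) (hq : 0 < q) (hr : r ∣ q) (a b : ℕ → ℝ) :
    ∑ k ∈ (Finset.Ico 1 q).filter (fun k => q / k.gcd q = r), ‖Asum q M a k‖ * ‖Bsum N b (k / q)‖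
    ≤ √(((M:ℝ) + r) * ∑ m ∈ Finset.range M, a m ^ 2) * √(Tr N b r) := by
  have hr0 : 0 < r := Nat.pos_of_dvd_of_pos hr hq
  obtain ⟨d, hd⟩ := hr
  have hd0 : 0 < d := by rcases Nat.eq_zero_or_pos d with h | h; · simp [h] at hd; omega
                         · exact h
  have hqr : q / r = d := by rw [hd, Nat.mul_div_cancel_left _ hr0]
  set S := (Finset.Ico 1 q).filter (fun k => q / k.gcd q = r) with hS
  have hk : ∀ k ∈ S, k = (k / d) * d ∧ k / d < r ∧ (k / d).Coprime r := by
    intro k hk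
    simp only [hS, Finset.mem_filter, Finset.mem_Ico] at hk
    have hg : k.gcd q = d := by
      have h1 : k.gcd q * r = q := by
        rw [← hk.2]; exact Nat.mul_div_cancel' (Nat.gcd_dvd_right k q)
      rw [hd, mul_comm r d] at h1
      have h2 := Nat.eq_of_mul_eq_mul_right hr0 h1
      rw [hd]; rw [mul_comm r d]; exact h2
    have hdk : d ∣ k := hg ▸ Nat.gcd_dvd_left k q
    refine ⟨(Nat.div_mul_cancel hdk).symm, ?_, ?_⟩
    · rw [Nat.div_lt_iff_lt_mul hd0, ← hd]; exact hk.1.2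
    · have := Nat.coprime_div_gcd_div_gcd (m := k) (n := q) (by rw [hg]; exact hd0)
      rw [hg] at this
      rwa [show q / d = r by rw [hd, Nat.mul_div_cancel _ hd0]] at this
  have hinj : Set.InjOn (fun k => k / d) (S : Set ℕ) := by
    intro k h1 k' h2 h
    simp only at h
    rw [(hk k h1).1, (hk k' h2).1, h]
  have hA : ∑ k ∈ S, ‖Asum q M a k‖ ^ 2 ≤ ((M:ℝ) + r) * ∑ m ∈ Finset.range M, a m ^ 2 := by
    refine le_trans ?_ (A_parseval q r M hq ⟨d, hd⟩ a)
    rw [hqr]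
    calc _ = ∑ k ∈ S.image (fun k => k / d), ‖Asum q M a (k * d)‖ ^ 2 := by
          rw [Finset.sum_image hinj]
          refine Finset.sum_congr rfl fun k h => ?_
          rw [← (hk k h).1]
      _ ≤ _ := by
          refine Finset.sum_le_sum_of_subset_of_nonneg ?_ fun _ _ _ => by positivity
          intro k h
          obtain ⟨k', h', rfl⟩ := Finset.mem_image.1 h
          exact Finset.mem_range.2 (hk k' h').2.1
  have hB : ∑ k ∈ S, ‖Bsum N b (k / q)‖ ^ 2 ≤ Tr N b r := by
    unfold Tr
    calc _ = ∑ k ∈ S.image (fun k => k / d), ‖Bsum N b (k / r)‖ ^ 2 := by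
          rw [Finset.sum_image hinj]
          refine Finset.sum_congr rfl fun k h => ?_
          congr 3
          conv_lhs => rw [(hk k h).1]
          rw [hd]
          have : (0:ℝ) < d := by exact_mod_cast hd0
          have : (0:ℝ) < r := by exact_mod_cast hr0
          push_cast; field_simp
      _ ≤ _ := by
          refine Finset.sum_le_sum_of_subset_of_nonneg ?_ fun _ _ _ => by positivity
          intro k h
          obtain ⟨k', h', rfl⟩ := Finset.mem_image.1 h
          exact Finset.mem_filter.2 ⟨Finset.mem_range.2 (hk k' h').2.1, (hk k' h').2.2⟩
  calc _ ≤ √(∑ k ∈ S, ‖Asum q M a k‖ ^ 2) * √(∑ k ∈ S, ‖Bsum N b (k / q)‖ ^ 2) :=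
        Real.sum_mul_le_sqrt_mul_sqrt _ _ _
    _ ≤ _ := by gcongr

lemma bil_small (𝒥 : Finset ℕ) (q : ℕ → ℕ) (L M N : ℕ) (z G : ℝ) (hG : 0 ≤ G) (hz : 1 ≤ z)
    (hqpos : ∀ j ∈ 𝒥, 0 < q j) (hN : 1 ≤ N) (hL : L ^ 3 ≤ N)
    (hrough : ∀ j ∈ 𝒥, ∀ p : ℕ, p.Prime → p ∣ q j → z ≤ p)
    (hmult : ∀ r : ℕ, 2 ≤ r → r ≤ L → ((𝒥.filter (fun j => r ∣ q j)).card : ℝ) ≤ 𝒥.card * G / r)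
    (a b : ℕ → ℝ) :
    ∑ j ∈ 𝒥, ∑ k ∈ (Finset.Ico 1 (q j)).filter (fun k => ¬ L < q j / k.gcd (q j)),
      ‖Asum (q j) M a k‖ * ‖Bsum N b (k / q j)‖
    ≤ 𝒥.card * G * √(M + L) * √(20 * N / z) * (√(∑ m ∈ Finset.range M, a m ^ 2) * √(∑ n ∈ Finset.range N, b n ^ 2)) := by
  set na := √(∑ m ∈ Finset.range M, a m ^ 2) with hna
  set nb := √(∑ n ∈ Finset.range N, b n ^ 2) with hnb
  have hTr0 : ∀ r, 0 ≤ Tr N b r := fun r => Finset.sum_nonneg fun _ _ => by positivity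
  set k0 := ⌈z⌉₊ - 1 with hk0
  have hzk : z ≤ (k0:ℝ) + 1 := by
    have h1 := Nat.le_ceil z
    have h2 : 1 ≤ ⌈z⌉₊ := Nat.one_le_ceil_iff.2 (by linarith)
    have : ((k0 + 1 : ℕ) : ℝ) = ⌈z⌉₊ := by rw [hk0]; congr 1; omega
    push_cast at this; linarith
  have hstep : ∀ j ∈ 𝒥, ∑ k ∈ (Finset.Ico 1 (q j)).filter (fun k => ¬ L < q j / k.gcd (q j)),
      ‖Asum (q j) M a k‖ * ‖Bsum N b (k / q j)‖
      ≤ ∑ r ∈ Finset.Icc 2 L, if r ∣ q j then √(M + L) * na * √(Tr N b r) else 0 := by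
    intro j hj
    have hmaps : ∀ k ∈ (Finset.Ico 1 (q j)).filter (fun k => ¬ L < q j / k.gcd (q j)),
        q j / k.gcd (q j) ∈ (Finset.Icc 2 L).filter (fun r => r ∣ q j) := by
      intro k hk
      simp only [Finset.mem_filter, Finset.mem_Ico, not_lt] at hk
      have hg : k.gcd (q j) ≤ k := Nat.gcd_le_left _ (by omega)
      have hgd := Nat.gcd_dvd_right k (q j)
      have hgp : 0 < k.gcd (q j) := Nat.gcd_pos_of_pos_right _ (hqpos j hj)
      refine Finset.mem_filter.2 ⟨Finset.mem_Icc.2 ⟨?_, hk.2⟩, Nat.div_dvd_of_dvd hgd⟩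
      obtain ⟨u, hu⟩ := hgd
      have : q j / k.gcd (q j) = u := Nat.div_eq_of_eq_mul_right hgp hu
      rw [this]
      by_contra hlt
      have hu1 : u = 0 ∨ u = 1 := by omega
      rcases hu1 with h | h
      · rw [h] at hu; have := hqpos j hj; omega
      · rw [h, mul_one] at hu; omega
    rw [← Finset.sum_fiberwise_of_maps_to hmaps, ← Finset.sum_filter]
    refine Finset.sum_le_sum fun r hr => ?_
    obtain ⟨hr1, hr2⟩ := Finset.mem_filter.1 hr
    calc _ ≤ ∑ k ∈ (Finset.Ico 1 (q j)).filter (fun k => q j / k.gcd (q j) = r), ‖Asum (q j) M a k‖ * ‖Bsum N b (k / q j)‖ := by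
          refine Finset.sum_le_sum_of_subset_of_nonneg ?_ fun _ _ _ => by positivity
          intro k hk
          simp only [Finset.mem_filter] at hk ⊢
          exact ⟨hk.1.1, hk.2⟩
      _ ≤ _ := bil_small_inner (q j) r M N (hqpos j hj) hr2 a b
      _ ≤ _ := by
          rw [Real.sqrt_mul (by positivity)]
          gcongr
          exact (Finset.mem_Icc.1 hr1).2
  have hmult2 : ∀ r ∈ Finset.Icc 2 L, ((𝒥.filter (fun j => r ∣ q j)).card : ℝ) ≤
      if k0 < r then 𝒥.card * G / r else 0 := by
    intro r hr
    obtain ⟨h2, hL⟩ := Finset.mem_Icc.1 hr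
    split_ifs with h
    · exact hmult r h2 hL
    · have : 𝒥.filter (fun j => r ∣ q j) = ∅ := by
        rw [Finset.filter_eq_empty_iff]
        intro j hj hd
        have hp := Nat.minFac_prime (n := r) (by omega)
        have h3 := hrough j hj r.minFac hp ((Nat.minFac_dvd r).trans hd)
        have h4 : ⌈z⌉₊ ≤ r.minFac := Nat.ceil_le.2 h3
        have h5 : r.minFac ≤ r := Nat.minFac_le (by omega)
        have h6 : 1 ≤ ⌈z⌉₊ := Nat.one_le_ceil_iff.2 (by linarith)
        omega
      rw [this]; simp
  calc _ ≤ ∑ j ∈ 𝒥, ∑ r ∈ Finset.Icc 2 L, (if r ∣ q j then √(M + L) * na * √(Tr N b r) else 0) :=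
        Finset.sum_le_sum hstep
    _ = ∑ r ∈ Finset.Icc 2 L, ((𝒥.filter (fun j => r ∣ q j)).card : ℝ) * (√(M + L) * na * √(Tr N b r)) := by
        rw [Finset.sum_comm]
        refine Finset.sum_congr rfl fun r _ => ?_
        rw [← Finset.sum_filter, Finset.sum_const, nsmul_eq_mul]
    _ ≤ ∑ r ∈ Finset.Icc 2 L, (if k0 < r then 𝒥.card * G / r else 0) * (√(M + L) * na * √(Tr N b r)) := by
        refine Finset.sum_le_sum fun r hr => ?_
        exact mul_le_mul_of_nonneg_right (hmult2 r hr) (by positivity)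
    _ = 𝒥.card * G * √(M + L) * na * ∑ r ∈ Finset.Icc 2 L, (if k0 < r then 1 / (r:ℝ) else 0) * √(Tr N b r) := by
        rw [Finset.mul_sum]
        refine Finset.sum_congr rfl fun r _ => ?_
        split_ifs <;> ring
    _ ≤ 𝒥.card * G * √(M + L) * na * (√(2 / z) * (√(5 * N) * nb)) := by
        gcongr
        calc _ ≤ √(∑ r ∈ Finset.Icc 2 L, (if k0 < r then 1 / (r:ℝ) else 0) ^ 2) * √(∑ r ∈ Finset.Icc 2 L, √(Tr N b r) ^ 2) :=
              Real.sum_mul_le_sqrt_mul_sqrt _ _ _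
          _ ≤ √(2 / z) * √(5 * N * ∑ n ∈ Finset.range N, b n ^ 2) := by
              gcongr
              · calc _ = ∑ r ∈ (Finset.Icc 2 L).filter (fun r => k0 < r), ((r:ℝ)^2)⁻¹ := by
                      rw [Finset.sum_filter]
                      refine Finset.sum_congr rfl fun r _ => ?_
                      split_ifs <;> simp
                  _ ≤ ∑ r ∈ Finset.Ioo k0 (L + 1), ((r:ℝ)^2)⁻¹ := by
                      refine Finset.sum_le_sum_of_subset_of_nonneg ?_ fun _ _ _ => by positivity
                      intro r hr
                      simp only [Finset.mem_filter, Finset.mem_Icc, Finset.mem_Ioo] at hr ⊢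
                      omega
                  _ ≤ 2 / ((k0:ℝ) + 1) := sum_Ioo_inv_sq_le _ _
                  _ ≤ _ := by gcongr
              · calc _ = ∑ r ∈ Finset.Icc 2 L, Tr N b r :=
                      Finset.sum_congr rfl fun r _ => Real.sq_sqrt (hTr0 r)
                  _ ≤ _ := Tr_sum L N hN hL b
          _ = _ := by rw [Real.sqrt_mul (by positivity) (∑ n ∈ Finset.range N, b n ^ 2)]
    _ ≤ _ := by
        have e1 : √(2 / z) * √(5 * N) ≤ √(20 * N / z) := by
          rw [← Real.sqrt_mul (by positivity)]
          apply Real.sqrt_le_sqrt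
          rw [div_mul_eq_mul_div]
          have hN0 : (0:ℝ) ≤ N := Nat.cast_nonneg N
          exact div_le_div_of_nonneg_right (by linarith) (by linarith)
        calc _ = 𝒥.card * G * √(M + L) * (√(2 / z) * √(5 * N)) * (na * nb) := by ring
          _ ≤ _ := by gcongr

/-- The bilinear estimate. -/
lemma bilinear (𝒥 : Finset ℕ) (q : ℕ → ℕ) (Q : ℝ) (L M N : ℕ) (E z G : ℝ) (hQ : 0 < Q) (hE : 0 ≤ E)
    (hG : 0 ≤ G) (hz : 1 ≤ z)
    (hq : ∀ j ∈ 𝒥, Q ≤ q j ∧ (q j : ℝ) ≤ 64 * Q) (hN : Q ≤ N) (hL : L ^ 3 ≤ N)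
    (hrough : ∀ j ∈ 𝒥, ∀ p : ℕ, p.Prime → p ∣ q j → z ≤ p)
    (hmult : ∀ r : ℕ, 2 ≤ r → r ≤ L → ((𝒥.filter (fun j => r ∣ q j)).card : ℝ) ≤ 𝒥.card * G / r)
    (hA4 : ∀ j₀ ∈ 𝒥, ∀ k : ℕ, 0 < k → k < q j₀ → L < q j₀ / k.gcd (q j₀) →
      ∑ j ∈ 𝒥, 1 / (1 + (N * nd (q j * (k / q j₀)) / Q) ^ 2) ≤ E) (a b : ℕ → ℝ) :
    ∑ j ∈ 𝒥, |∑ m ∈ Finset.range M, ∑ n ∈ Finset.range N, a m * b n * Wq (q j) m n|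
    ≤ (1 / Q) * (√(𝒥.card * (M + 64 * Q) * (5380 * N * E)) + 𝒥.card * G * √(M + L) * √(20 * N / z))
      * (√(∑ m ∈ Finset.range M, a m ^ 2) * √(∑ n ∈ Finset.range N, b n ^ 2)) := by
  have hN0 : (0:ℝ) < N := by linarith
  have hN1 : 1 ≤ N := by exact_mod_cast hN0
  have hqpos : ∀ j ∈ 𝒥, 0 < q j := fun j hj => by
    have := (hq j hj).1; exact_mod_cast (by linarith : (0:ℝ) < q j)
  have h1 := bil_large 𝒥 q Q L M N E hQ hE hq hN hA4 a b
  have h2 := bil_small 𝒥 q L M N z G hG hz hqpos hN1 hL hrough hmult a b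
  calc _ ≤ ∑ j ∈ 𝒥, (1 / Q) * ∑ k ∈ Finset.Ico 1 (q j), ‖Asum (q j) M a k‖ * ‖Bsum N b (k / q j)‖ := by
        refine Finset.sum_le_sum fun j hj => (bil_formula (q j) M N (hqpos j hj) a b).trans ?_
        gcongr
        exact (hq j hj).1
    _ = (1 / Q) * (∑ j ∈ 𝒥, ∑ k ∈ (Finset.Ico 1 (q j)).filter (fun k => L < q j / k.gcd (q j)),
      ‖Asum (q j) M a k‖ * ‖Bsum N b (k / q j)‖ + ∑ j ∈ 𝒥, ∑ k ∈ (Finset.Ico 1 (q j)).filter (fun k => ¬ L < q j / k.gcd (q j)),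
      ‖Asum (q j) M a k‖ * ‖Bsum N b (k / q j)‖) := by
        rw [← Finset.mul_sum, ← Finset.sum_add_distrib]
        congr 1
        refine Finset.sum_congr rfl fun j _ => ?_
        rw [Finset.sum_filter_add_sum_filter_not]
    _ ≤ _ := by
        rw [mul_assoc]
        gcongr
        rw [add_mul]
        exact add_le_add h1 h2

def PB (𝒥 : Finset ℕ) (M N : ℕ) (W : ℕ → ℕ → ℕ → ℝ) (Δ : ℝ) : Prop :=
  ∀ f g : ℕ → ℝ, ∑ j ∈ 𝒥, |∑ m ∈ Finset.range M, ∑ n ∈ Finset.range N, f m * g n * W j m n|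
    ≤ Δ * (√(∑ m ∈ Finset.range M, f m ^ 2) * √(∑ n ∈ Finset.range N, g n ^ 2))

lemma PB.swap {𝒥 : Finset ℕ} {M N : ℕ} {W : ℕ → ℕ → ℕ → ℝ} {Δ : ℝ} (h : PB 𝒥 M N W Δ) :
    PB 𝒥 N M (fun j m n => W j n m) Δ := by
  intro f g
  have := h g f
  rw [mul_comm (√_)]
  refine le_trans (le_of_eq ?_) this
  refine Finset.sum_congr rfl fun j _ => ?_
  rw [Finset.sum_comm]
  congr 1
  refine Finset.sum_congr rfl fun m _ => Finset.sum_congr rfl fun n _ => ?_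
  ring

lemma PB.add {𝒥 : Finset ℕ} {M N : ℕ} {W W' : ℕ → ℕ → ℕ → ℝ} {Δ Δ' : ℝ} (h : PB 𝒥 M N W Δ)
    (h' : PB 𝒥 M N W' Δ') : PB 𝒥 M N (fun j m n => W j m n + W' j m n) (Δ + Δ') := by
  intro f g
  rw [add_mul]
  refine le_trans ?_ (add_le_add (h f g) (h' f g))
  rw [← Finset.sum_add_distrib]
  refine Finset.sum_le_sum fun j _ => ?_
  refine le_trans (le_of_eq ?_) (abs_add_le _ _)
  congr 1
  rw [← Finset.sum_add_distrib]
  refine Finset.sum_congr rfl fun m _ => ?_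
  rw [← Finset.sum_add_distrib]
  refine Finset.sum_congr rfl fun n _ => ?_
  ring

lemma PB.restrict {𝒥 : Finset ℕ} {M N : ℕ} {W : ℕ → ℕ → ℕ → ℝ} {Δ : ℝ} (hΔ : 0 ≤ Δ) (h : PB 𝒥 M N W Δ)
    (s t : ℕ → Prop) : PB 𝒥 M N (fun j m n => W j m n * if s m ∧ t n then 1 else 0) Δ := by
  intro f g
  refine le_trans (le_of_eq ?_) (le_trans (h (fun m => if s m then f m else 0) (fun n => if t n then g n else 0)) ?_)
  · refine Finset.sum_congr rfl fun j _ => ?_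
    congr 1
    refine Finset.sum_congr rfl fun m _ => Finset.sum_congr rfl fun n _ => ?_
    by_cases h1 : s m <;> by_cases h2 : t n <;> simp [h1, h2]
  · have aux : ∀ (K : ℕ) (s : ℕ → Prop) (f : ℕ → ℝ), ∑ m ∈ Finset.range K, (if s m then f m else 0) ^ 2 ≤ ∑ m ∈ Finset.range K, f m ^ 2 := by
      intro K s f
      refine Finset.sum_le_sum fun m _ => ?_
      by_cases hs : s m
      · simp [hs]
      · simp [hs, sq_nonneg]
    exact mul_le_mul_of_nonneg_left (mul_le_mul (Real.sqrt_le_sqrt (aux M s f)) (Real.sqrt_le_sqrt (aux N t g)) (Real.sqrt_nonneg _) (Real.sqrt_nonneg _)) hΔ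

lemma PB.congr {𝒥 : Finset ℕ} {M N : ℕ} {W W' : ℕ → ℕ → ℕ → ℝ} {Δ : ℝ} (h : PB 𝒥 M N W Δ)
    (e : ∀ j ∈ 𝒥, ∀ m < M, ∀ n < N, W' j m n = W j m n) : PB 𝒥 M N W' Δ := by
  intro f g
  refine le_trans (le_of_eq ?_) (h f g)
  refine Finset.sum_congr rfl fun j hj => ?_
  congr 1
  refine Finset.sum_congr rfl fun m hm => Finset.sum_congr rfl fun n hn => ?_
  rw [e j hj m (Finset.mem_range.1 hm) n (Finset.mem_range.1 hn)]

lemma PB.eq {𝒥 : Finset ℕ} {M N : ℕ} {W : ℕ → ℕ → ℕ → ℝ} {Δ : ℝ} (hΔ : 0 ≤ Δ) (h : PB 𝒥 M N W Δ)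
    (u v : ℕ → ℕ) : PB 𝒥 M N (fun j m n => W j m n * if u m = v n then 1 else 0) Δ := by
  intro f g
  set I := (Finset.range M).image u with hI
  have key : ∀ j ∈ 𝒥, |∑ m ∈ Finset.range M, ∑ n ∈ Finset.range N, f m * g n * (W j m n * if u m = v n then 1 else 0)|
      ≤ ∑ w ∈ I, |∑ m ∈ Finset.range M, ∑ n ∈ Finset.range N, (if u m = w then f m else 0) * (if v n = w then g n else 0) * W j m n| := by
    intro j _
    refine le_trans (le_of_eq ?_) (Finset.abs_sum_le_sum_abs _ _)
    congr 1
    rw [Finset.sum_comm (s := I)]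
    refine Finset.sum_congr rfl fun m hm => ?_
    rw [Finset.sum_comm (s := I)]
    refine Finset.sum_congr rfl fun n _ => ?_
    rw [Finset.sum_eq_single (u m)]
    · by_cases h1 : u m = v n
      · simp [h1]
      · have h2 : ¬ v n = u m := fun h => h1 h.symm
        simp [h1, h2]
    · intro w _ hw
      simp [Ne.symm hw]
    · intro hh
      exact absurd (Finset.mem_image_of_mem u hm) hh
  calc _ ≤ ∑ j ∈ 𝒥, ∑ w ∈ I, |∑ m ∈ Finset.range M, ∑ n ∈ Finset.range N, (if u m = w then f m else 0) * (if v n = w then g n else 0) * W j m n| :=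
        Finset.sum_le_sum key
    _ ≤ ∑ w ∈ I, Δ * (√(∑ m ∈ Finset.range M, (if u m = w then f m else 0) ^ 2) * √(∑ n ∈ Finset.range N, (if v n = w then g n else 0) ^ 2)) := by
        rw [Finset.sum_comm]
        exact Finset.sum_le_sum fun w _ => h _ _
    _ ≤ Δ * (√(∑ w ∈ I, ∑ m ∈ Finset.range M, (if u m = w then f m else 0) ^ 2) * √(∑ w ∈ I, ∑ n ∈ Finset.range N, (if v n = w then g n else 0) ^ 2)) := by
        rw [← Finset.mul_sum]
        gcongr
        exact Real.sum_sqrt_mul_sqrt_le _ (fun _ => by positivity) (fun _ => by positivity)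
    _ ≤ _ := by
        have aux : ∀ (K : ℕ) (u : ℕ → ℕ) (f : ℕ → ℝ), ∑ w ∈ I, ∑ m ∈ Finset.range K, (if u m = w then f m else 0) ^ 2 ≤ ∑ m ∈ Finset.range K, f m ^ 2 := by
          intro K u f
          rw [Finset.sum_comm]
          refine Finset.sum_le_sum fun m _ => ?_
          have : ∀ w ∈ I, (if u m = w then f m else 0) ^ 2 = if u m = w then f m ^ 2 else 0 := by
            intro w _; split_ifs <;> simp
          rw [Finset.sum_congr rfl this, Finset.sum_ite_eq]
          split_ifs
          · exact le_rfl
          · positivity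
        gcongr
        · exact aux _ _ _
        · exact aux _ _ _

lemma PB.lt {𝒥 : Finset ℕ} {M N : ℕ} {W : ℕ → ℕ → ℕ → ℝ} {Δ : ℝ} (hΔ : 0 ≤ Δ) (h : PB 𝒥 M N W Δ)
    (k : ℕ) : ∀ (u v : ℕ → ℕ), (∀ m < M, u m < 2 ^ k) → (∀ n < N, v n < 2 ^ k) →
      PB 𝒥 M N (fun j m n => W j m n * if u m < v n then 1 else 0) (k * Δ) := by
  induction k with
  | zero =>
    intro u v hu hv f g
    have : ∀ j ∈ 𝒥, |∑ m ∈ Finset.range M, ∑ n ∈ Finset.range N, f m * g n * (W j m n * if u m < v n then 1 else 0)| = 0 := by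
      intro j _
      rw [abs_eq_zero]
      refine Finset.sum_eq_zero fun m hm => Finset.sum_eq_zero fun n hn => ?_
      have h1 := hu m (Finset.mem_range.1 hm)
      have h2 := hv n (Finset.mem_range.1 hn)
      rw [if_neg (by omega)]; simp
    rw [Finset.sum_congr rfl this]; simp
  | succ k ih =>
    intro u v hu hv
    have h1 := ih (fun m => u m / 2) (fun n => v n / 2)
      (fun m hm => by have := hu m hm; rw [pow_succ] at this; omega)
      (fun m hm => by have := hv m hm; rw [pow_succ] at this; omega)
    have h2 := (h.eq hΔ (fun m => u m / 2) (fun n => v n / 2)).restrict hΔ (fun m => u m % 2 = 0) (fun n => v n % 2 = 1)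
    have h3 := h1.add h2
    rw [show ((k + 1 : ℕ) : ℝ) * Δ = k * Δ + Δ by push_cast; ring]
    refine h3.congr ?_
    intro j _ m _ n _
    rw [mul_assoc, ← mul_add]
    congr 1
    by_cases c1 : u m / 2 < v n / 2
    · rw [if_pos (by omega), if_pos c1, if_neg (by omega)]; simp
    · rw [if_neg c1]
      by_cases c2 : u m / 2 = v n / 2
      · rw [if_pos c2]
        by_cases c3 : u m % 2 = 0 ∧ v n % 2 = 1
        · rw [if_pos (by omega), if_pos c3]; simp
        · rw [if_neg (by omega), if_neg c3]; simp
      · rw [if_neg c2, if_neg (by omega)]; simp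

lemma PB.lt' {𝒥 : Finset ℕ} {M N : ℕ} {W : ℕ → ℕ → ℕ → ℝ} {Δ : ℝ} (hΔ : 0 ≤ Δ) (h : PB 𝒥 M N W Δ)
    (k : ℕ) (u v : ℕ → ℕ) (hu : ∀ m < M, u m < 2 ^ k) (hv : ∀ n < N, v n < 2 ^ k) :
      PB 𝒥 M N (fun j m n => W j m n * if v n < u m then 1 else 0) (k * Δ) :=
  (h.swap.lt hΔ k v u hv hu).swap

structure Fam (t : ℕ) (c : ℝ) (𝒥 : Finset ℕ) (q : ℕ → ℕ) (Q : ℝ) (L : ℕ) (z G : ℝ) : Prop where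
  ne : 𝒥.Nonempty
  Q1 : 1 ≤ Q
  Q2 : Q ≤ (t:ℝ) ^ ((7:ℝ) / 2 - c)
  q1 : ∀ j ∈ 𝒥, Q ≤ q j ∧ (q j : ℝ) ≤ 64 * Q
  rough : ∀ j ∈ 𝒥, ∀ p : ℕ, p.Prime → p ∣ q j → z ≤ p
  L1 : L ≤ t
  G0 : 0 ≤ G
  Gz : G * Real.log t ^ 10 ≤ √z
  z1 : Real.log t ^ 10 ≤ z
  mult : ∀ r : ℕ, 2 ≤ r → r ≤ L → ((𝒥.filter (fun j => r ∣ q j)).card : ℝ) ≤ 𝒥.card * G / r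
  A4 : ∀ N : ℕ, (t:ℝ) ^ ((7:ℝ) / 2) ≤ N → N ≤ 2 * t ^ 4 →
    ∀ j₀ ∈ 𝒥, ∀ k : ℕ, 0 < k → k < q j₀ → L < q j₀ / k.gcd (q j₀) →
      ∑ j ∈ 𝒥, 1 / (1 + (N * nd (q j * (k / q j₀)) / Q) ^ 2)
        ≤ 𝒥.card * (t:ℝ) ^ (-c) * min 1 ((t:ℝ) ^ 7 / (N * Q))

lemma log_ge_one {t : ℕ} (ht : 3 ≤ t) : 1 ≤ Real.log t := by
  have h3 : (3:ℝ) ≤ t := by exact_mod_cast ht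
  rw [Real.le_log_iff_exp_le (by linarith)]
  linarith [Real.exp_one_lt_d9]

lemma block_PB {t : ℕ} {c : ℝ} {𝒥 : Finset ℕ} {q : ℕ → ℕ} {Q : ℝ} {L : ℕ} {z G : ℝ}
    (F : Fam t c 𝒥 q Q L z G) (hc : 0 < c) (ht : 3 ≤ t)
    (hlog : Real.log t ^ 10 ≤ (t:ℝ) ^ (c / 2)) (M N : ℕ)
    (hN1 : (t:ℝ) ^ ((7:ℝ) / 2) ≤ N) (hN2 : N ≤ 2 * t ^ 4) (hM : t ≤ M)
    (hMN : (M:ℝ) * N ≤ 8 * (t:ℝ) ^ 7) :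
    ∃ Δ, 0 ≤ Δ ∧ PB 𝒥 M N (fun j m n => Wq (q j) m n) Δ ∧
      Δ * (√M * √N) ≤ 2000 * (𝒥.card * ((t:ℝ) ^ 7 / Q) / Real.log t ^ 10) := by
  have hQ1 := F.Q1
  have hQ0 : 0 < Q := by linarith
  have hl := log_ge_one ht
  have h3 : (3:ℝ) ≤ t := by exact_mod_cast ht
  have ht0 : (0:ℝ) < t := by linarith
  have hl10 : 1 ≤ Real.log t ^ 10 := one_le_pow₀ hl
  have hz1 : 1 ≤ z := le_trans hl10 F.z1
  have hz0 : 0 < z := by linarith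
  have hN0 : (0:ℝ) < N := lt_of_lt_of_le (by positivity) hN1
  set X := (t:ℝ) ^ 7 with hX
  have hX0 : 0 < X := by positivity
  set E := 𝒥.card * (t:ℝ) ^ (-c) * min 1 (X / (N * Q)) with hE
  have hmin0 : 0 ≤ min 1 (X / (N * Q)) := le_min (by norm_num) (by positivity)
  have hE0 : 0 ≤ E := by positivity
  have hQN : Q ≤ N := by
    refine F.Q2.trans (le_trans ?_ hN1)
    exact Real.rpow_le_rpow_of_exponent_le (by linarith) (by linarith)
  have hL3 : L ^ 3 ≤ N := by
    have : ((t ^ 3 : ℕ) : ℝ) ≤ N := by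
      refine le_trans ?_ hN1
      push_cast
      rw [← Real.rpow_natCast]
      exact Real.rpow_le_rpow_of_exponent_le (by linarith) (by norm_num)
    have h2 : t ^ 3 ≤ N := by exact_mod_cast this
    exact (Nat.pow_le_pow_left F.L1 3).trans h2
  refine ⟨(1 / Q) * (√(𝒥.card * (M + 64 * Q) * (5380 * N * E)) + 𝒥.card * G * √(M + L) * √(20 * N / z)), ?_, ?_, ?_⟩
  · have := F.G0; positivity
  · intro f g
    exact bilinear 𝒥 q Q L M N E z G hQ0 hE0 F.G0 hz1 F.q1 hQN hL3 F.rough F.mult (F.A4 N hN1 hN2) f g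
  have hMN0 : (0:ℝ) ≤ (M:ℝ) * N := by positivity
  have e1 : √(𝒥.card * (M + 64 * Q) * (5380 * N * E)) * (√M * √N) ≤ 1762 * (𝒥.card * X / Real.log t ^ 10) := by
    rw [← Real.sqrt_mul (by positivity), ← Real.sqrt_mul (by positivity)]
    apply Real.sqrt_le_iff.2
    constructor
    · positivity
    have a1 : (M + 64 * Q) * N * (M * N) * min 1 (X / (N * Q)) ≤ 576 * X ^ 2 := by
      have b1 : (M * N) ^ 2 * min 1 (X / (N * Q)) ≤ 64 * X ^ 2 := by
        calc _ ≤ ((M:ℝ) * N) ^ 2 * 1 := by gcongr; exact min_le_left _ _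
          _ ≤ (8 * X) ^ 2 * 1 := by gcongr
          _ = _ := by ring
      have b2 : (64 * Q) * N * (M * N) * min 1 (X / (N * Q)) ≤ 512 * X ^ 2 := by
        calc _ ≤ (64 * Q) * N * (M * N) * (X / (N * Q)) := by gcongr; exact min_le_right _ _
          _ = 64 * (M * N) * X := by field_simp
          _ ≤ 64 * (8 * X) * X := by gcongr
          _ = _ := by ring
      nlinarith
    have a2 : (t:ℝ) ^ (-c) ≤ (1 / Real.log t ^ 10) ^ 2 := by
      have : (t:ℝ) ^ (-c) = (1 / (t:ℝ) ^ (c/2)) ^ 2 := by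
        rw [div_pow, one_pow, ← Real.rpow_natCast, ← Real.rpow_mul ht0.le, one_div, Real.rpow_neg ht0.le]
        congr 2; push_cast; ring
      rw [this]
      gcongr
    calc _ = 5380 * (𝒥.card:ℝ) ^ 2 * (t:ℝ) ^ (-c) * ((M + 64 * Q) * N * (M * N) * min 1 (X / (N * Q))) := by
          rw [hE]; ring
      _ ≤ 5380 * (𝒥.card:ℝ) ^ 2 * (1 / Real.log t ^ 10) ^ 2 * (576 * X ^ 2) := by gcongr
      _ = (5380 * 576) * (𝒥.card * X / Real.log t ^ 10) ^ 2 := by ring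
      _ ≤ 1762 ^ 2 * (𝒥.card * X / Real.log t ^ 10) ^ 2 := by gcongr; norm_num
      _ = _ := by ring
  have e2 : 𝒥.card * G * √(M + L) * √(20 * N / z) * (√M * √N) ≤ 56 * (𝒥.card * X / Real.log t ^ 10) := by
    have a1 : √(M + L) * √(20 * N / z) * (√M * √N) ≤ 56 * X / √z := by
      rw [← Real.sqrt_mul (by positivity), ← Real.sqrt_mul (by positivity), ← Real.sqrt_mul (by positivity)]
      apply Real.sqrt_le_iff.2
      constructor
      · positivity
      have hLM : (L:ℝ) ≤ M := by exact_mod_cast F.L1.trans hM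
      rw [div_pow, Real.sq_sqrt hz0.le]
      calc _ ≤ ((M:ℝ) + M) * (20 * N / z) * (M * N) := by gcongr
        _ = 40 * (M * N) ^ 2 / z := by ring
        _ ≤ 40 * (8 * X) ^ 2 / z := by gcongr
        _ ≤ _ := by gcongr; nlinarith [sq_nonneg X]
    have a2 : G / √z ≤ 1 / Real.log t ^ 10 := by
      rw [div_le_div_iff₀ (by positivity) (by positivity), one_mul]
      exact F.Gz
    have := F.G0
    calc _ = 𝒥.card * G * (√(M + L) * √(20 * N / z) * (√M * √N)) := by ring
      _ ≤ 𝒥.card * G * (56 * X / √z) := by gcongr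
      _ = 56 * 𝒥.card * X * (G / √z) := by ring
      _ ≤ 56 * 𝒥.card * X * (1 / Real.log t ^ 10) := by gcongr
      _ = _ := by ring
  calc _ = (1 / Q) * (√(𝒥.card * (M + 64 * Q) * (5380 * N * E)) * (√M * √N) + 𝒥.card * G * √(M + L) * √(20 * N / z) * (√M * √N)) := by ring
    _ ≤ (1 / Q) * (1762 * (𝒥.card * X / Real.log t ^ 10) + 56 * (𝒥.card * X / Real.log t ^ 10)) := by gcongr
    _ ≤ (1 / Q) * (2000 * (𝒥.card * X / Real.log t ^ 10)) := by
        gcongr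
        have : 0 ≤ 𝒥.card * X / Real.log t ^ 10 := by positivity
        linarith
    _ = _ := by ring

lemma sum_inv_le (X : ℕ) : ∑ m ∈ Finset.Icc 1 X, 1 / (m:ℝ) ≤ 1 + Real.log X := by
  have := harmonic_le_one_add_log X
  rw [harmonic_eq_sum_Icc] at this
  push_cast at this
  simpa using this

lemma card_primeFactors_le (q : ℕ) (hq : 0 < q) : (q.primeFactors.card : ℝ) ≤ 2 * Real.log q := by
  have h1 : 2 ^ q.primeFactors.card ≤ q := by
    calc 2 ^ q.primeFactors.card ≤ ∏ p ∈ q.primeFactors, p :=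
          Finset.pow_card_le_prod _ _ _ fun p hp => (Nat.prime_of_mem_primeFactors hp).two_le
      _ ≤ q := Nat.le_of_dvd hq (Nat.prod_primeFactors_dvd q)
  have h2 : ((2:ℝ) ^ q.primeFactors.card) ≤ q := by exact_mod_cast h1
  have h3 := Real.log_le_log (by positivity) h2
  rw [Real.log_pow] at h3
  have := Real.log_two_gt_d9
  nlinarith [(Nat.cast_nonneg q.primeFactors.card : (0:ℝ) ≤ _)]

lemma sum_inv_dvd (X p : ℕ) (hp : 0 < p) :
    ∑ m ∈ (Finset.Icc 1 X).filter (fun m => p ∣ m), 1 / (m:ℝ) ≤ (1 + Real.log X) / p := by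
  calc _ ≤ ∑ m ∈ (Finset.Icc 1 X).image (fun k => p * k), 1 / (m:ℝ) := by
        refine Finset.sum_le_sum_of_subset_of_nonneg ?_ fun _ _ _ => by positivity
        intro m hm
        simp only [Finset.mem_filter, Finset.mem_Icc] at hm
        obtain ⟨⟨h1, h2⟩, k, rfl⟩ := hm
        refine Finset.mem_image.2 ⟨k, Finset.mem_Icc.2 ⟨?_, ?_⟩, rfl⟩
        · exact Nat.pos_of_mul_pos_left h1
        · exact le_trans (Nat.le_mul_of_pos_left k hp) h2
    _ = ∑ k ∈ Finset.Icc 1 X, 1 / ((p * k : ℕ):ℝ) := by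
        rw [Finset.sum_image]
        intro a _ b _ hab
        exact Nat.eq_of_mul_eq_mul_left hp hab
    _ = (1 / p) * ∑ k ∈ Finset.Icc 1 X, 1 / (k:ℝ) := by
        rw [Finset.mul_sum]
        refine Finset.sum_congr rfl fun k _ => ?_
        push_cast
        rw [one_div_mul_one_div]
    _ ≤ (1 / p) * (1 + Real.log X) := by gcongr; exact sum_inv_le X
    _ = _ := by ring

lemma noncop_sum (q X : ℕ) (z : ℝ) (hz : 0 < z) (hq : 0 < q)
    (hr : ∀ p : ℕ, p.Prime → p ∣ q → z ≤ p) :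
    ∑ m ∈ (Finset.Icc 1 X).filter (fun m => ¬ m.Coprime q), 1 / (m:ℝ) ≤ 2 * Real.log q * (1 + Real.log X) / z := by
  have hlX : 0 ≤ Real.log X := Real.log_natCast_nonneg X
  calc _ ≤ ∑ p ∈ q.primeFactors, ∑ m ∈ (Finset.Icc 1 X).filter (fun m => p ∣ m), 1 / (m:ℝ) := by
        simp only [Finset.sum_filter]
        rw [Finset.sum_comm]
        refine Finset.sum_le_sum fun m hm => ?_
        by_cases h : m.Coprime q
        · rw [if_neg (by simpa using h)]
          exact Finset.sum_nonneg fun i _ => by positivity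
        · rw [if_pos h]
          obtain ⟨p, hp, hp1, hp2⟩ := Nat.Prime.not_coprime_iff_dvd.1 h
          refine le_trans ?_ (Finset.single_le_sum (f := fun p => if p ∣ m then 1 / (m:ℝ) else 0) (fun i _ => by positivity) (Nat.mem_primeFactors.2 ⟨hp, hp2, hq.ne'⟩))
          simp [hp1]
    _ ≤ ∑ p ∈ q.primeFactors, (1 + Real.log X) / z := by
        refine Finset.sum_le_sum fun p hp => ?_
        have hpp := Nat.prime_of_mem_primeFactors hp
        refine (sum_inv_dvd X p hpp.pos).trans ?_
        gcongr
        exact hr p hpp (Nat.dvd_of_mem_primeFactors hp)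
    _ = q.primeFactors.card * ((1 + Real.log X) / z) := by rw [Finset.sum_const, nsmul_eq_mul]
    _ ≤ (2 * Real.log q) * ((1 + Real.log X) / z) := by
        gcongr
        exact card_primeFactors_le q hq
    _ = _ := by ring

/-- indicator of the Type II conditions -/
noncomputable def cnd (X : ℕ) (ℓ h : ℕ → ℕ) (c b : ℕ) : ℝ :=
  if 1 ≤ b ∧ c * b ≤ X ∧ ℓ c ≤ h b then 1 else 0

noncomputable def Dq (q c b : ℕ) : ℝ := (if (q:ℤ) ∣ (c:ℤ) * b - 1 then 1 else 0) - 1 / (q:ℝ)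

lemma typeII_core (𝒥 : Finset ℕ) (X C B : ℕ) (V D : ℕ → ℕ → ℕ → ℝ) (Δ R : ℝ) (k : ℕ) (hΔ : 0 ≤ Δ)
    (hP : PB 𝒥 (2 * C) B V Δ) (hC : 1 ≤ C) (f : ℕ → ℝ) (hf1 : ∀ c, |f c| ≤ 1) (hf : ∀ c, c < C → f c = 0)
    (ℓ h : ℕ → ℕ) (hk : X + 1 < 2 ^ k) (hB : B ≤ X + 1) (hℓ : ∀ c < 2 * C, ℓ c ≤ X) (hh : ∀ b < B, h b ≤ X)
    (hcorr : ∀ j ∈ 𝒥, ∑ c ∈ Finset.range (2 * C), ∑ b ∈ Finset.range B, |f c| * cnd X ℓ h c b * |D j c b - V j c b| ≤ R) :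
    ∑ j ∈ 𝒥, |∑ c ∈ Finset.range (2 * C), ∑ b ∈ Finset.range B, f c * cnd X ℓ h c b * D j c b|
      ≤ k * (k * Δ) * (√((2 * C : ℕ):ℝ) * √B) + 𝒥.card * R := by
  have h1 : PB 𝒥 (2 * C) B (fun j c b => V j c b * if b < X / c + 1 then 1 else 0) (k * Δ) := by
    refine hP.lt' hΔ k (fun c => X / c + 1) (fun b => b) ?_ ?_
    · intro c _
      have := Nat.div_le_self X c
      omega
    · intro b hb
      omega
  have h2 := h1.lt (by positivity) k ℓ (fun b => h b + 1) (fun c hc => by have := hℓ c hc; omega)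
    (fun b hb => by have := hh b hb; omega)
  have h3 := h2 f (fun b => if 1 ≤ b then 1 else 0)
  have n1 : ∑ m ∈ Finset.range (2 * C), f m ^ 2 ≤ ((2 * C : ℕ):ℝ) := by
    calc _ ≤ ∑ m ∈ Finset.range (2 * C), (1:ℝ) := Finset.sum_le_sum fun m _ => by
          rw [← sq_abs]; exact pow_le_one₀ (abs_nonneg _) (hf1 m)
      _ = _ := by simp
  have n2 : ∑ b ∈ Finset.range B, (if 1 ≤ b then (1:ℝ) else 0) ^ 2 ≤ B := by
    calc _ ≤ ∑ m ∈ Finset.range B, (1:ℝ) := Finset.sum_le_sum fun m _ => by split_ifs <;> simp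
      _ = _ := by simp
  have h4 : ∑ j ∈ 𝒥, |∑ c ∈ Finset.range (2 * C), ∑ b ∈ Finset.range B, f c * cnd X ℓ h c b * V j c b| ≤
      k * (k * Δ) * (√((2 * C : ℕ):ℝ) * √B) := by
    refine le_trans (le_of_eq ?_) (h3.trans ?_)
    · refine Finset.sum_congr rfl fun j _ => ?_
      congr 1
      refine Finset.sum_congr rfl fun c _ => Finset.sum_congr rfl fun b _ => ?_
      rcases lt_or_ge c C with hcC | hcC
      · rw [hf c hcC]; simp
      · have hc0 : 0 < c := by omega
        have hiff : c * b ≤ X ↔ b < X / c + 1 := by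
          rw [Nat.lt_succ_iff, Nat.le_div_iff_mul_le hc0, mul_comm]
        unfold cnd
        by_cases q1 : 1 ≤ b <;> by_cases q2 : b < X / c + 1 <;> by_cases q3 : ℓ c ≤ h b <;>
          simp [q1, q2, q3, hiff]
    · gcongr
  have h5 : ∀ j ∈ 𝒥, |∑ c ∈ Finset.range (2 * C), ∑ b ∈ Finset.range B, f c * cnd X ℓ h c b * D j c b|
      ≤ |∑ c ∈ Finset.range (2 * C), ∑ b ∈ Finset.range B, f c * cnd X ℓ h c b * V j c b| + R := by
    intro j hj
    have e : ∑ c ∈ Finset.range (2 * C), ∑ b ∈ Finset.range B, f c * cnd X ℓ h c b * D j c b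
        = ∑ c ∈ Finset.range (2 * C), ∑ b ∈ Finset.range B, f c * cnd X ℓ h c b * V j c b
        + ∑ c ∈ Finset.range (2 * C), ∑ b ∈ Finset.range B, f c * cnd X ℓ h c b * (D j c b - V j c b) := by
      rw [← Finset.sum_add_distrib]
      refine Finset.sum_congr rfl fun c _ => ?_
      rw [← Finset.sum_add_distrib]
      refine Finset.sum_congr rfl fun b _ => ?_
      ring
    rw [e]
    refine (abs_add_le _ _).trans (add_le_add le_rfl (le_trans ?_ (hcorr j hj)))
    refine (Finset.abs_sum_le_sum_abs _ _).trans (Finset.sum_le_sum fun c _ => ?_)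
    refine (Finset.abs_sum_le_sum_abs _ _).trans (Finset.sum_le_sum fun b _ => ?_)
    rw [abs_mul, abs_mul]
    have : |cnd X ℓ h c b| = cnd X ℓ h c b := abs_of_nonneg (by unfold cnd; positivity)
    rw [this]
  calc _ ≤ ∑ j ∈ 𝒥, (|∑ c ∈ Finset.range (2 * C), ∑ b ∈ Finset.range B, f c * cnd X ℓ h c b * V j c b| + R) :=
        Finset.sum_le_sum h5
    _ ≤ _ := by
        rw [Finset.sum_add_distrib, Finset.sum_const, nsmul_eq_mul]
        gcongr

lemma pair_corr (S T : Finset ℕ) (q X : ℕ) (z : ℝ) (hz : 0 < z) (hq : 0 < q)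
    (hr : ∀ p : ℕ, p.Prime → p ∣ q → z ≤ p) :
    ∑ m ∈ S, ∑ n ∈ T, (if 1 ≤ m ∧ 1 ≤ n ∧ m * n ≤ X ∧ ¬ m.Coprime q then 1 / (q:ℝ) else 0)
      ≤ X / q * (2 * Real.log q * (1 + Real.log X) / z) := by
  have hin : ∀ m ∈ S, ∑ n ∈ T, (if 1 ≤ m ∧ 1 ≤ n ∧ m * n ≤ X ∧ ¬ m.Coprime q then 1 / (q:ℝ) else 0)
      ≤ if 1 ≤ m ∧ m ≤ X ∧ ¬ m.Coprime q then (X / q) * (1 / (m:ℝ)) else 0 := by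
    intro m _
    by_cases hm : 1 ≤ m ∧ m ≤ X ∧ ¬ m.Coprime q
    · rw [if_pos hm, ← Finset.sum_filter, Finset.sum_const, nsmul_eq_mul]
      have hm0 : (0:ℝ) < m := by exact_mod_cast hm.1
      have hc : (T.filter (fun n => 1 ≤ m ∧ 1 ≤ n ∧ m * n ≤ X ∧ ¬ m.Coprime q)).card ≤ X / m := by
        calc _ ≤ (Finset.Icc 1 (X / m)).card := by
              apply Finset.card_le_card
              intro n hn
              simp only [Finset.mem_filter] at hn
              refine Finset.mem_Icc.2 ⟨hn.2.2.1, ?_⟩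
              rw [Nat.le_div_iff_mul_le hm.1, mul_comm]; exact hn.2.2.2.1
          _ = _ := by simp
      have hc2 : ((T.filter (fun n => 1 ≤ m ∧ 1 ≤ n ∧ m * n ≤ X ∧ ¬ m.Coprime q)).card : ℝ) ≤ (X:ℝ) / m :=
        le_trans (by exact_mod_cast hc) Nat.cast_div_le
      calc _ ≤ ((X:ℝ) / m) * (1 / q) := by gcongr
        _ = _ := by ring
    · rw [if_neg hm]
      refine le_of_eq (Finset.sum_eq_zero fun n _ => ?_)
      rw [if_neg]
      rintro ⟨h1, h2, h3, h4⟩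
      exact hm ⟨h1, le_trans (Nat.le_mul_of_pos_right m h2) h3, h4⟩
  calc _ ≤ ∑ m ∈ S, if 1 ≤ m ∧ m ≤ X ∧ ¬ m.Coprime q then (X / q) * (1 / (m:ℝ)) else 0 := Finset.sum_le_sum hin
    _ = ∑ m ∈ S.filter (fun m => 1 ≤ m ∧ m ≤ X ∧ ¬ m.Coprime q), (X / q) * (1 / (m:ℝ)) := by rw [Finset.sum_filter]
    _ ≤ ∑ m ∈ (Finset.Icc 1 X).filter (fun m => ¬ m.Coprime q), (X / q) * (1 / (m:ℝ)) := by
        refine Finset.sum_le_sum_of_subset_of_nonneg ?_ fun _ _ _ => by positivity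
        intro m hm
        simp only [Finset.mem_filter, Finset.mem_Icc] at hm ⊢
        tauto
    _ = (X / q) * ∑ m ∈ (Finset.Icc 1 X).filter (fun m => ¬ m.Coprime q), (1 / (m:ℝ)) := by rw [Finset.mul_sum]
    _ ≤ _ := by gcongr; exact noncop_sum q X z hz hq hr

lemma Fam.log_q {t : ℕ} {c : ℝ} {𝒥 : Finset ℕ} {q : ℕ → ℕ} {Q : ℝ} {L : ℕ} {z G : ℝ}
    (F : Fam t c 𝒥 q Q L z G) (hc : 0 < c) (ht : 3 ≤ t) (j : ℕ) (hj : j ∈ 𝒥) :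
    0 < q j ∧ Real.log (q j) ≤ 8 * Real.log t := by
  have h3 : (3:ℝ) ≤ t := by exact_mod_cast ht
  have hQ1 := F.Q1
  have hq := F.q1 j hj
  have hq0 : (0:ℝ) < q j := by linarith
  refine ⟨by exact_mod_cast hq0, ?_⟩
  rw [show 8 * Real.log t = Real.log ((t:ℝ) ^ 8) by rw [Real.log_pow]; norm_num]
  apply Real.log_le_log hq0
  have h1 : Q ≤ (t:ℝ) ^ 4 := by
    refine F.Q2.trans ?_
    rw [← Real.rpow_natCast]
    exact Real.rpow_le_rpow_of_exponent_le (by linarith) (by push_cast; linarith)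
  have h2 : (64:ℝ) ≤ (t:ℝ) ^ 4 := by
    calc (64:ℝ) ≤ 3 ^ 4 := by norm_num
      _ ≤ _ := by gcongr
  calc (q j:ℝ) ≤ 64 * Q := hq.2
    _ ≤ (t:ℝ) ^ 4 * (t:ℝ) ^ 4 := by gcongr
    _ = _ := by ring

lemma Fam.corr {t : ℕ} {c : ℝ} {𝒥 : Finset ℕ} {q : ℕ → ℕ} {Q : ℝ} {L : ℕ} {z G : ℝ}
    (F : Fam t c 𝒥 q Q L z G) (hc : 0 < c) (ht : 3 ≤ t) (j : ℕ) (hj : j ∈ 𝒥) :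
    ((t^7:ℕ):ℝ) / q j * (2 * Real.log (q j) * (1 + Real.log ((t^7:ℕ):ℝ)) / z) ≤ 128 * ((t:ℝ)^7 / Q / Real.log t ^ 8) := by
  obtain ⟨h1, h2⟩ := F.log_q hc ht j hj
  have h3 : (3:ℝ) ≤ t := by exact_mod_cast ht
  have hl := log_ge_one ht
  have hQ0 : 0 < Q := by linarith [F.Q1]
  have hz0 : 0 < z := lt_of_lt_of_le (by positivity) F.z1
  have e : 1 + Real.log ((t^7:ℕ):ℝ) ≤ 8 * Real.log t := by
    push_cast; rw [Real.log_pow]; push_cast; linarith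
  have hX : 0 ≤ Real.log ((t^7:ℕ):ℝ) := Real.log_natCast_nonneg _
  have hq0 : 0 ≤ Real.log (q j) := Real.log_natCast_nonneg _
  calc _ ≤ ((t^7:ℕ):ℝ) / Q * (2 * (8 * Real.log t) * (8 * Real.log t) / Real.log t ^ 10) := by
        gcongr
        · exact (F.q1 j hj).1
        · exact F.z1
    _ = _ := by push_cast; field_simp; norm_num

lemma Fam.pair {t : ℕ} {c : ℝ} {𝒥 : Finset ℕ} {q : ℕ → ℕ} {Q : ℝ} {L : ℕ} {z G : ℝ}
    (F : Fam t c 𝒥 q Q L z G) (hc : 0 < c) (ht : 3 ≤ t) (j : ℕ) (hj : j ∈ 𝒥) (S T : Finset ℕ) :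
    ∑ m ∈ S, ∑ n ∈ T, (if 1 ≤ m ∧ 1 ≤ n ∧ m * n ≤ t ^ 7 ∧ ¬ m.Coprime (q j) then 1 / (q j:ℝ) else 0)
     ≤ 128 * ((t:ℝ)^7 / Q / Real.log t ^ 8) := by
  have hl := log_ge_one ht
  have hz0 : 0 < z := lt_of_lt_of_le (by positivity) F.z1
  exact (pair_corr S T (q j) (t^7) z hz0 (F.log_q hc ht j hj).1 (F.rough j hj)).trans (F.corr hc ht j hj)

lemma kbound {t : ℕ} (ht : 3 ≤ t) : ((7 * (Nat.log 2 t + 1) + 1 : ℕ) : ℝ) ≤ 22 * Real.log t ∧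
    t ^ 7 + 1 < 2 ^ (7 * (Nat.log 2 t + 1) + 1) ∧ ((Nat.log 2 t + 1 : ℕ):ℝ) ≤ 3 * Real.log t := by
  have hl := log_ge_one ht
  have h1 : ((2:ℝ) ^ (Nat.log 2 t)) ≤ t := by exact_mod_cast Nat.pow_log_le_self 2 (by omega)
  have h2 := Real.log_le_log (by positivity) h1
  rw [Real.log_pow] at h2
  have := Real.log_two_gt_d9
  have h4 : (Nat.log 2 t : ℝ) ≤ 2 * Real.log t := by
    nlinarith [(Nat.cast_nonneg (Nat.log 2 t) : (0:ℝ) ≤ _)]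
  refine ⟨by push_cast; linarith, ?_, by push_cast; linarith⟩
  have h5 : t < 2 ^ (Nat.log 2 t + 1) := Nat.lt_pow_succ_log_self (by norm_num) t
  have h6 : t ^ 7 < 2 ^ (7 * (Nat.log 2 t + 1)) := by
    calc t ^ 7 < (2 ^ (Nat.log 2 t + 1)) ^ 7 := Nat.pow_lt_pow_left h5 (by norm_num)
      _ = _ := by rw [← pow_mul, mul_comm]
  rw [pow_succ 2]
  have : 1 < 2 ^ (7 * (Nat.log 2 t + 1)) := Nat.one_lt_two_pow (by omega)
  omega

lemma typeII_block {t : ℕ} {c : ℝ} {𝒥 : Finset ℕ} {q : ℕ → ℕ} {Q : ℝ} {L : ℕ} {z G : ℝ}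
    (F : Fam t c 𝒥 q Q L z G) (hc : 0 < c) (ht : 3 ≤ t)
    (hlog : Real.log t ^ 10 ≤ (t:ℝ) ^ (c / 2)) (C : ℕ) (hC1 : t ^ 3 ≤ C) (hC2 : C ≤ t ^ 4)
    (f : ℕ → ℝ) (hf1 : ∀ c, |f c| ≤ 1) (hf : ∀ c, c < C → f c = 0)
    (ℓ h : ℕ → ℕ) (hℓ : ∀ c, ℓ c ≤ t ^ 7) (hh : ∀ b, h b ≤ t ^ 7) :
    ∑ j ∈ 𝒥, |∑ c ∈ Finset.range (2 * C), ∑ b ∈ Finset.range (t ^ 7 / C + 1), f c * cnd (t ^ 7) ℓ h c b * Dq (q j) c b|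
      ≤ 10 ^ 6 * (𝒥.card * ((t:ℝ) ^ 7 / Q) / Real.log t ^ 8) := by
  have hl := log_ge_one ht
  have h3 : (3:ℝ) ≤ t := by exact_mod_cast ht
  have ht0 : (0:ℝ) < t := by linarith
  have hQ0 : 0 < Q := by linarith [F.Q1]
  have hC0 : 0 < C := lt_of_lt_of_le (by positivity) hC1
  have hCr : (0:ℝ) < C := by exact_mod_cast hC0
  set B := t ^ 7 / C + 1 with hB
  obtain ⟨hk1, hk2, -⟩ := kbound ht
  set k := 7 * (Nat.log 2 t + 1) + 1 with hk
  have hBr : (B:ℝ) ≤ (t:ℝ)^7 / C + 1 := by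
    rw [hB]; push_cast
    have := @Nat.cast_div_le ℝ _ _ _ (t^7) C
    push_cast at this
    linarith
  have hBr2 : (t:ℝ)^7 / C ≤ B := by
    rw [div_le_iff₀ hCr]
    have := Nat.lt_div_mul_add (a := t^7) hC0
    have h2 : t ^ 7 ≤ B * C := by rw [hB, add_mul, one_mul]; exact this.le
    exact_mod_cast h2
  have hB1 : (1:ℝ) ≤ (t:ℝ)^7 / C := by
    rw [le_div_iff₀ hCr, one_mul]
    have : C ≤ t ^ 7 := hC2.trans (Nat.pow_le_pow_right (by omega) (by norm_num))
    exact_mod_cast this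
  have hMN : (B:ℝ) * (2 * C : ℕ) ≤ 8 * (t:ℝ)^7 := by
    push_cast
    calc (B:ℝ) * (2 * C) ≤ ((t:ℝ)^7 / C + (t:ℝ)^7 / C) * (2 * C) := by gcongr; linarith
      _ = 4 * (t:ℝ)^7 := by field_simp; norm_num
      _ ≤ _ := by nlinarith [pow_pos ht0 7]
  have htC : t ≤ C := le_trans (Nat.le_self_pow (by norm_num) t) hC1
  have htB : t ≤ B := by
    have : t ^ 3 ≤ t ^ 7 / C := by
      rw [Nat.le_div_iff_mul_le hC0]
      calc t ^ 3 * C ≤ t ^ 3 * t ^ 4 := Nat.mul_le_mul_left _ hC2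
        _ = t ^ 7 := by ring
    have h2 : t ≤ t ^ 3 := Nat.le_self_pow (by norm_num) t
    omega
  have hBX : B ≤ t ^ 7 + 1 := by rw [hB]; have := Nat.div_le_self (t^7) C; omega
  set R := 128 * ((t:ℝ)^7 / Q / Real.log t ^ 8) with hR
  have fin : ∀ Δ : ℝ, 0 ≤ Δ → Δ * (√((2 * C : ℕ):ℝ) * √B) ≤ 2000 * (𝒥.card * ((t:ℝ) ^ 7 / Q) / Real.log t ^ 10) →
      k * (k * Δ) * (√((2 * C : ℕ):ℝ) * √B) + 𝒥.card * R ≤ 10 ^ 6 * (𝒥.card * ((t:ℝ) ^ 7 / Q) / Real.log t ^ 8) := by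
    intro Δ _ h
    have h1 : k * (k * Δ) * (√((2 * C : ℕ):ℝ) * √B) ≤ (22 * Real.log t) * (22 * Real.log t) * (2000 * (𝒥.card * ((t:ℝ) ^ 7 / Q) / Real.log t ^ 10)) := by
      calc _ = k * k * (Δ * (√((2 * C : ℕ):ℝ) * √B)) := by ring
        _ ≤ _ := by gcongr
    have h2 : (22 * Real.log t) * (22 * Real.log t) * (2000 * (𝒥.card * ((t:ℝ) ^ 7 / Q) / Real.log t ^ 10))
       = 968000 * (𝒥.card * ((t:ℝ) ^ 7 / Q) / Real.log t ^ 8) := by field_simp; ring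
    have h3 : 𝒥.card * R = 128 * (𝒥.card * ((t:ℝ) ^ 7 / Q) / Real.log t ^ 8) := by rw [hR]; ring
    have h4 : 0 ≤ 𝒥.card * ((t:ℝ) ^ 7 / Q) / Real.log t ^ 8 := by positivity
    rw [h3]; rw [h2] at h1; linarith
  rcases le_or_gt ((t:ℝ) ^ ((7:ℝ)/2)) C with hcase | hcase
  · -- c on the n side
    obtain ⟨Δ, hΔ0, hP, hΔ⟩ := block_PB F hc ht hlog B (2 * C) (by push_cast; linarith) (by omega) htB hMN
    rw [mul_comm (√_)] at hΔ
    refine (typeII_core 𝒥 (t^7) C B _ (fun j c b => Dq (q j) c b) Δ R k hΔ0 hP.swap hC0 f hf1 hf ℓ h hk2 hBX (fun c _ => hℓ c) (fun b _ => hh b) ?_).trans (fin Δ hΔ0 hΔ)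
    intro j hj
    refine le_trans ?_ (F.pair hc ht j hj (Finset.range B) (Finset.range (2 * C)))
    rw [Finset.sum_comm]
    refine Finset.sum_le_sum fun b _ => Finset.sum_le_sum fun c _ => ?_
    rcases lt_or_ge c C with hcC | hcC
    · rw [hf c hcC]; simp; positivity
    have h0 : 0 ≤ 1 / (q j:ℝ) := by positivity
    unfold cnd Dq Wq
    by_cases h1 : 1 ≤ b ∧ c * b ≤ t ^ 7 ∧ ℓ c ≤ h b
    · rw [if_pos h1, mul_comm (b:ℤ) c, sub_sub_sub_cancel_left]
      by_cases h2 : b.Coprime (q j)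
      · rw [if_pos h2, if_neg (by tauto)]; simp
      · rw [if_neg h2, if_pos ⟨h1.1, by omega, by rw [mul_comm]; exact h1.2.1, h2⟩, zero_sub, abs_neg, abs_of_nonneg h0]
        have := hf1 c
        nlinarith
    · rw [if_neg h1]; simp only [mul_zero, zero_mul]; positivity
  · obtain ⟨Δ, hΔ0, hP, hΔ⟩ := block_PB F hc ht hlog (2 * C) B (by
      refine le_trans ?_ hBr2
      rw [le_div_iff₀ hCr]
      calc (t:ℝ) ^ ((7:ℝ)/2) * C ≤ (t:ℝ) ^ ((7:ℝ)/2) * (t:ℝ) ^ ((7:ℝ)/2) := by gcongr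
        _ = (t:ℝ)^7 := by rw [← Real.rpow_add ht0, ← Real.rpow_natCast]; norm_num) (by
      have : t ^ 7 / C ≤ t ^ 4 := by
        refine Nat.div_le_of_le_mul ?_
        calc t ^ 7 = t ^ 3 * t ^ 4 := by ring
          _ ≤ _ := Nat.mul_le_mul_right _ hC1
      have h2 : 1 ≤ t ^ 4 := Nat.one_le_pow _ _ (by omega)
      omega) (by omega) (by rw [mul_comm]; exact hMN)
    refine (typeII_core 𝒥 (t^7) C B _ (fun j c b => Dq (q j) c b) Δ R k hΔ0 hP hC0 f hf1 hf ℓ h hk2 hBX (fun c _ => hℓ c) (fun b _ => hh b) ?_).trans (fin Δ hΔ0 hΔ)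
    intro j hj
    refine le_trans ?_ (F.pair hc ht j hj (Finset.range (2 * C)) (Finset.range B))
    refine Finset.sum_le_sum fun c _ => Finset.sum_le_sum fun b _ => ?_
    rcases lt_or_ge c C with hcC | hcC
    · rw [hf c hcC]; simp; positivity
    have h0 : 0 ≤ 1 / (q j:ℝ) := by positivity
    unfold cnd Dq Wq
    by_cases h1 : 1 ≤ b ∧ c * b ≤ t ^ 7 ∧ ℓ c ≤ h b
    · rw [if_pos h1, sub_sub_sub_cancel_left]
      by_cases h2 : c.Coprime (q j)
      · rw [if_pos h2, if_neg (by tauto)]; simp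
      · rw [if_neg h2, if_pos ⟨by omega, h1.1, h1.2.1, h2⟩, zero_sub, abs_neg, abs_of_nonneg h0]
        have := hf1 c
        nlinarith
    · rw [if_neg h1]; simp only [mul_zero, zero_mul]; positivity

lemma typeII_total {t : ℕ} {c : ℝ} {𝒥 : Finset ℕ} {q : ℕ → ℕ} {Q : ℝ} {L : ℕ} {z G : ℝ}
    (F : Fam t c 𝒥 q Q L z G) (hc : 0 < c) (ht : 3 ≤ t)
    (hlog : Real.log t ^ 10 ≤ (t:ℝ) ^ (c / 2))
    (f : ℕ → ℝ) (hf1 : ∀ c, |f c| ≤ 1)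
    (ℓ h : ℕ → ℕ) (hℓ : ∀ c, ℓ c ≤ t ^ 7) (hh : ∀ b, h b ≤ t ^ 7) :
    ∑ j ∈ 𝒥, |∑ c ∈ Finset.Icc (t^3) (t^4), ∑ b ∈ Finset.range (t ^ 7 + 1), f c * cnd (t ^ 7) ℓ h c b * Dq (q j) c b|
      ≤ 3 * 10 ^ 6 * (𝒥.card * ((t:ℝ) ^ 7 / Q) / Real.log t ^ 7) := by
  have hl := log_ge_one ht
  have hQ0 : 0 < Q := by linarith [F.Q1]
  have ht3 : 0 < t ^ 3 := by positivity
  set K := Nat.log 2 t + 1 with hK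
  set cl : ℕ → ℕ := fun c => Nat.log 2 (c / t ^ 3) with hcl
  have hmaps : ∀ c ∈ Finset.Icc (t^3) (t^4), cl c ∈ Finset.range K := by
    intro c hc
    rw [Finset.mem_Icc] at hc
    rw [Finset.mem_range, hK, Nat.lt_succ_iff]
    apply Nat.log_mono_right
    apply Nat.div_le_of_le_mul
    calc c ≤ t ^ 4 := hc.2
      _ = _ := by ring
  set fi : ℕ → ℕ → ℝ := fun i c => if (t ^ 3 ≤ c ∧ c ≤ t ^ 4) ∧ cl c = i then f c else 0 with hfi
  have key : ∀ j, ∑ c ∈ Finset.Icc (t^3) (t^4), ∑ b ∈ Finset.range (t ^ 7 + 1), f c * cnd (t ^ 7) ℓ h c b * Dq (q j) c b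
      = ∑ i ∈ Finset.range K, ∑ c ∈ Finset.range (2 * (2 ^ i * t ^ 3)), ∑ b ∈ Finset.range (t ^ 7 / (2 ^ i * t ^ 3) + 1), fi i c * cnd (t ^ 7) ℓ h c b * Dq (q j) c b := by
    intro j
    rw [← Finset.sum_fiberwise_of_maps_to hmaps]
    refine Finset.sum_congr rfl fun i _ => ?_
    have hCpos : 0 < 2 ^ i * t ^ 3 := by positivity
    have hsub : (Finset.Icc (t^3) (t^4)).filter (fun c => cl c = i) = (Finset.range (2 * (2 ^ i * t ^ 3))).filter (fun c => (t ^ 3 ≤ c ∧ c ≤ t ^ 4) ∧ cl c = i) := by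
      ext c
      simp only [Finset.mem_filter, Finset.mem_Icc, Finset.mem_range]
      constructor
      · rintro ⟨h1, h2⟩
        refine ⟨?_, h1, h2⟩
        have h3 : c / t ^ 3 < 2 ^ (i + 1) := by
          rw [← h2]; exact Nat.lt_pow_succ_log_self (by norm_num) _
        rw [Nat.div_lt_iff_lt_mul ht3] at h3
        calc c < _ := h3
          _ = _ := by ring
      · tauto
    rw [hsub, Finset.sum_filter]
    refine Finset.sum_congr rfl fun c _ => ?_
    by_cases hcc : (t ^ 3 ≤ c ∧ c ≤ t ^ 4) ∧ cl c = i
    · rw [if_pos hcc]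
      simp only [hfi, if_pos hcc]
      symm
      apply Finset.sum_subset
      · intro b hb
        rw [Finset.mem_range] at hb ⊢
        have := Nat.div_le_self (t^7) (2 ^ i * t ^ 3)
        omega
      · intro b _ hb
        rw [Finset.mem_range, not_lt] at hb
        have h1 : 2 ^ i * t ^ 3 ≤ c := by
          have hne : c / t ^ 3 ≠ 0 := by
            have := Nat.div_pos hcc.1.1 ht3; omega
          have := Nat.pow_log_le_self 2 hne
          rw [show Nat.log 2 (c / t ^ 3) = i from hcc.2] at this
          exact (Nat.le_div_iff_mul_le ht3).1 this
        have h2 : t ^ 7 < c * b := by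
          have := (Nat.div_lt_iff_lt_mul hCpos).1 (Nat.lt_of_succ_le hb)
          calc t ^ 7 < b * (2 ^ i * t ^ 3) := this
            _ ≤ b * c := Nat.mul_le_mul_left _ h1
            _ = _ := mul_comm _ _
        unfold cnd
        rw [if_neg (by rintro ⟨-, h, -⟩; omega)]; simp
    · rw [if_neg hcc]
      simp only [hfi, if_neg hcc]; simp
  calc _ ≤ ∑ j ∈ 𝒥, ∑ i ∈ Finset.range K, |∑ c ∈ Finset.range (2 * (2 ^ i * t ^ 3)), ∑ b ∈ Finset.range (t ^ 7 / (2 ^ i * t ^ 3) + 1), fi i c * cnd (t ^ 7) ℓ h c b * Dq (q j) c b| := by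
        refine Finset.sum_le_sum fun j _ => ?_
        rw [key]; exact Finset.abs_sum_le_sum_abs _ _
    _ = ∑ i ∈ Finset.range K, ∑ j ∈ 𝒥, |∑ c ∈ Finset.range (2 * (2 ^ i * t ^ 3)), ∑ b ∈ Finset.range (t ^ 7 / (2 ^ i * t ^ 3) + 1), fi i c * cnd (t ^ 7) ℓ h c b * Dq (q j) c b| := Finset.sum_comm
    _ ≤ ∑ i ∈ Finset.range K, 10 ^ 6 * (𝒥.card * ((t:ℝ) ^ 7 / Q) / Real.log t ^ 8) := by
        refine Finset.sum_le_sum fun i hi => ?_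
        have hi2 : 2 ^ i ≤ t := by
          have h1 : i ≤ Nat.log 2 t := by rw [Finset.mem_range] at hi; omega
          exact (Nat.pow_le_pow_right (by norm_num) h1).trans (Nat.pow_log_le_self 2 (by omega))
        apply typeII_block F hc ht hlog
        · exact Nat.le_mul_of_pos_left _ (by positivity)
        · calc 2 ^ i * t ^ 3 ≤ t * t ^ 3 := Nat.mul_le_mul_right _ hi2
            _ = _ := by ring
        · intro c
          simp only [hfi]
          split_ifs
          · exact hf1 c
          · simp
        · intro c hcl2
          simp only [hfi]
          rw [if_neg]
          rintro ⟨⟨h1, h2⟩, h3⟩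
          have hne : c / t ^ 3 ≠ 0 := by
            have := Nat.div_pos h1 ht3; omega
          have := Nat.pow_log_le_self 2 hne
          rw [show Nat.log 2 (c / t ^ 3) = i from h3] at this
          have := (Nat.le_div_iff_mul_le ht3).1 this
          omega
        · exact hℓ
        · exact hh
    _ = K * (10 ^ 6 * (𝒥.card * ((t:ℝ) ^ 7 / Q) / Real.log t ^ 8)) := by simp
    _ ≤ (3 * Real.log t) * (10 ^ 6 * (𝒥.card * ((t:ℝ) ^ 7 / Q) / Real.log t ^ 8)) := by
        gcongr
        exact (kbound ht).2.2
    _ = _ := by field_simp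

/-- Type I sum. -/
lemma typeI_total {t : ℕ} {c : ℝ} {𝒥 : Finset ℕ} {q : ℕ → ℕ} {Q : ℝ} {L : ℕ} {z G : ℝ}
    (F : Fam t c 𝒥 q Q L z G) (hc : 0 < c) (ht : 3 ≤ t) (f : ℕ → ℝ) (hf1 : ∀ c, |f c| ≤ 1) (j : ℕ) (hj : j ∈ 𝒥) :
    |∑ a ∈ Finset.Icc 1 (t^3), ∑ b ∈ Finset.Icc 1 (t^7 / a), f a * Dq (q j) a b|
      ≤ 2 * (t:ℝ)^3 + 128 * ((t:ℝ)^7 / Q / Real.log t ^ 8) := by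
  have hq0 := (F.log_q hc ht j hj).1
  have hqr : (1:ℝ) ≤ q j := by exact_mod_cast hq0
  have key : ∀ a ∈ Finset.Icc 1 (t^3), |∑ b ∈ Finset.Icc 1 (t^7 / a), f a * Dq (q j) a b|
      ≤ 2 + ∑ n ∈ Finset.Icc 1 (t^7), if 1 ≤ a ∧ 1 ≤ n ∧ a * n ≤ t ^ 7 ∧ ¬ a.Coprime (q j) then 1 / (q j:ℝ) else 0 := by
    intro a ha
    rw [Finset.mem_Icc] at ha
    rw [← Finset.mul_sum, abs_mul]
    have h1 : |∑ b ∈ Finset.Icc 1 (t^7 / a), Dq (q j) a b|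
      ≤ 2 + ∑ n ∈ Finset.Icc 1 (t^7), if 1 ≤ a ∧ 1 ≤ n ∧ a * n ≤ t ^ 7 ∧ ¬ a.Coprime (q j) then 1 / (q j:ℝ) else 0 := by
      by_cases hcop : a.Coprime (q j)
      · have h0 : ∑ n ∈ Finset.Icc 1 (t^7), (if 1 ≤ a ∧ 1 ≤ n ∧ a * n ≤ t ^ 7 ∧ ¬ a.Coprime (q j) then 1 / (q j:ℝ) else 0) = 0 :=
          Finset.sum_eq_zero fun n _ => by rw [if_neg (by tauto)]
        rw [h0, add_zero]
        unfold Dq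
        rw [Finset.sum_sub_distrib]
        set T := t ^ 7 / a with hT
        obtain ⟨v, hv⟩ : ∃ v : ℕ, ∀ b : ℕ, ((q j:ℤ) ∣ (a:ℤ) * b - 1 ↔ b ≡ v [MOD q j]) := by
          refine ⟨(ZMod.inv (q j) (a : ZMod (q j))).val, fun b => ?_⟩
          have : NeZero (q j) := ⟨hq0.ne'⟩
          rw [← ZMod.intCast_zmod_eq_zero_iff_dvd, ← ZMod.natCast_eq_natCast_iff]
          push_cast
          rw [ZMod.natCast_zmod_val, sub_eq_zero]
          have hu : (a : ZMod (q j)) * (a : ZMod (q j))⁻¹ = 1 := ZMod.coe_mul_inv_eq_one a hcop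
          constructor
          · intro h
            calc (b : ZMod (q j)) = ((a : ZMod (q j)) * (a : ZMod (q j))⁻¹) * b := by rw [hu, one_mul]
              _ = (a : ZMod (q j))⁻¹ * ((a : ZMod (q j)) * b) := by ring
              _ = _ := by rw [h, mul_one]; rfl
          · intro h
            rw [h]; exact hu
        have e1 : ∑ b ∈ Finset.Icc 1 T, (if (q j:ℤ) ∣ (a:ℤ) * b - 1 then (1:ℝ) else 0) = (((Finset.Ioc 0 T).filter (fun b => b ≡ v [MOD q j])).card : ℝ) := by
          rw [Finset.sum_boole]
          congr 2
          ext b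
          simp only [Finset.mem_filter, Finset.mem_Icc, Finset.mem_Ioc, hv]
          rfl
        rw [e1]
        have e2 := Nat.Ioc_filter_modEq_card 0 T hq0 v
        simp only [Finset.sum_const, Nat.card_Icc, nsmul_eq_mul]
        have hqQ : (0:ℚ) < q j := by exact_mod_cast hq0
        set u1 : ℚ := ((T:ℚ) - v) / (q j:ℚ) with hu1
        set u2 : ℚ := (((0:ℕ):ℚ) - v) / (q j:ℚ) with hu2
        have hu : u1 = u2 + T / q j := by rw [hu1, hu2]; push_cast; ring
        have hT0 : (0:ℚ) ≤ T / q j := by positivity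
        have hle : ⌊u2⌋ ≤ ⌊u1⌋ := Int.floor_le_floor (by linarith)
        rw [max_eq_left (by linarith)] at e2
        set N0 := ((Finset.Ioc 0 T).filter (fun b => b ≡ v [MOD q j])).card with hN0
        have e3 : (N0:ℚ) = (⌊u1⌋:ℚ) - ⌊u2⌋ := by exact_mod_cast e2
        have b1 := Int.floor_le u1
        have b2 := Int.lt_floor_add_one u1
        have b3 := Int.floor_le u2
        have b4 := Int.lt_floor_add_one u2
        have e4 : |(N0:ℚ) - T / q j| ≤ 2 := by rw [abs_le]; constructor <;> linarith
        have e5 : |(N0:ℝ) - T / q j| ≤ 2 := by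
          have : ((|(N0:ℚ) - T / q j| : ℚ) : ℝ) ≤ ((2:ℚ):ℝ) := Rat.cast_le.2 e4
          push_cast at this
          exact this
        simpa [div_eq_mul_inv] using e5
      · have e : ∑ b ∈ Finset.Icc 1 (t^7 / a), Dq (q j) a b = -∑ n ∈ Finset.Icc 1 (t^7), if 1 ≤ a ∧ 1 ≤ n ∧ a * n ≤ t ^ 7 ∧ ¬ a.Coprime (q j) then 1 / (q j:ℝ) else 0 := by
          rw [← Finset.sum_neg_distrib]
          have hsub : Finset.Icc 1 (t^7/a) ⊆ Finset.Icc 1 (t^7) := Finset.Icc_subset_Icc le_rfl (Nat.div_le_self _ _)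
          rw [← Finset.sum_subset hsub]
          · refine Finset.sum_congr rfl fun n hn => ?_
            rw [Finset.mem_Icc, Nat.le_div_iff_mul_le ha.1, mul_comm] at hn
            unfold Dq
            rw [if_neg (fun h => hcop (coprime_of_dvd_sub h)), if_pos ⟨ha.1, hn.1, hn.2, hcop⟩]
            simp
          · intro n hn hn2
            rw [Finset.mem_Icc] at hn hn2
            rw [if_neg, neg_zero]
            rintro ⟨-, h1, h2, -⟩
            apply hn2
            refine ⟨h1, ?_⟩
            rw [Nat.le_div_iff_mul_le ha.1, mul_comm]; exact h2
        have hnn : 0 ≤ ∑ n ∈ Finset.Icc 1 (t^7), if 1 ≤ a ∧ 1 ≤ n ∧ a * n ≤ t ^ 7 ∧ ¬ a.Coprime (q j) then 1 / (q j:ℝ) else 0 :=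
          Finset.sum_nonneg fun n _ => by positivity
        rw [e, abs_neg, abs_of_nonneg hnn]
        linarith
    have := hf1 a
    nlinarith [abs_nonneg (∑ b ∈ Finset.Icc 1 (t^7 / a), Dq (q j) a b), abs_nonneg (f a)]
  calc _ ≤ ∑ a ∈ Finset.Icc 1 (t^3), |∑ b ∈ Finset.Icc 1 (t^7 / a), f a * Dq (q j) a b| := Finset.abs_sum_le_sum_abs _ _
    _ ≤ ∑ a ∈ Finset.Icc 1 (t^3), (2 + ∑ n ∈ Finset.Icc 1 (t^7), if 1 ≤ a ∧ 1 ≤ n ∧ a * n ≤ t ^ 7 ∧ ¬ a.Coprime (q j) then 1 / (q j:ℝ) else 0) := Finset.sum_le_sum key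
    _ ≤ _ := by
        rw [Finset.sum_add_distrib]
        refine add_le_add (le_of_eq ?_) (F.pair hc ht j hj _ _)
        simp; ring

def InA (t a : ℕ) : Prop := Squarefree a ∧ a < t ^ 3 ∧
  ∀ p q : ℕ, p.Prime → q.Prime → p ∣ a → q ∣ a → q < p → p * q ^ 2 ≤ t ^ 4

def Bd (t c : ℕ) : Prop := Squarefree c ∧ 1 < c ∧ c.minFac ≤ t ^ 4 ∧ ¬ InA t c ∧ InA t (c / c.minFac)

def rgh (y n : ℕ) : Prop := ∀ p : ℕ, p.Prime → p ∣ n → y ≤ p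

noncomputable def mu (n : ℕ) : ℝ := (ArithmeticFunction.moebius n : ℝ)

lemma mu_abs (n : ℕ) : |mu n| ≤ 1 := by
  unfold mu
  exact_mod_cast ArithmeticFunction.abs_moebius_le_one (n := n)

lemma mu_mul_prime {p T : ℕ} (hp : p.Prime) (hT : ¬ p ∣ T) : mu (p * T) = - mu T := by
  unfold mu
  rw [ArithmeticFunction.isMultiplicative_moebius.map_mul_of_coprime ((Nat.Prime.coprime_iff_not_dvd hp).2 hT),
    ArithmeticFunction.moebius_apply_prime hp]
  simp

lemma InA.dvd {t a b : ℕ} (h : InA t a) (hb : b ∣ a) : InA t b := by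
  refine ⟨h.1.squarefree_of_dvd hb, lt_of_le_of_lt (Nat.le_of_dvd (Nat.pos_of_ne_zero h.1.ne_zero) hb) h.2.1, ?_⟩
  intro p q hp hq h1 h2 h3
  exact h.2.2 p q hp hq (h1.trans hb) (h2.trans hb) h3

lemma InA_one {t : ℕ} (ht : 2 ≤ t) : InA t 1 := by
  refine ⟨squarefree_one, Nat.one_lt_pow (by norm_num) (by omega), ?_⟩
  intro p q hp _ h1
  exact absurd (Nat.dvd_one.1 h1) hp.one_lt.ne'

lemma buch {t n : ℕ} (ht : 2 ≤ t) (hn : 0 < n) :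
    (if rgh (t ^ 4 + 1) n then (1:ℝ) else 0) = ∑ a ∈ n.divisors.filter (InA t), mu a
      + ∑ c ∈ n.divisors.filter (Bd t), mu c * (if rgh c.minFac (n / c) then 1 else 0) := by
  by_cases hr : rgh (t ^ 4 + 1) n
  · rw [if_pos hr]
    have e1 : n.divisors.filter (InA t) = {1} := by
      ext a
      simp only [Finset.mem_filter, Nat.mem_divisors, Finset.mem_singleton]
      constructor
      · rintro ⟨⟨h1, -⟩, h2⟩
        by_contra ha
        have hp := Nat.minFac_prime ha
        have h3 := hr _ hp ((Nat.minFac_dvd a).trans h1)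
        have h4 := Nat.minFac_le (Nat.pos_of_ne_zero h2.1.ne_zero)
        have h5 := h2.2.1
        have : t ^ 3 ≤ t ^ 4 := Nat.pow_le_pow_right (by omega) (by norm_num)
        omega
      · rintro rfl
        exact ⟨⟨one_dvd _, hn.ne'⟩, InA_one ht⟩
    have e2 : n.divisors.filter (Bd t) = ∅ := by
      apply Finset.filter_eq_empty_iff.2
      intro c hc hB
      have hp := Nat.minFac_prime hB.2.1.ne'
      have h3 := hr _ hp ((Nat.minFac_dvd c).trans (Nat.dvd_of_mem_divisors hc))
      have := hB.2.2.1
      omega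
    rw [e1, e2]; simp [mu]
  · rw [if_neg hr]
    obtain ⟨p, hp, hpn, hpt, hmin⟩ : ∃ p : ℕ, p.Prime ∧ p ∣ n ∧ p ≤ t ^ 4 ∧ ∀ r : ℕ, r.Prime → r ∣ n → p ≤ r := by
      unfold rgh at hr
      push Not at hr
      obtain ⟨r, hr1, hr2, hr3⟩ := hr
      have hn1 : n ≠ 1 := by rintro rfl; exact hr1.one_lt.ne' (Nat.dvd_one.1 hr2)
      exact ⟨n.minFac, Nat.minFac_prime hn1, Nat.minFac_dvd n, by have := Nat.minFac_le_of_dvd hr1.two_le hr2; omega,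
        fun r h1 h2 => Nat.minFac_le_of_dvd h1.two_le h2⟩
    have hmf : ∀ d, d ∣ n → p ∣ d → d.minFac = p := by
      intro d hd hpd
      apply le_antisymm (Nat.minFac_le_of_dvd hp.two_le hpd)
      apply hmin _ (Nat.minFac_prime ?_) ((Nat.minFac_dvd d).trans hd)
      rintro rfl
      exact hp.one_lt.ne' (Nat.dvd_one.1 hpd)
    have s2 : ∑ c ∈ n.divisors.filter (Bd t), mu c * (if rgh c.minFac (n / c) then 1 else 0)
        = ∑ d ∈ n.divisors.filter (fun d => p ∣ d ∧ Bd t d), mu d := by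
      rw [Finset.sum_filter, Finset.sum_filter]
      refine Finset.sum_congr rfl fun d hd => ?_
      have hdn := Nat.dvd_of_mem_divisors hd
      by_cases hB : Bd t d
      · rw [if_pos hB]
        by_cases hpd : p ∣ d
        · have hR : rgh d.minFac (n / d) := by
            rw [hmf d hdn hpd]
            intro r h1 h2
            exact hmin r h1 (h2.trans (Nat.div_dvd_of_dvd hdn))
          rw [if_pos hR, if_pos ⟨hpd, hB⟩, mul_one]
        · rw [if_neg (c := p ∣ d ∧ Bd t d) (by tauto), if_neg, mul_zero]
          intro hrr
          have h1 : p ∣ n / d := by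
            have : p ∣ d * (n / d) := by rwa [Nat.mul_div_cancel' hdn]
            exact (hp.dvd_mul.1 this).resolve_left hpd
          have h2 := hrr p hp h1
          have h3 := Nat.minFac_prime hB.2.1.ne'
          have h4 := hmin _ h3 ((Nat.minFac_dvd d).trans hdn)
          exact hpd (le_antisymm h2 h4 ▸ Nat.minFac_dvd d)
      · rw [if_neg hB, if_neg (by tauto)]
    have s1 : ∑ a ∈ n.divisors.filter (InA t), mu a = ∑ a ∈ n.divisors.filter (fun a => ¬ p ∣ a ∧ InA t a), mu a
        + ∑ a ∈ n.divisors.filter (fun a => p ∣ a ∧ InA t a), mu a := by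
      simp only [Finset.sum_filter]
      rw [← Finset.sum_add_distrib]
      refine Finset.sum_congr rfl fun d _ => ?_
      by_cases h1 : p ∣ d <;> by_cases h2 : InA t d <;> simp [h1, h2]
    have s3 : ∑ a ∈ n.divisors.filter (fun a => p ∣ a ∧ InA t a), mu a + ∑ d ∈ n.divisors.filter (fun d => p ∣ d ∧ Bd t d), mu d
        = ∑ d ∈ n.divisors.filter (fun d => p ∣ d ∧ (InA t d ∨ Bd t d)), mu d := by
      simp only [Finset.sum_filter]
      rw [← Finset.sum_add_distrib]
      refine Finset.sum_congr rfl fun d _ => ?_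
      by_cases h1 : p ∣ d <;> by_cases h2 : InA t d <;> by_cases h3 : Bd t d <;> simp [h1, h2, h3]
      exact absurd h2 h3.2.2.2.1
    have s4 : ∑ d ∈ n.divisors.filter (fun d => p ∣ d ∧ (InA t d ∨ Bd t d)), mu d
        = ∑ a ∈ n.divisors.filter (fun a => ¬ p ∣ a ∧ InA t a), - mu a := by
      refine Finset.sum_nbij' (fun d => d / p) (fun T => p * T) ?_ ?_ ?_ ?_ ?_
      · intro d hd
        simp only [Finset.mem_filter, Nat.mem_divisors] at hd ⊢
        obtain ⟨⟨hdn, hn0⟩, hpd, hAB⟩ := hd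
        obtain ⟨T, rfl⟩ := hpd
        have hsq : Squarefree (p * T) := by rcases hAB with h | h <;> exact h.1
        rw [Nat.mul_div_cancel_left T hp.pos]
        refine ⟨⟨(Dvd.intro_left p rfl).trans hdn, hn0⟩, ?_, ?_⟩
        · intro h
          have := (Nat.squarefree_mul_iff.1 hsq).1
          exact (Nat.Prime.coprime_iff_not_dvd hp).1 this h
        · rcases hAB with h | h
          · exact h.dvd (Dvd.intro_left p rfl)
          · have h2 := h.2.2.2.2
            rwa [hmf _ hdn (Dvd.intro T rfl), Nat.mul_div_cancel_left T hp.pos] at h2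
      · intro T hT
        simp only [Finset.mem_filter, Nat.mem_divisors] at hT ⊢
        obtain ⟨⟨hdn, hn0⟩, hpT, hA⟩ := hT
        have hcop := (Nat.Prime.coprime_iff_not_dvd hp).2 hpT
        have hdvd := hcop.mul_dvd_of_dvd_of_dvd hpn hdn
        refine ⟨⟨hdvd, hn0⟩, Dvd.intro T rfl, ?_⟩
        by_cases hh : InA t (p * T)
        · exact Or.inl hh
        · right
          have hm := hmf _ hdvd (Dvd.intro T rfl)
          refine ⟨(Nat.squarefree_mul hcop).2 ⟨hp.squarefree, hA.1⟩, ?_, ?_, hh, ?_⟩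
          · have := Nat.pos_of_ne_zero hA.1.ne_zero
            have := hp.one_lt
            nlinarith
          · rw [hm]; exact hpt
          · rw [hm, Nat.mul_div_cancel_left T hp.pos]; exact hA
      · intro d hd
        simp only [Finset.mem_filter] at hd
        exact Nat.mul_div_cancel' hd.2.1
      · intro T _
        exact Nat.mul_div_cancel_left T hp.pos
      · intro d hd
        simp only [Finset.mem_filter, Nat.mem_divisors] at hd
        obtain ⟨⟨hdn, hn0⟩, hpd, hAB⟩ := hd
        obtain ⟨T, rfl⟩ := hpd
        have hsq : Squarefree (p * T) := by rcases hAB with h | h <;> exact h.1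
        rw [Nat.mul_div_cancel_left T hp.pos]
        exact mu_mul_prime hp ((Nat.Prime.coprime_iff_not_dvd hp).1 (Nat.squarefree_mul_iff.1 hsq).1)
    rw [s1, s2, add_assoc, s3, s4, Finset.sum_neg_distrib, add_neg_cancel]

/-- Classification of boundary elements. -/
lemma Bd_class {t c : ℕ} (ht : 2 ≤ t) (h : Bd t c) : (t ^ 3 ≤ c ∧ c ≤ t ^ 4) ∨
    ∃ p q : ℕ, p.Prime ∧ q.Prime ∧ c = p * q ∧ q < p ∧ c.minFac = q ∧ p < t ^ 3 ∧
      (t ^ 4 < p * q ∨ (p * q < t ^ 3 ∧ t ^ 4 < p * q ^ 2)) := by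
  obtain ⟨hsq, h1, hmt, hnA, hA⟩ := h
  have hq := Nat.minFac_prime h1.ne'
  set q := c.minFac with hqdef
  obtain ⟨a, ha⟩ : q ∣ c := Nat.minFac_dvd c
  have hca : c / q = a := by rw [ha]; exact Nat.mul_div_cancel_left a hq.pos
  rw [hca] at hA
  have hsq2 := hsq
  rw [ha] at hsq2
  have hcop := (Nat.squarefree_mul_iff.1 hsq2).1
  have hqa : ¬ q ∣ a := (Nat.Prime.coprime_iff_not_dvd hq).1 hcop
  have hapos : 0 < a := Nat.pos_of_ne_zero hA.1.ne_zero
  have hgt : ∀ p : ℕ, p.Prime → p ∣ a → q < p := by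
    intro p hp hpa
    have h2 : q ≤ p := Nat.minFac_le_of_dvd hp.two_le (hpa.trans (ha ▸ Dvd.intro_left q rfl))
    rcases h2.lt_or_eq with h3 | h3
    · exact h3
    · exact absurd (h3 ▸ hpa) hqa
  by_cases hc : t ^ 3 ≤ c ∧ c ≤ t ^ 4
  · exact Or.inl hc
  right
  have hex : c < t ^ 3 → ∃ p : ℕ, p.Prime ∧ p ∣ a ∧ t ^ 4 < p * q ^ 2 := by
    intro hlt
    by_contra hno
    push Not at hno
    apply hnA
    refine ⟨hsq, hlt, ?_⟩
    intro p r hp hr hpc hrc hrp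
    rw [ha] at hpc hrc
    have hqp : p ∣ a := by
      rcases hp.dvd_mul.1 hpc with h2 | h2
      · have := (Nat.prime_dvd_prime_iff_eq hp hq).1 h2
        subst this
        rcases hr.dvd_mul.1 hrc with h3 | h3
        · have := (Nat.prime_dvd_prime_iff_eq hr hq).1 h3; omega
        · have := hgt r hr h3; omega
      · exact h2
    rcases hr.dvd_mul.1 hrc with h2 | h2
    · have := (Nat.prime_dvd_prime_iff_eq hr hq).1 h2
      rw [this]; exact hno p hp hqp
    · exact hA.2.2 p r hp hr hqp h2 hrp
  by_cases ha1 : a = 1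
  · exfalso
    rw [ha1, mul_one] at ha
    rcases lt_or_ge c (t ^ 3) with h2 | h2
    · obtain ⟨p, hp, hpa, -⟩ := hex h2
      rw [ha1] at hpa
      exact hp.one_lt.ne' (Nat.dvd_one.1 hpa)
    · exact hc ⟨h2, by omega⟩
  have hp := Nat.minFac_prime ha1
  set p := a.minFac with hpdef
  obtain ⟨b, hb⟩ : p ∣ a := Nat.minFac_dvd a
  have hqp := hgt p hp (Nat.minFac_dvd a)
  by_cases hb1 : b = 1
  · rw [hb1, mul_one] at hb
    refine ⟨p, q, hp, hq, by rw [ha, hb, mul_comm], hqp, rfl, by rw [← hb]; exact hA.2.1, ?_⟩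
    have hcpq : c = p * q := by rw [ha, hb, mul_comm]
    rcases lt_or_ge c (t ^ 3) with h2 | h2
    · right
      refine ⟨by omega, ?_⟩
      obtain ⟨r, hr, hra, hr2⟩ := hex h2
      rw [hb] at hra
      rwa [(Nat.prime_dvd_prime_iff_eq hr hp).1 hra] at hr2
    · left
      rw [not_and] at hc
      have := hc h2
      omega
  exfalso
  -- a has at least two prime factors
  have hr := Nat.minFac_prime hb1
  set r := b.minFac with hrdef
  obtain ⟨d, hd⟩ : r ∣ b := Nat.minFac_dvd b
  have hAsq := hA.1
  rw [hb] at hAsq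
  have hpb : ¬ p ∣ b := (Nat.Prime.coprime_iff_not_dvd hp).1 (Nat.squarefree_mul_iff.1 hAsq).1
  have hra : r ∣ a := hb ▸ (Nat.minFac_dvd b).trans (Dvd.intro_left p rfl)
  have hpr : p < r := by
    have h2 : p ≤ r := Nat.minFac_le_of_dvd hr.two_le hra
    rcases h2.lt_or_eq with h3 | h3
    · exact h3
    · exact absurd (h3 ▸ Nat.minFac_dvd b) hpb
  have hadef : a = p * r * d := by rw [hb, hd]; ring
  have hd0 : 0 < d := by
    rcases Nat.eq_zero_or_pos d with h | h
    · rw [h] at hadef; omega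
    · exact h
  rcases lt_or_ge c (t ^ 3) with h2 | h2
  · obtain ⟨s, hs, hsa, hs2⟩ := hex h2
    have h34 : t ^ 3 ≤ t ^ 4 := Nat.pow_le_pow_right (by omega) (by norm_num)
    -- find another prime
    obtain ⟨u, hu, hua, hus⟩ : ∃ u : ℕ, u.Prime ∧ u ∣ a ∧ u ≠ s := by
      by_cases hps : p = s
      · exact ⟨r, hr, hra, by omega⟩
      · exact ⟨p, hp, Nat.minFac_dvd a, hps⟩
    have hqu := hgt u hu hua
    have hus2 : u * s ∣ a := ((Nat.coprime_primes hu hs).2 hus).mul_dvd_of_dvd_of_dvd hua hsa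
    have h5 := Nat.le_of_dvd hapos hus2
    have h6 : s * q ^ 2 ≤ c := by
      calc s * q ^ 2 = q * (q * s) := by ring
        _ ≤ q * (u * s) := Nat.mul_le_mul_left _ (Nat.mul_le_mul_right _ hqu.le)
        _ ≤ q * a := Nat.mul_le_mul_left _ h5
        _ = c := ha.symm
    omega
  · have hct : t ^ 4 < c := by
      rw [not_and] at hc; have := hc h2; omega
    have hqt : t < q := by
      by_contra hle
      have h5 : c < t ^ 4 := by
        calc c = q * a := ha
          _ ≤ t * a := Nat.mul_le_mul_right _ (by omega)
          _ < t * t ^ 3 := Nat.mul_lt_mul_of_pos_left hA.2.1 (by omega)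
          _ = t ^ 4 := by ring
      omega
    by_cases hd1 : d = 1
    · rw [hd1, mul_one] at hadef
      have h5 := hA.2.2 r p hr hp hra (Nat.minFac_dvd a) hpr
      have h6 : c ≤ r * p ^ 2 := by
        calc c = q * (p * r) := by rw [ha, hadef]
          _ ≤ p * (p * r) := Nat.mul_le_mul_right _ hqp.le
          _ = _ := by ring
      omega
    · have hs := Nat.minFac_prime hd1
      have hsd := Nat.minFac_le hd0
      have h5 := hgt _ hs ((Nat.minFac_dvd d).trans (hadef ▸ Dvd.intro_left (p * r) rfl))
      have h6 : t ^ 3 ≤ a := by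
        calc t ^ 3 = t * t * t := by ring
          _ ≤ p * r * d := Nat.mul_le_mul (Nat.mul_le_mul (by omega) (by omega)) (by omega)
          _ = a := hadef.symm
      have := hA.2.1
      omega

lemma sum_divisors_swap (X : ℕ) (H : ℕ → ℕ → ℝ) :
    ∑ n ∈ Finset.Icc 1 X, ∑ a ∈ n.divisors, H a (n / a) = ∑ a ∈ Finset.Icc 1 X, ∑ b ∈ Finset.Icc 1 (X / a), H a b := by
  rw [Finset.sum_sigma', Finset.sum_sigma']
  refine Finset.sum_nbij' (fun s => ⟨s.2, s.1 / s.2⟩) (fun s => ⟨s.1 * s.2, s.1⟩) ?_ ?_ ?_ ?_ ?_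
  · rintro ⟨n, a⟩ h
    simp only [Finset.mem_sigma, Finset.mem_Icc, Nat.mem_divisors] at h ⊢
    obtain ⟨⟨h1, h2⟩, h3, -⟩ := h
    have ha : 0 < a := Nat.pos_of_dvd_of_pos h3 h1
    have hle := Nat.le_of_dvd h1 h3
    exact ⟨⟨ha, by omega⟩, Nat.div_pos hle ha, Nat.div_le_div_right h2⟩
  · rintro ⟨a, b⟩ h
    simp only [Finset.mem_sigma, Finset.mem_Icc, Nat.mem_divisors] at h ⊢
    obtain ⟨⟨h1, h2⟩, h3, h4⟩ := h
    have : 0 < a * b := Nat.mul_pos h1 h3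
    rw [Nat.le_div_iff_mul_le h1, mul_comm] at h4
    exact ⟨⟨this, h4⟩, Dvd.intro b rfl, this.ne'⟩
  · rintro ⟨n, a⟩ h
    simp only [Finset.mem_sigma, Finset.mem_Icc, Nat.mem_divisors] at h
    simp only [Nat.mul_div_cancel' h.2.1]
  · rintro ⟨a, b⟩ h
    simp only [Finset.mem_sigma, Finset.mem_Icc] at h
    simp only [Nat.mul_div_cancel_left b h.1.1]
  · rintro ⟨n, a⟩ h
    rfl

def T2 (t c : ℕ) : Prop := Bd t c ∧ t ^ 3 ≤ c ∧ c ≤ t ^ 4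
def Drp (t c : ℕ) : Prop := Bd t c ∧ ¬ (t ^ 3 ≤ c ∧ c ≤ t ^ 4)

noncomputable def gf (t n : ℕ) : ℝ := ∑ a ∈ n.divisors.filter (InA t), mu a
      + ∑ c ∈ n.divisors.filter (T2 t), mu c * (if rgh c.minFac (n / c) then 1 else 0)

lemma mu_Drp {t c : ℕ} (ht : 2 ≤ t) (h : Drp t c) : mu c = 1 := by
  rcases Bd_class ht h.1 with h1 | ⟨p, q, hp, hq, hc, hqp, -, -, -⟩
  · exact absurd h1 h.2
  · rw [hc, mu_mul_prime hp]
    · unfold mu; rw [ArithmeticFunction.moebius_apply_prime hq]; simp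
    · intro hd
      have := (Nat.prime_dvd_prime_iff_eq hp hq).1 hd
      omega

lemma gf_eq {t n : ℕ} (ht : 2 ≤ t) (hn : 0 < n) :
    (if rgh (t ^ 4 + 1) n then (1:ℝ) else 0) = gf t n +
      ∑ c ∈ n.divisors.filter (Drp t), (if rgh c.minFac (n / c) then (1:ℝ) else 0) := by
  rw [buch ht hn]
  unfold gf
  rw [add_assoc]
  congr 1
  simp only [Finset.sum_filter]
  rw [← Finset.sum_add_distrib]
  refine Finset.sum_congr rfl fun c _ => ?_
  unfold T2
  by_cases h1 : Bd t c <;> by_cases h2 : (t ^ 3 ≤ c ∧ c ≤ t ^ 4)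
  · have h3 : ¬ Drp t c := fun h => h.2 h2
    simp [h1, h2, h3]
  · have h3 : Drp t c := ⟨h1, h2⟩
    have := mu_Drp ht h3
    simp [h1, h2, h3, this]
  · have h3 : ¬ Drp t c := fun h => h.2 h2
    simp [h1, h2, h3]
  · have h3 : ¬ Drp t c := fun h => h1 h.1
    simp [h1, h3]

lemma gf_le {t n : ℕ} (ht : 2 ≤ t) (hn : 0 < n) : gf t n ≤ if rgh (t ^ 4 + 1) n then (1:ℝ) else 0 := by
  rw [gf_eq ht hn]
  have : 0 ≤ ∑ c ∈ n.divisors.filter (Drp t), (if rgh c.minFac (n / c) then (1:ℝ) else 0) :=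
    Finset.sum_nonneg fun _ _ => by positivity
  linarith

noncomputable def phq (q n : ℕ) : ℝ := (if (q:ℤ) ∣ (n:ℤ) - 1 then 1 else 0) - 1 / (q:ℝ)

lemma gf_split {t : ℕ} (ht : 2 ≤ t) (q : ℕ) : ∃ ℓ h : ℕ → ℕ, (∀ c, ℓ c ≤ t ^ 7) ∧ (∀ b, h b ≤ t ^ 7) ∧ ∀ q : ℕ,
    ∑ n ∈ Finset.Icc 1 (t^7), gf t n * phq q n =
    ∑ a ∈ Finset.Icc 1 (t^3), ∑ b ∈ Finset.Icc 1 (t^7 / a), (if InA t a then mu a else 0) * Dq q a b +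
    ∑ c ∈ Finset.Icc (t^3) (t^4), ∑ b ∈ Finset.range (t ^ 7 + 1), (if T2 t c then mu c else 0) * cnd (t ^ 7) ℓ h c b * Dq q c b := by
  have ht1 : 1 ≤ t := by omega
  have h37 : t ^ 3 ≤ t ^ 7 := Nat.pow_le_pow_right ht1 (by norm_num)
  have h47 : t ^ 4 ≤ t ^ 7 := Nat.pow_le_pow_right ht1 (by norm_num)
  refine ⟨fun c => min c.minFac (t^7), fun b => if b = 1 then t^7 else min b.minFac (t^7), fun c => min_le_right _ _, ?_, ?_⟩
  · intro b
    dsimp only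
    split_ifs
    · exact le_rfl
    · exact min_le_right _ _
  intro q
  have e0 : ∀ a b : ℕ, Dq q a b = phq q (a * b) := by
    intro a b; unfold Dq phq; push_cast; rfl
  have e1 : ∀ n ∈ Finset.Icc 1 (t^7), gf t n * phq q n = ∑ a ∈ n.divisors, (if InA t a then mu a else 0) * phq q (a * (n / a))
      + ∑ a ∈ n.divisors, (if T2 t a then mu a else 0) * (if rgh a.minFac (n / a) then 1 else 0) * phq q (a * (n / a)) := by
    intro n _
    unfold gf
    rw [add_mul, Finset.sum_filter, Finset.sum_filter, Finset.sum_mul, Finset.sum_mul]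
    congr 1
    · refine Finset.sum_congr rfl fun a ha => ?_
      rw [Nat.mul_div_cancel' (Nat.dvd_of_mem_divisors ha)]
    · refine Finset.sum_congr rfl fun a ha => ?_
      rw [Nat.mul_div_cancel' (Nat.dvd_of_mem_divisors ha)]
      split_ifs <;> simp
  rw [Finset.sum_congr rfl e1, Finset.sum_add_distrib,
    sum_divisors_swap (t^7) (fun a b => (if InA t a then mu a else 0) * phq q (a * b)),
    sum_divisors_swap (t^7) (fun a b => (if T2 t a then mu a else 0) * (if rgh a.minFac b then 1 else 0) * phq q (a * b))]
  congr 1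
  · symm
    simp only [e0]
    apply Finset.sum_subset (Finset.Icc_subset_Icc le_rfl h37)
    intro a ha hna
    rw [Finset.mem_Icc] at ha hna
    have : ¬ InA t a := fun h => hna ⟨ha.1, h.2.1.le⟩
    simp [this]
  · symm
    simp only [e0]
    have h13 : 1 ≤ t ^ 3 := Nat.one_le_pow _ _ ht1
    rw [← Finset.sum_subset (Finset.Icc_subset_Icc h13 h47)]
    · refine Finset.sum_congr rfl fun c hc => ?_
      rw [Finset.mem_Icc] at hc
      have hc0 : 0 < c := by omega
      have hsub : Finset.Icc 1 (t ^ 7 / c) ⊆ Finset.range (t ^ 7 + 1) := by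
        intro b hb
        rw [Finset.mem_Icc] at hb
        have := Nat.div_le_self (t^7) c
        rw [Finset.mem_range]; omega
      symm
      rw [← Finset.sum_subset hsub]
      · refine Finset.sum_congr rfl fun b hb => ?_
        rw [Finset.mem_Icc, Nat.le_div_iff_mul_le hc0] at hb
        congr 2
        unfold cnd
        have hiff : rgh c.minFac b ↔ (1 ≤ b ∧ c * b ≤ t ^ 7 ∧ min c.minFac (t ^ 7) ≤ if b = 1 then t ^ 7 else min b.minFac (t ^ 7)) := by
          have hmc : c.minFac ≤ t ^ 7 := (Nat.minFac_le hc0).trans (hc.2.trans h47)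
          have hbX : b ≤ t ^ 7 := le_trans (Nat.le_mul_of_pos_right b hc0) hb.2
          have hmb : b.minFac ≤ t ^ 7 := (Nat.minFac_le hb.1).trans hbX
          rw [min_eq_left hmc, min_eq_left hmb, mul_comm c b]
          constructor
          · intro h
            refine ⟨hb.1, hb.2, ?_⟩
            split_ifs with h1
            · exact hmc
            · exact h _ (Nat.minFac_prime h1) (Nat.minFac_dvd b)
          · rintro ⟨-, -, h⟩ p hp hpb
            rw [if_neg] at h
            · exact h.trans (Nat.minFac_le_of_dvd hp.two_le hpb)
            · rintro rfl; exact hp.one_lt.ne' (Nat.dvd_one.1 hpb)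
        simp only [hiff]
      · intro b _ hb
        rw [Finset.mem_Icc, Nat.le_div_iff_mul_le hc0, mul_comm] at hb
        have hz : ∀ ℓ h : ℕ → ℕ, cnd (t^7) ℓ h c b = 0 := by
          intro ℓ h
          unfold cnd
          rw [if_neg]; tauto
        rw [hz]; simp
    · intro c _ hc
      rw [Finset.mem_Icc] at hc
      have : ¬ T2 t c := fun h => hc h.2
      simp [this]

lemma sieve_main {t : ℕ} {c : ℝ} {𝒥 : Finset ℕ} {q : ℕ → ℕ} {Q : ℝ} {L : ℕ} {z G : ℝ}
    (F : Fam t c 𝒥 q Q L z G) (hc : 0 < c) (ht : 3 ≤ t)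
    (hlog : Real.log t ^ 10 ≤ (t:ℝ) ^ (c / 2))
    (hno : ∀ j ∈ 𝒥, ∀ p : ℕ, p.Prime → t ^ 4 < p → p ≤ t ^ 7 → ¬ q j ∣ p - 1)
    (hg : 0 ≤ ∑ n ∈ Finset.Icc 1 (t^7), gf t n) :
    ∑ n ∈ Finset.Icc 1 (t^7), gf t n ≤ 64 * Q * (1 + 2 * (t:ℝ)^3) + 64 * 4 * 10 ^ 6 * ((t:ℝ)^7 / Real.log t ^ 7) := by
  have hl := log_ge_one ht
  have hQ0 : 0 < Q := by linarith [F.Q1]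
  obtain ⟨ℓ, h, hℓ, hh, hsp⟩ := gf_split (t := t) (by omega) 1
  set S := ∑ n ∈ Finset.Icc 1 (t^7), gf t n with hS
  have hJ : (0:ℝ) < 𝒥.card := by exact_mod_cast F.ne.card_pos
  have hII := typeII_total F hc ht hlog (fun c => if T2 t c then mu c else 0)
    (fun c => by split_ifs; exact mu_abs c; simp) ℓ h hℓ hh
  have key : ∀ j ∈ 𝒥, S / (64 * Q) ≤ 1 + (2 * (t:ℝ)^3 + 128 * ((t:ℝ)^7 / Q / Real.log t ^ 8)) +
     |∑ c ∈ Finset.Icc (t^3) (t^4), ∑ b ∈ Finset.range (t ^ 7 + 1), (if T2 t c then mu c else 0) * cnd (t ^ 7) ℓ h c b * Dq (q j) c b| := by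
    intro j hj
    have hI := typeI_total F hc ht (fun c => if InA t c then mu c else 0)
      (fun c => by split_ifs; exact mu_abs c; simp) j hj
    have hq := F.q1 j hj
    have hq0 : (0:ℝ) < q j := by linarith
    have h1 : S / (64 * Q) ≤ S * (1 / q j) := by
      rw [div_eq_mul_one_div]
      gcongr
      exact hq.2
    have h2 : ∑ n ∈ Finset.Icc 1 (t^7), gf t n * phq (q j) n = ∑ n ∈ Finset.Icc 1 (t^7), gf t n * (if ((q j:ℕ):ℤ) ∣ (n:ℤ) - 1 then 1 else 0) - S * (1 / q j) := by
      rw [hS, Finset.sum_mul, ← Finset.sum_sub_distrib]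
      refine Finset.sum_congr rfl fun n _ => ?_
      unfold phq; ring
    have h3 : ∑ n ∈ Finset.Icc 1 (t^7), gf t n * (if ((q j:ℕ):ℤ) ∣ (n:ℤ) - 1 then 1 else 0) ≤ 1 := by
      calc _ ≤ ∑ n ∈ Finset.Icc 1 (t^7), if n = 1 then (1:ℝ) else 0 := by
            refine Finset.sum_le_sum fun n hn => ?_
            rw [Finset.mem_Icc] at hn
            have hle := gf_le (t := t) (n := n) (by omega) hn.1
            by_cases hd : ((q j:ℕ):ℤ) ∣ (n:ℤ) - 1
            · rw [if_pos hd, mul_one]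
              refine hle.trans ?_
              by_cases hr : rgh (t ^ 4 + 1) n
              · rw [if_pos hr]
                by_cases hn1 : n = 1
                · simp [hn1]
                · exfalso
                  have hpr : n.Prime := by
                    by_contra hnp
                    have hp := Nat.minFac_prime hn1
                    have ha := hr _ hp (Nat.minFac_dvd n)
                    have hsq := Nat.minFac_sq_le_self hn.1 hnp
                    have h48 : (t ^ 4 + 1) ^ 2 ≤ n := (Nat.pow_le_pow_left ha 2).trans hsq
                    have h78 : t ^ 7 ≤ (t ^ 4) ^ 2 := by rw [← pow_mul]; exact Nat.pow_le_pow_right (by omega) (by norm_num)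
                    have h9 := Nat.pow_lt_pow_left (Nat.lt_succ_self (t^4)) two_ne_zero
                    rw [Nat.succ_eq_add_one] at h9
                    omega
                  have hgt := hr n hpr dvd_rfl
                  apply hno j hj n hpr (by omega) hn.2
                  have : ((n - 1 : ℕ) : ℤ) = (n:ℤ) - 1 := by push_cast [hn.1]; rfl
                  rw [← this] at hd
                  exact_mod_cast hd
              · rw [if_neg hr]; positivity
            · rw [if_neg hd, mul_zero]; positivity
        _ ≤ 1 := by
            rw [Finset.sum_ite_eq']
            split_ifs <;> simp
    rw [hsp (q j)] at h2
    have h4 := neg_abs_le (∑ a ∈ Finset.Icc 1 (t^3), ∑ b ∈ Finset.Icc 1 (t^7 / a), (if InA t a then mu a else 0) * Dq (q j) a b)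
    have h5 := neg_abs_le (∑ c ∈ Finset.Icc (t^3) (t^4), ∑ b ∈ Finset.range (t ^ 7 + 1), (if T2 t c then mu c else 0) * cnd (t ^ 7) ℓ h c b * Dq (q j) c b)
    linarith
  have hsum := Finset.sum_le_sum key
  rw [Finset.sum_const, nsmul_eq_mul, Finset.sum_add_distrib, Finset.sum_const, nsmul_eq_mul] at hsum
  have h6 : (𝒥.card:ℝ) * (S / (64 * Q)) ≤ 𝒥.card * (1 + (2 * (t:ℝ)^3 + 128 * ((t:ℝ)^7 / Q / Real.log t ^ 8)) + 3 * 10 ^ 6 * ((t:ℝ) ^ 7 / Q / Real.log t ^ 7)) := by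
    refine hsum.trans ?_
    rw [mul_add (𝒥.card:ℝ) (1 + _)]
    refine add_le_add le_rfl (hII.trans (le_of_eq ?_))
    ring
  have h7 := le_of_mul_le_mul_left h6 hJ
  have h8 : (t:ℝ)^7 / Q / Real.log t ^ 8 ≤ (t:ℝ)^7 / Q / Real.log t ^ 7 := by
    gcongr
    norm_num
  have h9 : S / (64 * Q) ≤ 1 + 2 * (t:ℝ)^3 + 4 * 10 ^ 6 * ((t:ℝ) ^ 7 / Q / Real.log t ^ 7) := by
    have : 0 ≤ (t:ℝ)^7 / Q / Real.log t ^ 7 := by positivity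
    linarith
  rw [div_le_iff₀ (by positivity)] at h9
  refine h9.trans (le_of_eq ?_)
  field_simp

lemma log_fact_eq (N : ℕ) : Real.log (N.factorial) = ∑ p ∈ Nat.primesLE N, (N.factorial.factorization p : ℝ) * Real.log p := by
  have h := Nat.prod_factorization_pow_eq_self (Nat.factorial_ne_zero N)
  conv_lhs => rw [← h]
  rw [Finsupp.prod_of_support_subset (s := Nat.primesLE N)]
  · push_cast
    rw [Real.log_prod]
    · refine Finset.sum_congr rfl fun p _ => by rw [Real.log_pow]
    · intro p hp
      have := (Nat.prime_of_mem_primesLE hp).pos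
      positivity
  · intro p hp
    rw [Nat.support_factorization, Nat.mem_primeFactors] at hp
    exact Nat.mem_primesLE.2 ⟨(hp.1.dvd_factorial).1 hp.2.1, hp.1⟩
  · intro p _; simp

lemma mertens_upper (N : ℕ) (hN : 1 ≤ N) : ∑ p ∈ Nat.primesLE N, Real.log p / p ≤ Real.log N + Real.log 4 := by
  have hN0 : (0:ℝ) < N := by exact_mod_cast hN
  have h1 : Real.log (N.factorial) ≤ N * Real.log N := by
    rw [← Real.log_pow]
    apply Real.log_le_log (by exact_mod_cast Nat.factorial_pos N)
    exact_mod_cast Nat.factorial_le_pow N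
  have hth := Chebyshev.theta_le_log4_mul_x (x := N) hN0.le
  rw [Chebyshev.theta_eq_sum_primesLE_log] at hth
  rw [log_fact_eq] at h1
  have h2 : ∀ p ∈ Nat.primesLE N, N * (Real.log p / p) - Real.log p ≤ (N.factorial.factorization p : ℝ) * Real.log p := by
    intro p hp
    have hpp := Nat.prime_of_mem_primesLE hp
    have hp0 : (0:ℝ) < p := by exact_mod_cast hpp.pos
    have hlog : 0 ≤ Real.log p := Real.log_natCast_nonneg p
    have h3 : N / p ≤ N.factorial.factorization p := by
      rw [Nat.factorization_factorial hpp (b := Nat.log p N + 2) (by omega)]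
      have := Finset.single_le_sum (f := fun i => N / p ^ i) (fun _ _ => Nat.zero_le _) (show 1 ∈ Finset.Ico 1 (Nat.log p N + 2) by simp)
      simpa using this
    have h4 : (N:ℝ) / p - 1 ≤ N.factorial.factorization p := by
      have h5 : (N:ℝ) / p < (N / p : ℕ) + 1 := by
        rw [div_lt_iff₀ hp0]
        exact_mod_cast Nat.lt_mul_of_div_lt (Nat.lt_succ_self _) hpp.pos
      have : ((N / p : ℕ):ℝ) ≤ N.factorial.factorization p := by exact_mod_cast h3
      linarith
    calc N * (Real.log p / p) - Real.log p = (N / p - 1) * Real.log p := by ring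
      _ ≤ _ := by gcongr
  have h3 := Finset.sum_le_sum h2
  rw [Finset.sum_sub_distrib, ← Finset.mul_sum] at h3
  have h4 : (N:ℝ) * ∑ p ∈ Nat.primesLE N, Real.log p / p ≤ N * (Real.log N + Real.log 4) := by linarith
  exact le_of_mul_le_mul_left h4 hN0

lemma mertens_lower : ∃ C : ℝ, 0 < C ∧ ∀ N : ℕ, 1 ≤ N → Real.log N - C ≤ ∑ p ∈ Nat.primesLE N, Real.log p / p := by
  have hs : Summable (fun n : ℕ => 4 / (n:ℝ) ^ ((3:ℝ)/2)) := by
    have := (Real.summable_one_div_nat_rpow (p := (3:ℝ)/2)).2 (by norm_num)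
    simpa [div_eq_mul_inv] using this.mul_left 4
  refine ⟨1 + ∑' n : ℕ, 4 / (n:ℝ) ^ ((3:ℝ)/2), by
    have : 0 ≤ ∑' n : ℕ, 4 / (n:ℝ) ^ ((3:ℝ)/2) := tsum_nonneg fun _ => by positivity
    linarith, fun N hN => ?_⟩
  have hN0 : (0:ℝ) < N := by exact_mod_cast hN
  have h1 : N * Real.log N - N ≤ Real.log (N.factorial) := by
    have := Real.pow_div_factorial_le_exp (x := N) hN0.le N
    have hf : (0:ℝ) < N.factorial := by exact_mod_cast Nat.factorial_pos N
    have h2 := Real.log_le_log (by positivity) this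
    rw [Real.log_exp, Real.log_div (by positivity) hf.ne', Real.log_pow] at h2
    linarith
  rw [log_fact_eq] at h1
  have h2 : ∀ p ∈ Nat.primesLE N, (N.factorial.factorization p : ℝ) * Real.log p ≤ N * (Real.log p / p + 4 / (p:ℝ) ^ ((3:ℝ)/2)) := by
    intro p hp
    have hpp := Nat.prime_of_mem_primesLE hp
    have hp2 : (2:ℝ) ≤ p := by exact_mod_cast hpp.two_le
    have hp0 : (0:ℝ) < p := by linarith
    have := Fact.mk hpp
    have h3 := sub_one_mul_padicValNat_factorial (p := p) N
    have hf : N.factorial.factorization p = padicValNat p N.factorial := Nat.factorization_def _ hpp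
    have h4 : ((p:ℝ) - 1) * (N.factorial.factorization p : ℝ) ≤ N := by
      rw [hf]
      have h5 : (p - 1) * padicValNat p N.factorial ≤ N := by omega
      have h6 : ((p - 1 : ℕ):ℝ) * (padicValNat p N.factorial : ℝ) ≤ N := by exact_mod_cast h5
      rwa [Nat.cast_sub hpp.one_lt.le, Nat.cast_one] at h6
    have hlog : 0 ≤ Real.log p := Real.log_natCast_nonneg p
    have h5 : (N.factorial.factorization p : ℝ) ≤ N / (p - 1) := by
      rw [le_div_iff₀ (by linarith)]; linarith
    have h6 : Real.log p ≤ 2 * (p:ℝ) ^ ((1:ℝ)/2) := by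
      have := Real.log_le_rpow_div hp0.le (ε := 1/2) (by norm_num)
      linarith
    have h7 : (p:ℝ) ^ ((3:ℝ)/2) * (p:ℝ) ^ ((1:ℝ)/2) = p * p := by
      rw [← Real.rpow_add hp0]; norm_num; ring
    have h8 : (0:ℝ) < (p:ℝ) ^ ((3:ℝ)/2) := by positivity
    have h9 : Real.log p / (p - 1) ≤ Real.log p / p + 4 / (p:ℝ) ^ ((3:ℝ)/2) := by
      have e1 : Real.log p / (p - 1) = Real.log p / p + Real.log p / (p * (p - 1)) := by
        have : (p:ℝ) - 1 ≠ 0 := by linarith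
        field_simp; ring
      rw [e1]
      refine add_le_add le_rfl ?_
      rw [div_le_div_iff₀ (by nlinarith) h8]
      calc Real.log p * (p:ℝ) ^ ((3:ℝ)/2) ≤ 2 * (p:ℝ) ^ ((1:ℝ)/2) * (p:ℝ) ^ ((3:ℝ)/2) := by gcongr
        _ = 2 * (p * p) := by rw [← h7]; ring
        _ ≤ 4 * (p * (p - 1)) := by nlinarith
    calc (N.factorial.factorization p : ℝ) * Real.log p ≤ N / (p - 1) * Real.log p := by gcongr
      _ = N * (Real.log p / (p - 1)) := by ring
      _ ≤ _ := by gcongr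
  have h3 := h1.trans (Finset.sum_le_sum h2)
  rw [← Finset.mul_sum, Finset.sum_add_distrib] at h3
  have h4 := hs.sum_le_tsum (Nat.primesLE N) (fun _ _ => by positivity)
  have h5 : (N:ℝ) * (Real.log N - 1) ≤ N * (∑ p ∈ Nat.primesLE N, Real.log p / p + ∑' n : ℕ, 4 / (n:ℝ) ^ ((3:ℝ)/2)) := by
    calc _ = N * Real.log N - N := by ring
      _ ≤ _ := h3
      _ ≤ _ := by gcongr
  have := le_of_mul_le_mul_left h5 hN0
  linarith

lemma mert_cell : ∃ C : ℝ, 0 < C ∧ ∀ y w : ℝ, 1 ≤ y → y ≤ w → ∀ P : Finset ℕ, (∀ p ∈ P, p.Prime ∧ y ≤ p ∧ (p:ℝ) ≤ w) →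
    ∑ p ∈ P, Real.log p / p ≤ Real.log (w / y) + C := by
  obtain ⟨C, hC, hlow⟩ := mertens_lower
  refine ⟨C + Real.log 4 + Real.log 2, by positivity, fun y w hy hyw P hP => ?_⟩
  have hw1 : 1 ≤ w := hy.trans hyw
  have hnn : ∀ p : ℕ, 0 ≤ Real.log p / p := fun p => div_nonneg (Real.log_natCast_nonneg p) (by positivity)
  have hf1 : 1 ≤ ⌊w⌋₊ := Nat.le_floor (by simpa using hw1)
  have hup := mertens_upper ⌊w⌋₊ hf1
  have hlf : Real.log ⌊w⌋₊ ≤ Real.log w := Real.log_le_log (by exact_mod_cast hf1) (Nat.floor_le (by linarith))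
  rw [Real.log_div (by linarith) (by linarith)]
  set M := ⌈y⌉₊ - 1 with hM
  have hc1 : 1 ≤ ⌈y⌉₊ := Nat.ceil_pos.2 (by linarith)
  have hdis : Disjoint P (Nat.primesLE M) := by
    rw [Finset.disjoint_left]
    intro p hp hp2
    have := Nat.ceil_le.2 (hP p hp).2.1
    have := Nat.le_of_mem_primesLE hp2
    omega
  have hsub : P ∪ Nat.primesLE M ⊆ Nat.primesLE ⌊w⌋₊ := by
    intro p hp
    rw [Finset.mem_union] at hp
    rcases hp with hp | hp
    · exact Nat.mem_primesLE.2 ⟨Nat.le_floor (hP p hp).2.2, (hP p hp).1⟩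
    · refine Nat.mem_primesLE.2 ⟨?_, Nat.prime_of_mem_primesLE hp⟩
      have h1 := Nat.le_of_mem_primesLE hp
      have h2 : ⌈y⌉₊ - 1 ≤ ⌊w⌋₊ := by
        have h3 : ⌈y⌉₊ ≤ ⌊y⌋₊ + 1 := Nat.ceil_le_floor_add_one y
        have h4 : ⌊y⌋₊ ≤ ⌊w⌋₊ := Nat.floor_le_floor hyw
        omega
      omega
  have hsum := Finset.sum_le_sum_of_subset_of_nonneg (f := fun p : ℕ => Real.log p / p) hsub (fun p _ _ => hnn p)
  rw [Finset.sum_union hdis] at hsum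
  have h2 : 0 < Real.log 2 := Real.log_pos (by norm_num)
  rcases Nat.eq_zero_or_pos M with h0 | h0
  · have hy1 : y ≤ 1 := by
      have : ⌈y⌉₊ ≤ 1 := by omega
      simpa using Nat.ceil_le.1 this
    have : Real.log y ≤ 0 := Real.log_nonpos (by linarith) hy1
    have : 0 ≤ ∑ p ∈ Nat.primesLE M, Real.log p / p := Finset.sum_nonneg fun p _ => hnn p
    linarith
  · have hl := hlow M h0
    have h3 : Real.log y ≤ Real.log M + Real.log 2 := by
      have hM0 : (0:ℝ) < M := by exact_mod_cast h0
      rw [← Real.log_mul hM0.ne' (by norm_num)]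
      apply Real.log_le_log (by linarith)
      have h4 : y ≤ ⌈y⌉₊ := Nat.le_ceil y
      have h5 : (⌈y⌉₊:ℝ) ≤ (M * 2 : ℕ) := by
        have : ⌈y⌉₊ ≤ M * 2 := by omega
        exact_mod_cast this
      push_cast at h5
      linarith
    linarith

end PS
end

section
open Filter
namespace PS

lemma cheb : ∃ c : ℝ, 0 < c ∧ (∀ ε : ℝ, 0 < ε → ∃ Y : ℝ, ∀ y : ℝ, Y ≤ y → (Nat.primeCounting ⌊y⌋₊ : ℝ) ≤ (1 + ε) * c * (y / Real.log y)) ∧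
    (∀ ε : ℝ, 0 < ε → ∀ Y : ℝ, ∃ y : ℝ, Y ≤ y ∧ (1 - ε) * c * (y / Real.log y) ≤ (Nat.primeCounting ⌊y⌋₊ : ℝ)) := by
  set f : ℝ → ℝ := fun y => (Nat.primeCounting ⌊y⌋₊ : ℝ) * (Real.log y / y) with hf
  have hup : ∀ᶠ y in atTop, f y ≤ Real.log 4 + 1 := by
    filter_upwards [Chebyshev.eventually_primeCounting_le (ε := 1) one_pos, eventually_gt_atTop 2] with y hy hy2
    have hl : 0 < Real.log y := Real.log_pos (by linarith)
    rw [hf]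
    calc (Nat.primeCounting ⌊y⌋₊ : ℝ) * (Real.log y / y) ≤ (Real.log 4 + 1) * y / Real.log y * (Real.log y / y) := by
          have : 0 ≤ Real.log y / y := by positivity
          gcongr
      _ = _ := by field_simp
  have hlo : ∀ᶠ y in atTop, 1 / 3 ≤ f y := by
    filter_upwards [eventually_gt_atTop 20] with y hy
    have hl : 0 < Real.log y := Real.log_pos (by linarith)
    have h1 := Chebyshev.pi_ge' (x := y) (by linarith)
    have h2 : Real.log (y + 2) ≤ (y + 2) / 16 + 2 := by
      have h3 : Real.log (y + 2) = Real.log ((y + 2) / 16) + 4 * Real.log 2 := by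
        rw [show (4:ℝ) * Real.log 2 = Real.log 16 by rw [show (16:ℝ) = 2 ^ 4 by norm_num, Real.log_pow]; norm_num]
        rw [← Real.log_mul (by positivity) (by norm_num)]; congr 1; ring
      have h4 := Real.log_le_sub_one_of_pos (x := (y + 2) / 16) (by positivity)
      have := Real.log_two_lt_d9
      linarith
    have h5 : y / 3 ≤ (y - 1) * Real.log 2 - Real.log (y + 2) := by
      have := Real.log_two_gt_d9
      nlinarith
    rw [hf]
    calc (1:ℝ) / 3 = (y / 3) / Real.log y * (Real.log y / y) := by field_simp
      _ ≤ (Nat.primeCounting ⌊y⌋₊ : ℝ) * (Real.log y / y) := by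
          have : 0 ≤ Real.log y / y := by positivity
          gcongr
          refine le_trans ?_ h1
          gcongr
  have hb : IsBoundedUnder (· ≤ ·) atTop f := ⟨_, by rw [eventually_map]; exact hup⟩
  have hb' : IsBoundedUnder (· ≥ ·) atTop f := ⟨_, by rw [eventually_map]; exact hlo⟩
  have hcb : IsCoboundedUnder (· ≤ ·) atTop f := hb'.isCoboundedUnder_le
  have hc : 1 / 3 ≤ limsup f atTop := by
    refine le_limsup_of_le hb fun b hb2 => ?_
    obtain ⟨y, h1, h2⟩ := (hb2.and hlo).exists
    linarith
  refine ⟨limsup f atTop, by linarith, fun ε hε => ?_, fun ε hε Y => ?_⟩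
  · have h1 := eventually_lt_of_limsup_lt (show limsup f atTop < (1 + ε) * limsup f atTop by nlinarith) hb
    obtain ⟨Y, hY⟩ := eventually_atTop.1 (h1.and (eventually_gt_atTop (2:ℝ)))
    refine ⟨Y, fun y hy => ?_⟩
    obtain ⟨h3, h4⟩ := hY y hy
    have hl : 0 < Real.log y := Real.log_pos (by linarith)
    calc (Nat.primeCounting ⌊y⌋₊ : ℝ) = f y * (y / Real.log y) := by rw [hf]; field_simp
      _ ≤ _ := by gcongr
  · have h1 := frequently_lt_of_lt_limsup hcb (show (1 - ε) * limsup f atTop < limsup f atTop by nlinarith)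
    obtain ⟨y, h3, h4, h5⟩ := (h1.and_eventually ((eventually_ge_atTop Y).and (eventually_gt_atTop (2:ℝ)))).exists
    refine ⟨y, h4, ?_⟩
    have hl : 0 < Real.log y := Real.log_pos (by linarith)
    calc _ ≤ f y * (y / Real.log y) := by gcongr
      _ = _ := by rw [hf]; field_simp

lemma cheb_t : ∃ c : ℝ, 0 < c ∧ (∀ ε : ℝ, 0 < ε → ∃ T : ℕ, ∀ t : ℕ, T ≤ t → ∀ s y : ℝ, 1 ≤ s → (t:ℝ) ^ s ≤ y →
     (Nat.primeCounting ⌊y⌋₊ : ℝ) ≤ (1 + ε) * c * (y / (s * Real.log t))) ∧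
    (∀ ε : ℝ, 0 < ε → ε < 1 → ∀ T : ℕ, ∃ t : ℕ, T ≤ t ∧ (1 - ε) * c * ((t:ℝ)^7 / (7 * Real.log t)) ≤ (Nat.primeCounting (t^7) : ℝ)) := by
  obtain ⟨c, hc, h1, h2⟩ := cheb
  refine ⟨c, hc, fun ε hε => ?_, fun ε hε hε1 T => ?_⟩
  · obtain ⟨Y, hY⟩ := h1 ε hε
    refine ⟨max 3 ⌈Y⌉₊, fun t ht s y hs hy => ?_⟩
    have ht3 : 3 ≤ t := (le_max_left _ _).trans ht
    have htY : Y ≤ t := (Nat.le_ceil Y).trans (by exact_mod_cast (le_max_right _ _).trans ht)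
    have ht1 : (1:ℝ) ≤ t := by exact_mod_cast (show 1 ≤ t by omega)
    have hl := log_ge_one ht3
    have hty : (t:ℝ) ≤ y := by
      refine le_trans ?_ hy
      simpa using Real.rpow_le_rpow_of_exponent_le ht1 hs
    refine (hY y (htY.trans hty)).trans ?_
    have h3 : s * Real.log t ≤ Real.log y := by
      rw [← Real.log_rpow (by linarith)]
      exact Real.log_le_log (by positivity) hy
    have hy0 : 0 < y := by linarith
    have : 0 < s * Real.log t := by positivity
    gcongr
  · obtain ⟨y, hy, hp⟩ := h2 (ε / 2) (by positivity) (max 2 (((T:ℝ) + 14 / ε + 3) ^ 7))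
    have hy2 : 2 ≤ y := (le_max_left _ _).trans hy
    have hyT := (le_max_right _ _).trans hy
    set w := y ^ ((1:ℝ)/7) with hw
    have hw0 : 0 < w := by positivity
    have hw7 : w ^ 7 = y := by
      rw [hw, ← Real.rpow_natCast, ← Real.rpow_mul (by linarith)]; norm_num
    have hwT : (T:ℝ) + 14 / ε + 3 ≤ w := by
      rw [← hw7] at hyT
      exact (pow_le_pow_iff_left₀ (by positivity) hw0.le (by norm_num)).1 hyT
    have hTT : (0:ℝ) ≤ T := by positivity
    have hee : 0 < 14 / ε := by positivity
    set t := ⌈w⌉₊ with ht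
    have htw : w ≤ t := Nat.le_ceil w
    have htw' : (t:ℝ) < w + 1 := Nat.ceil_lt_add_one hw0.le
    have ht0 : (0:ℝ) < t := by linarith
    refine ⟨t, by exact_mod_cast (show (T:ℝ) ≤ t by linarith), ?_⟩
    have hl : 1 ≤ Real.log t := log_ge_one (by exact_mod_cast (show (3:ℝ) ≤ t by linarith))
    have hyt : y ≤ (t:ℝ) ^ 7 := by rw [← hw7]; gcongr
    have h3 : (Nat.primeCounting ⌊y⌋₊ : ℝ) ≤ Nat.primeCounting (t ^ 7) := by
      have : ⌊y⌋₊ ≤ t ^ 7 := by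
        have := Nat.floor_le_floor hyt
        rwa [show ((t:ℝ) ^ 7) = ((t ^ 7 : ℕ):ℝ) by push_cast; rfl, Nat.floor_natCast] at this
      exact_mod_cast Nat.monotone_primeCounting this
    refine le_trans ?_ (hp.trans h3)
    have hly : 0 < Real.log y := Real.log_pos (by linarith)
    have h4 : Real.log y ≤ 7 * Real.log t := by
      have := Real.log_le_log (by linarith) hyt
      rw [Real.log_pow] at this; exact_mod_cast this
    have h5 : (1 - ε) * (t:ℝ) ^ 7 ≤ (1 - ε / 2) * y := by
      rw [← hw7]
      have h6 : (1 - 1 / (t:ℝ)) ^ 7 * (t:ℝ) ^ 7 ≤ w ^ 7 := by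
        rw [← mul_pow]
        have : (1 - 1 / (t:ℝ)) * t = t - 1 := by field_simp
        rw [this]
        apply pow_le_pow_left₀ <;> linarith
      have h7 := one_add_mul_le_pow (a := - (1 / (t:ℝ))) (by
        have : 1 / (t:ℝ) ≤ 1 := by rw [div_le_one ht0]; linarith
        linarith) 7
      have h8 : 7 * (1 / (t:ℝ)) ≤ ε / 2 := by
        rw [mul_one_div, div_le_iff₀ ht0]
        have : 14 / ε ≤ t := by linarith
        rw [div_le_iff₀ hε] at this
        linarith
      have h9 : (1 - ε / 2) ≤ (1 - 1 / (t:ℝ)) ^ 7 := by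
        push_cast at h7
        have e : (1 + -(1 / (t:ℝ))) = 1 - 1 / t := by ring
        rw [e] at h7
        linarith
      have h10 : (1 - ε / 2) * (t:ℝ) ^ 7 ≤ w ^ 7 := le_trans (by gcongr) h6
      calc (1 - ε) * (t:ℝ) ^ 7 ≤ (1 - ε / 2) * ((1 - ε / 2) * (t:ℝ) ^ 7) := by
            have : 0 ≤ ε ^ 2 * (t:ℝ) ^ 7 := by positivity
            nlinarith
        _ ≤ _ := by
          apply mul_le_mul_of_nonneg_left h10; linarith
    calc (1 - ε) * c * ((t:ℝ)^7 / (7 * Real.log t)) = c * ((1 - ε) * (t:ℝ) ^ 7) / (7 * Real.log t) := by ring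
      _ ≤ c * ((1 - ε / 2) * y) / (7 * Real.log t) := by gcongr
      _ ≤ c * ((1 - ε / 2) * y) / Real.log y := by
          have : 0 ≤ 1 - ε / 2 := by linarith
          gcongr
      _ = _ := by ring

lemma cell_sum (e : ℝ) (he : 0 < e) : ∃ T : ℕ, 3 ≤ T ∧ ∀ t : ℕ, T ≤ t → ∀ a b : ℝ, 1 ≤ a → a ≤ b → ∀ P : Finset ℕ,
    (∀ p ∈ P, p.Prime ∧ (t:ℝ) ^ a ≤ p ∧ (p:ℝ) ≤ (t:ℝ) ^ b) → ∑ p ∈ P, 1 / (p:ℝ) ≤ (b - a) / a + e := by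
  obtain ⟨C, hC, h⟩ := mert_cell
  obtain ⟨T, hT⟩ := (Filter.tendsto_atTop.1 (Real.tendsto_log_atTop.comp tendsto_natCast_atTop_atTop) (C / e)).exists_forall_of_atTop
  refine ⟨max 3 T, le_max_left _ _, fun t ht a b ha hab P hP => ?_⟩
  have ht3 : 3 ≤ t := (le_max_left _ _).trans ht
  have hl := log_ge_one ht3
  have hCe : C / e ≤ Real.log t := hT t ((le_max_right _ _).trans ht)
  have ht1 : (1:ℝ) ≤ t := by exact_mod_cast (show 1 ≤ t by omega)
  have ht0 : (0:ℝ) < t := by linarith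
  have h1 := h ((t:ℝ)^a) ((t:ℝ)^b) (Real.one_le_rpow ht1 (by linarith)) (Real.rpow_le_rpow_of_exponent_le ht1 hab) P hP
  rw [← Real.rpow_sub ht0, Real.log_rpow ht0] at h1
  have h2 : (a * Real.log t) * ∑ p ∈ P, 1 / (p:ℝ) ≤ ∑ p ∈ P, Real.log p / p := by
    rw [Finset.mul_sum]
    refine Finset.sum_le_sum fun p hp => ?_
    rw [mul_one_div]
    gcongr
    rw [← Real.log_rpow ht0]
    exact Real.log_le_log (by positivity) (hP p hp).2.1
  have h3 : (a * Real.log t) * ∑ p ∈ P, 1 / (p:ℝ) ≤ (a * Real.log t) * ((b - a) / a + e) := by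
    refine h2.trans (h1.trans ?_)
    have h4 : C ≤ e * Real.log t := by rw [div_le_iff₀ he] at hCe; linarith
    have h5 : (a * Real.log t) * ((b - a) / a + e) = (b - a) * Real.log t + a * (e * Real.log t) := by field_simp
    rw [h5]
    have : e * Real.log t ≤ a * (e * Real.log t) := le_mul_of_one_le_left (by positivity) ha
    linarith
  exact le_of_mul_le_mul_left h3 (by positivity)

noncomputable def Sr (y q : ℕ) : ℕ := ((Finset.Icc 2 y).filter (fun m => rgh q m)).card

noncomputable def Pset (q y : ℕ) : Finset ℕ := (Finset.Icc q y).filter (fun r => r.Prime ∧ r ^ 2 ≤ y)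

lemma Sr_zero {y q : ℕ} (h : y < q) : Sr y q = 0 := by
  unfold Sr
  rw [Finset.card_eq_zero, Finset.filter_eq_empty_iff]
  intro m hm hr
  rw [Finset.mem_Icc] at hm
  have h1 := hr _ (Nat.minFac_prime (show m ≠ 1 by omega)) (Nat.minFac_dvd m)
  have h2 := Nat.minFac_le (show 0 < m by omega)
  omega

lemma Sr_rec (y q : ℕ) : Sr y q ≤ Nat.primeCounting y + ∑ r ∈ Pset q y, Sr (y / r) r := by
  have hsub : (Finset.Icc 2 y).filter (fun m => rgh q m) ⊆ Nat.primesLE y ∪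
      (Pset q y).biUnion (fun r => ((Finset.Icc 2 (y / r)).filter (fun m => rgh r m)).image (fun m => r * m)) := by
    intro m hm
    rw [Finset.mem_filter, Finset.mem_Icc] at hm
    obtain ⟨⟨h2, hy⟩, hr⟩ := hm
    rw [Finset.mem_union]
    by_cases hp : m.Prime
    · left; exact Nat.mem_primesLE.2 ⟨hy, hp⟩
    · right
      have hmf := Nat.minFac_prime (show m ≠ 1 by omega)
      have hsq := Nat.minFac_sq_le_self (show 0 < m by omega) hp
      have hd := Nat.minFac_dvd m
      have hq := hr _ hmf hd
      set r := m.minFac with hrdef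
      have hle := Nat.minFac_le (show 0 < m by omega)
      have hmr : r * (m / r) = m := Nat.mul_div_cancel' hd
      rw [Finset.mem_biUnion]
      refine ⟨r, ?_, ?_⟩
      · unfold Pset
        rw [Finset.mem_filter, Finset.mem_Icc]
        exact ⟨⟨hq, by omega⟩, hmf, by omega⟩
      · rw [Finset.mem_image]
        refine ⟨m / r, ?_, hmr⟩
        rw [Finset.mem_filter, Finset.mem_Icc]
        refine ⟨⟨?_, Nat.div_le_div_right hy⟩, ?_⟩
        · have := hmf.two_le
          have h3 : r ≤ m / r := by rw [Nat.le_div_iff_mul_le hmf.pos]; nlinarith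
          omega
        · intro s hs hsd
          exact Nat.minFac_le_of_dvd hs.two_le (hsd.trans (Nat.div_dvd_of_dvd hd))
  unfold Sr
  refine (Finset.card_le_card hsub).trans ((Finset.card_union_le _ _).trans ?_)
  rw [Nat.primesLE_card_eq_primeCounting]
  refine Nat.add_le_add_left ?_ _
  refine Finset.card_biUnion_le.trans (Finset.sum_le_sum fun r _ => Finset.card_image_le)

lemma mem_Pset {q y r : ℕ} : r ∈ Pset q y ↔ q ≤ r ∧ r.Prime ∧ r ^ 2 ≤ y := by
  unfold Pset
  rw [Finset.mem_filter, Finset.mem_Icc]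
  constructor
  · rintro ⟨⟨h1, h2⟩, h3, h4⟩; exact ⟨h1, h3, h4⟩
  · rintro ⟨h1, h3, h4⟩
    refine ⟨⟨h1, ?_⟩, h3, h4⟩
    have := h3.pos
    nlinarith

lemma Sr_one {y q : ℕ} (h : y < q ^ 2) : Sr y q ≤ Nat.primeCounting y := by
  refine (Sr_rec y q).trans ?_
  have : Pset q y = ∅ := by
    rw [Finset.eq_empty_iff_forall_notMem]
    intro r hr
    rw [mem_Pset] at hr
    have := Nat.pow_le_pow_left hr.1 2
    omega
  rw [this]; simp

lemma Sr_two {y q : ℕ} (h : y < q ^ 3) : Sr y q ≤ Nat.primeCounting y + ∑ r ∈ Pset q y, Nat.primeCounting (y / r) := by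
  refine (Sr_rec y q).trans (Nat.add_le_add_left (Finset.sum_le_sum fun r hr => Sr_one ?_) _)
  rw [mem_Pset] at hr
  rw [Nat.div_lt_iff_lt_mul hr.2.1.pos]
  have := Nat.pow_le_pow_left hr.1 3
  calc y < q ^ 3 := h
    _ ≤ r ^ 3 := this
    _ = r ^ 2 * r := by ring

lemma Sr_three {y q : ℕ} (h : y < q ^ 4) : Sr y q ≤ Nat.primeCounting y + ∑ r ∈ Pset q y, (Nat.primeCounting (y / r) +
    ∑ s ∈ Pset r (y / r), Nat.primeCounting (y / r / s)) := by
  refine (Sr_rec y q).trans (Nat.add_le_add_left (Finset.sum_le_sum fun r hr => Sr_two ?_) _)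
  rw [mem_Pset] at hr
  rw [Nat.div_lt_iff_lt_mul hr.2.1.pos]
  have := Nat.pow_le_pow_left hr.1 4
  calc y < q ^ 4 := h
    _ ≤ r ^ 4 := this
    _ = r ^ 3 * r := by ring

/-- pairs -/
def D1 (t p q : ℕ) : Prop := p.Prime ∧ q.Prime ∧ q < p ∧ p < t ^ 3 ∧ t ^ 4 < p * q
def D2 (t p q : ℕ) : Prop := p.Prime ∧ q.Prime ∧ q < p ∧ p * q < t ^ 3 ∧ t ^ 4 < p * q ^ 2

lemma rpow_of_pow {x t : ℝ} (hx : 0 ≤ x) (ht : 0 < t) {k n : ℕ} (hk : 0 < k) (h : x ^ k ≤ t ^ n) : x ≤ t ^ ((n:ℝ) / k) := by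
  have h1 : (t ^ ((n:ℝ) / k)) ^ k = t ^ n := by
    rw [← Real.rpow_natCast (t ^ ((n:ℝ) / k)), ← Real.rpow_mul ht.le, div_mul_cancel₀ _ (by positivity), Real.rpow_natCast]
  rw [← h1] at h
  exact (pow_le_pow_iff_left₀ hx (by positivity) hk.ne').1 h

/-- hypothesis package on `t` -/
structure Good (t : ℕ) (κ e : ℝ) : Prop where
  t3 : 3 ≤ t
  κ0 : 0 ≤ κ
  pi : ∀ (A k n : ℕ), 1 ≤ A → 0 < k → n ≤ 6 * k → A ^ k ≤ t ^ n → (Nat.primeCounting (t ^ 7 / A) : ℝ) ≤ κ * (7 / (7 - (n:ℝ) / k)) / A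
  cell : ∀ a b : ℝ, 1 ≤ a → a ≤ b → ∀ P : Finset ℕ,
    (∀ p ∈ P, p.Prime ∧ (t:ℝ) ^ a ≤ p ∧ (p:ℝ) ≤ (t:ℝ) ^ b) → ∑ p ∈ P, 1 / (p:ℝ) ≤ (b - a) / a + e

lemma S_D1 {t : ℕ} {κ e : ℝ} (hG : Good t κ e) (he : 0 ≤ e) {p q : ℕ} (h : D1 t p q) :
    (Sr (t ^ 7 / (p * q)) q : ℝ) ≤ (if p * q ^ 2 ≤ t ^ 7 then κ * 3.5 / (p * q) else 0) +
      (if p * q ^ 3 ≤ t ^ 7 then κ * (5.25 * (0.5 + e)) / (p * q) else 0) := by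
  obtain ⟨hp, hq, hqp, hpt, hpq⟩ := h
  have hp0 := hp.pos
  have hq0 := hq.pos
  have ht3 := hG.t3
  have ht0 : (0:ℝ) < t := by exact_mod_cast (show 0 < t by omega)
  have hκ := hG.κ0
  have hpq0 : 0 < p * q := Nat.mul_pos hp0 hq0
  have htq : t < q := by
    by_contra hc
    push Not at hc
    have : p * q ≤ t ^ 3 * t := Nat.mul_le_mul hpt.le hc
    have : t ^ 3 * t = t ^ 4 := by ring
    omega
  set y := t ^ 7 / (p * q) with hy
  have hy3 : y < t ^ 3 := by
    rw [hy, Nat.div_lt_iff_lt_mul hpq0]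
    have : 0 < t ^ 3 := by positivity
    calc t ^ 7 = t ^ 3 * t ^ 4 := by ring
      _ < t ^ 3 * (p * q) := by gcongr
  have hyq : y < q ^ 3 := hy3.trans_le (Nat.pow_le_pow_left htq.le 3)
  have hnn1 : (0:ℝ) ≤ (if p * q ^ 2 ≤ t ^ 7 then κ * 3.5 / (p * q) else 0) := by split_ifs <;> positivity
  have hnn2 : (0:ℝ) ≤ (if p * q ^ 3 ≤ t ^ 7 then κ * (5.25 * (0.5 + e)) / (p * q) else 0) := by split_ifs <;> positivity
  by_cases hqy : q ≤ y
  · have hA : p * q ^ 2 ≤ t ^ 7 := by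
      rw [hy, Nat.le_div_iff_mul_le hpq0] at hqy
      calc p * q ^ 2 = q * (p * q) := by ring
        _ ≤ _ := hqy
    rw [if_pos hA]
    have h1 : (Sr y q : ℝ) ≤ Nat.primeCounting y + ∑ r ∈ Pset q y, (Nat.primeCounting (y / r) : ℝ) := by
      exact_mod_cast Sr_two hyq
    refine h1.trans (add_le_add ?_ ?_)
    · have := hG.pi (p * q) 2 10 hpq0 (by norm_num) (by norm_num) (by
        calc (p * q) ^ 2 = p * (p * q ^ 2) := by ring
          _ ≤ t ^ 3 * t ^ 7 := Nat.mul_le_mul hpt.le hA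
          _ = t ^ 10 := by ring)
      refine this.trans (le_of_eq ?_)
      push_cast; norm_num
    · by_cases hB : p * q ^ 3 ≤ t ^ 7
      · rw [if_pos hB]
        have h13 : (p * q) ^ 3 ≤ t ^ 13 := by
          calc (p * q) ^ 3 = p * p * (p * q ^ 3) := by ring
            _ ≤ t ^ 3 * t ^ 3 * t ^ 7 := by gcongr
            _ = t ^ 13 := by ring
        have h2 : ∀ r ∈ Pset q y, (Nat.primeCounting (y / r) : ℝ) ≤ κ * 5.25 / (p * q) * (1 / r) := by
          intro r hr
          rw [mem_Pset] at hr
          have hr0 := hr.2.1.pos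
          have hr2 : p * q * r ^ 2 ≤ t ^ 7 := by
            have := hr.2.2
            rw [hy, Nat.le_div_iff_mul_le hpq0] at this
            linarith
          have := hG.pi (p * q * r) 6 34 (Nat.mul_pos hpq0 hr0) (by norm_num) (by norm_num) (by
            calc (p * q * r) ^ 6 = (p * q) ^ 3 * (p * q * r ^ 2) ^ 3 := by ring
              _ ≤ t ^ 13 * (t ^ 7) ^ 3 := by gcongr
              _ = t ^ 34 := by ring)
          rw [hy, Nat.div_div_eq_div_mul]
          refine this.trans (le_of_eq ?_)
          push_cast; field_simp; norm_num; try ring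
        refine (Finset.sum_le_sum h2).trans ?_
        rw [← Finset.mul_sum]
        have h3 := hG.cell 1 (3/2) le_rfl (by norm_num) (Pset q y) (fun r hr => by
          rw [mem_Pset] at hr
          refine ⟨hr.2.1, ?_, ?_⟩
          · rw [Real.rpow_one]; exact_mod_cast htq.le.trans hr.1
          · have := rpow_of_pow (x := r) (t := t) (k := 2) (n := 3) (by positivity) ht0 (by norm_num) (by exact_mod_cast hr.2.2.trans hy3.le)
            exact_mod_cast this)
        calc κ * 5.25 / (p * q) * ∑ r ∈ Pset q y, 1 / (r:ℝ) ≤ κ * 5.25 / (p * q) * ((3/2 - 1) / 1 + e) := by gcongr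
          _ = _ := by norm_num; ring
      · rw [if_neg hB]
        have : Pset q y = ∅ := by
          rw [Finset.eq_empty_iff_forall_notMem]
          intro r hr
          rw [mem_Pset] at hr
          apply hB
          have h5 := hr.2.2
          rw [hy, Nat.le_div_iff_mul_le hpq0] at h5
          have h6 := Nat.pow_le_pow_left hr.1 2
          calc p * q ^ 3 = q ^ 2 * (p * q) := by ring
            _ ≤ r ^ 2 * (p * q) := by gcongr
            _ ≤ _ := h5
        rw [this]; simp
  · rw [Sr_zero (by omega)]
    push_cast
    linarith

lemma S_D2 {t : ℕ} {κ e : ℝ} (hG : Good t κ e) (he : 0 ≤ e) {p q : ℕ} (h : D2 t p q) :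
    (Sr (t ^ 7 / (p * q)) q : ℝ) ≤ κ * (1.75 + 3.5 * (53/60 + 3 * e) + 5.25 * ((4/9 + e) * (7/12 + 2 * e))) / (p * q) := by
  obtain ⟨hp, hq, hqp, hpt, hpq⟩ := h
  have hp0 := hp.pos
  have hq0 := hq.pos
  have ht3 := hG.t3
  have ht0 : (0:ℝ) < t := by exact_mod_cast (show 0 < t by omega)
  have ht1 : (1:ℝ) ≤ t := by exact_mod_cast (show 1 ≤ t by omega)
  have hκ := hG.κ0
  have hpq0 : 0 < p * q := Nat.mul_pos hp0 hq0
  have htq : t < q := by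
    by_contra hc
    push Not at hc
    have : p * q * q ≤ t ^ 3 * t := Nat.mul_le_mul hpt.le hc
    have : t ^ 3 * t = t ^ 4 := by ring
    have : p * q ^ 2 = p * q * q := by ring
    omega
  set y := t ^ 7 / (p * q) with hy
  have hyq : y < q ^ 4 := by
    rw [hy, Nat.div_lt_iff_lt_mul hpq0]
    have h3 : t ^ 3 ≤ q ^ 3 := Nat.pow_le_pow_left htq.le 3
    calc t ^ 7 = t ^ 3 * t ^ 4 := by ring
      _ ≤ q ^ 3 * t ^ 4 := by gcongr
      _ < q ^ 3 * (p * q ^ 2) := by gcongr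
      _ = _ := by ring
  have hpq8 : t ^ 8 ≤ (p * q) ^ 3 := by
    calc t ^ 8 = (t ^ 4) ^ 2 := by ring
      _ ≤ (p * q ^ 2) ^ 2 := by gcongr
      _ = p ^ 2 * q ^ 3 * q := by ring
      _ ≤ p ^ 2 * q ^ 3 * p := by gcongr
      _ = _ := by ring
  have hy13 : y ^ 3 ≤ t ^ 13 := by
    have h1 : y * (p * q) ≤ t ^ 7 := Nat.div_mul_le_self _ _
    have h2 : y ^ 3 * t ^ 8 ≤ t ^ 13 * t ^ 8 := by
      calc y ^ 3 * t ^ 8 ≤ y ^ 3 * (p * q) ^ 3 := by gcongr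
        _ = (y * (p * q)) ^ 3 := by ring
        _ ≤ (t ^ 7) ^ 3 := by gcongr
        _ = _ := by ring
    exact Nat.le_of_mul_le_mul_right h2 (by positivity)
  have h1 : (Sr y q : ℝ) ≤ Nat.primeCounting y + ∑ r ∈ Pset q y, ((Nat.primeCounting (y / r) : ℝ) +
      ∑ s ∈ Pset r (y / r), (Nat.primeCounting (y / r / s) : ℝ)) := by
    exact_mod_cast Sr_three hyq
  rw [Finset.sum_add_distrib] at h1
  have b1 : (Nat.primeCounting y : ℝ) ≤ κ * 1.75 / (p * q) := by
    have := hG.pi (p * q) 1 3 hpq0 (by norm_num) (by norm_num) (by simpa using hpt.le)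
    refine this.trans (le_of_eq ?_)
    push_cast; norm_num
  have hPr : ∀ r ∈ Pset q y, p * q * r ^ 2 ≤ t ^ 7 := by
    intro r hr
    have := (mem_Pset.1 hr).2.2
    rw [hy, Nat.le_div_iff_mul_le hpq0] at this
    linarith
  have hPl : ∀ r ∈ Pset q y, (t:ℝ) ≤ r := by
    intro r hr
    exact_mod_cast htq.le.trans (mem_Pset.1 hr).1
  have b2 : ∑ r ∈ Pset q y, (Nat.primeCounting (y / r) : ℝ) ≤ κ * (3.5 * (53/60 + 3 * e)) / (p * q) := by
    have h2 : ∀ r ∈ Pset q y, (Nat.primeCounting (y / r) : ℝ) ≤ κ * 3.5 / (p * q) * (1 / r) := by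
      intro r hr
      have hr2 := hPr r hr
      rw [mem_Pset] at hr
      have hr0 := hr.2.1.pos
      have := hG.pi (p * q * r) 2 10 (Nat.mul_pos hpq0 hr0) (by norm_num) (by norm_num) (by
        calc (p * q * r) ^ 2 = (p * q) * (p * q * r ^ 2) := by ring
          _ ≤ t ^ 3 * t ^ 7 := by gcongr
          _ = t ^ 10 := by ring)
      rw [hy, Nat.div_div_eq_div_mul]
      refine this.trans (le_of_eq ?_)
      push_cast; field_simp; norm_num; try ring
    refine (Finset.sum_le_sum h2).trans ?_
    rw [← Finset.mul_sum]
    have hup : ∀ r ∈ Pset q y, (r:ℝ) ≤ (t:ℝ) ^ ((13:ℝ)/6) := by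
      intro r hr
      have h5 : r ^ 6 ≤ t ^ 13 := by
        calc r ^ 6 = (r ^ 2) ^ 3 := by ring
          _ ≤ y ^ 3 := Nat.pow_le_pow_left (mem_Pset.1 hr).2.2 3
          _ ≤ _ := hy13
      have := rpow_of_pow (x := r) (t := t) (k := 6) (n := 13) (by positivity) ht0 (by norm_num) (by exact_mod_cast h5)
      exact_mod_cast this
    have h3 : ∑ r ∈ Pset q y, 1 / (r:ℝ) ≤ 53/60 + 3 * e := by
      rw [← Finset.sum_filter_add_sum_filter_not (Pset q y) (fun r : ℕ => (r:ℝ) ≤ (t:ℝ) ^ ((4:ℝ)/3))]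
      rw [← Finset.sum_filter_add_sum_filter_not ((Pset q y).filter (fun r : ℕ => ¬ (r:ℝ) ≤ (t:ℝ) ^ ((4:ℝ)/3))) (fun r : ℕ => (r:ℝ) ≤ (t:ℝ) ^ ((5:ℝ)/3))]
      have c1 := hG.cell 1 (4/3) le_rfl (by norm_num) ((Pset q y).filter (fun r : ℕ => (r:ℝ) ≤ (t:ℝ) ^ ((4:ℝ)/3))) (fun r hr => by
        rw [Finset.mem_filter] at hr
        refine ⟨(mem_Pset.1 hr.1).2.1, ?_, hr.2⟩
        rw [Real.rpow_one]; exact hPl r hr.1)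
      have c2 := hG.cell (4/3) (5/3) (by norm_num) (by norm_num) (((Pset q y).filter (fun r : ℕ => ¬ (r:ℝ) ≤ (t:ℝ) ^ ((4:ℝ)/3))).filter (fun r : ℕ => (r:ℝ) ≤ (t:ℝ) ^ ((5:ℝ)/3))) (fun r hr => by
        rw [Finset.mem_filter, Finset.mem_filter] at hr
        exact ⟨(mem_Pset.1 hr.1.1).2.1, (not_le.1 hr.1.2).le, hr.2⟩)
      have c3 := hG.cell (5/3) (13/6) (by norm_num) (by norm_num) (((Pset q y).filter (fun r : ℕ => ¬ (r:ℝ) ≤ (t:ℝ) ^ ((4:ℝ)/3))).filter (fun r : ℕ => ¬ (r:ℝ) ≤ (t:ℝ) ^ ((5:ℝ)/3))) (fun r hr => by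
        rw [Finset.mem_filter, Finset.mem_filter] at hr
        exact ⟨(mem_Pset.1 hr.1.1).2.1, (not_le.1 hr.2).le, hup r hr.1.1⟩)
      norm_num at c1 c2 c3 ⊢
      linarith
    calc κ * 3.5 / (p * q) * ∑ r ∈ Pset q y, 1 / (r:ℝ) ≤ κ * 3.5 / (p * q) * (53/60 + 3 * e) := by gcongr
      _ = _ := by ring
  have b3 : ∑ r ∈ Pset q y, ∑ s ∈ Pset r (y / r), (Nat.primeCounting (y / r / s) : ℝ) ≤ κ * (5.25 * ((4/9 + e) * (7/12 + 2 * e))) / (p * q) := by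
    set Q3 := (Pset q y).filter (fun r : ℕ => (r:ℝ) ≤ (t:ℝ) ^ ((13:ℝ)/9)) with hQ3
    have h2 : ∀ r ∈ Pset q y, ∑ s ∈ Pset r (y / r), (Nat.primeCounting (y / r / s) : ℝ) ≤
        if (r:ℝ) ≤ (t:ℝ) ^ ((13:ℝ)/9) then κ * (5.25 * (7/12 + 2 * e)) / (p * q) * (1 / r) else 0 := by
      intro r hr
      have hr0 := (mem_Pset.1 hr).2.1.pos
      have hrR : (0:ℝ) < r := by exact_mod_cast hr0
      have hs2 : ∀ s ∈ Pset r (y / r), r * s ^ 2 ≤ y := by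
        intro s hs
        have := (mem_Pset.1 hs).2.2
        rw [Nat.le_div_iff_mul_le hr0] at this
        linarith
      split_ifs with hc
      · have h4 : ∀ s ∈ Pset r (y / r), (Nat.primeCounting (y / r / s) : ℝ) ≤ κ * 5.25 / (p * q) * (1 / r) * (1 / s) := by
          intro s hs
          have h5 := hs2 s hs
          rw [mem_Pset] at hs
          have hs0 := hs.2.1.pos
          have h6 : p * q * r * s ^ 2 ≤ t ^ 7 := by
            rw [hy, Nat.le_div_iff_mul_le hpq0] at h5
            linarith
          have := hG.pi (p * q * r * s) 3 17 (Nat.mul_pos (Nat.mul_pos hpq0 hr0) hs0) (by norm_num) (by norm_num) (by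
            calc (p * q * r * s) ^ 3 = (p * q) ^ 3 * r ^ 2 * s ^ 3 * r := by ring
              _ ≤ (p * q) ^ 3 * r ^ 2 * s ^ 3 * s := by gcongr; exact hs.1
              _ = (p * q) * (p * q * r * s ^ 2) ^ 2 := by ring
              _ ≤ t ^ 3 * (t ^ 7) ^ 2 := by gcongr
              _ = t ^ 17 := by ring)
          rw [hy, Nat.div_div_eq_div_mul, Nat.div_div_eq_div_mul, ← mul_assoc]
          refine this.trans (le_of_eq ?_)
          push_cast; field_simp; norm_num; try ring
        refine (Finset.sum_le_sum h4).trans ?_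
        rw [← Finset.mul_sum]
        have hlo : ∀ s ∈ Pset r (y / r), (t:ℝ) ≤ s := by
          intro s hs
          exact (hPl r hr).trans (by exact_mod_cast (mem_Pset.1 hs).1)
        have hup : ∀ s ∈ Pset r (y / r), (s:ℝ) ≤ (t:ℝ) ^ ((5:ℝ)/3) := by
          intro s hs
          have h5 := hs2 s hs
          have h7 : t ^ 3 ≤ r ^ 3 := Nat.pow_le_pow_left (by exact_mod_cast hPl r hr) 3
          have h6 : s ^ 6 * t ^ 3 ≤ t ^ 10 * t ^ 3 := by
            calc s ^ 6 * t ^ 3 ≤ s ^ 6 * r ^ 3 := by gcongr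
              _ = (r * s ^ 2) ^ 3 := by ring
              _ ≤ y ^ 3 := Nat.pow_le_pow_left h5 3
              _ ≤ t ^ 13 := hy13
              _ = _ := by ring
          have h8 : s ^ 6 ≤ t ^ 10 := Nat.le_of_mul_le_mul_right h6 (by positivity)
          have := rpow_of_pow (x := s) (t := t) (k := 6) (n := 10) (by positivity) ht0 (by norm_num) (by exact_mod_cast h8)
          norm_num at this
          exact this
        have h3 : ∑ s ∈ Pset r (y / r), 1 / (s:ℝ) ≤ 7/12 + 2 * e := by
          rw [← Finset.sum_filter_add_sum_filter_not (Pset r (y / r)) (fun r : ℕ => (r:ℝ) ≤ (t:ℝ) ^ ((4:ℝ)/3))]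
          have c1 := hG.cell 1 (4/3) le_rfl (by norm_num) ((Pset r (y / r)).filter (fun r : ℕ => (r:ℝ) ≤ (t:ℝ) ^ ((4:ℝ)/3))) (fun s hs => by
            rw [Finset.mem_filter] at hs
            refine ⟨(mem_Pset.1 hs.1).2.1, ?_, hs.2⟩
            rw [Real.rpow_one]; exact hlo s hs.1)
          have c2 := hG.cell (4/3) (5/3) (by norm_num) (by norm_num) ((Pset r (y / r)).filter (fun r : ℕ => ¬ (r:ℝ) ≤ (t:ℝ) ^ ((4:ℝ)/3))) (fun s hs => by
            rw [Finset.mem_filter] at hs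
            exact ⟨(mem_Pset.1 hs.1).2.1, (not_le.1 hs.2).le, hup s hs.1⟩)
          norm_num at c1 c2 ⊢
          linarith
        calc κ * 5.25 / (p * q) * (1 / r) * ∑ s ∈ Pset r (y / r), 1 / (s:ℝ) ≤ κ * 5.25 / (p * q) * (1 / r) * (7/12 + 2 * e) := by gcongr
          _ = _ := by ring
      · have : Pset r (y / r) = ∅ := by
          rw [Finset.eq_empty_iff_forall_notMem]
          intro s hs
          apply hc
          have h5 := hs2 s hs
          have h6 := Nat.pow_le_pow_left (mem_Pset.1 hs).1 2
          have h7 : r ^ 9 ≤ t ^ 13 := by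
            calc r ^ 9 = (r * r ^ 2) ^ 3 := by ring
              _ ≤ (r * s ^ 2) ^ 3 := by gcongr
              _ ≤ y ^ 3 := Nat.pow_le_pow_left h5 3
              _ ≤ _ := hy13
          have := rpow_of_pow (x := r) (t := t) (k := 9) (n := 13) (by positivity) ht0 (by norm_num) (by exact_mod_cast h7)
          exact_mod_cast this
        rw [this]; simp
    refine (Finset.sum_le_sum h2).trans ?_
    rw [← Finset.sum_filter, ← Finset.mul_sum]
    have c1 := hG.cell 1 (13/9) le_rfl (by norm_num) Q3 (fun r hr => by
        rw [hQ3, Finset.mem_filter] at hr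
        refine ⟨(mem_Pset.1 hr.1).2.1, ?_, hr.2⟩
        rw [Real.rpow_one]; exact hPl r hr.1)
    calc κ * (5.25 * (7/12 + 2 * e)) / (p * q) * ∑ r ∈ Q3, 1 / (r:ℝ) ≤ κ * (5.25 * (7/12 + 2 * e)) / (p * q) * ((13/9 - 1) / 1 + e) := by gcongr
      _ = _ := by norm_num; ring
  refine h1.trans ?_
  calc _ ≤ κ * 1.75 / (p * q) + (κ * (3.5 * (53/60 + 3 * e)) / (p * q) + κ * (5.25 * ((4/9 + e) * (7/12 + 2 * e))) / (p * q)) := add_le_add b1 (add_le_add b2 b3)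
    _ = _ := by ring

/-- a sum by primitive recursion, which the kernel evaluates quickly -/
def nsum (f : ℕ → ℕ) (n : ℕ) : ℕ := Nat.rec (motive := fun _ => ℕ) 0 (fun k s => Nat.add s (f k)) n

lemma sum_eq_nsum (f g : ℕ → ℕ) (n : ℕ) (h : ∀ i, f i = g i) : ∑ i ∈ Finset.range n, f i = nsum g n := by
  induction n with
  | zero => rfl
  | succ k ih => rw [Finset.sum_range_succ, ih, h]; rfl

lemma num1 : (∑ i ∈ Finset.range 120, ∑ j ∈ Finset.range 120, if 40 ≤ j ∧ j ≤ i ∧ 160 < i + j + 2 ∧ i + 2 * j ≤ 280 then 10^9/(i*j)+100 else 0) ≤ 157000000 := by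
  rw [sum_eq_nsum _ (fun i => nsum (fun j => cond (Nat.ble 40 j && (Nat.ble j i && (Nat.ble 161 (i + j + 2) && Nat.ble (i + 2 * j) 280)))
    (1000000000 / (i * j) + 100) 0) 120) 120 (fun i => sum_eq_nsum _ _ 120 (fun j => by simp only [Bool.cond_eq_ite, Bool.and_eq_true, Nat.ble_eq, Nat.lt_iff_add_one_le]; norm_num))]
  exact Nat.le_of_ble_eq_true (by decide +kernel)
lemma num2 : (∑ i ∈ Finset.range 120, ∑ j ∈ Finset.range 120, if 40 ≤ j ∧ j ≤ i ∧ 160 < i + j + 2 ∧ i + 3 * j ≤ 280 then 10^9/(i*j)+100 else 0) ≤ 28250000 := by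
  rw [sum_eq_nsum _ (fun i => nsum (fun j => cond (Nat.ble 40 j && (Nat.ble j i && (Nat.ble 161 (i + j + 2) && Nat.ble (i + 3 * j) 280)))
    (1000000000 / (i * j) + 100) 0) 120) 120 (fun i => sum_eq_nsum _ _ 120 (fun j => by simp only [Bool.cond_eq_ite, Bool.and_eq_true, Nat.ble_eq, Nat.lt_iff_add_one_le]; norm_num))]
  exact Nat.le_of_ble_eq_true (by decide +kernel)
lemma num3 : (∑ i ∈ Finset.range 120, ∑ j ∈ Finset.range 120, if 40 ≤ j ∧ j ≤ i ∧ i + j < 120 ∧ 160 < i + 2 * j + 3 then 10^9/(i*j)+100 else 0) ≤ 50100000 := by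
  rw [sum_eq_nsum _ (fun i => nsum (fun j => cond (Nat.ble 40 j && (Nat.ble j i && (Nat.ble (i + j + 1) 120 && Nat.ble 161 (i + 2 * j + 3))))
    (1000000000 / (i * j) + 100) 0) 120) 120 (fun i => sum_eq_nsum _ _ 120 (fun j => by simp only [Bool.cond_eq_ite, Bool.and_eq_true, Nat.ble_eq, Nat.lt_iff_add_one_le]; norm_num))]
  exact Nat.le_of_ble_eq_true (by decide +kernel)

noncomputable def idx (t p : ℕ) : ℕ := ⌊40 * (Real.log p / Real.log t)⌋₊

lemma idx_pow {t p : ℕ} (ht : 3 ≤ t) (hp : 0 < p) : (t:ℝ) ^ ((idx t p : ℝ) / 40) ≤ p ∧ (p:ℝ) < (t:ℝ) ^ (((idx t p : ℝ) + 1) / 40) := by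
  have hl := log_ge_one ht
  have ht0 : (0:ℝ) < t := by exact_mod_cast (show 0 < t by omega)
  have hp0 : (0:ℝ) < p := by exact_mod_cast hp
  have hlp : 0 ≤ Real.log p := Real.log_natCast_nonneg p
  have h1 : (idx t p : ℝ) ≤ 40 * (Real.log p / Real.log t) := Nat.floor_le (by positivity)
  have h2 : 40 * (Real.log p / Real.log t) < idx t p + 1 := Nat.lt_floor_add_one _
  constructor
  · rw [← Real.log_le_log_iff (by positivity) hp0, Real.log_rpow ht0]
    rw [← mul_div_assoc, le_div_iff₀ (by linarith)] at h1
    linarith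
  · rw [← Real.log_lt_log_iff hp0 (by positivity), Real.log_rpow ht0]
    rw [← mul_div_assoc, div_lt_iff₀ (by linarith)] at h2
    linarith

lemma pair_cells {t : ℕ} {κ : ℝ} (hG : Good t κ (1 / 10 ^ 8)) (Ps : Finset (ℕ × ℕ)) (Cn : ℕ → ℕ → Prop)
    (hPs : ∀ x ∈ Ps, x.1.Prime ∧ x.2.Prime ∧ idx t x.1 < 120 ∧ 40 ≤ idx t x.2 ∧ idx t x.2 ≤ idx t x.1 ∧ Cn (idx t x.1) (idx t x.2)) :
    ∑ x ∈ Ps, 1 / ((x.1:ℝ) * x.2) ≤ (∑ i ∈ Finset.range 120, ∑ j ∈ Finset.range 120, if 40 ≤ j ∧ j ≤ i ∧ Cn i j then 10^9/(i*j)+100 else 0 : ℕ) / (10:ℝ) ^ 9 := by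
  have ht := hG.t3
  have hcell : ∀ i : ℕ, 40 ≤ i → ∀ P : Finset ℕ, (∀ p ∈ P, p.Prime ∧ idx t p = i) → ∑ p ∈ P, 1 / (p:ℝ) ≤ 1 / i + 1 / 10 ^ 8 := by
    intro i hi P hP
    have hi' : (40:ℝ) ≤ i := by exact_mod_cast hi
    have := hG.cell ((i:ℝ)/40) (((i:ℝ) + 1)/40) (by linarith) (by linarith) P (fun p hp => by
      obtain ⟨h1, h2⟩ := hP p hp
      have := idx_pow ht h1.pos
      rw [h2] at this
      exact ⟨h1, this.1, this.2.le⟩)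
    refine this.trans (le_of_eq ?_)
    congr 1
    field_simp; ring
  have hfib := Finset.sum_fiberwise_of_maps_to (s := Ps) (t := Finset.range 120 ×ˢ Finset.range 120) (g := fun x => (idx t x.1, idx t x.2))
    (fun x hx => by
      have := hPs x hx
      simp only [Finset.mem_product, Finset.mem_range]
      omega) (fun x => 1 / ((x.1:ℝ) * x.2))
  rw [← hfib, Finset.sum_product]
  push_cast
  rw [Finset.sum_div]
  refine Finset.sum_le_sum fun i _ => ?_
  rw [Finset.sum_div]
  refine Finset.sum_le_sum fun j _ => ?_
  by_cases hc : 40 ≤ j ∧ j ≤ i ∧ Cn i j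
  · rw [if_pos hc]
    obtain ⟨hj, hji, -⟩ := hc
    set A := Ps.filter (fun x => (idx t x.1, idx t x.2) = (i, j)) with hA
    have hsub : A ⊆ (A.image Prod.fst) ×ˢ (A.image Prod.snd) := by
      intro x hx
      rw [Finset.mem_product]
      exact ⟨Finset.mem_image_of_mem _ hx, Finset.mem_image_of_mem _ hx⟩
    have h1 := hcell i (by omega) (A.image Prod.fst) (fun p hp => by
      obtain ⟨x, hx, rfl⟩ := Finset.mem_image.1 hp
      rw [hA, Finset.mem_filter, Prod.mk.injEq] at hx
      exact ⟨(hPs x hx.1).1, hx.2.1⟩)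
    have h2 := hcell j hj (A.image Prod.snd) (fun p hp => by
      obtain ⟨x, hx, rfl⟩ := Finset.mem_image.1 hp
      rw [hA, Finset.mem_filter, Prod.mk.injEq] at hx
      exact ⟨(hPs x hx.1).2.1, hx.2.2⟩)
    have hi' : (40:ℝ) ≤ i := by exact_mod_cast hj.trans hji
    have hj' : (40:ℝ) ≤ j := by exact_mod_cast hj
    have hpos : ∀ x : ℕ × ℕ, 0 ≤ 1 / ((x.1:ℝ) * x.2) := fun x => div_nonneg zero_le_one (mul_nonneg (Nat.cast_nonneg _) (Nat.cast_nonneg _))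
    have hpos2 : 0 ≤ ∑ q ∈ A.image Prod.snd, 1 / (q:ℝ) := Finset.sum_nonneg fun q _ => div_nonneg zero_le_one (Nat.cast_nonneg _)
    have hpos3 : 0 ≤ 1 / (i:ℝ) + 1 / 10 ^ 8 := add_nonneg (div_nonneg zero_le_one (Nat.cast_nonneg _)) (by norm_num)
    calc ∑ x ∈ A, 1 / ((x.1:ℝ) * x.2) ≤ ∑ x ∈ (A.image Prod.fst) ×ˢ (A.image Prod.snd), 1 / ((x.1:ℝ) * x.2) :=
          Finset.sum_le_sum_of_subset_of_nonneg hsub (fun _ _ _ => hpos _)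
      _ = (∑ p ∈ A.image Prod.fst, 1 / (p:ℝ)) * ∑ q ∈ A.image Prod.snd, 1 / (q:ℝ) := by
          rw [Finset.sum_mul_sum, Finset.sum_product]
          refine Finset.sum_congr rfl fun p _ => Finset.sum_congr rfl fun q _ => ?_
          simp only [one_div, mul_inv]
      _ ≤ (1 / i + 1 / 10 ^ 8) * (1 / j + 1 / 10 ^ 8) := mul_le_mul h1 h2 hpos2 hpos3
      _ ≤ 1 / ((i:ℝ) * j) + 50 / 10 ^ 9 := by
          have a1 : (1:ℝ) / i ≤ 1 := by rw [div_le_one (by linarith)]; linarith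
          have a2 : (1:ℝ) / j ≤ 1 := by rw [div_le_one (by linarith)]; linarith
          have a3 : (1:ℝ) / ((i:ℝ) * j) = 1 / i * (1 / j) := by rw [one_div_mul_one_div]
          rw [a3]
          nlinarith
      _ ≤ _ := by
          have h3 : (10:ℝ) ^ 9 / ((i:ℝ) * j) < ((10 ^ 9 / (i * j) : ℕ) : ℝ) + 1 := by
            have hij : 0 < i * j := Nat.mul_pos (by omega) (by omega)
            rw [div_lt_iff₀ (by exact_mod_cast hij)]
            exact_mod_cast Nat.lt_mul_of_div_lt (Nat.lt_succ_self _) hij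
          rw [le_div_iff₀ (by positivity)]
          push_cast
          have : (1 / ((i:ℝ) * j) + 50 / 10 ^ 9) * 10 ^ 9 = 10 ^ 9 / ((i:ℝ) * j) + 50 := by ring
          rw [this]
          push_cast at h3
          linarith
  · rw [if_neg hc]
    have : Ps.filter (fun x => (idx t x.1, idx t x.2) = (i, j)) = ∅ := by
      rw [Finset.filter_eq_empty_iff]
      intro x hx h
      rw [Prod.mk.injEq] at h
      have := hPs x hx
      rw [h.1, h.2] at this
      exact hc this.2.2.2
    rw [this]; simp

/-- lower index comparisons -/
lemma idx_mono {t p q : ℕ} (ht : 3 ≤ t) (hq : 0 < q) (h : q ≤ p) : idx t q ≤ idx t p := by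
  have hl := log_ge_one ht
  apply Nat.floor_le_floor
  have : Real.log q ≤ Real.log p := Real.log_le_log (by exact_mod_cast hq) (by exact_mod_cast h)
  gcongr

lemma idx_le {t p q a b n : ℕ} (ht : 3 ≤ t) (hp : 0 < p) (hq : 0 < q) (h : p ^ a * q ^ b ≤ t ^ n) : a * idx t p + b * idx t q ≤ 40 * n := by
  have hl := log_ge_one ht
  have hlp : 0 ≤ Real.log p := Real.log_natCast_nonneg p
  have hlq : 0 ≤ Real.log q := Real.log_natCast_nonneg q
  have h1 : (idx t p : ℝ) ≤ 40 * (Real.log p / Real.log t) := Nat.floor_le (by positivity)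
  have h2 : (idx t q : ℝ) ≤ 40 * (Real.log q / Real.log t) := Nat.floor_le (by positivity)
  have hp0 : (0:ℝ) < p := by exact_mod_cast hp
  have hq0 : (0:ℝ) < q := by exact_mod_cast hq
  have h3 : a * Real.log p + b * Real.log q ≤ n * Real.log t := by
    rw [← Real.log_pow, ← Real.log_pow, ← Real.log_pow, ← Real.log_mul (by positivity) (by positivity)]
    apply Real.log_le_log (by positivity)
    exact_mod_cast h
  have h4 : (a:ℝ) * (Real.log p / Real.log t) + b * (Real.log q / Real.log t) ≤ n := by
    rw [← mul_div_assoc, ← mul_div_assoc, ← add_div, div_le_iff₀ (by linarith)]; exact h3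
  have h5 : (a:ℝ) * idx t p + b * idx t q ≤ 40 * n := by
    calc (a:ℝ) * idx t p + b * idx t q ≤ a * (40 * (Real.log p / Real.log t)) + b * (40 * (Real.log q / Real.log t)) := by gcongr
      _ ≤ _ := by linarith
  exact_mod_cast h5

lemma idx_lt {t p q a b n : ℕ} (ht : 3 ≤ t) (hp : 0 < p) (hq : 0 < q) (ha : 0 < a) (h : p ^ a * q ^ b < t ^ n) : a * idx t p + b * idx t q < 40 * n := by
  have hl := log_ge_one ht
  have hlp : 0 ≤ Real.log p := Real.log_natCast_nonneg p
  have hlq : 0 ≤ Real.log q := Real.log_natCast_nonneg q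
  have h1 : (idx t p : ℝ) ≤ 40 * (Real.log p / Real.log t) := Nat.floor_le (by positivity)
  have h2 : (idx t q : ℝ) ≤ 40 * (Real.log q / Real.log t) := Nat.floor_le (by positivity)
  have hp0 : (0:ℝ) < p := by exact_mod_cast hp
  have hq0 : (0:ℝ) < q := by exact_mod_cast hq
  have h3 : a * Real.log p + b * Real.log q < n * Real.log t := by
    rw [← Real.log_pow, ← Real.log_pow, ← Real.log_pow, ← Real.log_mul (by positivity) (by positivity)]
    apply Real.log_lt_log (by positivity)
    exact_mod_cast h
  have h4 : (a:ℝ) * (Real.log p / Real.log t) + b * (Real.log q / Real.log t) < n := by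
    rw [← mul_div_assoc, ← mul_div_assoc, ← add_div, div_lt_iff₀ (by linarith)]; exact h3
  have h5 : (a:ℝ) * idx t p + b * idx t q < 40 * n := by
    calc (a:ℝ) * idx t p + b * idx t q ≤ a * (40 * (Real.log p / Real.log t)) + b * (40 * (Real.log q / Real.log t)) := by gcongr
      _ < _ := by linarith
  exact_mod_cast h5

lemma idx_gt {t p q a b n : ℕ} (ht : 3 ≤ t) (hp : 0 < p) (hq : 0 < q) (ha : 0 < a) (h : t ^ n < p ^ a * q ^ b) : 40 * n < a * (idx t p + 1) + b * (idx t q + 1) := by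
  have hl := log_ge_one ht
  have ht0 : (0:ℝ) < t := by exact_mod_cast (show 0 < t by omega)
  have h1 : 40 * (Real.log p / Real.log t) < idx t p + 1 := Nat.lt_floor_add_one _
  have h2 : 40 * (Real.log q / Real.log t) < idx t q + 1 := Nat.lt_floor_add_one _
  have hp0 : (0:ℝ) < p := by exact_mod_cast hp
  have hq0 : (0:ℝ) < q := by exact_mod_cast hq
  have h3 : n * Real.log t < a * Real.log p + b * Real.log q := by
    rw [← Real.log_pow, ← Real.log_pow, ← Real.log_pow, ← Real.log_mul (by positivity) (by positivity)]
    apply Real.log_lt_log (by positivity)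
    exact_mod_cast h
  have h4 : (n:ℝ) < (a:ℝ) * (Real.log p / Real.log t) + b * (Real.log q / Real.log t) := by
    rw [← mul_div_assoc, ← mul_div_assoc, ← add_div, lt_div_iff₀ (by linarith)]; exact h3
  have h5 : (40:ℝ) * n < (a:ℝ) * (idx t p + 1) + b * (idx t q + 1) := by
    calc (40:ℝ) * n < a * (40 * (Real.log p / Real.log t)) + b * (40 * (Real.log q / Real.log t)) := by linarith
      _ ≤ _ := by gcongr
  exact_mod_cast h5

lemma idx_ge {t q : ℕ} (ht : 3 ≤ t) (h : t ≤ q) : 40 ≤ idx t q := by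
  have hl := log_ge_one ht
  apply Nat.le_floor
  have h1 : Real.log t ≤ Real.log q := Real.log_le_log (by exact_mod_cast (show 0 < t by omega)) (by exact_mod_cast h)
  have : 1 ≤ Real.log q / Real.log t := by rw [le_div_iff₀ (by linarith)]; linarith
  push_cast
  linarith

lemma D1_tq {t p q : ℕ} (h : D1 t p q) : t < q := by
  obtain ⟨hp, hq, hqp, hpt, hpq⟩ := h
  by_contra hc
  push Not at hc
  have : p * q ≤ t ^ 3 * t := Nat.mul_le_mul hpt.le hc
  have : t ^ 3 * t = t ^ 4 := by ring
  omega

lemma D2_tq {t p q : ℕ} (h : D2 t p q) : t < q := by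
  obtain ⟨hp, hq, hqp, hpt, hpq⟩ := h
  by_contra hc
  push Not at hc
  have : p * q * q ≤ t ^ 3 * t := Nat.mul_le_mul hpt.le hc
  have : t ^ 3 * t = t ^ 4 := by ring
  have : p * q ^ 2 = p * q * q := by ring
  omega

lemma E1_bound {t : ℕ} {κ : ℝ} (hG : Good t κ (1 / 10 ^ 8)) (Ps : Finset (ℕ × ℕ)) (h : ∀ x ∈ Ps, D1 t x.1 x.2 ∧ x.1 * x.2 ^ 2 ≤ t ^ 7) :
    ∑ x ∈ Ps, 1 / ((x.1:ℝ) * x.2) ≤ 0.157 := by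
  have ht := hG.t3
  have := pair_cells hG Ps (fun i j => 160 < i + j + 2 ∧ i + 2 * j ≤ 280) (fun x hx => by
    obtain ⟨h1, h2⟩ := h x hx
    have htq := D1_tq h1
    obtain ⟨hp, hq, hqp, hpt, hpq⟩ := h1
    have a1 := idx_lt (t := t) (p := x.1) (q := x.2) (a := 1) (b := 0) (n := 3) ht hp.pos hq.pos one_pos (by simpa using hpt)
    have a2 := idx_gt (t := t) (p := x.1) (q := x.2) (a := 1) (b := 1) (n := 4) ht hp.pos hq.pos one_pos (by simpa using hpq)
    have a3 := idx_le (t := t) (p := x.1) (q := x.2) (a := 1) (b := 2) (n := 7) ht hp.pos hq.pos (by simpa using h2)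
    have a4 := idx_ge ht htq.le
    have a5 := idx_mono ht hq.pos hqp.le
    refine ⟨hp, hq, ?_, a4, a5, ?_, ?_⟩ <;> omega)
  refine this.trans ?_
  rw [div_le_iff₀ (by positivity)]
  have h2 : ((157000000 : ℕ) : ℝ) = 0.157 * 10 ^ 9 := by norm_num
  rw [← h2]
  refine Nat.cast_le.2 (le_trans (le_of_eq ?_) num1)
  refine Finset.sum_congr rfl fun i _ => Finset.sum_congr rfl fun j _ => ?_
  congr

lemma E2_bound {t : ℕ} {κ : ℝ} (hG : Good t κ (1 / 10 ^ 8)) (Ps : Finset (ℕ × ℕ)) (h : ∀ x ∈ Ps, D1 t x.1 x.2 ∧ x.1 * x.2 ^ 3 ≤ t ^ 7) :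
    ∑ x ∈ Ps, 1 / ((x.1:ℝ) * x.2) ≤ 0.02825 := by
  have ht := hG.t3
  have := pair_cells hG Ps (fun i j => 160 < i + j + 2 ∧ i + 3 * j ≤ 280) (fun x hx => by
    obtain ⟨h1, h2⟩ := h x hx
    have htq := D1_tq h1
    obtain ⟨hp, hq, hqp, hpt, hpq⟩ := h1
    have a1 := idx_lt (t := t) (p := x.1) (q := x.2) (a := 1) (b := 0) (n := 3) ht hp.pos hq.pos one_pos (by simpa using hpt)
    have a2 := idx_gt (t := t) (p := x.1) (q := x.2) (a := 1) (b := 1) (n := 4) ht hp.pos hq.pos one_pos (by simpa using hpq)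
    have a3 := idx_le (t := t) (p := x.1) (q := x.2) (a := 1) (b := 3) (n := 7) ht hp.pos hq.pos (by simpa using h2)
    have a4 := idx_ge ht htq.le
    have a5 := idx_mono ht hq.pos hqp.le
    refine ⟨hp, hq, ?_, a4, a5, ?_, ?_⟩ <;> omega)
  refine this.trans ?_
  rw [div_le_iff₀ (by positivity)]
  have h2 : ((28250000 : ℕ) : ℝ) = 0.02825 * 10 ^ 9 := by norm_num
  rw [← h2]
  refine Nat.cast_le.2 (le_trans (le_of_eq ?_) num2)
  refine Finset.sum_congr rfl fun i _ => Finset.sum_congr rfl fun j _ => ?_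
  congr

lemma E3_bound {t : ℕ} {κ : ℝ} (hG : Good t κ (1 / 10 ^ 8)) (Ps : Finset (ℕ × ℕ)) (h : ∀ x ∈ Ps, D2 t x.1 x.2) :
    ∑ x ∈ Ps, 1 / ((x.1:ℝ) * x.2) ≤ 0.0501 := by
  have ht := hG.t3
  have := pair_cells hG Ps (fun i j => i + j < 120 ∧ 160 < i + 2 * j + 3) (fun x hx => by
    have h1 := h x hx
    have htq := D2_tq h1
    obtain ⟨hp, hq, hqp, hpt, hpq⟩ := h1
    have a1 := idx_lt (t := t) (p := x.1) (q := x.2) (a := 1) (b := 1) (n := 3) ht hp.pos hq.pos one_pos (by simpa using hpt)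
    have a2 := idx_gt (t := t) (p := x.1) (q := x.2) (a := 1) (b := 2) (n := 4) ht hp.pos hq.pos one_pos (by simpa using hpq)
    have a4 := idx_ge ht htq.le
    have a5 := idx_mono ht hq.pos hqp.le
    refine ⟨hp, hq, ?_, a4, a5, ?_, ?_⟩ <;> omega)
  refine this.trans ?_
  rw [div_le_iff₀ (by positivity)]
  have h2 : ((50100000 : ℕ) : ℝ) = 0.0501 * 10 ^ 9 := by norm_num
  rw [← h2]
  refine Nat.cast_le.2 (le_trans (le_of_eq ?_) num3)
  refine Finset.sum_congr rfl fun i _ => Finset.sum_congr rfl fun j _ => ?_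
  congr

lemma cnt_le_Sr (y q : ℕ) : ∑ m ∈ Finset.Icc 1 y, (if rgh q m then (1:ℝ) else 0) ≤ 1 + Sr y q := by
  unfold Sr
  rw [← Finset.sum_filter, Finset.sum_const, nsmul_eq_mul, mul_one]
  have : ((Finset.Icc 1 y).filter (fun m => rgh q m)) ⊆ insert 1 ((Finset.Icc 2 y).filter (fun m => rgh q m)) := by
    intro m hm
    simp only [Finset.mem_insert, Finset.mem_filter, Finset.mem_Icc] at hm ⊢
    by_cases h : m = 1
    · left; exact h
    · right; exact ⟨⟨by omega, hm.1.2⟩, hm.2⟩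
  have h2 := (Finset.card_le_card this).trans (Finset.card_insert_le _ _)
  have : (((Finset.Icc 1 y).filter (fun m => rgh q m)).card : ℝ) ≤ ((Finset.Icc 2 y).filter (fun m => rgh q m)).card + 1 := by exact_mod_cast h2
  linarith

lemma Drp_sum {t : ℕ} {κ : ℝ} (hG : Good t κ (1 / 10 ^ 8)) :
    ∑ n ∈ Finset.Icc 1 (t ^ 7), ∑ c ∈ n.divisors.filter (Drp t), (if rgh c.minFac (n / c) then (1:ℝ) else 0) ≤ κ * 0.94 + t ^ 6 := by
  have ht := hG.t3
  have hκ := hG.κ0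
  have h1 : ∑ n ∈ Finset.Icc 1 (t ^ 7), ∑ c ∈ n.divisors.filter (Drp t), (if rgh c.minFac (n / c) then (1:ℝ) else 0)
      = ∑ c ∈ Finset.Icc 1 (t ^ 7), ∑ m ∈ Finset.Icc 1 (t ^ 7 / c), (if Drp t c then (if rgh c.minFac m then (1:ℝ) else 0) else 0) := by
    rw [← sum_divisors_swap (t ^ 7) (fun c m => if Drp t c then (if rgh c.minFac m then (1:ℝ) else 0) else 0)]
    refine Finset.sum_congr rfl fun n _ => ?_
    rw [Finset.sum_filter]
  rw [h1]
  set F : ℕ → ℝ := fun c => 1 + Sr (t ^ 7 / c) c.minFac with hF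
  have hF0 : ∀ c, 0 ≤ F c := fun c => by simp only [hF]; positivity
  set Pr := ((Finset.range (t ^ 3)) ×ˢ (Finset.range (t ^ 3))).filter (fun x : ℕ × ℕ => (D1 t x.1 x.2 ∨ D2 t x.1 x.2) ∧ (x.1 * x.2).minFac = x.2) with hPr
  have h2 : ∑ c ∈ Finset.Icc 1 (t ^ 7), ∑ m ∈ Finset.Icc 1 (t ^ 7 / c), (if Drp t c then (if rgh c.minFac m then (1:ℝ) else 0) else 0)
      ≤ ∑ c ∈ (Finset.Icc 1 (t ^ 7)).filter (Drp t), F c := by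
    rw [Finset.sum_filter]
    refine Finset.sum_le_sum fun c _ => ?_
    by_cases hc : Drp t c
    · simp only [if_pos hc]
      exact cnt_le_Sr _ _
    · simp [hc]
  have hsub : (Finset.Icc 1 (t ^ 7)).filter (Drp t) ⊆ Pr.image (fun x => x.1 * x.2) := by
    intro c hc
    rw [Finset.mem_filter] at hc
    obtain ⟨-, hc1, hc2⟩ := hc
    rcases Bd_class (by omega) hc1 with h | ⟨p, q, hp, hq, hcpq, hqp, hmf, hpt, hor⟩
    · exact absurd h hc2
    · rw [Finset.mem_image]
      refine ⟨(p, q), ?_, hcpq.symm⟩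
      simp only [hPr, Finset.mem_filter, Finset.mem_product, Finset.mem_range]
      refine ⟨⟨hpt, by omega⟩, ?_, by rw [← hcpq]; exact hmf⟩
      rcases hor with h | h
      · left; exact ⟨hp, hq, hqp, hpt, h⟩
      · right; exact ⟨hp, hq, hqp, h.1, h.2⟩
  have h3 : ∑ c ∈ (Finset.Icc 1 (t ^ 7)).filter (Drp t), F c ≤ ∑ x ∈ Pr, F (x.1 * x.2) :=
    (Finset.sum_le_sum_of_subset_of_nonneg hsub (fun _ _ _ => hF0 _)).trans
      (Finset.sum_image_le_of_nonneg (fun _ _ => hF0 _))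
  have hcard : (Pr.card : ℝ) ≤ t ^ 6 := by
    have : Pr.card ≤ t ^ 3 * t ^ 3 := by
      refine (Finset.card_filter_le _ _).trans ?_
      rw [Finset.card_product, Finset.card_range]
    have h : t ^ 3 * t ^ 3 = t ^ 6 := by ring
    rw [h] at this
    exact_mod_cast this
  have h4 : ∀ x ∈ Pr, F (x.1 * x.2) ≤ 1 + ((if D1 t x.1 x.2 ∧ x.1 * x.2 ^ 2 ≤ t ^ 7 then κ * 3.5 * (1 / ((x.1:ℝ) * x.2)) else 0)
      + (if D1 t x.1 x.2 ∧ x.1 * x.2 ^ 3 ≤ t ^ 7 then κ * 2.626 * (1 / ((x.1:ℝ) * x.2)) else 0)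
      + (if D2 t x.1 x.2 then κ * 6.21 * (1 / ((x.1:ℝ) * x.2)) else 0)) := by
    intro x hx
    simp only [hPr, Finset.mem_filter] at hx
    obtain ⟨-, hor, hmf⟩ := hx
    simp only [hF]
    rw [hmf]
    have hinv : 0 ≤ κ * (1 / ((x.1:ℝ) * x.2)) := mul_nonneg hκ (div_nonneg zero_le_one (mul_nonneg (Nat.cast_nonneg _) (Nat.cast_nonneg _)))
    by_cases hd : D1 t x.1 x.2
    · have hnd : ¬ D2 t x.1 x.2 := by
        intro h
        have a := hd.2.2.2.2
        have b := h.2.2.2.1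
        have : t ^ 3 ≤ t ^ 4 := Nat.pow_le_pow_right (by omega) (by norm_num)
        omega
      have := S_D1 hG (by norm_num) hd
      simp only [hd, hnd, true_and, if_false, add_zero]
      refine add_le_add le_rfl (this.trans ?_)
      refine add_le_add ?_ ?_
      · split_ifs
        · exact le_of_eq (by ring)
        · exact le_rfl
      · split_ifs
        · calc κ * (5.25 * (0.5 + 1 / 10 ^ 8)) / ((x.1:ℝ) * x.2) = (5.25 * (0.5 + 1 / 10 ^ 8)) * (κ * (1 / ((x.1:ℝ) * x.2))) := by ring
            _ ≤ 2.626 * (κ * (1 / ((x.1:ℝ) * x.2))) := mul_le_mul_of_nonneg_right (by norm_num) hinv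
            _ = _ := by ring
        · exact le_rfl
    · have hd2 : D2 t x.1 x.2 := hor.resolve_left hd
      have := S_D2 hG (by norm_num) hd2
      simp only [hd, hd2, false_and, if_false, if_true, zero_add]
      refine add_le_add le_rfl (this.trans ?_)
      calc _ = (1.75+3.5*(53/60+3*(1 / 10 ^ 8))+5.25*((4/9+(1 / 10 ^ 8))*(7/12+2*(1 / 10 ^ 8)))) * (κ * (1 / ((x.1:ℝ) * x.2))) := by ring
            _ ≤ 6.21 * (κ * (1 / ((x.1:ℝ) * x.2))) := mul_le_mul_of_nonneg_right (by norm_num) hinv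
            _ = _ := by ring
  have b1 := E1_bound hG (Pr.filter (fun x => D1 t x.1 x.2 ∧ x.1 * x.2 ^ 2 ≤ t ^ 7)) (fun x hx => (Finset.mem_filter.1 hx).2)
  have b2 := E2_bound hG (Pr.filter (fun x => D1 t x.1 x.2 ∧ x.1 * x.2 ^ 3 ≤ t ^ 7)) (fun x hx => (Finset.mem_filter.1 hx).2)
  have b3 := E3_bound hG (Pr.filter (fun x => D2 t x.1 x.2)) (fun x hx => (Finset.mem_filter.1 hx).2)
  clear_value F
  have h5 := Finset.sum_le_sum h4
  rw [Finset.sum_add_distrib, Finset.sum_add_distrib, Finset.sum_add_distrib, ← Finset.sum_filter, ← Finset.sum_filter, ← Finset.sum_filter,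
    ← Finset.mul_sum, ← Finset.mul_sum, ← Finset.mul_sum, Finset.sum_const, nsmul_eq_mul, mul_one] at h5
  have c1 := mul_le_mul_of_nonneg_left b1 (show 0 ≤ κ * 3.5 by positivity)
  have c2 := mul_le_mul_of_nonneg_left b2 (show 0 ≤ κ * 2.626 by positivity)
  have c3 := mul_le_mul_of_nonneg_left b3 (show 0 ≤ κ * 6.21 by positivity)
  have : κ * 3.5 * 0.157 + κ * 2.626 * 0.02825 + κ * 6.21 * 0.0501 ≤ κ * 0.94 := by
    have : κ * 3.5 * 0.157 + κ * 2.626 * 0.02825 + κ * 6.21 * 0.0501 = κ * (3.5 * 0.157 + 2.626 * 0.02825 + 6.21 * 0.0501) := by ring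
    rw [this]
    exact mul_le_mul_of_nonneg_left (by norm_num) hκ
  linarith [h2, h3, h5, hcard]

lemma rgh_sum_ge (t : ℕ) : (Nat.primeCounting (t ^ 7) : ℝ) - t ^ 4 ≤ ∑ n ∈ Finset.Icc 1 (t ^ 7), (if rgh (t ^ 4 + 1) n then (1:ℝ) else 0) := by
  rw [← Finset.sum_filter, Finset.sum_const, nsmul_eq_mul, mul_one]
  have hs : (Finset.range (t ^ 7 + 1)).filter Nat.Prime ⊆ (Finset.Icc 1 (t ^ 7)).filter (fun n => rgh (t ^ 4 + 1) n) ∪ Finset.Icc 1 (t ^ 4) := by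
    intro p hp
    simp only [Finset.mem_filter, Finset.mem_range, Finset.mem_union, Finset.mem_Icc] at hp ⊢
    have := hp.2.pos
    by_cases h : p ≤ t ^ 4
    · right; omega
    · left
      refine ⟨by omega, fun r hr hrp => ?_⟩
      rw [(Nat.prime_dvd_prime_iff_eq hr hp.2).1 hrp]
      omega
  have := (Finset.card_le_card hs).trans (Finset.card_union_le _ _)
  rw [Nat.card_Icc, Nat.add_sub_cancel] at this
  have hpi : Nat.primeCounting (t ^ 7) = ((Finset.range (t ^ 7 + 1)).filter Nat.Prime).card := by
    rw [Nat.primeCounting, Nat.primeCounting', Nat.count_eq_card_filter_range]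
  rw [hpi]
  have h2 : (((Finset.range (t ^ 7 + 1)).filter Nat.Prime).card : ℝ) ≤ ((Finset.Icc 1 (t ^ 7)).filter (fun n => rgh (t ^ 4 + 1) n)).card + t ^ 4 := by exact_mod_cast this
  linarith

lemma M6_main : ∃ c0 : ℝ, 0 < c0 ∧ ∀ T : ℕ, ∃ t : ℕ, T ≤ t ∧ c0 * ((t:ℝ) ^ 7 / Real.log t) ≤ ∑ n ∈ Finset.Icc 1 (t ^ 7), gf t n := by
  obtain ⟨c, hc, hup, hlo⟩ := cheb_t
  obtain ⟨T1, hT1⟩ := hup 0.01 (by norm_num)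
  obtain ⟨T2, hT2, hcell⟩ := cell_sum (1 / 10 ^ 8) (by norm_num)
  have hev : ∀ᶠ x : ℝ in Filter.atTop, Real.log x ≤ (0.01 * c / 14) * x := by
    have := (Real.isLittleO_log_id_atTop.def (show 0 < 0.01 * c / 14 by positivity))
    filter_upwards [this, Filter.eventually_ge_atTop 1] with x hx h1
    simp only [id, Real.norm_eq_abs] at hx
    rw [abs_of_nonneg (Real.log_nonneg h1), abs_of_nonneg (by linarith)] at hx
    exact hx
  obtain ⟨T3, hT3⟩ := ((tendsto_natCast_atTop_atTop (R := ℝ)).eventually hev).exists_forall_of_atTop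
  refine ⟨0.01 * c / 7, by positivity, fun T => ?_⟩
  obtain ⟨t, ht, hpi⟩ := hlo 0.01 (by norm_num) (by norm_num) (max T (max T1 (max T2 T3)))
  simp only [max_le_iff] at ht
  obtain ⟨htT, ht1, ht2, ht3⟩ := ht
  refine ⟨t, htT, ?_⟩
  have h3t : 3 ≤ t := hT2.trans ht2
  have hl := log_ge_one h3t
  have ht0 : (0:ℝ) < t := by exact_mod_cast (show 0 < t by omega)
  have htr : (3:ℝ) ≤ t := by exact_mod_cast h3t
  have hG : Good t ((1 + 0.01) * c * ((t:ℝ) ^ 7 / (7 * Real.log t))) (1 / 10 ^ 8) := by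
    refine ⟨h3t, by positivity, ?_, hcell t ht2⟩
    intro A k n hA hk hn hAk
    have hA0 : (0:ℝ) < A := by exact_mod_cast hA
    have hk0 : (0:ℝ) < k := by exact_mod_cast hk
    have hnk : (n:ℝ) / k ≤ 6 := by
      rw [div_le_iff₀ hk0]; exact_mod_cast hn
    have hAt : (A:ℝ) ≤ (t:ℝ) ^ ((n:ℝ) / k) := rpow_of_pow hA0.le ht0 hk (by exact_mod_cast hAk)
    have := hT1 t ht1 (7 - (n:ℝ) / k) ((t:ℝ) ^ 7 / A) (by linarith) (by
      rw [Real.rpow_sub ht0, show (7:ℝ) = ((7:ℕ):ℝ) by norm_num, Real.rpow_natCast]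
      gcongr)
    have hfl : ⌊(t:ℝ) ^ 7 / A⌋₊ = t ^ 7 / A := by
      have := Nat.floor_div_eq_div (K := ℝ) (t ^ 7) A
      rw [← this]; push_cast; rfl
    rw [hfl] at this
    refine this.trans (le_of_eq ?_)
    have h7 : (7:ℝ) - n / k ≠ 0 := by linarith
    field_simp
  have hD := Drp_sum hG
  have hR := rgh_sum_ge t
  have hsum : ∑ n ∈ Finset.Icc 1 (t ^ 7), (if rgh (t ^ 4 + 1) n then (1:ℝ) else 0) = ∑ n ∈ Finset.Icc 1 (t ^ 7), gf t n + ∑ n ∈ Finset.Icc 1 (t ^ 7), ∑ c ∈ n.divisors.filter (Drp t), (if rgh c.minFac (n / c) then (1:ℝ) else 0) := by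
    rw [← Finset.sum_add_distrib]
    refine Finset.sum_congr rfl fun n hn => gf_eq (by omega) (Finset.mem_Icc.1 hn).1
  rw [hsum] at hR
  have hlog := hT3 t ht3
  have hsm : (t:ℝ) ^ 4 + t ^ 6 ≤ 0.01 * c * ((t:ℝ) ^ 7 / (7 * Real.log t)) := by
    have e1 : (t:ℝ) ^ 4 ≤ t ^ 6 := pow_le_pow_right₀ (by linarith) (by norm_num)
    have e2 : 2 * (t:ℝ) ^ 6 ≤ 0.01 * c * ((t:ℝ) ^ 7 / (7 * Real.log t)) := by
      rw [← mul_div_assoc, le_div_iff₀ (by positivity)]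
      calc 2 * (t:ℝ) ^ 6 * (7 * Real.log t) = 14 * t ^ 6 * Real.log t := by ring
        _ ≤ 14 * t ^ 6 * ((0.01 * c / 14) * t) := by gcongr
        _ = _ := by ring
    linarith
  have hX : 0 ≤ c * ((t:ℝ) ^ 7 / (7 * Real.log t)) := by positivity
  have hY : 0.01 * c / 7 * ((t:ℝ) ^ 7 / Real.log t) = 0.01 * (c * ((t:ℝ) ^ 7 / (7 * Real.log t))) := by
    field_simp
  rw [hY]
  set X := c * ((t:ℝ) ^ 7 / (7 * Real.log t)) with hXd
  have q1 : (1 - 0.01) * c * ((t:ℝ) ^ 7 / (7 * Real.log t)) = 0.99 * X := by rw [hXd]; ring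
  have q2 : (1 + 0.01) * c * ((t:ℝ) ^ 7 / (7 * Real.log t)) = 1.01 * X := by rw [hXd]; ring
  have q3 : 0.01 * c * ((t:ℝ) ^ 7 / (7 * Real.log t)) = 0.01 * X := by rw [hXd]; ring
  rw [q1] at hpi
  rw [q2] at hD
  rw [q3] at hsm
  linarith

lemma log_pow_le_rpow (k : ℕ) (e : ℝ) (he : 0 < e) (K : ℝ) (hK : 0 < K) : ∃ T : ℕ, ∀ t : ℕ, T ≤ t → K * Real.log t ^ k ≤ (t:ℝ) ^ e := by
  have h1 := ((isLittleO_log_rpow_rpow_atTop (k:ℝ) he).def (show 0 < 1 / K by positivity))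
  have h2 : ∀ᶠ x : ℝ in Filter.atTop, K * Real.log x ^ k ≤ x ^ e := by
    filter_upwards [h1, Filter.eventually_ge_atTop 1] with x hx h1
    rw [Real.rpow_natCast, Real.norm_of_nonneg (pow_nonneg (Real.log_nonneg h1) _), Real.norm_of_nonneg (by positivity)] at hx
    calc K * Real.log x ^ k ≤ K * (1 / K * x ^ e) := by gcongr
      _ = x ^ e := by field_simp
  exact ((tendsto_natCast_atTop_atTop (R := ℝ)).eventually h2).exists_forall_of_atTop

def FamEx (α ϑ : ℝ) : Prop := ∃ c : ℝ, 0 < c ∧ ∃ T : ℕ, ∀ t : ℕ, T ≤ t → ∃ (𝒥 : Finset ℕ) (Q : ℝ) (L : ℕ) (z G : ℝ),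
      Fam t c 𝒥 (fun j => ⌊(j:ℝ) ^ α⌋₊) Q L z G ∧ (t:ℝ) ^ (7 * ϑ) ≤ Q

lemma final_of_fam {α ϑ : ℝ} (hϑ : 0 < ϑ) (hF : FamEx α ϑ) :
    ∀ n₀ : ℕ, ∃ p : ℕ, n₀ < p ∧ p.Prime ∧ (p : ℝ) ^ ϑ ≤ (PSdivisor α (p - 1) : ℝ) := by
  intro n₀
  obtain ⟨c, hc, T1, hF⟩ := hF
  obtain ⟨c0, hc0, hM⟩ := M6_main
  obtain ⟨T2, hT2⟩ := log_pow_le_rpow 10 (c / 2) (by positivity) 1 one_pos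
  obtain ⟨T3, hT3⟩ := log_pow_le_rpow 1 (1 / 2 + c) (by positivity) (64 * 3 * 4 / c0) (by positivity)
  obtain ⟨T4, hT4⟩ : ∃ T : ℕ, ∀ t : ℕ, T ≤ t → 64 * 4 * 10 ^ 6 * 4 / c0 ≤ Real.log t :=
    ((Real.tendsto_log_atTop.comp (tendsto_natCast_atTop_atTop (R := ℝ))).eventually (Filter.eventually_ge_atTop _)).exists_forall_of_atTop
  obtain ⟨t, ht, hlow⟩ := hM (max (n₀ + 3) (max T1 (max T2 (max T3 T4))))
  simp only [max_le_iff] at ht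
  obtain ⟨h3, ht1, ht2, ht3, ht4⟩ := ht
  obtain ⟨𝒥, Q, L, z, G, F, hQ⟩ := hF t ht1
  have h3t : 3 ≤ t := by omega
  have hl := log_ge_one h3t
  have ht0 : (0:ℝ) < t := by exact_mod_cast (show 0 < t by omega)
  have htr : (3:ℝ) ≤ t := by exact_mod_cast h3t
  by_contra hcon
  push Not at hcon
  have hno : ∀ j ∈ 𝒥, ∀ p : ℕ, p.Prime → t ^ 4 < p → p ≤ t ^ 7 → ¬ ⌊(j:ℝ) ^ α⌋₊ ∣ p - 1 := by
    intro j hj p hp hp1 hp2 hd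
    have hnp : n₀ < p := by
      have : t ≤ t ^ 4 := Nat.le_self_pow (by norm_num) t
      omega
    have h := hcon p hnp hp
    have hle : ⌊(j:ℝ) ^ α⌋₊ ≤ PSdivisor α (p - 1) := by
      unfold PSdivisor
      refine Finset.le_sup (f := id) (b := ⌊(j:ℝ) ^ α⌋₊) ?_
      rw [Finset.mem_filter, Nat.mem_divisors]
      exact ⟨⟨hd, by have := hp.two_le; omega⟩, j, rfl⟩
    have h2 : (p:ℝ) ^ ϑ ≤ (t:ℝ) ^ (7 * ϑ) := by
      have : (p:ℝ) ≤ (t:ℝ) ^ (7:ℝ) := by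
        rw [show (7:ℝ) = ((7:ℕ):ℝ) by norm_num, Real.rpow_natCast]; exact_mod_cast hp2
      rw [Real.rpow_mul ht0.le]
      exact Real.rpow_le_rpow (Nat.cast_nonneg _) this hϑ.le
    have h3 := (F.q1 j hj).1
    have h4 : ((⌊(j:ℝ) ^ α⌋₊ : ℕ) : ℝ) ≤ PSdivisor α (p - 1) := by exact_mod_cast hle
    linarith
  have hX : 0 < (t:ℝ) ^ 7 / Real.log t := by positivity
  have hs := sieve_main F hc h3t (by simpa using hT2 t ht2) hno (le_trans (by positivity) hlow)
  have s1 : 64 * Q * (1 + 2 * (t:ℝ) ^ 3) ≤ c0 / 4 * ((t:ℝ) ^ 7 / Real.log t) := by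
    have a1 : (1:ℝ) ≤ (t:ℝ) ^ 3 := one_le_pow₀ (by linarith)
    have a2 := hT3 t ht3
    rw [pow_one] at a2
    have a3 : Q * t ^ 3 * (t:ℝ) ^ (1 / 2 + c) ≤ (t:ℝ) ^ 7 := by
      calc Q * t ^ 3 * (t:ℝ) ^ (1 / 2 + c) ≤ (t:ℝ) ^ ((7:ℝ) / 2 - c) * t ^ 3 * (t:ℝ) ^ (1 / 2 + c) := by gcongr; exact F.Q2
        _ = (t:ℝ) ^ ((7:ℝ) / 2 - c) * (t:ℝ) ^ (3:ℝ) * (t:ℝ) ^ (1 / 2 + c) := by norm_cast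
        _ = (t:ℝ) ^ (7:ℝ) := by rw [← Real.rpow_add ht0, ← Real.rpow_add ht0]; congr 1; ring
        _ = _ := by norm_cast
    have hQ0 : 0 < Q := by linarith [F.Q1]
    rw [← mul_div_assoc, le_div_iff₀ (by linarith)]
    calc 64 * Q * (1 + 2 * (t:ℝ) ^ 3) * Real.log t ≤ 64 * Q * (3 * (t:ℝ) ^ 3) * Real.log t := by gcongr; linarith
      _ = c0 / 4 * (Q * t ^ 3 * (64 * 3 * 4 / c0 * Real.log t)) := by field_simp
      _ ≤ c0 / 4 * (Q * t ^ 3 * (t:ℝ) ^ (1 / 2 + c)) := by gcongr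
      _ ≤ _ := by gcongr
  have s2 : 64 * 4 * 10 ^ 6 * ((t:ℝ)^7 / Real.log t ^ 7) ≤ c0 / 4 * ((t:ℝ) ^ 7 / Real.log t) := by
    have a := hT4 t ht4
    have b : Real.log t ≤ Real.log t ^ 6 := le_self_pow₀ hl (by norm_num)
    have : (t:ℝ)^7 / Real.log t ^ 7 = ((t:ℝ) ^ 7 / Real.log t) / Real.log t ^ 6 := by
      field_simp
    rw [this, ← mul_div_assoc, div_le_iff₀ (by positivity)]
    have h : 64 * 4 * 10 ^ 6 ≤ c0 / 4 * Real.log t ^ 6 := by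
      rw [div_le_iff₀ hc0] at a
      nlinarith
    calc 64 * 4 * 10 ^ 6 * ((t:ℝ) ^ 7 / Real.log t) ≤ (c0 / 4 * Real.log t ^ 6) * ((t:ℝ) ^ 7 / Real.log t) := by gcongr
      _ = _ := by ring
  nlinarith

lemma layer_pt (u : ℝ) (hu : 0 ≤ u) (I : ℕ) : 1 / (1 + u ^ 2) ≤ ∑ i ∈ Finset.range I, (if u ≤ 2 ^ i then 4 * (1 / 4 : ℝ) ^ i else 0) + 4 * (1 / 4 : ℝ) ^ I := by
  induction I with
  | zero =>
    simp only [Finset.range_zero, Finset.sum_empty, pow_zero, mul_one, zero_add]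
    rw [div_le_iff₀ (by positivity)]
    nlinarith [sq_nonneg u]
  | succ I ih =>
    rw [Finset.sum_range_succ]
    by_cases h : u ≤ 2 ^ I
    · rw [if_pos h]
      have : (0:ℝ) ≤ 4 * (1 / 4 : ℝ) ^ (I + 1) := by positivity
      linarith
    · rw [if_neg h]
      push Not at h
      have h1 : 0 ≤ ∑ i ∈ Finset.range I, (if u ≤ 2 ^ i then 4 * (1 / 4 : ℝ) ^ i else 0) :=
        Finset.sum_nonneg fun i _ => by split_ifs <;> positivity
      have h2 : 1 / (1 + u ^ 2) ≤ 4 * (1 / 4 : ℝ) ^ (I + 1) := by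
        have h3 : 4 * (1 / 4 : ℝ) ^ (I + 1) = 1 / (2 ^ I) ^ 2 := by
          rw [pow_succ, one_div_pow, ← pow_mul, mul_comm I 2, pow_mul]; norm_num
          ring
        rw [h3]
        have : (0:ℝ) < 2 ^ I := by positivity
        apply one_div_le_one_div_of_le (by positivity)
        nlinarith
      linarith

lemma geo4 (I : ℕ) : ∑ i ∈ Finset.range I, (1 / 4 : ℝ) ^ i ≤ 4 / 3 := by
  rw [geom_sum_eq (by norm_num)]
  have : (0:ℝ) ≤ (1 / 4) ^ I := by positivity
  rw [div_le_iff_of_neg (by norm_num)]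
  linarith

lemma geo2 (I : ℕ) : ∑ i ∈ Finset.range I, (1 / 2 : ℝ) ^ i ≤ 2 := by
  rw [geom_sum_eq (by norm_num)]
  have : (0:ℝ) ≤ (1 / 2) ^ I := by positivity
  rw [div_le_iff_of_neg (by norm_num)]
  linarith

lemma layer (S : Finset ℕ) (u : ℕ → ℝ) (hu : ∀ j ∈ S, 0 ≤ u j) (A B : ℝ) (hA : 0 ≤ A) (hB : 0 < B)
    (hK : ∀ i : ℕ, ((S.filter (fun j => u j ≤ 2 ^ i)).card : ℝ) ≤ 2 ^ i * A + B) :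
    ∑ j ∈ S, 1 / (1 + u j ^ 2) ≤ 8 * (A + B) := by
  obtain ⟨I, hI⟩ : ∃ I : ℕ, (1 / 4 : ℝ) ^ I < B / (4 * (S.card + 1)) := exists_pow_lt_of_lt_one (by positivity) (by norm_num)
  have h1 : ∑ j ∈ S, 1 / (1 + u j ^ 2) ≤ ∑ j ∈ S, (∑ i ∈ Finset.range I, (if u j ≤ 2 ^ i then 4 * (1 / 4 : ℝ) ^ i else 0) + 4 * (1 / 4 : ℝ) ^ I) :=
    Finset.sum_le_sum fun j hj => layer_pt _ (hu j hj) I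
  rw [Finset.sum_add_distrib, Finset.sum_comm, Finset.sum_const, nsmul_eq_mul] at h1
  have h2 : (S.card : ℝ) * (4 * (1 / 4 : ℝ) ^ I) ≤ B := by
    rw [lt_div_iff₀ (by positivity)] at hI
    have : (0:ℝ) < (1 / 4) ^ I := by positivity
    nlinarith
  have h3 : ∑ i ∈ Finset.range I, ∑ j ∈ S, (if u j ≤ 2 ^ i then 4 * (1 / 4 : ℝ) ^ i else 0) ≤ ∑ i ∈ Finset.range I, (4 * A * (1 / 2 : ℝ) ^ i + 4 * B * (1 / 4 : ℝ) ^ i) := by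
    refine Finset.sum_le_sum fun i _ => ?_
    rw [← Finset.sum_filter, Finset.sum_const, nsmul_eq_mul]
    calc ((S.filter (fun j => u j ≤ 2 ^ i)).card : ℝ) * (4 * (1 / 4 : ℝ) ^ i) ≤ (2 ^ i * A + B) * (4 * (1 / 4 : ℝ) ^ i) := by gcongr; exact hK i
      _ = 4 * A * (2 * (1 / 4) : ℝ) ^ i + 4 * B * (1 / 4 : ℝ) ^ i := by rw [mul_pow]; ring
      _ = _ := by norm_num
  rw [Finset.sum_add_distrib, ← Finset.mul_sum, ← Finset.mul_sum] at h3
  have h4 := mul_le_mul_of_nonneg_left (geo2 I) (show 0 ≤ 4 * A by positivity)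
  have h5 := mul_le_mul_of_nonneg_left (geo4 I) (show 0 ≤ 4 * B by positivity)
  linarith

lemma divisor_bound (ε : ℝ) (h0 : 0 < ε) (h1 : ε < 1) : ∃ C : ℝ, 0 < C ∧ ∀ n : ℕ, 0 < n → (n.divisors.card : ℝ) ≤ C * (n:ℝ) ^ ε := by
  set η := (2:ℝ) ^ ε - 1 with hη
  have hη0 : 0 < η := by
    have : (1:ℝ) < 2 ^ ε := Real.one_lt_rpow (by norm_num) h0
    linarith
  have hη1 : η ≤ 1 := by
    have : (2:ℝ) ^ ε ≤ 2 ^ (1:ℝ) := Real.rpow_le_rpow_of_exponent_le (by norm_num) h1.le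
    rw [Real.rpow_one] at this
    linarith
  set P := ⌈(2:ℝ) ^ (1 / ε)⌉₊ with hP
  have hC1 : 1 ≤ 1 / η := by rw [le_div_iff₀ hη0]; linarith
  refine ⟨(1 / η) ^ P, by positivity, fun n hn => ?_⟩
  rw [Nat.card_divisors hn.ne']
  push_cast
  have hstep : ∀ p ∈ n.primeFactors, ((n.factorization p : ℝ) + 1) ≤ (if p < P then 1 / η else 1) * ((p:ℝ) ^ n.factorization p) ^ ε := by
    intro p hp
    have hpp := Nat.prime_of_mem_primeFactors hp
    have hp2 : (2:ℝ) ≤ p := by exact_mod_cast hpp.two_le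
    set a := n.factorization p
    have hcomm : ((p:ℝ) ^ a) ^ ε = ((p:ℝ) ^ ε) ^ a := by
      rw [← Real.rpow_natCast, ← Real.rpow_natCast, ← Real.rpow_mul (by linarith), ← Real.rpow_mul (by linarith), mul_comm]
    rw [hcomm]
    split_ifs with h
    · have h2 : 1 + η ≤ (p:ℝ) ^ ε := by
        rw [hη]
        have := Real.rpow_le_rpow (by norm_num) hp2 h0.le
        linarith
      have h3 : 1 + (a:ℝ) * η ≤ (1 + η) ^ a := one_add_mul_le_pow (by linarith) a
      have h4 : (1 + η) ^ a ≤ ((p:ℝ) ^ ε) ^ a := pow_le_pow_left₀ (by linarith) h2 a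
      rw [div_mul_eq_mul_div, le_div_iff₀ hη0]
      nlinarith
    · push Not at h
      have hp' : (2:ℝ) ^ (1 / ε) ≤ p := (Nat.le_ceil _).trans (by exact_mod_cast h)
      have h2 : (2:ℝ) ≤ (p:ℝ) ^ ε := by
        have := Real.rpow_le_rpow (by positivity) hp' h0.le
        rwa [← Real.rpow_mul (by norm_num), one_div_mul_cancel h0.ne', Real.rpow_one] at this
      have h3 : 1 + (a:ℝ) * 1 ≤ (1 + 1) ^ a := one_add_mul_le_pow (by linarith) a
      have h4 : (1 + 1 : ℝ) ^ a ≤ ((p:ℝ) ^ ε) ^ a := pow_le_pow_left₀ (by linarith) (by linarith) a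
      linarith
  calc ∏ p ∈ n.primeFactors, ((n.factorization p : ℝ) + 1) ≤ ∏ p ∈ n.primeFactors, ((if p < P then 1 / η else 1) * ((p:ℝ) ^ n.factorization p) ^ ε) :=
        Finset.prod_le_prod (fun _ _ => by positivity) hstep
    _ = (∏ p ∈ n.primeFactors, (if p < P then 1 / η else 1)) * (n:ℝ) ^ ε := by
        rw [Finset.prod_mul_distrib, Real.finsetProd_rpow _ _ (fun _ _ => by positivity)]
        congr 2
        have := Nat.prod_factorization_pow_eq_self hn.ne'
        rw [Finsupp.prod, Nat.support_factorization] at this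
        exact_mod_cast this
    _ ≤ (1 / η) ^ P * (n:ℝ) ^ ε := by
        gcongr
        rw [← Finset.prod_filter, Finset.prod_const]
        apply pow_le_pow_right₀ hC1
        calc _ ≤ (Finset.range P).card := Finset.card_le_card (fun p hp => Finset.mem_range.2 (Finset.mem_filter.1 hp).2)
          _ = P := Finset.card_range P

lemma nd_sub_le (x y : ℝ) : nd (x - y) ≤ nd x + nd y := by
  have h := nd_le (x - y) (round x - round y)
  unfold nd at *
  refine h.trans ?_
  push_cast
  have : x - y - ((round x : ℝ) - round y) = (x - round x) - (y - round y) := by ring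
  rw [this]
  exact abs_sub _ _

lemma bohr {r b : ℕ} (hr : 0 < r) (hb : b.Coprime r) {Δ : ℝ} (hΔ : 0 ≤ Δ) (M : ℕ) :
    (((Finset.Icc 1 M).filter (fun D : ℕ => nd ((D:ℝ) * (b / r)) ≤ Δ)).card : ℝ) ≤ ((M:ℝ) / r + 1) * (2 * Δ * r + 1) := by
  have hr0 : (0:ℝ) < r := by exact_mod_cast hr
  set w := ⌊Δ * r⌋₊ with hw
  set R := (Finset.range (w + 1)) ∪ (Finset.Ico (r - w) r) with hR
  have hRc : (R.card : ℝ) ≤ 2 * Δ * r + 1 := by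
    have h1 : R.card ≤ (w + 1) + w := by
      refine (Finset.card_union_le _ _).trans ?_
      rw [Finset.card_range, Nat.card_Ico]
      omega
    have h2 : (w:ℝ) ≤ Δ * r := Nat.floor_le (by positivity)
    have h3 : (R.card : ℝ) ≤ (w + 1) + w := by exact_mod_cast h1
    linarith
  have hmap : ((Finset.Icc 1 M).filter (fun D : ℕ => nd ((D:ℝ) * (b / r)) ≤ Δ)).card ≤ ((Finset.range (M / r + 1)) ×ˢ R).card := by
    refine Finset.card_le_card_of_injOn (fun D => (D / r, (D * b) % r)) ?_ ?_
    · intro D hD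
      simp only [Finset.coe_filter, Finset.mem_Icc, Set.mem_ofPred_eq] at hD
      simp only [Finset.coe_product, Set.mem_prod, Finset.mem_coe, Finset.mem_range]
      refine ⟨Nat.lt_succ_of_le (Nat.div_le_div_right hD.1.2), ?_⟩
      set m := (D * b) % r with hm
      have hmr : m < r := Nat.mod_lt _ hr
      have hDm : (D:ℝ) * (b / r) = (m:ℝ) / r + ((D * b / r : ℕ) : ℤ) := by
        have := Nat.div_add_mod (D * b) r
        have h : ((D:ℝ) * b) = r * ((D * b / r : ℕ) : ℝ) + m := by rw [hm]; exact_mod_cast this.symm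
        rw [← mul_div_assoc, h, Int.cast_natCast]
        generalize D * b / r = k
        field_simp
        ring
      have hnd := hD.2
      rw [hDm, nd_add_int] at hnd
      rw [hR, Finset.mem_union, Finset.mem_range, Finset.mem_Ico]
      unfold nd at hnd
      rw [abs_le] at hnd
      have hround : round ((m:ℝ) / r) = 0 ∨ round ((m:ℝ) / r) = 1 := by
        have h1 : (m:ℝ) / r < 1 := by rw [div_lt_one hr0]; exact_mod_cast hmr
        have h2 : 0 ≤ (m:ℝ) / r := by positivity
        rw [round_eq]
        have h3 : 0 ≤ ⌊(m:ℝ) / r + 1 / 2⌋ := Int.floor_nonneg.2 (by linarith)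
        have h4 : ⌊(m:ℝ) / r + 1 / 2⌋ < 2 := Int.floor_lt.2 (by push_cast; linarith)
        omega
      rcases hround with h | h
      · left
        rw [h] at hnd
        have : (m:ℝ) ≤ Δ * r := by
          rw [← div_le_iff₀ hr0]; simpa using hnd.2
        have := Nat.le_floor this
        omega
      · right
        rw [h] at hnd
        have h5 : ((r - m : ℕ) : ℝ) ≤ Δ * r := by
          rw [Nat.cast_sub hmr.le]
          have := hnd.1
          push_cast at this
          have h6 : 1 - (m:ℝ) / r ≤ Δ := by linarith
          have h7 : 1 - (m:ℝ) / r = (r - m) / r := by field_simp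
          rwa [h7, div_le_iff₀ hr0] at h6
        have := Nat.le_floor h5
        omega
    · intro D _ D' _ h
      simp only [Prod.mk.injEq] at h
      have h1 : D * b ≡ D' * b [MOD r] := h.2
      have h2 : D ≡ D' [MOD r] := Nat.ModEq.cancel_right_of_coprime (by rw [Nat.gcd_comm]; exact hb) h1
      rw [← Nat.div_add_mod D r, ← Nat.div_add_mod D' r, h.1]
      have : D % r = D' % r := h2
      rw [this]
  rw [Finset.card_product, Finset.card_range] at hmap
  have hd : ((M / r : ℕ) : ℝ) ≤ (M:ℝ) / r := Nat.cast_div_le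
  calc _ ≤ (((M / r + 1) * R.card : ℕ) : ℝ) := by exact_mod_cast hmap
    _ = (((M / r : ℕ) : ℝ) + 1) * R.card := by push_cast; ring
    _ ≤ _ := by gcongr

lemma prime_count : ∃ T : ℕ, ∀ J : ℕ, T ≤ J → (J:ℝ) ≤ ((Finset.Ioc J (8 * J)).filter Nat.Prime).card * Real.log (8 * J) := by
  obtain ⟨T, hT⟩ := log_pow_le_rpow 1 (1 / 2) (by norm_num) (32 / 3) (by norm_num)
  refine ⟨max T 3, fun J hJ => ?_⟩
  rw [max_le_iff] at hJ
  have h1 := hT (8 * J) (by omega)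
  rw [← Real.sqrt_eq_rpow, pow_one] at h1
  have h2 := Chebyshev.theta_ge (8 * J)
  have h3 := Chebyshev.theta_le_log4_mul_x (x := (J:ℝ)) (Nat.cast_nonneg _)
  rw [Chebyshev.theta_eq_sum_primesLE_log] at h2 h3
  have hJ3 : (3:ℝ) ≤ J := by exact_mod_cast hJ.2
  have h4 : ∑ p ∈ Nat.primesLE (8 * J), Real.log p ≤ ∑ p ∈ Nat.primesLE J, Real.log p + ((Finset.Ioc J (8 * J)).filter Nat.Prime).card * Real.log (8 * J) := by
    have hs : Nat.primesLE (8 * J) ⊆ Nat.primesLE J ∪ (Finset.Ioc J (8 * J)).filter Nat.Prime := by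
      intro p hp
      simp only [Nat.mem_primesLE, Finset.mem_union, Finset.mem_filter, Finset.mem_Ioc] at hp ⊢
      by_cases h : p ≤ J
      · left; exact ⟨h, hp.2⟩
      · right; exact ⟨⟨by omega, hp.1⟩, hp.2⟩
    calc ∑ p ∈ Nat.primesLE (8 * J), Real.log p ≤ ∑ p ∈ Nat.primesLE J ∪ (Finset.Ioc J (8 * J)).filter Nat.Prime, Real.log p :=
          Finset.sum_le_sum_of_subset_of_nonneg hs (fun p _ _ => Real.log_natCast_nonneg p)
      _ ≤ ∑ p ∈ Nat.primesLE J, Real.log p + ∑ p ∈ (Finset.Ioc J (8 * J)).filter Nat.Prime, Real.log p := by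
          rw [← Finset.sum_union_inter]
          have : 0 ≤ ∑ p ∈ Nat.primesLE J ∩ (Finset.Ioc J (8 * J)).filter Nat.Prime, Real.log p := Finset.sum_nonneg fun p _ => Real.log_natCast_nonneg p
          linarith
      _ ≤ _ := by
          gcongr
          rw [← nsmul_eq_mul]
          refine Finset.sum_le_card_nsmul _ _ _ fun p hp => ?_
          simp only [Finset.mem_filter, Finset.mem_Ioc] at hp
          apply Real.log_le_log (by exact_mod_cast hp.2.pos)
          exact_mod_cast hp.1.2
  push_cast at h1 h2
  set n : ℝ := 8 * J with hn
  have hn24 : 24 ≤ n := by linarith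
  have hl0 : 0 ≤ Real.log n := Real.log_nonneg (by linarith)
  have hs1 : 1 ≤ √n := by rw [Real.one_le_sqrt]; linarith
  have h5 : Real.log (n + 1) ≤ 2 * √n * Real.log n := by
    calc Real.log (n + 1) ≤ Real.log (n ^ 2) := Real.log_le_log (by linarith) (by nlinarith)
      _ = 2 * Real.log n := by rw [Real.log_pow]; norm_num
      _ ≤ _ := by nlinarith
  have h6 : 4 * √n * Real.log n ≤ 3 / 8 * n := by
    have := Real.mul_self_sqrt (show 0 ≤ n by linarith)
    nlinarith
  have h7 : Real.log 4 = 2 * Real.log 2 := by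
    rw [show (4:ℝ) = 2 ^ 2 by norm_num, Real.log_pow]; norm_num
  have h8 := Real.log_two_gt_d9
  rw [h7] at h3
  nlinarith

lemma K_sq {J : ℕ} (S : Finset ℕ) (hS : S ⊆ Finset.Ioc J (8 * J)) {r b : ℕ} (hr : 0 < r) (hb : b.Coprime r) {Δ : ℝ} (hΔ : 0 ≤ Δ)
    (hnd : ∀ j ∈ S, nd ((j:ℝ) ^ 2 * (b / r)) ≤ Δ) (B : ℕ) (hB : ∀ n : ℕ, 0 < n → n ≤ 64 * J ^ 2 → n.divisors.card ≤ B) :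
    (S.card : ℝ) ^ 2 ≤ S.card + 2 * B * (((64 * J ^ 2 : ℕ) / r + 1) * (2 * (2 * Δ) * r + 1)) := by
  set P := (S ×ˢ S).filter (fun x => x.2 < x.1) with hP
  set Bo := (Finset.Icc 1 (64 * J ^ 2)).filter (fun D : ℕ => nd ((D:ℝ) * (b / r)) ≤ 2 * Δ) with hBo
  have hbo := bohr hr hb (show 0 ≤ 2 * Δ by linarith) (64 * J ^ 2)
  have hPB : P.card ≤ B * Bo.card := by
    have hpos : ∀ x ∈ P, 0 < x.1 ^ 2 - x.2 ^ 2 ∧ x.1 ^ 2 - x.2 ^ 2 ≤ 64 * J ^ 2 := by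
      intro x hx
      simp only [hP, Finset.mem_filter, Finset.mem_product] at hx
      have h1 := Finset.mem_Ioc.1 (hS hx.1.1)
      have h2 : x.2 ^ 2 < x.1 ^ 2 := Nat.pow_lt_pow_left hx.2 (by norm_num)
      have h3 : x.1 ^ 2 ≤ (8 * J) ^ 2 := Nat.pow_le_pow_left h1.2 2
      have h4 : (8 * J) ^ 2 = 64 * J ^ 2 := by ring
      omega
    have himg : P.image (fun x => x.1 ^ 2 - x.2 ^ 2) ⊆ Bo := by
      intro D hD
      obtain ⟨x, hx, rfl⟩ := Finset.mem_image.1 hD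
      have h0 := hpos x hx
      simp only [hP, Finset.mem_filter, Finset.mem_product] at hx
      rw [hBo, Finset.mem_filter, Finset.mem_Icc]
      refine ⟨⟨h0.1, h0.2⟩, ?_⟩
      have h2 : x.2 ^ 2 ≤ x.1 ^ 2 := Nat.pow_le_pow_left hx.2.le 2
      rw [Nat.cast_sub h2]
      push_cast
      rw [sub_mul]
      refine (nd_sub_le _ _).trans ?_
      have := hnd x.1 hx.1.1
      have := hnd x.2 hx.1.2
      linarith
    refine (Finset.card_le_mul_card_image (f := fun x : ℕ × ℕ => x.1 ^ 2 - x.2 ^ 2) P B ?_).trans (Nat.mul_le_mul_left _ (Finset.card_le_card himg))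
    intro D hD
    have hDB := Finset.mem_Icc.1 (Finset.mem_filter.1 (himg hD)).1
    refine le_trans ?_ (hB D hDB.1 hDB.2)
    refine Finset.card_le_card_of_injOn (fun x => x.1 - x.2) ?_ ?_
    · intro x hx
      simp only [Finset.coe_filter, Set.mem_ofPred_eq] at hx
      simp only [Finset.mem_coe, Nat.mem_divisors]
      refine ⟨⟨x.1 + x.2, ?_⟩, by omega⟩
      rw [← hx.2, Nat.sq_sub_sq, mul_comm]
    · intro x hx y hy h
      simp only [Finset.coe_filter, Set.mem_ofPred_eq] at hx hy
      obtain ⟨hx1, hx2⟩ := hx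
      obtain ⟨hy1, hy2⟩ := hy
      simp only [hP, Finset.mem_filter, Finset.mem_product] at hx1 hy1
      simp only at h
      rw [Nat.sq_sub_sq] at hx2 hy2
      rw [← h, ← hx2] at hy2
      have hp : 0 < x.1 - x.2 := by omega
      have := Nat.eq_of_mul_eq_mul_right hp hy2
      ext <;> omega
  have hsplit : (S ×ˢ S).card ≤ S.card + (P.card + P.card) := by
    have hsub : S ×ˢ S ⊆ S.image (fun j => (j, j)) ∪ (P ∪ P.image Prod.swap) := by
      intro x hx
      rw [Finset.mem_product] at hx
      simp only [Finset.mem_union, Finset.mem_image]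
      rcases lt_trichotomy x.1 x.2 with h | h | h
      · right; right
        exact ⟨(x.2, x.1), by simp only [hP, Finset.mem_filter, Finset.mem_product]; exact ⟨⟨hx.2, hx.1⟩, h⟩, rfl⟩
      · left; exact ⟨x.1, hx.1, by ext <;> simp [h]⟩
      · right; left
        simp only [hP, Finset.mem_filter, Finset.mem_product]; exact ⟨hx, h⟩
    refine (Finset.card_le_card hsub).trans ((Finset.card_union_le _ _).trans ?_)
    refine add_le_add Finset.card_image_le ((Finset.card_union_le _ _).trans ?_)
    exact add_le_add le_rfl Finset.card_image_le
  rw [Finset.card_product] at hsplit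
  have h1 : (S.card : ℝ) ^ 2 ≤ S.card + 2 * P.card := by
    have : S.card * S.card ≤ S.card + 2 * P.card := by omega
    rw [sq]; exact_mod_cast this
  have h2 : (P.card : ℝ) ≤ B * Bo.card := by exact_mod_cast hPB
  calc (S.card : ℝ) ^ 2 ≤ S.card + 2 * (B * Bo.card) := by linarith
    _ ≤ S.card + 2 * (B * (((64 * J ^ 2 : ℕ) / r + 1) * (2 * (2 * Δ) * r + 1))) := by gcongr
    _ = _ := by ring

/-- square-root form -/
lemma K_sq' {J : ℕ} (hJ : 0 < J) (S : Finset ℕ) (hS : S ⊆ Finset.Ioc J (8 * J)) {r b : ℕ} (hr : J ≤ r) (hr2 : r ≤ 64 * J ^ 2) (hb : b.Coprime r) {Δ : ℝ} (hΔ : 0 ≤ Δ)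
    (hnd : ∀ j ∈ S, nd ((j:ℝ) ^ 2 * (b / r)) ≤ Δ) (B : ℕ) (hB1 : 1 ≤ B) (hB : ∀ n : ℕ, 0 < n → n ≤ 64 * J ^ 2 → n.divisors.card ≤ B) :
    (S.card : ℝ) ≤ √B * (36 * √Δ * J + 12 * √J) := by
  have h := K_sq S hS (by omega) hb hΔ hnd B hB
  have hJ0 : (1:ℝ) ≤ J := by exact_mod_cast hJ
  have hr0 : (J:ℝ) ≤ r := by exact_mod_cast hr
  have hr0' : (r:ℝ) ≤ 64 * J ^ 2 := by exact_mod_cast hr2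
  have hB0 : (1:ℝ) ≤ B := by exact_mod_cast hB1
  have hSc : (S.card : ℝ) ≤ 8 * J := by
    have := Finset.card_le_card hS
    rw [Nat.card_Ioc] at this
    have h : S.card ≤ 8 * J := by omega
    exact_mod_cast h
  have hb1 : ((64 * J ^ 2 : ℕ) / (r:ℝ) + 1) * (2 * (2 * Δ) * r + 1) ≤ 512 * Δ * J ^ 2 + 65 * J := by
    push_cast
    have hrp : (0:ℝ) < r := by linarith
    have e1 : (64 * (J:ℝ) ^ 2 / r + 1) * (2 * (2 * Δ) * r + 1) = 256 * Δ * J ^ 2 + 64 * J ^ 2 / r + 4 * Δ * r + 1 := by field_simp; ring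
    rw [e1]
    have e2 : 64 * (J:ℝ) ^ 2 / r ≤ 64 * J := by
      rw [div_le_iff₀ hrp]; nlinarith
    have e3 : 4 * Δ * r ≤ 256 * Δ * J ^ 2 := by nlinarith
    linarith
  have h2 : (S.card : ℝ) ^ 2 ≤ B * (1024 * Δ * J ^ 2 + 138 * J) := by
    have e4 : 2 * (B:ℝ) * (((64 * J ^ 2 : ℕ) / (r:ℝ) + 1) * (2 * (2 * Δ) * r + 1)) ≤ 2 * B * (512 * Δ * J ^ 2 + 65 * J) := by gcongr
    nlinarith
  refine le_of_sq_le_sq ?_ (by positivity)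
  refine h2.trans ?_
  rw [mul_pow, Real.sq_sqrt (by linarith)]
  gcongr
  have s1 := Real.sq_sqrt hΔ
  have s2 := Real.sq_sqrt (show (0:ℝ) ≤ J by linarith)
  have s3 := Real.sqrt_nonneg Δ
  have s4 := Real.sqrt_nonneg (J:ℝ)
  calc 1024 * Δ * (J:ℝ) ^ 2 + 138 * J ≤ 36 ^ 2 * Δ * J ^ 2 + 12 ^ 2 * J := by
        have : 0 ≤ Δ * (J:ℝ) ^ 2 := by positivity
        nlinarith
    _ = 36 ^ 2 * √Δ ^ 2 * J ^ 2 + 12 ^ 2 * √J ^ 2 := by rw [s1, s2]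
    _ ≤ _ := by
        have : 0 ≤ √Δ * J * √J := by positivity
        nlinarith

lemma frac_reduce {q k : ℕ} (hq : 0 < q) : ((k:ℝ) / q) = ((k / k.gcd q : ℕ) : ℝ) / ((q / k.gcd q : ℕ) : ℝ) ∧ (k / k.gcd q).Coprime (q / k.gcd q) := by
  have hg : 0 < k.gcd q := Nat.gcd_pos_of_pos_right _ hq
  refine ⟨?_, Nat.coprime_div_gcd_div_gcd hg⟩
  have hg0 : ((k.gcd q : ℕ) : ℝ) ≠ 0 := by exact_mod_cast hg.ne'
  rw [Nat.cast_div (Nat.gcd_dvd_left _ _) hg0, Nat.cast_div (Nat.gcd_dvd_right _ _) hg0]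
  rw [div_div_div_cancel_right₀ hg0]

/-- final numerology for squares -/
lemma sq_num {t J N : ℝ} (ht : 1 ≤ t) (hJ1 : t ^ (1.5:ℝ) ≤ J) (hJ2 : J ≤ 2 * t ^ (1.625:ℝ)) (hN1 : t ^ ((7:ℝ)/2) ≤ N) (hN2 : N ≤ 2 * t ^ 4) :
    √(J ^ 2 / N) ≤ 12 * t ^ (-(1/8) : ℝ) * min 1 (t ^ 7 / (N * J ^ 2)) ∧ 1 / √J ≤ 8 * t ^ (-(1/2) : ℝ) * min 1 (t ^ 7 / (N * J ^ 2)) := by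
  have t0 : 0 < t := by linarith
  have hJ0 : 0 < J := lt_of_lt_of_le (by positivity) hJ1
  have hN0 : 0 < N := lt_of_lt_of_le (by positivity) hN1
  have hsN1 : t ^ (1.75:ℝ) ≤ √N := by
    apply Real.le_sqrt_of_sq_le
    rw [← Real.rpow_natCast, ← Real.rpow_mul t0.le]
    norm_num at hN1 ⊢
    exact hN1
  have hsN2 : √N ≤ 1.5 * t ^ (2:ℝ) := by
    apply Real.sqrt_le_left (by positivity) |>.2 |> fun h => h
    rw [mul_pow, ← Real.rpow_natCast (t ^ (2:ℝ)), ← Real.rpow_mul t0.le]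
    have : t ^ ((2:ℝ) * (2:ℕ)) = t ^ 4 := by norm_num
    rw [this]
    have : 0 < t ^ 4 := by positivity
    nlinarith
  have hsq : √(J ^ 2 / N) = J / √N := by
    rw [Real.sqrt_div (by positivity), Real.sqrt_sq hJ0.le]
  have hsN0 : 0 < √N := Real.sqrt_pos.2 hN0
  have hNs : N = √N * √N := (Real.mul_self_sqrt hN0.le).symm
  have hJs : J = √J * √J := (Real.mul_self_sqrt hJ0.le).symm
  have hsJ0 : 0 < √J := Real.sqrt_pos.2 hJ0
  have t7 : t ^ 7 = t ^ (7:ℝ) := by norm_cast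
  have hsJ2 : √J ≤ 1.5 * t ^ (0.8125:ℝ) := by
    apply Real.sqrt_le_left (by positivity) |>.2 |> fun h => h
    rw [mul_pow, ← Real.rpow_natCast (t ^ (0.8125:ℝ)), ← Real.rpow_mul t0.le]
    have : (0.8125:ℝ) * (2:ℕ) = 1.625 := by norm_num
    rw [this]
    have : 0 < t ^ (1.625:ℝ) := by positivity
    nlinarith
  have hsJ1 : t ^ (0.75:ℝ) ≤ √J := by
    apply Real.le_sqrt_of_sq_le
    rw [← Real.rpow_natCast, ← Real.rpow_mul t0.le]
    norm_num at hJ1 ⊢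
    exact hJ1
  constructor
  · rw [hsq]
    rcases min_choice (1:ℝ) (t ^ 7 / (N * J ^ 2)) with h | h <;> rw [h]
    · rw [mul_one, div_le_iff₀ hsN0]
      calc J ≤ 2 * t ^ (1.625:ℝ) := hJ2
        _ ≤ 12 * t ^ (1.625:ℝ) := by gcongr; norm_num
        _ = 12 * t ^ (-(1/8) : ℝ) * t ^ (1.75:ℝ) := by rw [mul_assoc, ← Real.rpow_add t0]; norm_num
        _ ≤ _ := by gcongr
    · rw [← mul_div_assoc, div_le_div_iff₀ hsN0 (by positivity), t7, mul_assoc, mul_assoc, ← mul_assoc (t ^ _), ← Real.rpow_add t0]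
      calc J * (N * J ^ 2) = J ^ 3 * √N * √N := by rw [mul_assoc, ← hNs]; ring
        _ ≤ (2 * t ^ (1.625:ℝ)) ^ 3 * (1.5 * t ^ (2:ℝ)) * √N := by gcongr
        _ = 12 * ((t ^ (1.625:ℝ)) ^ 3 * t ^ (2:ℝ) * √N) := by ring
        _ = 12 * (t ^ (-(1/8) + (7:ℝ)) * √N) := by
            rw [← Real.rpow_natCast (t ^ (1.625:ℝ)), ← Real.rpow_mul t0.le, ← Real.rpow_add t0]; norm_num
        _ ≤ _ := le_rfl
  · rcases min_choice (1:ℝ) (t ^ 7 / (N * J ^ 2)) with h | h <;> rw [h]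
    · rw [mul_one, div_le_iff₀ hsJ0]
      calc (1:ℝ) = t ^ (-(1/2):ℝ) * t ^ (0.5:ℝ) := by rw [← Real.rpow_add t0]; norm_num
        _ ≤ t ^ (-(1/2):ℝ) * t ^ (0.75:ℝ) := by gcongr <;> norm_num
        _ ≤ 8 * t ^ (-(1/2):ℝ) * √J := by
            have : 0 < t ^ (-(1/2):ℝ) := by positivity
            have h2 : t ^ (-(1/2):ℝ) * t ^ (0.75:ℝ) ≤ t ^ (-(1/2):ℝ) * √J := by gcongr
            have : 0 ≤ t ^ (-(1/2):ℝ) * √J := by positivity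
            linarith
    · rw [← mul_div_assoc, div_le_div_iff₀ hsJ0 (by positivity), t7, mul_assoc, mul_assoc, ← mul_assoc (t ^ _), ← Real.rpow_add t0, one_mul]
      calc N * J ^ 2 = N * (J * √J) * √J := by rw [mul_assoc, mul_assoc, ← hJs]; ring
        _ ≤ (2 * t ^ 4) * ((2 * t ^ (1.625:ℝ)) * (1.5 * t ^ (0.8125:ℝ))) * √J := by gcongr
        _ = 6 * (t ^ (4:ℝ) * t ^ (1.625:ℝ) * t ^ (0.8125:ℝ)) * √J := by
            have : t ^ 4 = t ^ (4:ℝ) := by norm_cast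
            rw [this]; ring
        _ = 6 * t ^ (6.4375:ℝ) * √J := by rw [← Real.rpow_add t0, ← Real.rpow_add t0]; norm_num
        _ ≤ 8 * t ^ (-(1/2) + (7:ℝ)) * √J := by gcongr <;> norm_num
        _ = _ := by ring

set_option maxHeartbeats 1600000 in
lemma fam_two (ϑ : ℝ) (h1 : 3 / 7 ≤ ϑ) (h2 : ϑ ≤ 13 / 28) : FamEx 2 ϑ := by
  obtain ⟨C, hC, hdiv⟩ := divisor_bound (1 / 200) (by norm_num) (by norm_num)
  obtain ⟨T0, hT0⟩ := prime_count
  obtain ⟨T1, hT1⟩ := log_pow_le_rpow 10 1 (by norm_num) 1 one_pos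
  obtain ⟨T2, hT2⟩ := log_pow_le_rpow 0 (1/100) (by norm_num) (8 * 36 * 12 * 2 * 2 * (C + 1) * 256) (by positivity)
  obtain ⟨T3, hT3⟩ := log_pow_le_rpow 1 (1/100) (by norm_num) 30 (by norm_num)
  refine ⟨1 / 50, by norm_num, max (T0 + 64) (max T1 (max T2 T3)), fun t ht => ?_⟩
  simp only [max_le_iff] at ht
  obtain ⟨ht0, ht1, ht2, ht3⟩ := ht
  have h3t : 3 ≤ t := by omega
  have hl := log_ge_one h3t
  have t64 : (64:ℝ) ≤ t := by exact_mod_cast (show 64 ≤ t by omega)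
  have tpos : (0:ℝ) < t := by linarith
  have tone : (1:ℝ) ≤ t := by linarith
  set J := ⌈(t:ℝ) ^ (7 * ϑ / 2)⌉₊ with hJ
  have hJlow : (t:ℝ) ^ (7 * ϑ / 2) ≤ J := Nat.le_ceil _
  have hJone : (1:ℝ) ≤ (t:ℝ) ^ (7 * ϑ / 2) := Real.one_le_rpow tone (by linarith)
  have hJ1 : (t:ℝ) ^ (1.5:ℝ) ≤ J := le_trans (Real.rpow_le_rpow_of_exponent_le tone (by linarith)) hJlow
  have hJup : (J:ℝ) ≤ 2 * (t:ℝ) ^ (7 * ϑ / 2) := by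
    have := Nat.ceil_lt_add_one (show 0 ≤ (t:ℝ) ^ (7 * ϑ / 2) by positivity)
    linarith
  have hJ2 : (J:ℝ) ≤ 2 * (t:ℝ) ^ (1.625:ℝ) := by
    refine hJup.trans ?_
    gcongr
    norm_num; linarith
  have hJt : t ≤ J := by
    have : (t:ℝ) ≤ J := by
      refine le_trans ?_ hJ1
      calc (t:ℝ) = (t:ℝ) ^ (1:ℝ) := (Real.rpow_one _).symm
        _ ≤ _ := Real.rpow_le_rpow_of_exponent_le tone (by norm_num)
    exact_mod_cast this
  have hJpos : (0:ℝ) < J := by linarith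
  set 𝒥 := (Finset.Ioc J (8 * J)).filter Nat.Prime with h𝒥
  have hcnt := hT0 J (by omega)
  have hqe : ∀ j : ℕ, ⌊(j:ℝ) ^ (2:ℝ)⌋₊ = j ^ 2 := by
    intro j
    have : (j:ℝ) ^ (2:ℝ) = ((j ^ 2 : ℕ) : ℝ) := by push_cast; norm_cast
    rw [this, Nat.floor_natCast]
  have h8J : 1 ≤ Real.log (8 * J) := by
    have := log_ge_one (t := 8 * J) (by omega)
    push_cast at this; exact this
  have hlogJ : Real.log (8 * J) ≤ (t:ℝ) ^ (1 / 100 : ℝ) := by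
    have a1 : (8:ℝ) * J ≤ (t:ℝ) ^ (3:ℝ) := by
      calc (8:ℝ) * J ≤ 16 * (t:ℝ) ^ (1.625:ℝ) := by linarith
        _ ≤ (t:ℝ) ^ (1:ℝ) * (t:ℝ) ^ (1.625:ℝ) := by rw [Real.rpow_one]; gcongr; linarith
        _ = (t:ℝ) ^ (2.625:ℝ) := by rw [← Real.rpow_add tpos]; norm_num
        _ ≤ _ := Real.rpow_le_rpow_of_exponent_le tone (by norm_num)
    have a2 := Real.log_le_log (by positivity) a1
    rw [Real.log_rpow tpos] at a2
    have := hT3 t ht3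
    rw [pow_one] at this
    linarith
  have hcard : (J:ℝ) * (t:ℝ) ^ (-(1 / 100) : ℝ) ≤ 𝒥.card := by
    rw [Real.rpow_neg tpos.le, ← div_eq_mul_inv, div_le_iff₀ (by positivity)]
    exact hcnt.trans (by gcongr)
  have hne : 𝒥.Nonempty := by
    rw [← Finset.card_pos]
    have : (0:ℝ) < 𝒥.card := lt_of_lt_of_le (by positivity) hcard
    exact_mod_cast this
  refine ⟨𝒥, (J:ℝ) ^ 2, t, Real.log t ^ 10, 0, ⟨hne, ?_, ?_, ?_, ?_, le_rfl, le_rfl, ?_, le_rfl, ?_, ?_⟩, ?_⟩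
  · exact one_le_pow₀ (by linarith)
  · calc (J:ℝ) ^ 2 ≤ (2 * (t:ℝ) ^ (1.625:ℝ)) ^ 2 := by gcongr
      _ = 4 * (t:ℝ) ^ (3.25:ℝ) := by rw [mul_pow, ← Real.rpow_natCast ((t:ℝ) ^ (1.625:ℝ)), ← Real.rpow_mul tpos.le]; norm_num
      _ ≤ (t:ℝ) ^ (0.01:ℝ) * (t:ℝ) ^ (3.25:ℝ) := by
          gcongr
          have := hT2 t ht2
          rw [pow_zero, mul_one] at this
          norm_num at this ⊢
          linarith
      _ = (t:ℝ) ^ (3.26:ℝ) := by rw [← Real.rpow_add tpos]; norm_num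
      _ ≤ _ := Real.rpow_le_rpow_of_exponent_le tone (by norm_num)
  · intro j hj
    have := Finset.mem_Ioc.1 (Finset.mem_filter.1 hj).1
    simp only [hqe]
    push_cast
    have b1 : (J:ℝ) ≤ j := by exact_mod_cast this.1.le
    have b2 : (j:ℝ) ≤ 8 * J := by exact_mod_cast this.2
    constructor
    · gcongr
    · calc (j:ℝ) ^ 2 ≤ (8 * J) ^ 2 := by gcongr
        _ = _ := by ring
  · intro j hj p hp hpj
    simp only [hqe] at hpj
    have hj' := Finset.mem_filter.1 hj
    have := (Nat.prime_dvd_prime_iff_eq hp hj'.2).1 (hp.dvd_of_dvd_pow hpj)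
    rw [this]
    have b := (Finset.mem_Ioc.1 hj'.1).1
    have c : t ≤ j := by omega
    have := hT1 t ht1
    rw [one_mul, Real.rpow_one] at this
    exact this.trans (by exact_mod_cast c)
  · rw [zero_mul]; exact Real.sqrt_nonneg _
  · intro r hr2 hrt
    have : 𝒥.filter (fun j : ℕ => r ∣ ⌊(j:ℝ) ^ (2:ℝ)⌋₊) = ∅ := by
      rw [Finset.filter_eq_empty_iff]
      intro j hj hd
      rw [hqe] at hd
      have hj' := Finset.mem_filter.1 hj
      have b := (Finset.mem_Ioc.1 hj'.1).1
      have hp := Nat.minFac_prime (show r ≠ 1 by omega)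
      have := (Nat.prime_dvd_prime_iff_eq hp hj'.2).1 (hp.dvd_of_dvd_pow ((Nat.minFac_dvd r).trans hd))
      have := Nat.minFac_le (n := r) (by omega)
      omega
    rw [this]; simp
  · intro N hN1 hN2 j₀ hj₀ k hk0 hk hL
    simp only [hqe] at hk hL ⊢
    have hj' := Finset.mem_filter.1 hj₀
    have hj'' := Finset.mem_Ioc.1 hj'.1
    have hq0 : 0 < j₀ ^ 2 := by have := hj'.2.pos; positivity
    obtain ⟨hfr, hco⟩ := frac_reduce (k := k) hq0
    set r := j₀ ^ 2 / k.gcd (j₀ ^ 2) with hr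
    set b := k / k.gcd (j₀ ^ 2) with hb
    have hrd : r ∣ j₀ ^ 2 := Nat.div_dvd_of_dvd (Nat.gcd_dvd_right _ _)
    have hjr : j₀ ∣ r := by
      obtain ⟨i, hi, hri⟩ := (Nat.dvd_prime_pow hj'.2).1 hrd
      rw [hri]
      apply dvd_pow_self
      rintro rfl
      rw [pow_zero] at hri
      omega
    have hrJ : J ≤ r := by have := Nat.le_of_dvd (by omega) hjr; omega
    have hr64 : r ≤ 64 * J ^ 2 := by
      have a := Nat.le_of_dvd hq0 hrd
      have b := Nat.pow_le_pow_left hj''.2 2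
      have c : (8 * J) ^ 2 = 64 * J ^ 2 := by ring
      omega
    have hNpos : (0:ℝ) < N := lt_of_lt_of_le (by positivity) hN1
    set Bd := ⌈C * ((64 * J ^ 2 : ℕ) : ℝ) ^ (1 / 200 : ℝ)⌉₊ with hBd
    have hBdiv : ∀ n : ℕ, 0 < n → n ≤ 64 * J ^ 2 → n.divisors.card ≤ Bd := by
      intro n hn hnJ
      have a := hdiv n hn
      have : (n.divisors.card : ℝ) ≤ C * ((64 * J ^ 2 : ℕ) : ℝ) ^ (1 / 200 : ℝ) := a.trans (by gcongr)
      exact_mod_cast this.trans (Nat.le_ceil _)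
    have hBd1 : 1 ≤ Bd := Nat.one_le_iff_ne_zero.2 (Nat.ceil_pos.2 (by positivity)).ne'
    have hBdle : √(Bd:ℝ) ≤ (t:ℝ) ^ (2/100:ℝ) := by
      have a0 : ((64 * J ^ 2 : ℕ) : ℝ) ≤ (t:ℝ) ^ (4.75:ℝ) * 1 := by
        push_cast
        calc 64 * (J:ℝ) ^ 2 ≤ 64 * (2 * (t:ℝ) ^ (1.625:ℝ)) ^ 2 := by gcongr
          _ = 256 * (t:ℝ) ^ (3.25:ℝ) := by rw [mul_pow, ← Real.rpow_natCast ((t:ℝ) ^ (1.625:ℝ)), ← Real.rpow_mul tpos.le]; norm_num; ring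
          _ ≤ (t:ℝ) ^ (1.5:ℝ) * (t:ℝ) ^ (3.25:ℝ) := by
              gcongr
              calc (256:ℝ) ≤ (64:ℝ) ^ (1.5:ℝ) := by
                    rw [show (64:ℝ) = 4 ^ (3:ℝ) by norm_num, ← Real.rpow_mul (by norm_num)]
                    calc (256:ℝ) = 4 ^ (4:ℝ) := by norm_num
                      _ ≤ _ := Real.rpow_le_rpow_of_exponent_le (by norm_num) (by norm_num)
                _ ≤ _ := by gcongr
          _ = _ := by rw [← Real.rpow_add tpos, mul_one]; norm_num
      rw [mul_one] at a0
      have a1 : (Bd:ℝ) ≤ (C + 1) * (t:ℝ) ^ (2.375/100:ℝ) := by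
        have b1 := Nat.ceil_lt_add_one (show 0 ≤ C * ((64 * J ^ 2 : ℕ) : ℝ) ^ (1 / 200 : ℝ) by positivity)
        have b2 : ((64 * J ^ 2 : ℕ) : ℝ) ^ (1 / 200 : ℝ) ≤ (t:ℝ) ^ (2.375/100:ℝ) := by
          refine (Real.rpow_le_rpow (by positivity) a0 (by norm_num)).trans (le_of_eq ?_)
          rw [← Real.rpow_mul tpos.le]; norm_num
        have b3 : 1 ≤ (t:ℝ) ^ (2.375/100:ℝ) := Real.one_le_rpow tone (by norm_num)
        have b4 : (Bd:ℝ) < C * ((64 * J ^ 2 : ℕ) : ℝ) ^ (1 / 200 : ℝ) + 1 := b1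
        nlinarith
      have a2 := hT2 t ht2
      rw [pow_zero, mul_one] at a2
      rw [Real.sqrt_le_left (by positivity)]
      calc (Bd:ℝ) ≤ (C + 1) * (t:ℝ) ^ (2.375/100:ℝ) := a1
        _ ≤ (t:ℝ) ^ (1/100:ℝ) * (t:ℝ) ^ (2.375/100:ℝ) := by gcongr; linarith
        _ = (t:ℝ) ^ (3.375/100:ℝ) := by rw [← Real.rpow_add tpos]; norm_num
        _ ≤ (t:ℝ) ^ (4/100:ℝ) := Real.rpow_le_rpow_of_exponent_le tone (by norm_num)
        _ = _ := by rw [← Real.rpow_natCast ((t:ℝ) ^ (2/100:ℝ)), ← Real.rpow_mul tpos.le]; norm_num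
    have hlay := layer 𝒥 (fun j => N * nd (((j ^ 2 : ℕ) : ℝ) * (k / ((j₀ ^ 2 : ℕ):ℝ))) / (J:ℝ) ^ 2)
      (fun j _ => by have := nd_nonneg (((j ^ 2 : ℕ) : ℝ) * (k / ((j₀ ^ 2 : ℕ):ℝ))); positivity)
      (√Bd * (36 * √((J:ℝ) ^ 2 / N) * J)) (√Bd * (12 * √J)) (by positivity)
      (by have : (0:ℝ) < Bd := by exact_mod_cast hBd1
          have := Real.sqrt_pos.2 this
          have := Real.sqrt_pos.2 hJpos
          positivity) (by
        intro i
        have := K_sq' (J := J) (by omega) (𝒥.filter (fun j => N * nd (((j ^ 2 : ℕ) : ℝ) * (k / ((j₀ ^ 2 : ℕ):ℝ))) / (J:ℝ) ^ 2 ≤ 2 ^ i))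
          ((Finset.filter_subset _ _).trans (Finset.filter_subset _ _)) hrJ hr64 hco (Δ := 2 ^ i * ((J:ℝ) ^ 2 / N)) (by positivity)
          (by
            intro j hj
            have h := (Finset.mem_filter.1 hj).2
            rw [hfr] at h
            push_cast at h ⊢
            rw [div_le_iff₀ (by positivity)] at h
            have e : (2:ℝ) ^ i * ((J:ℝ) ^ 2 / N) = 2 ^ i * (J:ℝ) ^ 2 / N := by ring
            rw [e, le_div_iff₀ hNpos]
            linarith) Bd hBd1 hBdiv
        refine this.trans ?_
        rw [Real.sqrt_mul (by positivity)]
        have hs2 : √((2:ℝ) ^ i) ≤ 2 ^ i := by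
          rw [Real.sqrt_le_left (by positivity)]
          exact le_self_pow₀ (one_le_pow₀ (by norm_num)) (by norm_num)
        calc √Bd * (36 * (√((2:ℝ) ^ i) * √((J:ℝ) ^ 2 / N)) * J + 12 * √J) ≤ √Bd * (36 * ((2:ℝ) ^ i * √((J:ℝ) ^ 2 / N)) * J + 12 * √J) := by gcongr
          _ = _ := by ring)
    refine hlay.trans ?_
    obtain ⟨n1, n2⟩ := sq_num (t := t) (J := J) (N := N) tone hJ1 hJ2 hN1 (by exact_mod_cast hN2)
    set m := min 1 ((t:ℝ) ^ 7 / (N * (J:ℝ) ^ 2)) with hm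
    have hm0 : 0 ≤ m := le_min zero_le_one (by positivity)
    have hsJ : √(J:ℝ) = J * (1 / √J) := by
      have := Real.mul_self_sqrt hJpos.le
      have h0 := Real.sqrt_pos.2 hJpos
      field_simp
      linarith
    have a2 := hT2 t ht2
    rw [pow_zero, mul_one] at a2
    have a2' : (8 * 36 * 12 * 2 : ℝ) ≤ (t:ℝ) ^ (1 / 100:ℝ) := by nlinarith
    calc 8 * (√Bd * (36 * √((J:ℝ) ^ 2 / N) * J) + √Bd * (12 * √J))
        = 8 * √Bd * J * (36 * √((J:ℝ) ^ 2 / N) + 12 * (1 / √J)) := by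
          have hk2 : √(Bd:ℝ) * (12 * √(J:ℝ)) = √(Bd:ℝ) * (12 * (J * (1 / √(J:ℝ)))) := by rw [← hsJ]
          rw [hk2]; ring
      _ ≤ 8 * (t:ℝ) ^ (2/100:ℝ) * J * (36 * (12 * t ^ (-(1/8) : ℝ) * m) + 12 * (8 * t ^ (-(1/2) : ℝ) * m)) := by gcongr
      _ ≤ 8 * (t:ℝ) ^ (2/100:ℝ) * J * (36 * (12 * t ^ (-(1/8) : ℝ) * m) + 12 * (8 * t ^ (-(1/8) : ℝ) * m)) := by
          gcongr <;> norm_num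
      _ = (8 * (36 * 12 + 12 * 8)) * ((t:ℝ) ^ (2/100:ℝ) * t ^ (-(1/8) : ℝ)) * (J * m) := by ring
      _ ≤ (t:ℝ) ^ (1 / 100:ℝ) * ((t:ℝ) ^ (2/100:ℝ) * t ^ (-(1/8) : ℝ)) * (J * m) := by gcongr; linarith
      _ = (t:ℝ) ^ (-(9.5/100):ℝ) * (J * m) := by rw [← Real.rpow_add tpos, ← Real.rpow_add tpos]; norm_num
      _ ≤ (t:ℝ) ^ (-(3/100):ℝ) * (J * m) := by
          gcongr <;> norm_num
      _ = (J * (t:ℝ) ^ (-(1 / 100) : ℝ)) * (t:ℝ) ^ (-(1 / 50):ℝ) * m := by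
          rw [mul_assoc (J:ℝ), ← Real.rpow_add tpos]; norm_num; ring
      _ ≤ _ := by gcongr
  · calc (t:ℝ) ^ (7 * ϑ) = ((t:ℝ) ^ (7 * ϑ / 2)) ^ 2 := by rw [← Real.rpow_natCast, ← Real.rpow_mul tpos.le]; congr 1; push_cast; ring
      _ ≤ _ := by gcongr

/-- truncated inclusion-exclusion sum -/
noncomputable def TB (k : ℕ) (P : Finset ℕ) (x : ℕ → ℝ) : ℝ :=
  ∑ D ∈ P.powerset, if D.card < k then (-1) ^ D.card * ∏ p ∈ D, x p else 0

lemma TB_zero (P : Finset ℕ) (x : ℕ → ℝ) : TB 0 P x = 0 := by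
  unfold TB; simp

lemma TB_insert (k : ℕ) {P : Finset ℕ} {p : ℕ} (hp : p ∉ P) (x : ℕ → ℝ) :
    TB (k + 1) (insert p P) x = TB (k + 1) P x - x p * TB k P x := by
  unfold TB
  rw [Finset.sum_powerset_insert hp, Finset.mul_sum, sub_eq_add_neg, ← Finset.sum_neg_distrib]
  congr 1
  apply Finset.sum_congr rfl
  intro D hD
  have hpD : p ∉ D := fun h => hp (Finset.mem_powerset.1 hD h)
  rw [Finset.card_insert_of_notMem hpD, Finset.prod_insert hpD]
  by_cases h : D.card < k
  · rw [if_pos h, if_pos (by omega)]; ring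
  · rw [if_neg h, if_neg (by omega)]; ring

lemma TB_bound (lam : ℝ) (hlam : 1 ≤ lam) (x : ℕ → ℝ) (P : Finset ℕ) (hx0 : ∀ p ∈ P, 0 ≤ x p) (hx1 : ∀ p ∈ P, x p ≤ 1) :
    ∀ k : ℕ, 0 ≤ (-1) ^ (k + 1) * (TB k P x - ∏ p ∈ P, (1 - x p)) ∧
      (-1) ^ (k + 1) * (TB k P x - ∏ p ∈ P, (1 - x p)) ≤ (1 / lam) ^ k * ∏ p ∈ P, (1 + lam * x p) := by
  induction P using Finset.induction_on with
  | empty =>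
    intro k
    cases k with
    | zero => simp [TB_zero]
    | succ k =>
      simp [TB]
      positivity
  | insert p P hp ih =>
    have ih' := ih (fun q hq => hx0 q (Finset.mem_insert_of_mem hq)) (fun q hq => hx1 q (Finset.mem_insert_of_mem hq))
    have h0 := hx0 p (Finset.mem_insert_self _ _)
    have h1 := hx1 p (Finset.mem_insert_self _ _)
    intro k
    cases k with
    | zero =>
      rw [TB_zero]
      have a : 0 ≤ ∏ q ∈ insert p P, (1 - x q) := Finset.prod_nonneg fun q hq => by linarith [hx1 q hq]
      have b : ∏ q ∈ insert p P, (1 - x q) ≤ ∏ q ∈ insert p P, (1 + lam * x q) :=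
        Finset.prod_le_prod (fun q hq => by linarith [hx1 q hq]) fun q hq => by nlinarith [hx0 q hq]
      constructor
      · norm_num; exact a
      · norm_num; exact b
    | succ k =>
      rw [TB_insert k hp, Finset.prod_insert hp, Finset.prod_insert hp]
      obtain ⟨a1, a2⟩ := ih' (k + 1)
      obtain ⟨b1, b2⟩ := ih' k
      set Pi0 := ∏ q ∈ P, (1 - x q)
      set M := ∏ q ∈ P, (1 + lam * x q)
      have e : (-1:ℝ) ^ (k + 1 + 1) * (TB (k + 1) P x - x p * TB k P x - (1 - x p) * Pi0)
          = (-1) ^ (k + 1 + 1) * (TB (k + 1) P x - Pi0) + x p * ((-1) ^ (k + 1) * (TB k P x - Pi0)) := by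
        rw [pow_succ _ (k + 1)]; ring
      have e2 : (1 / lam) ^ (k + 1) * ((1 + lam * x p) * M) = (1 / lam) ^ (k + 1) * M + x p * ((1 / lam) ^ k * M) := by
        rw [pow_succ]; field_simp
      rw [e, e2]
      exact ⟨by positivity, by gcongr⟩

/-- pure sieve -/
lemma pure_sieve (S : Finset ℕ) (w : ℕ → ℝ) (hw : ∀ j ∈ S, 0 ≤ w j) (q : ℕ → ℕ) (P : Finset ℕ) (hP : ∀ p ∈ P, p.Prime)
    (k : ℕ) (hk : Even k) (X R : ℝ) (hX : 0 ≤ X) (hR : ∀ D ⊆ P, D.card < k →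
      |∑ j ∈ S.filter (fun j => (∏ p ∈ D, p) ∣ q j), w j - X * ∏ p ∈ D, (1 / (p:ℝ))| ≤ R) (hR0 : 0 ≤ R)
    (lam : ℝ) (hlam : 1 ≤ lam) (y : ℝ) (hy : 1 ≤ y) (hyP : P.card ≤ y) :
    X * (∏ p ∈ P, (1 - 1 / (p:ℝ)) - (1 / lam) ^ k * ∏ p ∈ P, (1 + lam * (1 / (p:ℝ)))) - R * (y ^ k * 3)
      ≤ ∑ j ∈ S.filter (fun j => ∀ p ∈ P, ¬ p ∣ q j), w j := by
  have key : ∑ j ∈ S, w j * TB k P (fun p => if p ∣ q j then 1 else 0) ≤ ∑ j ∈ S.filter (fun j => ∀ p ∈ P, ¬ p ∣ q j), w j := by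
    rw [Finset.sum_filter]
    apply Finset.sum_le_sum
    intro j hj
    obtain ⟨a, -⟩ := TB_bound lam hlam (fun p => if p ∣ q j then (1:ℝ) else 0) P (fun p _ => by split_ifs <;> norm_num) (fun p _ => by split_ifs <;> norm_num) k
    rw [hk.add_one.neg_one_pow] at a
    have hle : TB k P (fun p => if p ∣ q j then 1 else 0) ≤ ∏ p ∈ P, (1 - if p ∣ q j then (1:ℝ) else 0) := by linarith
    have hprod : ∏ p ∈ P, (1 - if p ∣ q j then (1:ℝ) else 0) = if ∀ p ∈ P, ¬ p ∣ q j then 1 else 0 := by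
      split_ifs with h
      · exact Finset.prod_eq_one fun p hp => by simp [h p hp]
      · push Not at h
        obtain ⟨p, hp, hd⟩ := h
        exact Finset.prod_eq_zero hp (by simp [hd])
    rw [hprod] at hle
    have := mul_le_mul_of_nonneg_left hle (hw j hj)
    refine this.trans (le_of_eq ?_)
    split_ifs <;> simp
  refine le_trans ?_ key
  have e1 : ∑ j ∈ S, w j * TB k P (fun p => if p ∣ q j then 1 else 0)
      = ∑ D ∈ P.powerset, if D.card < k then (-1) ^ D.card * ∑ j ∈ S.filter (fun j => (∏ p ∈ D, p) ∣ q j), w j else 0 := by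
    unfold TB
    simp_rw [Finset.mul_sum]
    rw [Finset.sum_comm]
    apply Finset.sum_congr rfl
    intro D hD
    by_cases h : D.card < k
    · simp only [if_pos h]
      rw [Finset.sum_filter]
      apply Finset.sum_congr rfl
      intro j hj
      have : ∏ p ∈ D, (if p ∣ q j then (1:ℝ) else 0) = if (∏ p ∈ D, p) ∣ q j then 1 else 0 := by
        split_ifs with h
        · exact Finset.prod_eq_one fun p hp => by simp [(Finset.dvd_prod_of_mem _ hp).trans h]
        · by_contra hne
          apply h
          have hall : ∀ p ∈ D, p ∣ q j := by
            intro p hp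
            by_contra hpn
            exact hne (Finset.prod_eq_zero hp (by simp [hpn]))
          apply Finset.prod_primes_dvd
          · intro p hp; exact (hP p (Finset.mem_powerset.1 hD hp)).prime
          · exact hall
      rw [this]
      split_ifs <;> ring
    · simp [if_neg h]
  have e2 : X * TB k P (fun p => 1 / (p:ℝ)) - R * (y ^ k * 3) ≤ ∑ j ∈ S, w j * TB k P (fun p => if p ∣ q j then 1 else 0) := by
    rw [e1]
    unfold TB
    rw [Finset.mul_sum, sub_le_iff_le_add]
    have hcount : ∑ D ∈ P.powerset, (if D.card < k then (1:ℝ) else 0) ≤ y ^ k * 3 := by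
      calc ∑ D ∈ P.powerset, (if D.card < k then (1:ℝ) else 0) ≤ ∑ D ∈ P.powerset, y ^ k * (1 / y) ^ D.card := by
            apply Finset.sum_le_sum
            intro D _
            split_ifs with h
            · rw [one_div, inv_pow, ← div_eq_mul_inv, le_div_iff₀ (by positivity), one_mul]
              exact pow_le_pow_right₀ hy h.le
            · positivity
        _ = y ^ k * (1 + 1 / y) ^ P.card := by
            rw [← Finset.mul_sum]
            congr 1
            have := Finset.prod_add (fun _ : ℕ => 1 / y) (fun _ => (1:ℝ)) P
            simp only [Finset.prod_const, one_pow, mul_one] at this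
            rw [← this]; ring
        _ ≤ y ^ k * 3 := by
            gcongr
            calc (1 + 1 / y) ^ P.card ≤ (Real.exp (1 / y)) ^ P.card := by
                  gcongr; linarith [Real.add_one_le_exp (1 / y)]
              _ = Real.exp (P.card * (1 / y)) := by rw [← Real.exp_nat_mul]
              _ ≤ Real.exp 1 := by
                  apply Real.exp_le_exp.2
                  rw [mul_one_div, div_le_one (by linarith)]; exact hyP
              _ ≤ 3 := by linarith [Real.exp_one_lt_d9]
    have : ∑ D ∈ P.powerset, X * (if D.card < k then (-1) ^ D.card * ∏ p ∈ D, (1 / (p:ℝ)) else 0)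
        ≤ ∑ D ∈ P.powerset, ((if D.card < k then (-1) ^ D.card * ∑ j ∈ S.filter (fun j => (∏ p ∈ D, p) ∣ q j), w j else 0) + R * (if D.card < k then (1:ℝ) else 0)) := by
      apply Finset.sum_le_sum
      intro D hD
      split_ifs with h
      · have hr := hR D (Finset.mem_powerset.1 hD) h
        rw [abs_le] at hr
        rcases neg_one_pow_eq_or ℝ D.card with h' | h' <;> rw [h'] <;> linarith
      · simp
    refine this.trans ?_
    rw [Finset.sum_add_distrib, ← Finset.mul_sum]
    gcongr
  refine le_trans ?_ e2
  have hp1 : ∀ p ∈ P, 1 / (p:ℝ) ≤ 1 := fun p hp => by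
    rw [div_le_one (by exact_mod_cast (hP p hp).pos)]; exact_mod_cast (hP p hp).one_le
  obtain ⟨-, b⟩ := TB_bound lam hlam (fun p => 1 / (p:ℝ)) P (fun p _ => by positivity) hp1 k
  rw [hk.add_one.neg_one_pow] at b
  have : ∏ p ∈ P, (1 - 1 / (p:ℝ)) - (1 / lam) ^ k * ∏ p ∈ P, (1 + lam * (1 / (p:ℝ))) ≤ TB k P (fun p => 1 / (p:ℝ)) := by linarith
  have := mul_le_mul_of_nonneg_left this hX
  linarith

lemma cos_series {x : ℝ} (h0 : 0 ≤ x) (h1 : x ≤ 1) :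
    HasSum (fun n : ℕ => 1 / (n : ℝ) ^ 2 * Real.cos (2 * Real.pi * n * x)) (Real.pi ^ 2 * (x ^ 2 - x + 1 / 6)) := by
  have := hasSum_one_div_nat_pow_mul_cos (k := 1) one_ne_zero (x := x) ⟨h0, h1⟩
  have hB : (Polynomial.map (algebraMap ℚ ℝ) (Polynomial.bernoulli (2 * 1))).eval x = x ^ 2 - x + 1 / 6 := by
    simp [Polynomial.bernoulli, Finset.sum_range_succ, bernoulli_two, bernoulli_one, Polynomial.eval_monomial, Nat.choose]
    ring
  rw [hB] at this
  have e2 : Real.pi ^ 2 * (x ^ 2 - x + 1 / 6) = (-1) ^ (1 + 1) * (2 * Real.pi) ^ (2 * 1) / 2 / ((2 * 1).factorial : ℝ) * (x ^ 2 - x + 1 / 6) := by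
    have hf : ((2 * 1).factorial : ℝ) = 2 := by norm_num [Nat.factorial]
    rw [hf]
    ring
  rw [e2]
  exact this

/-- Fourier coefficient of the hat function -/
noncomputable def hc (δ : ℝ) (n : ℕ) : ℝ := 1 / Real.pi ^ 2 * (1 / (n:ℝ) ^ 2 * (1 - Real.cos (2 * Real.pi * n * δ)))

lemma hc_nonneg (δ : ℝ) (n : ℕ) : 0 ≤ hc δ n := by
  unfold hc
  have := Real.cos_le_one (2 * Real.pi * n * δ)
  have : 0 ≤ 1 - Real.cos (2 * Real.pi * n * δ) := by linarith
  positivity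

lemma hc_le (δ : ℝ) (n : ℕ) : hc δ n ≤ 1 / (n:ℝ) ^ 2 := by
  unfold hc
  have h := Real.neg_one_le_cos (2 * Real.pi * n * δ)
  have hpi := Real.pi_gt_three
  have h2 : 1 / Real.pi ^ 2 ≤ 1 / 2 := by
    apply one_div_le_one_div_of_le (by norm_num); nlinarith
  have hn : 0 ≤ 1 / (n:ℝ) ^ 2 := by positivity
  calc _ ≤ 1 / 2 * (1 / (n:ℝ) ^ 2 * 2) := by
        gcongr
        · exact mul_nonneg hn (by linarith [Real.cos_le_one (2 * Real.pi * n * δ)])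
        · linarith
    _ = _ := by ring

lemma cos_nd (n : ℕ) (y : ℝ) : Real.cos (2 * Real.pi * n * nd y) = Real.cos (2 * Real.pi * n * y) := by
  unfold nd
  have h1 : Real.cos (2 * Real.pi * n * |y - round y|) = Real.cos (2 * Real.pi * n * (y - round y)) := by
    rcases abs_choice (y - round y) with h | h <;> rw [h]
    rw [mul_neg, Real.cos_neg]
  rw [h1]
  have : 2 * Real.pi * n * (y - round y) = 2 * Real.pi * n * y - ((n * round y : ℤ) : ℝ) * (2 * Real.pi) := by
    push_cast; ring
  rw [this, Real.cos_sub_int_mul_two_pi]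

lemma hat_series {δ : ℝ} (h0 : 0 < δ) (h1 : δ ≤ 1 / 2) (y : ℝ) :
    HasSum (fun n : ℕ => hc δ n * Real.cos (2 * Real.pi * n * y)) (max (δ - nd y) 0 - δ ^ 2) := by
  set v := nd y with hv
  have v0 : 0 ≤ v := nd_nonneg y
  have v1 : v ≤ 1 / 2 := nd_le_half y
  have s1 := cos_series (x := v) v0 (by linarith)
  have s2 := cos_series (x := v + δ) (by linarith) (by linarith)
  have s3 := cos_series (x := |v - δ|) (abs_nonneg _) (by rw [abs_le]; constructor <;> linarith)
  have s := ((s1.sub (s2.mul_left (1/2))).sub (s3.mul_left (1/2))).mul_left (1 / Real.pi ^ 2)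
  have e1 : (fun n : ℕ => hc δ n * Real.cos (2 * Real.pi * n * y)) = (fun i : ℕ =>
      1 / Real.pi ^ 2 *
        (1 / (i:ℝ) ^ 2 * Real.cos (2 * Real.pi * i * v) - 1 / 2 * (1 / (i:ℝ) ^ 2 * Real.cos (2 * Real.pi * i * (v + δ))) -
          1 / 2 * (1 / (i:ℝ) ^ 2 * Real.cos (2 * Real.pi * i * |v - δ|)))) := by
    funext n
    rw [← cos_nd n y, ← hv]
    have e3 : Real.cos (2 * Real.pi * n * |v - δ|) = Real.cos (2 * Real.pi * n * v - 2 * Real.pi * n * δ) := by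
      rcases abs_choice (v - δ) with h | h <;> rw [h]
      · ring_nf
      · rw [← Real.cos_neg]; ring_nf
    rw [e3, mul_add, Real.cos_add, Real.cos_sub]
    unfold hc
    ring
  have e2 : max (δ - v) 0 - δ ^ 2 = 1 / Real.pi ^ 2 *
      (Real.pi ^ 2 * (v ^ 2 - v + 1 / 6) - 1 / 2 * (Real.pi ^ 2 * ((v + δ) ^ 2 - (v + δ) + 1 / 6)) -
        1 / 2 * (Real.pi ^ 2 * (|v - δ| ^ 2 - |v - δ| + 1 / 6))) := by
    have hpi := Real.pi_pos.ne'
    rw [sq_abs]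
    rcases le_total v δ with h | h
    · rw [max_eq_left (by linarith), abs_of_nonpos (by linarith)]
      field_simp; ring
    · rw [max_eq_right (by linarith), abs_of_nonneg (by linarith)]
      field_simp; ring
  rw [e1, e2]
  exact s

lemma ES_triv (α θ : ℝ) (J : ℕ) : ‖ES α θ J‖ ≤ J := by
  unfold ES
  refine (norm_sum_le _ _).trans ?_
  simp [norm_e]

/-- equidistribution of `j^α/d` in smooth form -/
lemma hat_equi {α : ℝ} (hα : 1 < α) (hα' : α < 9 / 4) (h2 : α ≠ 2) :
    ∃ C η : ℝ, 0 < C ∧ 0 < η ∧ ∀ (J d : ℕ) (δ b : ℝ), 1 ≤ J → 1 ≤ d → 0 < δ → δ ≤ 1 / 2 →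
      |∑ n ∈ Finset.range J, max (δ - nd (((J + n : ℕ) : ℝ) ^ α / d - b)) 0 - J * δ ^ 2| ≤ C * d * (J:ℝ) ^ (1 - η) := by
  obtain ⟨C, hC, hE⟩ := ES_bound (σ := 1/10) (ε := 1/10) hα hα' h2 (by norm_num) (by norm_num) (by linarith)
  have sum2 : Summable (fun n : ℕ => 1 / (n:ℝ) ^ 2) := Real.summable_one_div_nat_pow.2 (by norm_num)
  have sum3 : Summable (fun n : ℕ => 1 / (n:ℝ) ^ (3/2:ℝ)) := Real.summable_one_div_nat_rpow.2 (by norm_num)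
  set Z2 := ∑' n : ℕ, 1 / (n:ℝ) ^ 2
  set Z3 := ∑' n : ℕ, 1 / (n:ℝ) ^ (3/2:ℝ)
  have Z20 : 0 ≤ Z2 := tsum_nonneg fun n => by positivity
  have Z30 : 0 ≤ Z3 := tsum_nonneg fun n => by positivity
  refine ⟨Z2 * (C * 2) + Z3 + 1, min (1/20) (α - 1), by positivity, lt_min (by norm_num) (by linarith), fun J d δ b hJ hd hδ hδ' => ?_⟩
  set η := min (1/20) (α - 1)
  have hη1 : η ≤ 1/20 := min_le_left _ _
  have hη2 : η ≤ α - 1 := min_le_right _ _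
  have J1 : (1:ℝ) ≤ J := by exact_mod_cast hJ
  have J0 : (0:ℝ) < J := by linarith
  have d1 : (1:ℝ) ≤ d := by exact_mod_cast hd
  have d0 : (0:ℝ) < d := by linarith
  have hs := hasSum_sum (s := Finset.range J) (fun n _ => hat_series hδ hδ' (((J + n : ℕ) : ℝ) ^ α / d - b))
  have hE' : ∑ n ∈ Finset.range J, max (δ - nd (((J + n : ℕ) : ℝ) ^ α / d - b)) 0 - J * δ ^ 2
      = ∑ n ∈ Finset.range J, (max (δ - nd (((J + n : ℕ) : ℝ) ^ α / d - b)) 0 - δ ^ 2) := by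
    rw [Finset.sum_sub_distrib]; simp
  rw [hE', ← hs.tsum_eq, ← Real.norm_eq_abs]
  set X := (J:ℝ) ^ (1 - η)
  have X0 : 0 < X := by positivity
  have hb1 : HasSum (fun n : ℕ => 1 / (n:ℝ) ^ 2 * (C * 2 * d * X) + 1 / (n:ℝ) ^ (3/2:ℝ) * (d * X)) (Z2 * (C * 2 * d * X) + Z3 * (d * X)) :=
    (sum2.hasSum.mul_right _).add (sum3.hasSum.mul_right _)
  refine (tsum_of_norm_bounded hb1 ?_).trans ?_
  · intro m
    rcases Nat.eq_zero_or_pos m with rfl | hm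
    · simp [hc]
    have m1 : (1:ℝ) ≤ m := by exact_mod_cast hm
    have m0 : (0:ℝ) < m := by linarith
    rw [← Finset.mul_sum]
    have hre : ∑ n ∈ Finset.range J, Real.cos (2 * Real.pi * m * (((J + n : ℕ) : ℝ) ^ α / d - b)) = (ES α (m / d) J * e (-(m * b))).re := by
      unfold ES
      rw [Finset.sum_mul, Complex.re_sum]
      apply Finset.sum_congr rfl
      intro n _
      rw [← e_add, e_re]
      congr 1; ring
    have hle : |(ES α (m / d) J * e (-(m * b))).re| ≤ ‖ES α (m / d) J‖ := by
      refine (Complex.abs_re_le_norm _).trans ?_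
      rw [norm_mul, norm_e, mul_one]
    have hES : ‖ES α (m / d) J‖ ≤ C * 2 * d * X + (m:ℝ) ^ (1/2:ℝ) * (d * X) := by
      by_cases hcase : (m:ℝ) / d ≤ (J:ℝ) ^ (1/10:ℝ)
      · refine (hE J (m / d) hJ (by positivity) hcase).trans ?_
        have a1 : (J:ℝ) ^ (1 - α) / (m / d) ≤ d * X := by
          rw [div_div_eq_mul_div, div_le_iff₀ m0]
          calc (J:ℝ) ^ (1 - α) * d ≤ 1 * d := by gcongr; exact Real.rpow_le_one_of_one_le_of_nonpos J1 (by linarith)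
            _ ≤ d * X * m := by
              have : 1 ≤ X := Real.one_le_rpow J1 (by linarith)
              have : 1 ≤ X * m := one_le_mul_of_one_le_of_one_le this m1
              nlinarith
        have a2 : (J:ℝ) ^ (1 - 1/10:ℝ) ≤ d * X := by
          calc (J:ℝ) ^ (1 - 1/10:ℝ) ≤ 1 * X := by
                rw [one_mul]; exact Real.rpow_le_rpow_of_exponent_le J1 (by linarith)
            _ ≤ _ := by gcongr
        have : 0 ≤ (m:ℝ) ^ (1/2:ℝ) * (d * X) := by positivity
        nlinarith
      · push Not at hcase
        refine (ES_triv _ _ _).trans ?_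
        have a3 : (J:ℝ) ^ (1/10:ℝ) ≤ m := by
          refine hcase.le.trans (div_le_self m0.le d1)
        have a4 : (J:ℝ) ^ (1/20:ℝ) ≤ (m:ℝ) ^ (1/2:ℝ) := by
          calc (J:ℝ) ^ (1/20:ℝ) = ((J:ℝ) ^ (1/10:ℝ)) ^ (1/2:ℝ) := by rw [← Real.rpow_mul J0.le]; norm_num
            _ ≤ _ := by gcongr
        have a5 : (J:ℝ) ≤ (m:ℝ) ^ (1/2:ℝ) * X := by
          calc (J:ℝ) = (J:ℝ) ^ (1:ℝ) := (Real.rpow_one _).symm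
            _ ≤ (J:ℝ) ^ (1/20 + (1 - η):ℝ) := Real.rpow_le_rpow_of_exponent_le J1 (by linarith)
            _ = (J:ℝ) ^ (1/20:ℝ) * X := Real.rpow_add J0 _ _
            _ ≤ _ := by gcongr
        have a6 : (m:ℝ) ^ (1/2:ℝ) * X ≤ (m:ℝ) ^ (1/2:ℝ) * (d * X) := by
          gcongr; nlinarith
        have : 0 ≤ C * 2 * d * X := by positivity
        linarith
    rw [hre, Real.norm_eq_abs, abs_mul, abs_of_nonneg (hc_nonneg _ _)]
    calc hc δ m * |(ES α (m / d) J * e (-(m * b))).re| ≤ 1 / (m:ℝ) ^ 2 * (C * 2 * d * X + (m:ℝ) ^ (1/2:ℝ) * (d * X)) := by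
          gcongr
          · exact hc_le _ _
          · exact hle.trans hES
      _ = _ := by
          have : 1 / (m:ℝ) ^ 2 * (m:ℝ) ^ (1/2:ℝ) = 1 / (m:ℝ) ^ (3/2:ℝ) := by
            rw [← Real.rpow_natCast, one_div ((m:ℝ) ^ _), one_div ((m:ℝ) ^ _), ← Real.rpow_neg m0.le, ← Real.rpow_neg m0.le, ← Real.rpow_add m0]; norm_num
          rw [mul_add, ← mul_assoc _ ((m:ℝ) ^ (1/2:ℝ)), this]
  · have : 0 ≤ (d:ℝ) * X := by positivity
    nlinarith

lemma nd_eq_abs {w : ℝ} (h : |w| ≤ 1 / 2) : nd w = |w| := by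
  apply le_antisymm
  · have := nd_le w 0; simpa using this
  · unfold nd
    by_cases hr : round w = 0
    · rw [hr]; simp
    · have h1 : (1:ℝ) ≤ |(round w : ℝ)| := by exact_mod_cast Int.one_le_abs hr
      have := abs_sub_abs_le_abs_sub (round w : ℝ) w
      rw [abs_sub_comm] at this
      linarith

lemma nd_ge {w : ℝ} (h0 : 0 ≤ w) (h1 : w ≤ 1) : min w (1 - w) ≤ nd w := by
  rcases le_total w (1/2) with h | h
  · rw [nd_eq_abs (by rw [abs_of_nonneg h0]; exact h), abs_of_nonneg h0]
    exact min_le_left _ _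
  · have : nd w = nd (w - 1) := by
      have := nd_add_int (w - 1) 1
      rw [← this]; congr 1; push_cast; ring
    rw [this, nd_eq_abs (by rw [abs_of_nonpos (by linarith)]; linarith), abs_of_nonpos (by linarith)]
    refine (min_le_right _ _).trans (by linarith)

/-- smooth weight supported on `{y} < 1/8` -/
noncomputable def wt (y : ℝ) : ℝ := 16 * max (1 / 16 - |Int.fract y - 1 / 16|) 0

lemma wt_nonneg (y : ℝ) : 0 ≤ wt y := by unfold wt; positivity

lemma wt_le (y : ℝ) : wt y ≤ 1 := by
  unfold wt
  have : max (1 / 16 - |Int.fract y - 1 / 16|) 0 ≤ 1 / 16 := max_le (by linarith [abs_nonneg (Int.fract y - 1 / 16)]) (by norm_num)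
  linarith

lemma wt_supp {y : ℝ} (h : 1 / 8 ≤ Int.fract y) : wt y = 0 := by
  unfold wt
  rw [max_eq_right, mul_zero]
  rw [abs_of_nonneg (by linarith)]; linarith

lemma wt_dvd {y : ℝ} (hy : 0 ≤ y) {d : ℕ} (hd : 1 ≤ d) :
    16 * d * max (1 / (16 * d) - nd (y / d - 1 / (16 * d))) 0 = if d ∣ ⌊y⌋₊ then wt y else 0 := by
  have d1 : (1:ℝ) ≤ d := by exact_mod_cast hd
  have d0 : (0:ℝ) < d := by linarith
  have hf0 := Int.fract_nonneg y
  have hf1 := Int.fract_lt_one y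
  set f := Int.fract y with hf
  set q := ⌊y⌋₊ with hq
  have hyq : y = q + f := by
    have h := Int.floor_add_fract y
    rw [← Int.natCast_floor_eq_floor hy] at h
    push_cast at h
    linarith
  obtain ⟨m, r, hr, hqm⟩ : ∃ m r : ℕ, r < d ∧ q = d * m + r := ⟨q / d, q % d, Nat.mod_lt _ hd, (Nat.div_add_mod q d).symm⟩
  set δ := 1 / (16 * (d:ℝ)) with hδ
  have hdδ : d * δ = 1 / 16 := by rw [hδ]; field_simp
  have hδ0 : 0 < δ := by positivity
  have hnd : nd (y / d - δ) = nd ((r + f) / d - δ) := by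
    have : y / d - δ = ((r + f) / d - δ) + ((m:ℤ):ℝ) := by
      rw [hyq, hqm]; push_cast; field_simp; ring
    rw [this, nd_add_int]
  rw [hnd]
  by_cases hr0 : r = 0
  · rw [if_pos (by rw [hqm, hr0]; simp)]
    rw [hr0]
    unfold wt
    rw [← hf]
    set w := ((0:ℕ) + f) / d - δ with hw
    have hdw : d * w = f - 1 / 16 := by
      rw [hw, mul_sub, hdδ]; push_cast; field_simp; ring
    by_cases hwh : |w| ≤ 1 / 2
    · rw [nd_eq_abs hwh, ← hdw, abs_mul, abs_of_pos d0, ← hdδ, ← mul_sub, mul_assoc, mul_max_of_nonneg _ _ d0.le, mul_zero]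
    · push Not at hwh
      have hw1 : 1 / 2 < w := by
        by_contra hcon
        push Not at hcon
        rw [lt_abs] at hwh
        rcases hwh with h | h
        · linarith
        · nlinarith
      have hw2 : w ≤ 1 - δ := by
        have : d * w ≤ d * (1 - δ) := by rw [hdw, mul_sub, hdδ]; linarith
        exact le_of_mul_le_mul_left this d0
      have h3 := nd_ge (w := w) (by linarith) (by linarith)
      have h4 : δ ≤ 1 / 16 := by nlinarith
      have h5 : δ ≤ min w (1 - w) := le_min (by linarith) (by linarith)
      have h6 : f - 1 / 16 ≥ 1 / 2 := by rw [← hdw]; nlinarith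
      rw [max_eq_right (by linarith), max_eq_right (by rw [abs_of_nonneg (by linarith)]; linarith)]
      ring
  · have hnd : ¬ d ∣ q := by
      intro h
      rw [hqm, Nat.dvd_add_right (dvd_mul_right _ _)] at h
      exact hr0 (Nat.eq_zero_of_dvd_of_lt h hr)
    rw [if_neg hnd]
    have r1 : (1:ℝ) ≤ r := by exact_mod_cast Nat.one_le_iff_ne_zero.2 hr0
    have rd : (r:ℝ) + 1 ≤ d := by exact_mod_cast hr
    set w := (r + f) / d - δ with hw
    have hdw : d * w = r + f - 1 / 16 := by
      rw [hw, mul_sub, hdδ]; field_simp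
    have hw2 : w ≤ 1 - δ := by
      have : d * w ≤ d * (1 - δ) := by rw [hdw, mul_sub, hdδ]; linarith
      exact le_of_mul_le_mul_left this d0
    have hw1 : δ ≤ w := by
      have : d * δ ≤ d * w := by rw [hdw, hdδ]; linarith
      exact le_of_mul_le_mul_left this d0
    have h3 := nd_ge (w := w) (by linarith) (by linarith)
    have h5 : δ ≤ min w (1 - w) := le_min (by linarith) (by linarith)
    rw [max_eq_right (by linarith), mul_zero]

lemma wt_equi {α : ℝ} (hα : 1 < α) (hα' : α < 9 / 4) (h2 : α ≠ 2) :
    ∃ C η : ℝ, 0 < C ∧ 0 < η ∧ ∀ (J d : ℕ), 1 ≤ J → 1 ≤ d →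
      |∑ j ∈ (Finset.Ico J (2 * J)).filter (fun j : ℕ => d ∣ ⌊(j:ℝ) ^ α⌋₊), wt ((j:ℝ) ^ α) - (J / 16 : ℝ) * (1 / (d:ℝ))| ≤ C * (d:ℝ) ^ 2 * (J:ℝ) ^ (1 - η) := by
  obtain ⟨C, η, hC, hη, h⟩ := hat_equi hα hα' h2
  refine ⟨16 * C, η, by positivity, hη, fun J d hJ hd => ?_⟩
  have d1 : (1:ℝ) ≤ d := by exact_mod_cast hd
  have d0 : (0:ℝ) < d := by linarith
  have := h J d (1 / (16 * d)) (1 / (16 * d)) hJ hd (by positivity) (by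
    apply one_div_le_one_div_of_le (by norm_num); linarith)
  have e1 : ∑ j ∈ (Finset.Ico J (2 * J)).filter (fun j : ℕ => d ∣ ⌊(j:ℝ) ^ α⌋₊), wt ((j:ℝ) ^ α)
      = 16 * d * ∑ n ∈ Finset.range J, max (1 / (16 * d) - nd (((J + n : ℕ) : ℝ) ^ α / d - 1 / (16 * d))) 0 := by
    rw [Finset.sum_filter, Finset.sum_Ico_eq_sum_range, Finset.mul_sum, show 2 * J - J = J by omega]
    apply Finset.sum_congr rfl
    intro n _
    rw [wt_dvd (by positivity) hd]
  have e2 : (J / 16 : ℝ) * (1 / (d:ℝ)) = 16 * d * (J * (1 / (16 * d)) ^ 2) := by field_simp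
  rw [e1, e2, ← mul_sub, abs_mul, abs_of_nonneg (by positivity)]
  calc 16 * (d:ℝ) * _ ≤ 16 * d * (C * d * (J:ℝ) ^ (1 - η)) := by gcongr
    _ = _ := by ring

lemma recip_sum : ∃ C : ℝ, 0 < C ∧ ∀ Z : ℕ, 1 ≤ Z → ∑ p ∈ Nat.primesLE Z, 1 / (p:ℝ) ≤ 1 / 20 * Real.log Z + C := by
  set Y := ⌈Real.exp 20⌉₊
  refine ⟨∑ p ∈ Finset.range Y, 1 / (p:ℝ) + 1 / 20 * Real.log 4, ?_, fun Z hZ => ?_⟩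
  · have : 0 ≤ ∑ p ∈ Finset.range Y, 1 / (p:ℝ) := Finset.sum_nonneg fun _ _ => by positivity
    have : 0 < Real.log 4 := Real.log_pos (by norm_num)
    linarith
  · have hm := mertens_upper Z hZ
    have : ∑ p ∈ Nat.primesLE Z, 1 / (p:ℝ) ≤ ∑ p ∈ Nat.primesLE Z, ((if p < Y then 1 / (p:ℝ) else 0) + 1 / 20 * (Real.log p / p)) := by
      apply Finset.sum_le_sum
      intro p hp
      have hlp : 0 ≤ Real.log p / p := div_nonneg (Real.log_natCast_nonneg _) (by positivity)
      split_ifs with h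
      · linarith
      · push Not at h
        have hY : Real.exp 20 ≤ p := (Nat.le_ceil _).trans (by exact_mod_cast h)
        have hp0 : (0:ℝ) < p := lt_of_lt_of_le (Real.exp_pos _) hY
        have h20 : 20 ≤ Real.log p := by rwa [Real.le_log_iff_exp_le hp0]
        rw [zero_add, ← mul_div_assoc]
        gcongr
        linarith
    refine this.trans ?_
    rw [Finset.sum_add_distrib, ← Finset.mul_sum, ← Finset.sum_filter]
    have h2 : ∑ p ∈ (Nat.primesLE Z).filter (fun p => p < Y), 1 / (p:ℝ) ≤ ∑ p ∈ Finset.range Y, 1 / (p:ℝ) := by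
      apply Finset.sum_le_sum_of_subset_of_nonneg
      · intro p hp; exact Finset.mem_range.2 (Finset.mem_filter.1 hp).2
      · intros; positivity
    linarith

lemma exp_le_one_sub {x : ℝ} (h0 : 0 ≤ x) (h1 : x ≤ 1 / 2) : Real.exp (-(2 * x)) ≤ 1 - x := by
  rw [Real.exp_neg, inv_le_comm₀ (Real.exp_pos _) (by linarith)]
  have := Real.add_one_le_exp (2 * x)
  refine le_trans ?_ this
  rw [inv_le_iff_one_le_mul₀ (by linarith)]
  nlinarith

/-- the indices with small fractional part and rough value -/
noncomputable def RJ (α : ℝ) (J Z : ℕ) : Finset ℕ :=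
  (Finset.Ico J (2 * J)).filter (fun j : ℕ => Int.fract ((j:ℝ) ^ α) < 1 / 8 ∧ ∀ p ∈ Nat.primesLE Z, ¬ p ∣ ⌊(j:ℝ) ^ α⌋₊)

lemma rough_lower {α : ℝ} (hα : 1 < α) (hα' : α < 9 / 4) (h2 : α ≠ 2) :
    ∃ c C η : ℝ, ∃ Z0 : ℕ, 0 < c ∧ 0 < C ∧ 0 < η ∧ ∀ (Z J : ℕ), Z0 ≤ Z → 1 ≤ J →
      c * J * (Z:ℝ) ^ (-(1/10):ℝ) - C * Real.exp (9 * (Real.log Z) ^ 2) * (J:ℝ) ^ (1 - η) ≤ ((RJ α J Z).card : ℝ) := by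
  obtain ⟨C, η, hC, hη, hw⟩ := wt_equi hα hα' h2
  obtain ⟨S0, hS0, hS⟩ := recip_sum
  obtain ⟨T1, hT1⟩ : ∃ T : ℕ, ∀ Z : ℕ, T ≤ Z → 2 * Real.exp (5 * S0) ≤ (Z:ℝ) ^ (1/2 : ℝ) := by
    obtain ⟨T, hT⟩ := log_pow_le_rpow 0 (1/2) (by norm_num) (2 * Real.exp (5 * S0)) (by positivity)
    exact ⟨T, fun Z hZ => by simpa using hT Z hZ⟩
  refine ⟨1 / 32 * Real.exp (-(2 * S0)), 3 * C, η, T1 + 8, by positivity, by positivity, hη, fun Z J hZ hJ => ?_⟩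
  have hZ8 : (8:ℝ) ≤ Z := by exact_mod_cast (show 8 ≤ Z by omega)
  have hZ0 : (0:ℝ) < Z := by linarith
  have hlZ : 2 ≤ Real.log Z := by
    rw [Real.le_log_iff_exp_le hZ0]
    have : Real.exp 2 = Real.exp 1 ^ 2 := by rw [← Real.exp_nat_mul]; norm_num
    rw [this]
    have := Real.exp_one_lt_d9
    have := Real.exp_pos 1
    nlinarith
  set l := Real.log Z with hl
  set P := Nat.primesLE Z with hP
  set k := 2 * ⌈l⌉₊ with hk
  have hkl : l ≤ k := by
    have := Nat.le_ceil l
    rw [hk]; push_cast; linarith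
  have hku : (k:ℝ) ≤ 3 * l := by
    have := Nat.ceil_lt_add_one (show 0 ≤ l by linarith)
    rw [hk]; push_cast; linarith
  have hPp : ∀ p ∈ P, p.Prime := fun p hp => Nat.prime_of_mem_primesLE hp
  set R := C * ((Z:ℝ) ^ k) ^ 2 * (J:ℝ) ^ (1 - η) with hR
  have hPcard : (P.card : ℝ) ≤ Z := by
    have h : P ⊆ Finset.Ioc 0 Z := by
      intro p hp
      exact Finset.mem_Ioc.2 ⟨(hPp p hp).pos, Nat.le_of_mem_primesLE hp⟩
    have := Finset.card_le_card h
    rw [Nat.card_Ioc] at this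
    exact_mod_cast this
  have hsv := pure_sieve (Finset.Ico J (2 * J)) (fun j => wt ((j:ℝ) ^ α)) (fun j _ => wt_nonneg _) (fun j => ⌊(j:ℝ) ^ α⌋₊) P hPp k
    ⟨⌈l⌉₊, by omega⟩ (J / 16) R (by positivity) (by
      intro D hD hDk
      have hD1 : 1 ≤ ∏ p ∈ D, p := Nat.one_le_iff_ne_zero.2 (Finset.prod_ne_zero_iff.2 fun p hp => (hPp p (hD hp)).ne_zero)
      have h := hw J (∏ p ∈ D, p) hJ hD1
      have e : (1 / ((∏ p ∈ D, p : ℕ) : ℝ)) = ∏ p ∈ D, (1 / (p:ℝ)) := by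
        rw [Nat.cast_prod, Finset.prod_div_distrib]; simp
      rw [e] at h
      refine h.trans ?_
      rw [hR]
      have hle : ((∏ p ∈ D, p : ℕ) : ℝ) ≤ (Z:ℝ) ^ k := by
        rw [Nat.cast_prod]
        calc ∏ p ∈ D, (p:ℝ) ≤ ∏ p ∈ D, (Z:ℝ) := Finset.prod_le_prod (fun _ _ => by positivity) fun p hp => by
              exact_mod_cast Nat.le_of_mem_primesLE (hD hp)
          _ = (Z:ℝ) ^ D.card := by simp
          _ ≤ _ := pow_le_pow_right₀ (by linarith) hDk.le
      gcongr) (by positivity) (Real.exp 1) (by have := Real.add_one_le_exp (1:ℝ); linarith) Z (by linarith) hPcard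
  have hub : ∑ j ∈ (Finset.Ico J (2 * J)).filter (fun j : ℕ => ∀ p ∈ P, ¬ p ∣ ⌊(j:ℝ) ^ α⌋₊), wt ((j:ℝ) ^ α) ≤ ((RJ α J Z).card : ℝ) := by
    rw [Finset.card_eq_sum_ones, Nat.cast_sum]
    unfold RJ
    rw [Finset.sum_filter, Finset.sum_filter]
    apply Finset.sum_le_sum
    intro j _
    by_cases h1 : ∀ p ∈ P, ¬ p ∣ ⌊(j:ℝ) ^ α⌋₊
    · rw [if_pos h1]
      by_cases h3 : Int.fract ((j:ℝ) ^ α) < 1 / 8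
      · rw [if_pos ⟨h3, h1⟩]; simpa using wt_le _
      · rw [wt_supp (not_lt.1 h3)]; positivity
    · rw [if_neg h1, if_neg (fun h => h1 h.2)]
  refine le_trans ?_ (hsv.trans hub)
  set S := ∑ p ∈ P, 1 / (p:ℝ) with hSdef
  have hSle : S ≤ 1 / 20 * l + S0 := hS Z (by omega)
  have p1 : Real.exp (-(2 * S)) ≤ ∏ p ∈ P, (1 - 1 / (p:ℝ)) := by
    rw [hSdef, Finset.mul_sum, ← Finset.sum_neg_distrib, Real.exp_sum]
    apply Finset.prod_le_prod (fun _ _ => (Real.exp_pos _).le)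
    intro p hp
    apply exp_le_one_sub (by positivity)
    apply one_div_le_one_div_of_le (by norm_num)
    exact_mod_cast (hPp p hp).two_le
  have p2 : ∏ p ∈ P, (1 + Real.exp 1 * (1 / (p:ℝ))) ≤ Real.exp (3 * S) := by
    rw [hSdef, Finset.mul_sum, Real.exp_sum]
    apply Finset.prod_le_prod (fun _ _ => by positivity)
    intro p hp
    have h1 := Real.add_one_le_exp (Real.exp 1 * (1 / (p:ℝ)))
    have h2 : Real.exp (Real.exp 1 * (1 / (p:ℝ))) ≤ Real.exp (3 * (1 / (p:ℝ))) := by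
      apply Real.exp_le_exp.2
      have := Real.exp_one_lt_d9
      gcongr; linarith
    linarith
  have hZr : ∀ a : ℝ, (Z:ℝ) ^ a = Real.exp (a * l) := fun a => by
    rw [Real.rpow_def_of_pos hZ0, mul_comm]
  have p3 : Real.exp (-(2 * S0)) * (Z:ℝ) ^ (-(1/10):ℝ) ≤ ∏ p ∈ P, (1 - 1 / (p:ℝ)) := by
    refine le_trans ?_ p1
    rw [hZr, ← Real.exp_add]
    apply Real.exp_le_exp.2
    linarith
  have p4 : (1 / Real.exp 1) ^ k * ∏ p ∈ P, (1 + Real.exp 1 * (1 / (p:ℝ))) ≤ 1 / 2 * (Real.exp (-(2 * S0)) * (Z:ℝ) ^ (-(1/10):ℝ)) := by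
    have q1 : (1 / Real.exp 1) ^ k = Real.exp (-(k:ℝ)) := by
      rw [one_div, ← Real.exp_neg, ← Real.exp_nat_mul]; congr 1; ring
    have q2 := hT1 Z (by omega)
    calc (1 / Real.exp 1) ^ k * ∏ p ∈ P, (1 + Real.exp 1 * (1 / (p:ℝ))) ≤ Real.exp (-(k:ℝ)) * Real.exp (3 * S) := by
          rw [q1]; gcongr
      _ ≤ Real.exp (5 * S0) * (Real.exp (-(2 * S0)) * Real.exp (-(17/20) * l)) := by
          rw [← Real.exp_add, ← Real.exp_add, ← Real.exp_add]
          apply Real.exp_le_exp.2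
          linarith
      _ ≤ (1 / 2 * (Z:ℝ) ^ (1/2 : ℝ)) * (Real.exp (-(2 * S0)) * Real.exp (-(17/20) * l)) := by
          gcongr; linarith
      _ = 1 / 2 * (Real.exp (-(2 * S0)) * Real.exp (-(7/20) * l)) := by
          rw [hZr]
          have : Real.exp (-(7/20) * l) = Real.exp (1/2 * l) * Real.exp (-(17/20) * l) := by rw [← Real.exp_add]; ring_nf
          rw [this]; ring
      _ ≤ _ := by
          rw [hZr]
          have hh : Real.exp (-(7/20) * l) ≤ Real.exp (-(1/10) * l) := Real.exp_le_exp.2 (by linarith)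
          exact mul_le_mul_of_nonneg_left (mul_le_mul_of_nonneg_left hh (Real.exp_pos _).le) (by norm_num)
  have p5 : R * ((Z:ℝ) ^ k * 3) ≤ 3 * C * Real.exp (9 * l ^ 2) * (J:ℝ) ^ (1 - η) := by
    have : ((Z:ℝ) ^ k) ^ 2 * (Z:ℝ) ^ k ≤ Real.exp (9 * l ^ 2) := by
      rw [← pow_succ, ← pow_mul, ← Real.rpow_natCast, hZr]
      apply Real.exp_le_exp.2
      push_cast
      nlinarith
    calc R * ((Z:ℝ) ^ k * 3) = 3 * C * (((Z:ℝ) ^ k) ^ 2 * (Z:ℝ) ^ k) * (J:ℝ) ^ (1 - η) := by rw [hR]; ring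
      _ ≤ _ := by gcongr
  have p6 : 1 / 2 * (Real.exp (-(2 * S0)) * (Z:ℝ) ^ (-(1/10):ℝ)) ≤ ∏ p ∈ P, (1 - 1 / (p:ℝ)) - (1 / Real.exp 1) ^ k * ∏ p ∈ P, (1 + Real.exp 1 * (1 / (p:ℝ))) := by linarith
  have p7 := mul_le_mul_of_nonneg_left p6 (show (0:ℝ) ≤ J / 16 by positivity)
  have p8 : (J:ℝ) / 16 * (1 / 2 * (Real.exp (-(2 * S0)) * (Z:ℝ) ^ (-(1/10):ℝ))) = 1 / 32 * Real.exp (-(2 * S0)) * J * (Z:ℝ) ^ (-(1/10):ℝ) := by ring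
  linarith

lemma inj_sum (I : Finset ℕ) (m : ℕ → ℤ) (r : ℕ) (hinj : ∀ i ∈ I, ∀ j ∈ I, m i = m j → i = j)
    (hm : ∀ i ∈ I, 1 ≤ m i ∧ m i ≤ r) : ∑ i ∈ I, 1 / (m i : ℝ) ≤ 1 + Real.log r := by
  have h1 : ∑ i ∈ I, 1 / (m i : ℝ) = ∑ n ∈ I.image (fun i => (m i).toNat), 1 / (n:ℝ) := by
    rw [Finset.sum_image]
    · apply Finset.sum_congr rfl
      intro i hi
      have : ((m i).toNat : ℤ) = m i := Int.toNat_of_nonneg (by linarith [(hm i hi).1])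
      have : (((m i).toNat : ℤ) : ℝ) = m i := by rw [this]
      rw [← this, Int.cast_natCast]
    · intro i hi j hj hij
      simp only at hij
      have a := (hm i hi).1
      have b := (hm j hj).1
      exact hinj i hi j hj (by omega)
  rw [h1]
  have h2 : ∑ n ∈ I.image (fun i => (m i).toNat), 1 / (n:ℝ) ≤ ∑ n ∈ Finset.Icc 1 r, 1 / (n:ℝ) := by
    apply Finset.sum_le_sum_of_subset_of_nonneg
    · intro n hn
      obtain ⟨i, hi, rfl⟩ := Finset.mem_image.1 hn
      have := hm i hi
      rw [Finset.mem_Icc]; omega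
    · intros; positivity
  refine h2.trans ?_
  have := harmonic_le_one_add_log r
  rw [harmonic_eq_sum_Icc] at this
  push_cast at this
  simpa [one_div] using this

lemma inj_sum_abs (I : Finset ℕ) (m : ℕ → ℤ) (r : ℕ) (hinj : ∀ i ∈ I, ∀ j ∈ I, m i = m j → i = j)
    (hm : ∀ i ∈ I, m i ≠ 0 ∧ |m i| ≤ r) : ∑ i ∈ I, 1 / |(m i : ℝ)| ≤ 2 * (1 + Real.log r) := by
  rw [← Finset.sum_filter_add_sum_filter_not I (fun i => 0 < m i)]
  have h1 : ∑ i ∈ I.filter (fun i => 0 < m i), 1 / |(m i : ℝ)| ≤ 1 + Real.log r := by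
    refine le_trans (le_of_eq ?_) (inj_sum (I.filter (fun i => 0 < m i)) m r ?_ ?_)
    · apply Finset.sum_congr rfl
      intro i hi
      have := (Finset.mem_filter.1 hi).2
      rw [abs_of_pos (by exact_mod_cast this)]
    · intro i hi j hj; exact hinj i (Finset.mem_filter.1 hi).1 j (Finset.mem_filter.1 hj).1
    · intro i hi
      have a := (Finset.mem_filter.1 hi).2
      have b := hm i (Finset.mem_filter.1 hi).1
      exact ⟨a, (le_abs_self _).trans b.2⟩
  have h2 : ∑ i ∈ I.filter (fun i => ¬ 0 < m i), 1 / |(m i : ℝ)| ≤ 1 + Real.log r := by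
    refine le_trans (le_of_eq ?_) (inj_sum (I.filter (fun i => ¬ 0 < m i)) (fun i => - m i) r ?_ ?_)
    · apply Finset.sum_congr rfl
      intro i hi
      have := (Finset.mem_filter.1 hi).2
      rw [abs_of_nonpos (by exact_mod_cast not_lt.1 this)]; push_cast; rfl
    · intro i hi j hj h; exact hinj i (Finset.mem_filter.1 hi).1 j (Finset.mem_filter.1 hj).1 (neg_injective h)
    · intro i hi
      have a := (Finset.mem_filter.1 hi).2
      have b := hm i (Finset.mem_filter.1 hi).1
      have c := neg_abs_le (m i)
      have := b.1
      constructor <;> omega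
  linarith

/-- signed nearest-integer remainder of `h β` -/
noncomputable def rho (β : ℝ) (h : ℕ) : ℝ := h * β - round (h * β)

lemma rho_abs (β : ℝ) (h : ℕ) : |rho β h| ≤ 1 / 2 := abs_sub_round _

lemma ES_neg (α θ : ℝ) (J : ℕ) : ‖ES α (-θ) J‖ = ‖ES α θ J‖ := by
  have : ES α (-θ) J = (starRingEnd ℂ) (ES α θ J) := by
    unfold ES
    rw [map_sum]
    apply Finset.sum_congr rfl
    intro n _
    rw [neg_mul, e_neg]
  rw [this, RCLike.norm_conj]

/-- expanding the square -/
lemma sq_expand (α : ℝ) (J H : ℕ) (ρ : ℕ → ℝ) :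
    ∑ j ∈ Finset.Ico J (2 * J), ‖∑ h ∈ Finset.range H, e (ρ h * (j:ℝ) ^ α)‖ ^ 2
      ≤ ∑ h ∈ Finset.range H, ∑ h' ∈ Finset.range H, ‖ES α (ρ h - ρ h') J‖ := by
  have key : ((∑ j ∈ Finset.Ico J (2 * J), ‖∑ h ∈ Finset.range H, e (ρ h * (j:ℝ) ^ α)‖ ^ 2 : ℝ) : ℂ)
      = ∑ h ∈ Finset.range H, ∑ h' ∈ Finset.range H, ES α (ρ h - ρ h') J := by
    push_cast
    have : ∀ j ∈ Finset.Ico J (2 * J), ((‖∑ h ∈ Finset.range H, e (ρ h * (j:ℝ) ^ α)‖ : ℂ)) ^ 2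
        = ∑ h ∈ Finset.range H, ∑ h' ∈ Finset.range H, e ((ρ h - ρ h') * (j:ℝ) ^ α) := by
      intro j _
      rw [← Complex.mul_conj', map_sum, Finset.sum_mul_sum]
      apply Finset.sum_congr rfl; intro h _
      apply Finset.sum_congr rfl; intro h' _
      rw [sub_mul, e_sub]
    rw [Finset.sum_congr rfl this, Finset.sum_comm]
    apply Finset.sum_congr rfl; intro h _
    rw [Finset.sum_comm]
    apply Finset.sum_congr rfl; intro h' _
    unfold ES
    rw [Finset.sum_Ico_eq_sum_range, show 2 * J - J = J by omega]
  have hn : (0:ℝ) ≤ ∑ j ∈ Finset.Ico J (2 * J), ‖∑ h ∈ Finset.range H, e (ρ h * (j:ℝ) ^ α)‖ ^ 2 := Finset.sum_nonneg fun _ _ => by positivity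
  calc ∑ j ∈ Finset.Ico J (2 * J), ‖∑ h ∈ Finset.range H, e (ρ h * (j:ℝ) ^ α)‖ ^ 2
      = ‖((∑ j ∈ Finset.Ico J (2 * J), ‖∑ h ∈ Finset.range H, e (ρ h * (j:ℝ) ^ α)‖ ^ 2 : ℝ) : ℂ)‖ := by
        rw [Complex.norm_real, Real.norm_of_nonneg hn]
    _ ≤ _ := by
        rw [key]
        refine (norm_sum_le _ _).trans ?_
        exact Finset.sum_le_sum fun h _ => norm_sum_le _ _

lemma re_lower {α β : ℝ} {H : ℕ} (hH : 1 ≤ H) {j : ℕ} (hf : Int.fract ((j:ℝ) ^ α) < 1 / 8)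
    (hn : nd (⌊(j:ℝ) ^ α⌋₊ * β) ≤ 1 / (16 * H)) {h : ℕ} (hh : h < H) : 1 / 2 ≤ (e (rho β h * (j:ℝ) ^ α)).re := by
  set y := (j:ℝ) ^ α with hy
  have y0 : 0 ≤ y := by positivity
  set f := Int.fract y
  set q := ⌊y⌋₊
  have hf0 : 0 ≤ f := Int.fract_nonneg y
  have hyq : y = q + f := by
    have h := Int.floor_add_fract y
    rw [← Int.natCast_floor_eq_floor y0] at h
    push_cast at h
    linarith
  set s := (q:ℝ) * β - round ((q:ℝ) * β) with hs
  have hs' : |s| ≤ 1 / (16 * H) := hn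
  have H0 : (0:ℝ) < H := by exact_mod_cast hH
  have e1 : rho β h * y = (h * s + rho β h * f) + (((h:ℤ) * round ((q:ℝ) * β) - round (h * β) * (q:ℤ) : ℤ) : ℝ) := by
    rw [hyq, hs]; unfold rho; push_cast; ring
  rw [e1, e_add_int, e_re]
  set w := h * s + rho β h * f with hw
  have hwle : |w| ≤ 1 / 8 := by
    have a1 : |(h:ℝ) * s| ≤ 1 / 16 := by
      rw [abs_mul, Nat.abs_cast]
      calc (h:ℝ) * |s| ≤ H * (1 / (16 * H)) := by
            gcongr
        _ = _ := by field_simp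
    have a2 : |rho β h * f| ≤ 1 / 16 := by
      rw [abs_mul, abs_of_nonneg hf0]
      have := rho_abs β h
      have := abs_nonneg (rho β h)
      nlinarith
    have := abs_add_le ((h:ℝ) * s) (rho β h * f)
    linarith
  have hcos := Real.one_sub_sq_div_two_le_cos (x := 2 * Real.pi * w)
  refine le_trans ?_ hcos
  have hpi := Real.pi_lt_d2
  have hpi0 := Real.pi_pos
  have hx : (2 * Real.pi * w) ^ 2 ≤ 1 := by
    rw [sq_le_one_iff_abs_le_one, abs_mul, abs_of_pos (by positivity)]
    nlinarith
  linarith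

lemma K_main {α σ : ℝ} (hα : 1 < α) (hα' : α < 9 / 4) (h2 : α ≠ 2) (hσ0 : 0 < σ) (hσ : σ ≤ 1 / 6) (hσ' : 6 * σ ≤ 3 - α) :
    ∃ C : ℝ, 0 < C ∧ ∀ (J r b H : ℕ) (S : Finset ℕ), 1 ≤ J → 1 ≤ H → H ≤ r → b.Coprime r → S ⊆ Finset.Ico J (2 * J) →
      (∀ j ∈ S, Int.fract ((j:ℝ) ^ α) < 1 / 8 ∧ nd (⌊(j:ℝ) ^ α⌋₊ * ((b:ℝ) / r)) ≤ 1 / (16 * H)) →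
      (S.card : ℝ) ≤ C * J * ((1 + r * (J:ℝ) ^ (-α) * (1 + Real.log r)) / H + (J:ℝ) ^ (-σ)) := by
  obtain ⟨C, hC, hE⟩ := ES_bound (ε := 0) hα hα' h2 hσ0 hσ (by linarith)
  refine ⟨4 * (2 * C + 1), by positivity, fun J r b H S hJ hH hHr hbr hS hSj => ?_⟩
  have r1 : 1 ≤ r := hH.trans hHr
  have r0 : (0:ℝ) < r := by exact_mod_cast r1
  have J0 : (0:ℝ) < J := by exact_mod_cast hJ
  have H0 : (0:ℝ) < H := by exact_mod_cast hH
  set β := (b:ℝ) / r with hβ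
  set m : ℕ → ℤ := fun h => h * b - r * round (h * β) with hm
  have hmr : ∀ h, (m h : ℝ) = r * rho β h := by
    intro h; simp only [hm]; unfold rho; push_cast; rw [hβ]; field_simp
  have hminj : ∀ h < H, ∀ h' < H, m h = m h' → h = h' := by
    intro h hh h' hh' heq
    simp only [hm] at heq
    have hd : (r:ℤ) ∣ ((h:ℤ) - h') * b := ⟨round (h * β) - round (h' * β), by linear_combination heq⟩
    have hco : IsCoprime (r:ℤ) (b:ℤ) := (Nat.isCoprime_iff_coprime.2 hbr).symm
    have hd2 : (r:ℤ) ∣ (h:ℤ) - h' := hco.dvd_of_dvd_mul_right hd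
    have := Int.eq_zero_of_abs_lt_dvd hd2 (by rw [abs_lt]; constructor <;> omega)
    omega
  have hLow : (S.card : ℝ) * (H / 2) ^ 2 ≤ ∑ j ∈ Finset.Ico J (2 * J), ‖∑ h ∈ Finset.range H, e (rho β h * (j:ℝ) ^ α)‖ ^ 2 := by
    calc (S.card : ℝ) * (H / 2) ^ 2 = ∑ j ∈ S, ((H:ℝ) / 2) ^ 2 := by rw [Finset.sum_const, nsmul_eq_mul]
      _ ≤ ∑ j ∈ S, ‖∑ h ∈ Finset.range H, e (rho β h * (j:ℝ) ^ α)‖ ^ 2 := by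
          apply Finset.sum_le_sum
          intro j hj
          gcongr
          refine le_trans ?_ (Complex.re_le_norm _)
          rw [Complex.re_sum]
          calc (H:ℝ) / 2 = ∑ h ∈ Finset.range H, (1 / 2 : ℝ) := by simp; ring
            _ ≤ _ := Finset.sum_le_sum fun h hh => re_lower hH (hSj j hj).1 (hSj j hj).2 (Finset.mem_range.1 hh)
      _ ≤ _ := Finset.sum_le_sum_of_subset_of_nonneg hS fun _ _ _ => by positivity
  have hrow : ∀ h ∈ Finset.range H, ∑ h' ∈ Finset.range H, ‖ES α (rho β h - rho β h') J‖
      ≤ J + (C * (J:ℝ) ^ (1 - α) * r * (2 * (1 + Real.log r)) + H * (C * (J:ℝ) ^ (1 - σ))) := by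
    intro h hh
    rw [← Finset.add_sum_erase _ _ hh]
    have t0 : ‖ES α (rho β h - rho β h) J‖ ≤ J := ES_triv _ _ _
    have t1 : ∑ h' ∈ (Finset.range H).erase h, ‖ES α (rho β h - rho β h') J‖
        ≤ ∑ h' ∈ (Finset.range H).erase h, (C * (J:ℝ) ^ (1 - α) * r * (1 / |((m h - m h' : ℤ) : ℝ)|) + C * (J:ℝ) ^ (1 - σ)) := by
      apply Finset.sum_le_sum
      intro h' hh'
      have hne : h' ≠ h := (Finset.mem_erase.1 hh').1
      have hlt := Finset.mem_range.1 (Finset.mem_erase.1 hh').2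
      have hmne : m h - m h' ≠ 0 := fun h0 => hne (hminj h (Finset.mem_range.1 hh) h' hlt (by omega)).symm
      set θ := rho β h - rho β h' with hθ
      have hmθ : ((m h - m h' : ℤ) : ℝ) = r * θ := by push_cast; rw [hmr, hmr, hθ]; ring
      have hθ0 : θ ≠ 0 := by
        intro h0
        rw [h0, mul_zero] at hmθ
        exact hmne (by exact_mod_cast hmθ)
      have hθ1 : |θ| ≤ 1 := by
        have a := rho_abs β h
        have b := rho_abs β h'
        have := abs_sub (rho β h) (rho β h')
        linarith
      have hab : ‖ES α θ J‖ = ‖ES α |θ| J‖ := by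
        rcases abs_choice θ with h | h <;> rw [h]
        rw [ES_neg]
      rw [hab]
      refine (hE J |θ| hJ (abs_pos.2 hθ0) (by simpa using hθ1)).trans (le_of_eq ?_)
      rw [hmθ, abs_mul, abs_of_pos r0]
      have : |θ| ≠ 0 := abs_ne_zero.2 hθ0
      field_simp
    have t2 : ∑ h' ∈ (Finset.range H).erase h, 1 / |((m h - m h' : ℤ) : ℝ)| ≤ 2 * (1 + Real.log r) := by
      apply inj_sum_abs _ (fun h' => m h - m h') r
      · intro i hi j hj hij
        exact hminj i (Finset.mem_range.1 (Finset.mem_erase.1 hi).2) j (Finset.mem_range.1 (Finset.mem_erase.1 hj).2) (by omega)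
      · intro i hi
        have hlt := Finset.mem_range.1 (Finset.mem_erase.1 hi).2
        refine ⟨fun h0 => (Finset.mem_erase.1 hi).1 (hminj h (Finset.mem_range.1 hh) i hlt (by omega)).symm, ?_⟩
        have : |((m h - m i : ℤ) : ℝ)| ≤ r := by
          push_cast
          rw [hmr, hmr, ← mul_sub, abs_mul, abs_of_pos r0]
          have a := rho_abs β h
          have b := rho_abs β i
          have := abs_sub (rho β h) (rho β i)
          nlinarith
        exact_mod_cast this
    rw [Finset.sum_add_distrib, ← Finset.mul_sum, Finset.sum_const, nsmul_eq_mul] at t1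
    have t3 : (((Finset.range H).erase h).card : ℝ) ≤ H := by
      have := Finset.card_erase_le (s := Finset.range H) (a := h)
      rw [Finset.card_range] at this
      exact_mod_cast this
    have t4 : C * (J:ℝ) ^ (1 - α) * r * ∑ h' ∈ (Finset.range H).erase h, 1 / |((m h - m h' : ℤ) : ℝ)| ≤ C * (J:ℝ) ^ (1 - α) * r * (2 * (1 + Real.log r)) := by gcongr
    have t5 : (((Finset.range H).erase h).card : ℝ) * (C * (J:ℝ) ^ (1 - σ)) ≤ H * (C * (J:ℝ) ^ (1 - σ)) := by gcongr
    linarith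
  have hall := (hLow.trans (sq_expand α J H (rho β))).trans (Finset.sum_le_sum hrow)
  rw [Finset.sum_const, Finset.card_range, nsmul_eq_mul] at hall
  have hJa : (J:ℝ) ^ (1 - α) = J * (J:ℝ) ^ (-α) := by rw [sub_eq_add_neg, Real.rpow_add J0, Real.rpow_one]
  have hJs : (J:ℝ) ^ (1 - σ) = J * (J:ℝ) ^ (-σ) := by rw [sub_eq_add_neg, Real.rpow_add J0, Real.rpow_one]
  rw [hJa, hJs] at hall
  have hlog : 0 ≤ Real.log r := Real.log_natCast_nonneg _
  set A := (r:ℝ) * (J:ℝ) ^ (-α) * (1 + Real.log r) with hA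
  have A0 : 0 ≤ A := by positivity
  set B := (J:ℝ) ^ (-σ) with hB
  have B0 : 0 < B := by positivity
  have e1 : (H:ℝ) * (J + (C * (J * (J:ℝ) ^ (-α)) * r * (2 * (1 + Real.log r)) + H * (C * (J * B)))) = H * J * (1 + 2 * C * A) + H ^ 2 * J * C * B := by
    rw [hA]; ring
  rw [e1] at hall
  have e2 : 4 * (2 * C + 1) * J * ((1 + A) / H + B) = (4 * (2 * C + 1) * J * (H * (1 + A) + H ^ 2 * B)) / H ^ 2 := by
    field_simp
  rw [e2, le_div_iff₀ (by positivity)]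
  have f1 : (H:ℝ) * J * (1 + 2 * C * A) ≤ H * J * ((2 * C + 1) * (1 + A)) := by gcongr; nlinarith
  have f2 : (H:ℝ) ^ 2 * J * C * B ≤ (2 * C + 1) * (J * H ^ 2 * B) := by
    have : 0 < (J:ℝ) * H ^ 2 * B := by positivity
    nlinarith
  nlinarith

lemma K_delta {α σ : ℝ} (hα : 1 < α) (hα' : α < 9 / 4) (h2 : α ≠ 2) (hσ0 : 0 < σ) (hσ : σ ≤ 1 / 6) (hσ' : 6 * σ ≤ 3 - α) :
    ∃ C : ℝ, 0 < C ∧ ∀ (J r b : ℕ) (S : Finset ℕ) (Δ : ℝ), 1 ≤ J → 1 ≤ r → b.Coprime r → 0 ≤ Δ → S ⊆ Finset.Ico J (2 * J) →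
      (∀ j ∈ S, Int.fract ((j:ℝ) ^ α) < 1 / 8 ∧ nd (⌊(j:ℝ) ^ α⌋₊ * ((b:ℝ) / r)) ≤ Δ) →
      (S.card : ℝ) ≤ C * J * ((1 + r * (J:ℝ) ^ (-α) * (1 + Real.log r)) * (Δ + 1 / r) + (J:ℝ) ^ (-σ)) := by
  obtain ⟨C, hC, hK⟩ := K_main hα hα' h2 hσ0 hσ hσ'
  refine ⟨32 * (C + 1), by positivity, fun J r b S Δ hJ hr hbr hΔ hS hSj => ?_⟩
  have r0 : (0:ℝ) < r := by exact_mod_cast hr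
  have J0 : (0:ℝ) < J := by exact_mod_cast hJ
  have hlog : 0 ≤ Real.log r := Real.log_natCast_nonneg _
  set W := 1 + r * (J:ℝ) ^ (-α) * (1 + Real.log r) with hW
  have W1 : 1 ≤ W := by rw [hW]; have : 0 ≤ r * (J:ℝ) ^ (-α) * (1 + Real.log r) := by positivity
                        linarith
  set B := (J:ℝ) ^ (-σ) with hB
  have B0 : 0 < B := by positivity
  have gen : ∀ H : ℕ, 1 ≤ H → H ≤ r → Δ ≤ 1 / (16 * H) → 1 / (H:ℝ) ≤ 32 * (Δ + 1 / r) → (S.card : ℝ) ≤ 32 * (C + 1) * J * (W * (Δ + 1 / r) + B) := by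
    intro H hH hHr hHΔ hHi
    have H0 : (0:ℝ) < H := by exact_mod_cast hH
    have := hK J r b H S hJ hH hHr hbr hS (fun j hj => ⟨(hSj j hj).1, (hSj j hj).2.trans hHΔ⟩)
    refine this.trans ?_
    calc C * J * (W / H + B) = C * J * (W * (1 / H) + B) := by ring
      _ ≤ C * J * (W * (32 * (Δ + 1 / r)) + 32 * B) := by gcongr; linarith
      _ = 32 * C * J * (W * (Δ + 1 / r) + B) := by ring
      _ ≤ _ := by gcongr; linarith
  have hr1 : 0 < 1 / (r:ℝ) := by positivity
  by_cases h1 : Δ ≤ 1 / (16 * r)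
  · apply gen r hr le_rfl h1
    linarith
  push Not at h1
  have hΔ0 : 0 < Δ := lt_of_le_of_lt (by positivity) h1
  by_cases h3 : 1 ≤ 16 * Δ
  · have hc : (S.card : ℝ) ≤ J := by
      have := Finset.card_le_card hS
      rw [Nat.card_Ico] at this
      exact_mod_cast (show S.card ≤ J by omega)
    calc (S.card : ℝ) ≤ J * 1 := by linarith
      _ ≤ J * (32 * (W * (Δ + 1 / r) + B)) := by
          gcongr
          have : Δ ≤ W * (Δ + 1 / r) := by nlinarith
          linarith
      _ = 32 * 1 * J * (W * (Δ + 1 / r) + B) := by ring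
      _ ≤ _ := by gcongr; linarith
  · push Not at h3
    set y := 1 / (16 * Δ) with hy
    have hy1 : 1 ≤ y := by rw [hy, le_div_iff₀ (by positivity)]; linarith
    have hyr : y ≤ r := by
      rw [hy, div_le_iff₀ (by positivity)]
      rw [div_lt_iff₀ (by positivity)] at h1
      linarith
    set H := ⌊y⌋₊ with hH
    have H1 : 1 ≤ H := Nat.le_floor (by simpa using hy1)
    have Hy : (H:ℝ) ≤ y := Nat.floor_le (by linarith)
    have Hy2 : y < H + 1 := Nat.lt_floor_add_one y
    have H1' : (1:ℝ) ≤ H := by exact_mod_cast H1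
    have hyΔ : y * (16 * Δ) = 1 := by rw [hy]; field_simp
    apply gen H H1 (by exact_mod_cast Hy.trans hyr)
    · rw [le_div_iff₀ (by positivity)]
      nlinarith
    · rw [div_le_iff₀ (by linarith)]
      have : y ≤ 2 * H := by linarith
      nlinarith

lemma gen_num {t N Q s κ : ℝ} (ht : 1 ≤ t) (hN1 : t ^ ((7:ℝ)/2) ≤ N) (hN2 : N ≤ 2 * t ^ 4) (hQ0 : 0 < Q) (hQ : 2 * Q ≤ t ^ (s + κ))
    (hs : 3 ≤ s) (hκ : 0 < κ) (hsκ : s + 5 * κ ≤ 7 / 2) :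
    Q / N ≤ t ^ (-(3 * κ)) * min 1 (t ^ 7 / (N * Q)) ∧ t ^ (-(s - 3 + 5 * κ)) ≤ t ^ (-(3 * κ)) * min 1 (t ^ 7 / (N * Q)) := by
  have t0 : 0 < t := by linarith
  have hN0 : 0 < N := lt_of_lt_of_le (by positivity) hN1
  have t7 : t ^ 7 = t ^ (7:ℝ) := by norm_cast
  have t4 : t ^ 4 = t ^ (4:ℝ) := by norm_cast
  have hQ' : Q ≤ t ^ (s + κ) := by linarith
  rw [mul_min_of_nonneg _ _ (by positivity), mul_one]
  refine ⟨le_min ?_ ?_, le_min ?_ ?_⟩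
  · rw [div_le_iff₀ hN0]
    calc Q ≤ t ^ (s + κ) := hQ'
      _ ≤ t ^ (-(3 * κ) + 7 / 2) := Real.rpow_le_rpow_of_exponent_le ht (by linarith)
      _ = t ^ (-(3 * κ)) * t ^ ((7:ℝ) / 2) := Real.rpow_add t0 _ _
      _ ≤ _ := by gcongr
  · rw [← mul_div_assoc, div_le_div_iff₀ hN0 (by positivity), t7, ← Real.rpow_add t0]
    calc Q * (N * Q) = (Q * Q) * N := by ring
      _ ≤ (t ^ (s + κ) * t ^ (s + κ)) * N := by gcongr
      _ = t ^ (s + κ + (s + κ)) * N := by rw [← Real.rpow_add t0]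
      _ ≤ _ := mul_le_mul_of_nonneg_right (Real.rpow_le_rpow_of_exponent_le ht (by linarith)) hN0.le
  · exact Real.rpow_le_rpow_of_exponent_le ht (by linarith)
  · rw [← mul_div_assoc, le_div_iff₀ (by positivity), t7, ← Real.rpow_add t0]
    calc t ^ (-(s - 3 + 5 * κ)) * (N * Q) ≤ t ^ (-(s - 3 + 5 * κ)) * (2 * t ^ 4 * Q) := by gcongr
      _ = t ^ (-(s - 3 + 5 * κ)) * (t ^ (4:ℝ) * (2 * Q)) := by rw [t4]; ring
      _ ≤ t ^ (-(s - 3 + 5 * κ)) * (t ^ (4:ℝ) * t ^ (s + κ)) := by gcongr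
      _ = t ^ (-(s - 3 + 5 * κ) + (4 + (s + κ))) := by rw [← Real.rpow_add t0, ← Real.rpow_add t0]
      _ ≤ _ := Real.rpow_le_rpow_of_exponent_le ht (by linarith)

lemma loglog_small (e : ℝ) (he : 0 < e) : ∃ T : ℕ, ∀ t : ℕ, T ≤ t → (Real.log (Real.log t)) ^ 2 ≤ e * Real.log t := by
  have h := (Real.isLittleO_pow_log_id_atTop (n := 2)).bound he
  have ht : Filter.Tendsto (fun t : ℕ => Real.log (t:ℝ)) Filter.atTop Filter.atTop := Real.tendsto_log_atTop.comp tendsto_natCast_atTop_atTop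
  have := (ht.eventually h).and (ht.eventually (Filter.eventually_ge_atTop 0))
  obtain ⟨T, hT⟩ := Filter.eventually_atTop.1 this
  refine ⟨T, fun t h => ?_⟩
  obtain ⟨a, b⟩ := hT t h
  rw [Real.norm_of_nonneg (by positivity), id, Real.norm_of_nonneg b] at a
  exact a

lemma log_large (K : ℝ) : ∃ T : ℕ, ∀ t : ℕ, T ≤ t → K ≤ Real.log t := by
  have ht : Filter.Tendsto (fun t : ℕ => Real.log (t:ℝ)) Filter.atTop Filter.atTop := Real.tendsto_log_atTop.comp tendsto_natCast_atTop_atTop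
  exact Filter.eventually_atTop.1 (ht.eventually (Filter.eventually_ge_atTop K))

lemma card_lower {α : ℝ} (hα : 1 < α) (hα' : α < 9 / 4) (h2 : α ≠ 2) :
    ∃ c : ℝ, 0 < c ∧ ∃ T : ℕ, ∀ t : ℕ, T ≤ t → ∀ J : ℕ, t ≤ J →
      c * J * (⌈(Real.log t) ^ 40⌉₊ : ℝ) ^ (-(1/10) : ℝ) ≤ ((RJ α J ⌈(Real.log t) ^ 40⌉₊).card : ℝ) := by
  obtain ⟨c, C, η, Z0, hc, hC, hη, hR⟩ := rough_lower hα hα' h2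
  obtain ⟨T0, hT0⟩ := log_large (max 2 Z0)
  obtain ⟨T1, hT1⟩ := loglog_small (η / (3 * 9 * 1681)) (by positivity)
  obtain ⟨T2, hT2⟩ := log_pow_le_rpow 40 (η / 3) (by positivity) (C * (2 / c) * 2) (by positivity)
  refine ⟨c / 2, by positivity, max 3 (max T0 (max T1 T2)), fun t ht J hJ => ?_⟩
  simp only [max_le_iff] at ht
  obtain ⟨h3, ht0, ht1, ht2⟩ := ht
  have hl := hT0 t ht0
  rw [max_le_iff] at hl
  have hll := hT1 t ht1
  have hlp := hT2 t ht2
  set l := Real.log t with hldef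
  set Z := ⌈l ^ 40⌉₊ with hZ
  have t0 : (0:ℝ) < t := by exact_mod_cast (show 0 < t by omega)
  have t1 : (1:ℝ) ≤ t := by exact_mod_cast (show 1 ≤ t by omega)
  have J0 : (0:ℝ) < J := by exact_mod_cast (show 0 < J by omega)
  have tJ : (t:ℝ) ≤ J := by exact_mod_cast hJ
  have l0 : 0 < l := by linarith
  have l1 : 1 ≤ l := by linarith
  have hZlow : l ^ 40 ≤ Z := Nat.le_ceil _
  have hl40 : 1 ≤ l ^ 40 := one_le_pow₀ l1
  have hZ1 : (1:ℝ) ≤ Z := hl40.trans hZlow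
  have Zpos : (0:ℝ) < Z := by linarith
  have hZup : (Z:ℝ) ≤ 2 * l ^ 40 := by
    have := Nat.ceil_lt_add_one (show 0 ≤ l ^ 40 by positivity)
    linarith
  have hZ0 : Z0 ≤ Z := by
    have : (Z0:ℝ) ≤ Z := by
      refine hl.2.trans (le_trans ?_ hZlow)
      exact le_self_pow₀ l1 (by norm_num)
    exact_mod_cast this
  have hlogZ : Real.log Z ≤ 41 * Real.log l := by
    have : (Z:ℝ) ≤ l ^ 41 := by
      refine hZup.trans ?_
      rw [pow_succ l 40, mul_comm]
      exact mul_le_mul_of_nonneg_left hl.1 (by positivity)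
    have := Real.log_le_log Zpos this
    rw [Real.log_pow] at this
    push_cast at this
    exact this
  have hlogZ0 : 0 ≤ Real.log Z := Real.log_nonneg hZ1
  have hexp : Real.exp (9 * (Real.log Z) ^ 2) ≤ (t:ℝ) ^ (η / 3) := by
    rw [Real.rpow_def_of_pos t0, ← hldef, Real.exp_le_exp]
    have : (Real.log Z) ^ 2 ≤ (41 * Real.log l) ^ 2 := pow_le_pow_left₀ hlogZ0 hlogZ 2
    have e : η / (3 * 9 * 1681) * l * (9 * 1681) = l * (η / 3) := by ring
    nlinarith
  have hR' := hR Z J hZ0 (by omega)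
  refine le_trans ?_ hR'
  have hJη : (J:ℝ) ^ (1 - η) ≤ J * (t:ℝ) ^ (-η) := by
    rw [sub_eq_add_neg, Real.rpow_add J0, Real.rpow_one]
    exact mul_le_mul_of_nonneg_left (Real.rpow_le_rpow_of_nonpos t0 tJ (by linarith)) J0.le
  have hZ10 : (Z:ℝ) ^ (1/10 : ℝ) ≤ 2 * l ^ 40 := by
    refine le_trans ?_ hZup
    calc (Z:ℝ) ^ (1/10 : ℝ) ≤ (Z:ℝ) ^ (1:ℝ) := Real.rpow_le_rpow_of_exponent_le hZ1 (by norm_num)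
      _ = _ := Real.rpow_one _
  have key : C * (t:ℝ) ^ (-(2 * η / 3)) ≤ c / 2 * (Z:ℝ) ^ (-(1/10) : ℝ) := by
    rw [Real.rpow_neg t0.le, Real.rpow_neg Zpos.le, ← div_eq_mul_inv, ← div_eq_mul_inv, div_le_div_iff₀ (by positivity) (by positivity)]
    have a : (t:ℝ) ^ (η / 3) ≤ (t:ℝ) ^ (2 * η / 3) := Real.rpow_le_rpow_of_exponent_le t1 (by linarith)
    calc C * (Z:ℝ) ^ (1/10 : ℝ) ≤ C * (2 * l ^ 40) := mul_le_mul_of_nonneg_left hZ10 hC.le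
      _ = c / 2 * (C * (2 / c) * 2 * l ^ 40) := by field_simp
      _ ≤ c / 2 * (t:ℝ) ^ (2 * η / 3) := mul_le_mul_of_nonneg_left (hlp.trans a) (by positivity)
  have fin : C * Real.exp (9 * (Real.log Z) ^ 2) * (J:ℝ) ^ (1 - η) ≤ c / 2 * J * (Z:ℝ) ^ (-(1/10) : ℝ) := by
    calc C * Real.exp (9 * (Real.log Z) ^ 2) * (J:ℝ) ^ (1 - η) ≤ C * (t:ℝ) ^ (η / 3) * (J * (t:ℝ) ^ (-η)) :=
          mul_le_mul (mul_le_mul_of_nonneg_left hexp hC.le) hJη (by positivity) (by positivity)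
      _ = J * (C * ((t:ℝ) ^ (η / 3) * (t:ℝ) ^ (-η))) := by ring
      _ = J * (C * (t:ℝ) ^ (-(2 * η / 3))) := by rw [← Real.rpow_add t0]; congr 3; ring
      _ ≤ J * (c / 2 * (Z:ℝ) ^ (-(1/10) : ℝ)) := mul_le_mul_of_nonneg_left key J0.le
      _ = _ := by ring
  linarith

lemma W_bound {J : ℕ} {t : ℝ} {r : ℕ} {α : ℝ} (hJ : 1 ≤ J) (ht : 1 ≤ Real.log t) (t0 : 0 < t) (hr : 1 ≤ r)
    (h1 : (r:ℝ) ≤ 32 * (J:ℝ) ^ α) (h2 : (r:ℝ) ≤ t ^ (5:ℝ)) : 1 + r * (J:ℝ) ^ (-α) * (1 + Real.log r) ≤ 300 * Real.log t := by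
  have J0 : (0:ℝ) < J := by exact_mod_cast hJ
  have r0 : (0:ℝ) < r := by exact_mod_cast hr
  have a : r * (J:ℝ) ^ (-α) ≤ 32 := by
    rw [Real.rpow_neg J0.le, ← div_eq_mul_inv, div_le_iff₀ (by positivity)]; exact h1
  have b := Real.log_le_log r0 h2
  rw [Real.log_rpow t0] at b
  have hlog : 0 ≤ Real.log r := Real.log_natCast_nonneg _
  have c : r * (J:ℝ) ^ (-α) * (1 + Real.log r) ≤ 32 * (1 + 5 * Real.log t) := mul_le_mul a (by linarith) (by linarith) (by norm_num)
  linarith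

set_option maxHeartbeats 1600000 in
lemma fam_gen {α σ s κ ϑ : ℝ} (hα : 1 < α) (hα' : α < 9 / 4) (h2 : α ≠ 2) (hσ0 : 0 < σ) (hσ : σ ≤ 1 / 6) (hσ' : 6 * σ ≤ 3 - α)
    (hκ : 0 < κ) (hs : 3 ≤ s) (hsκ : s + 5 * κ ≤ 7 / 2) (hsσ : s - 3 + 5 * κ ≤ σ * (s / α)) (hϑ : 7 * ϑ < s) : FamEx α ϑ := by
  obtain ⟨c, hc, T0, hcard⟩ := card_lower hα hα' h2
  obtain ⟨C, hC, hK⟩ := K_delta hα hα' h2 hσ0 hσ hσ'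
  obtain ⟨T1, hT1⟩ := log_large (301 * C / c)
  obtain ⟨T2, hT2⟩ := log_pow_le_rpow 40 κ hκ (2 / c) (by positivity)
  obtain ⟨T3, hT3⟩ := log_pow_le_rpow 0 κ hκ 8 (by positivity)
  obtain ⟨T4, hT4⟩ := log_pow_le_rpow 0 (s - 7 * ϑ) (by linarith) 2 (by positivity)
  obtain ⟨T5, hT5⟩ := log_pow_le_rpow 1 κ hκ (16 * 301 * C) (by positivity)
  refine ⟨κ, hκ, max (max 256 T0) (max (max T1 T2) (max (max T3 T4) T5)), fun t ht => ?_⟩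
  simp only [max_le_iff] at ht
  obtain ⟨⟨t256, ht0⟩, ⟨ht1, ht2⟩, ⟨ht3, ht4⟩, ht5⟩ := ht
  have h1 := hT1 t ht1
  have h2' := hT2 t ht2
  have h3 := hT3 t ht3
  have h4 := hT4 t ht4
  have h5 := hT5 t ht5
  rw [pow_zero, mul_one] at h3 h4
  rw [pow_one] at h5
  have l1 := log_ge_one (show 3 ≤ t by omega)
  have tt : (256:ℝ) ≤ t := by exact_mod_cast t256
  have t0 : (0:ℝ) < t := by linarith
  have t1 : (1:ℝ) ≤ t := by linarith
  have α0 : 0 < α := by linarith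
  set J := ⌈(t:ℝ) ^ (s / α)⌉₊ with hJ
  have hJlow : (t:ℝ) ^ (s / α) ≤ J := Nat.le_ceil _
  have hsα : 1 ≤ s / α := by rw [le_div_iff₀ α0]; linarith
  have htJr : (t:ℝ) ≤ J := by
    refine le_trans ?_ hJlow
    calc (t:ℝ) = (t:ℝ) ^ (1:ℝ) := (Real.rpow_one _).symm
      _ ≤ _ := Real.rpow_le_rpow_of_exponent_le t1 hsα
  have htJ : t ≤ J := by exact_mod_cast htJr
  have J0 : (0:ℝ) < J := by linarith
  have J1 : 1 ≤ J := by omega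
  have hJup : (J:ℝ) ≤ 2 * (t:ℝ) ^ (s / α) := by
    have := Nat.ceil_lt_add_one (show 0 ≤ (t:ℝ) ^ (s / α) by positivity)
    have : (1:ℝ) ≤ (t:ℝ) ^ (s / α) := Real.one_le_rpow t1 (by linarith)
    linarith
  have hts : ((t:ℝ) ^ (s / α)) ^ α = (t:ℝ) ^ s := by
    rw [← Real.rpow_mul t0.le, div_mul_cancel₀ _ α0.ne']
  have h2α : (2:ℝ) ^ α ≤ 8 := by
    calc (2:ℝ) ^ α ≤ (2:ℝ) ^ (3:ℝ) := Real.rpow_le_rpow_of_exponent_le (by norm_num) (by linarith)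
      _ = 8 := by norm_num
  have hJα1 : (t:ℝ) ^ s ≤ (J:ℝ) ^ α := by
    rw [← hts]; exact Real.rpow_le_rpow (by positivity) hJlow α0.le
  have hts0 : 0 < (t:ℝ) ^ s := by positivity
  have hJα2 : (J:ℝ) ^ α ≤ 8 * (t:ℝ) ^ s := by
    calc (J:ℝ) ^ α ≤ (2 * (t:ℝ) ^ (s / α)) ^ α := Real.rpow_le_rpow J0.le hJup α0.le
      _ = 2 ^ α * (t:ℝ) ^ s := by rw [Real.mul_rpow (by norm_num) (by positivity), hts]
      _ ≤ _ := mul_le_mul_of_nonneg_right h2α hts0.le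
  have htsT : (t:ℝ) ≤ (t:ℝ) ^ s := by
    calc (t:ℝ) = (t:ℝ) ^ (1:ℝ) := (Real.rpow_one _).symm
      _ ≤ _ := Real.rpow_le_rpow_of_exponent_le t1 (by linarith)
  set A := (J:ℝ) ^ α with hA
  have A0 : 0 < A := by linarith
  have h2Q : A ≤ (t:ℝ) ^ (s + κ) := by
    rw [Real.rpow_add t0, mul_comm]
    exact hJα2.trans (mul_le_mul_of_nonneg_right h3 hts0.le)
  have ht5' : 32 * A ≤ (t:ℝ) ^ (5:ℝ) := by
    calc 32 * A ≤ 256 * (t:ℝ) ^ s := by linarith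
      _ ≤ t * (t:ℝ) ^ s := mul_le_mul_of_nonneg_right tt hts0.le
      _ = (t:ℝ) ^ (1 + s) := by rw [Real.rpow_add t0, Real.rpow_one]
      _ ≤ _ := Real.rpow_le_rpow_of_exponent_le t1 (by linarith)
  set d := s - 3 + 5 * κ with hd
  have hJσ : (t:ℝ) ^ d ≤ (J:ℝ) ^ σ := by
    calc (t:ℝ) ^ d ≤ (t:ℝ) ^ (σ * (s / α)) := Real.rpow_le_rpow_of_exponent_le t1 hsσ
      _ = ((t:ℝ) ^ (s / α)) ^ σ := by rw [mul_comm, Real.rpow_mul t0.le]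
      _ ≤ _ := Real.rpow_le_rpow (by positivity) hJlow hσ0.le
  have hJσ' : (J:ℝ) ^ (-σ) ≤ (t:ℝ) ^ (-d) := by
    rw [Real.rpow_neg J0.le, Real.rpow_neg t0.le]
    exact inv_anti₀ (by positivity) hJσ
  have hcd := hcard t ht0 J htJ
  set l := Real.log t with hl
  have l0 : 0 < l := by linarith
  set Z := ⌈l ^ 40⌉₊ with hZ
  have hZlow : l ^ 40 ≤ Z := Nat.le_ceil _
  have hl40 : 1 ≤ l ^ 40 := one_le_pow₀ l1
  have hZ1 : (1:ℝ) ≤ Z := hl40.trans hZlow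
  have Zpos : (0:ℝ) < Z := by linarith
  have hZup : (Z:ℝ) ≤ 2 * l ^ 40 := by
    have := Nat.ceil_lt_add_one (show 0 ≤ l ^ 40 by positivity)
    linarith
  have hZ10 : (Z:ℝ) ^ (1/10 : ℝ) ≤ 2 * l ^ 40 := by
    refine le_trans ?_ hZup
    calc (Z:ℝ) ^ (1/10 : ℝ) ≤ (Z:ℝ) ^ (1:ℝ) := Real.rpow_le_rpow_of_exponent_le hZ1 (by norm_num)
      _ = _ := Real.rpow_one _
  set 𝒥 := RJ α J Z with h𝒥
  have hcd2 : (J:ℝ) * (t:ℝ) ^ (-κ) ≤ 𝒥.card := by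
    refine le_trans ?_ hcd
    rw [mul_comm c, mul_assoc]
    refine mul_le_mul_of_nonneg_left ?_ J0.le
    rw [Real.rpow_neg t0.le, Real.rpow_neg Zpos.le, ← div_eq_mul_inv, inv_eq_one_div, div_le_div_iff₀ (by positivity) (by positivity), one_mul]
    calc (Z:ℝ) ^ (1/10 : ℝ) ≤ 2 * l ^ 40 := hZ10
      _ = c * (2 / c * l ^ 40) := by field_simp
      _ ≤ _ := mul_le_mul_of_nonneg_left h2' hc.le
  have hne : 𝒥.Nonempty := by
    rw [← Finset.card_pos]
    have : (0:ℝ) < 𝒥.card := lt_of_lt_of_le (by positivity) hcd2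
    exact_mod_cast this
  have hmem : ∀ j ∈ 𝒥, J ≤ j ∧ j < 2 * J ∧ Int.fract ((j:ℝ) ^ α) < 1/8 ∧ ∀ p ∈ Nat.primesLE Z, ¬ p ∣ ⌊(j:ℝ)^α⌋₊ := by
    intro j hj
    have a := Finset.mem_filter.1 hj
    have b := Finset.mem_Ico.1 a.1
    exact ⟨b.1, b.2, a.2.1, a.2.2⟩
  have h𝒥sub : 𝒥 ⊆ Finset.Ico J (2 * J) := Finset.filter_subset _ _
  have hq : ∀ j ∈ 𝒥, A / 2 ≤ (⌊(j:ℝ) ^ α⌋₊ : ℝ) ∧ (⌊(j:ℝ) ^ α⌋₊ : ℝ) ≤ 8 * A := by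
    intro j hj
    obtain ⟨a, b, -, -⟩ := hmem j hj
    have a' : (J:ℝ) ≤ j := by exact_mod_cast a
    have b' : (j:ℝ) ≤ 2 * J := by exact_mod_cast b.le
    have a2 : A ≤ (j:ℝ) ^ α := Real.rpow_le_rpow J0.le a' α0.le
    have b2 : (j:ℝ) ^ α ≤ 8 * A := by
      calc (j:ℝ) ^ α ≤ (2 * (J:ℝ)) ^ α := Real.rpow_le_rpow (by positivity) b' α0.le
        _ = 2 ^ α * A := by rw [Real.mul_rpow (by norm_num) J0.le]
        _ ≤ _ := mul_le_mul_of_nonneg_right h2α A0.le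
    have f1 := Nat.lt_floor_add_one ((j:ℝ) ^ α)
    have f2 := Nat.floor_le (show 0 ≤ (j:ℝ) ^ α by positivity)
    constructor <;> linarith
  have hC1 : ∀ r : ℕ, 1 ≤ r → (r:ℝ) ≤ 32 * A → 1 + r * (J:ℝ) ^ (-α) * (1 + Real.log r) ≤ 300 * l := fun r hr hrA =>
    W_bound J1 l1 t0 hr hrA (hrA.trans ht5')
  have hd1 : d ≤ 1 := by rw [hd]; linarith
  have hd0 : 0 < d := by rw [hd]; linarith
  have htd0 : 0 < (t:ℝ) ^ d := by positivity
  have htd1 : (t:ℝ) ^ d ≤ t := by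
    calc (t:ℝ) ^ d ≤ (t:ℝ) ^ (1:ℝ) := Real.rpow_le_rpow_of_exponent_le t1 hd1
      _ = _ := Real.rpow_one _
  refine ⟨𝒥, A / 2, ⌊(t:ℝ) ^ d⌋₊, (Z:ℝ), 301 * C / c * l * (Z:ℝ) ^ (1/10:ℝ), ⟨hne, ?_, ?_, ?_, ?_, ?_, ?_, ?_, ?_, ?_, ?_⟩, ?_⟩
  · linarith
  · have : (t:ℝ) ^ (s + κ) ≤ (t:ℝ) ^ ((7:ℝ)/2 - κ) := Real.rpow_le_rpow_of_exponent_le t1 (by linarith)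
    linarith
  · intro j hj
    have := hq j hj
    constructor
    · exact this.1
    · linarith [this.2]
  · intro j hj p hp hpj
    have := (hmem j hj).2.2.2 p
    by_contra hlt
    push Not at hlt
    exact this (Nat.mem_primesLE.2 ⟨by exact_mod_cast hlt.le, hp⟩) hpj
  · exact Nat.floor_le_of_le htd1
  · positivity
  · rw [Real.sqrt_eq_rpow]
    have e : (Z:ℝ) ^ (1/2:ℝ) = (Z:ℝ) ^ (4/10:ℝ) * (Z:ℝ) ^ (1/10:ℝ) := by rw [← Real.rpow_add Zpos]; norm_num
    have e2 : l ^ 16 ≤ (Z:ℝ) ^ (4/10:ℝ) := by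
      calc l ^ 16 = (l ^ 40) ^ (4/10:ℝ) := by
            rw [← Real.rpow_natCast, ← Real.rpow_natCast, ← Real.rpow_mul l0.le]; norm_num
        _ ≤ _ := Real.rpow_le_rpow (by positivity) hZlow (by norm_num)
    rw [e]
    calc 301 * C / c * l * (Z:ℝ) ^ (1/10:ℝ) * l ^ 10 = (301 * C / c * l ^ 11) * (Z:ℝ) ^ (1/10:ℝ) := by ring
      _ ≤ (l * l ^ 11) * (Z:ℝ) ^ (1/10:ℝ) := by
          refine mul_le_mul_of_nonneg_right (mul_le_mul_of_nonneg_right h1 (by positivity)) (by positivity)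
      _ ≤ (Z:ℝ) ^ (4/10:ℝ) * (Z:ℝ) ^ (1/10:ℝ) := by
          refine mul_le_mul_of_nonneg_right (le_trans ?_ e2) (by positivity)
          rw [← pow_succ']
          exact pow_le_pow_right₀ l1 (by norm_num)
  · exact (pow_le_pow_right₀ l1 (by norm_num)).trans hZlow
  · intro r hr2 hrL
    have hr0 : (0:ℝ) < r := by exact_mod_cast (show 0 < r by omega)
    have hrd : (r:ℝ) ≤ (t:ℝ) ^ d := (Nat.le_floor_iff htd0.le).1 hrL
    have hrA : (r:ℝ) ≤ 32 * A := by linarith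
    have k := hK J r 1 (𝒥.filter (fun j : ℕ => r ∣ ⌊(j:ℝ) ^ α⌋₊)) 0 J1 (by omega) (Nat.coprime_one_left r) le_rfl
      ((Finset.filter_subset _ _).trans h𝒥sub) (by
        intro j hj
        obtain ⟨hj1, hj2⟩ := Finset.mem_filter.1 hj
        refine ⟨(hmem j hj1).2.2.1, ?_⟩
        obtain ⟨m, hm⟩ := hj2
        rw [hm]
        have : (((r * m : ℕ) : ℝ)) * (((1:ℕ):ℝ) / r) = ((m:ℤ):ℝ) := by push_cast; field_simp
        rw [this]
        simp [nd])
    refine k.trans ?_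
    have w := hC1 r (by omega) hrA
    have hJr : (J:ℝ) ^ (-σ) ≤ l * (1 / r) := by
      have : (t:ℝ) ^ (-d) ≤ 1 / r := by
        rw [Real.rpow_neg t0.le, inv_eq_one_div]
        exact one_div_le_one_div_of_le hr0 hrd
      have b : 0 < 1 / (r:ℝ) := by positivity
      nlinarith
    have hcd' : c * J ≤ 𝒥.card * (Z:ℝ) ^ (1/10:ℝ) := by
      calc c * J = (c * J * (Z:ℝ) ^ (-(1/10):ℝ)) * (Z:ℝ) ^ (1/10:ℝ) := by
            rw [mul_assoc, ← Real.rpow_add Zpos]; norm_num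
        _ ≤ _ := mul_le_mul_of_nonneg_right hcd (by positivity)
    calc C * J * ((1 + r * (J:ℝ) ^ (-α) * (1 + Real.log r)) * (0 + 1 / r) + (J:ℝ) ^ (-σ))
        ≤ C * J * (300 * l * (0 + 1 / r) + l * (1 / r)) := by
          refine mul_le_mul_of_nonneg_left ?_ (by positivity)
          exact add_le_add (mul_le_mul_of_nonneg_right w (by positivity)) hJr
      _ = (301 * C / c * l / r) * (c * J) := by field_simp; ring
      _ ≤ (301 * C / c * l / r) * (𝒥.card * (Z:ℝ) ^ (1/10:ℝ)) := mul_le_mul_of_nonneg_left hcd' (by positivity)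
      _ = _ := by ring
  · intro N hN1 hN2 j₀ hj₀ k hk0 hk hL
    have hq0 : 0 < ⌊(j₀:ℝ) ^ α⌋₊ := by
      have : (0:ℝ) < ⌊(j₀:ℝ) ^ α⌋₊ := by linarith [(hq j₀ hj₀).1]
      exact_mod_cast this
    obtain ⟨hfr, hco⟩ := frac_reduce (k := k) hq0
    set q₀ := ⌊(j₀:ℝ) ^ α⌋₊ with hq₀
    set r := q₀ / k.gcd q₀ with hr
    set b := k / k.gcd q₀ with hb
    have hrq : r ≤ q₀ := Nat.div_le_self _ _
    have hrd : (t:ℝ) ^ d < r := Nat.lt_of_floor_lt hL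
    have hr0 : (0:ℝ) < r := by linarith
    have hr1 : 1 ≤ r := by exact_mod_cast hr0
    have hrA : (r:ℝ) ≤ 32 * A := by
      have : (r:ℝ) ≤ q₀ := by exact_mod_cast hrq
      linarith [(hq j₀ hj₀).2]
    have w := hC1 r hr1 hrA
    have hr1d : 1 / (r:ℝ) ≤ (t:ℝ) ^ (-d) := by
      rw [Real.rpow_neg t0.le, inv_eq_one_div]
      exact one_div_le_one_div_of_le htd0 hrd.le
    have hNpos : (0:ℝ) < N := lt_of_lt_of_le (by positivity) hN1
    have htd' : 0 < (t:ℝ) ^ (-d) := by positivity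
    have hlay := layer 𝒥 (fun j => N * nd ((⌊(j:ℝ) ^ α⌋₊ : ℝ) * (k / (q₀:ℝ))) / (A / 2))
      (fun j _ => by have := nd_nonneg ((⌊(j:ℝ) ^ α⌋₊ : ℝ) * (k / (q₀:ℝ))); positivity)
      (C * J * (300 * l * (A / 2 / N))) (C * J * (301 * l * (t:ℝ) ^ (-d))) (by positivity) (by positivity) (by
        intro i
        have kk := hK J r b (𝒥.filter (fun j => N * nd ((⌊(j:ℝ) ^ α⌋₊ : ℝ) * (k / (q₀:ℝ))) / (A / 2) ≤ 2 ^ i)) (2 ^ i * (A / 2 / N)) J1 hr1 hco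
          (by positivity) ((Finset.filter_subset _ _).trans h𝒥sub) (by
            intro j hj
            obtain ⟨hj1, h⟩ := Finset.mem_filter.1 hj
            refine ⟨(hmem j hj1).2.2.1, ?_⟩
            rw [hfr, div_le_iff₀ (by positivity)] at h
            have e : (2:ℝ) ^ i * (A / 2 / N) = 2 ^ i * (A / 2) / N := by ring
            rw [e, le_div_iff₀ hNpos]
            linarith)
        refine kk.trans ?_
        calc C * J * ((1 + r * (J:ℝ) ^ (-α) * (1 + Real.log r)) * (2 ^ i * (A / 2 / N) + 1 / r) + (J:ℝ) ^ (-σ))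
            ≤ C * J * (300 * l * (2 ^ i * (A / 2 / N) + (t:ℝ) ^ (-d)) + l * (t:ℝ) ^ (-d)) := by
              refine mul_le_mul_of_nonneg_left ?_ (by positivity)
              refine add_le_add (mul_le_mul w (by linarith) (by positivity) (by positivity)) ?_
              nlinarith
          _ = _ := by ring)
    refine hlay.trans ?_
    obtain ⟨n1, n2⟩ := gen_num (t := t) (N := N) (Q := A / 2) (s := s) (κ := κ) t1 hN1 (by exact_mod_cast hN2) (by positivity) (by linarith) hs hκ hsκ
    set m := min 1 ((t:ℝ) ^ 7 / (N * (A / 2))) with hm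
    have hm0 : 0 ≤ m := le_min zero_le_one (by positivity)
    rw [← hd] at n2
    have hQN : 0 ≤ A / 2 / N := by positivity
    calc 8 * (C * J * (300 * l * (A / 2 / N)) + C * J * (301 * l * (t:ℝ) ^ (-d)))
        ≤ 8 * (C * J * (301 * l * (A / 2 / N)) + C * J * (301 * l * (t:ℝ) ^ (-d))) := by
          gcongr; norm_num
      _ = 8 * 301 * C * l * J * (A / 2 / N + (t:ℝ) ^ (-d)) := by ring
      _ ≤ 8 * 301 * C * l * J * ((t:ℝ) ^ (-(3 * κ)) * m + (t:ℝ) ^ (-(3 * κ)) * m) :=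
          mul_le_mul_of_nonneg_left (add_le_add n1 n2) (by positivity)
      _ = 16 * 301 * C * l * (J * (t:ℝ) ^ (-(3 * κ)) * m) := by ring
      _ ≤ (t:ℝ) ^ κ * (J * (t:ℝ) ^ (-(3 * κ)) * m) := mul_le_mul_of_nonneg_right h5 (by positivity)
      _ = J * ((t:ℝ) ^ κ * (t:ℝ) ^ (-(3 * κ))) * m := by ring
      _ = J * ((t:ℝ) ^ (-κ) * (t:ℝ) ^ (-κ)) * m := by
          rw [← Real.rpow_add t0, ← Real.rpow_add t0]; congr 3; ring
      _ = (J * (t:ℝ) ^ (-κ)) * ((t:ℝ) ^ (-κ) * m) := by ring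
      _ ≤ 𝒥.card * ((t:ℝ) ^ (-κ) * m) := mul_le_mul_of_nonneg_right hcd2 (by positivity)
      _ = _ := by ring
  · have e : (t:ℝ) ^ s = (t:ℝ) ^ (7 * ϑ) * (t:ℝ) ^ (s - 7 * ϑ) := by rw [← Real.rpow_add t0]; congr 1; ring
    have : 0 < (t:ℝ) ^ (7 * ϑ) := by positivity
    nlinarith

lemma phi_aux {α N D : ℝ} (hD : 0 < D) (h1 : 0.44 * D < N) (h2 : 2 * N < D) (h3 : 6 * (α * (7 * N - 3 * D)) < 7 * N)
    (h4 : 6 * (α * (7 * N - 3 * D)) < (3 - α) * (7 * N)) :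
    0.44 < N / D ∧ N / D < 1 / 2 ∧ 6 * (α * (7 * (N / D) - 3)) < 7 * (N / D) ∧ 6 * (α * (7 * (N / D) - 3)) < (3 - α) * (7 * (N / D)) := by
  have hN : N = N / D * D := by field_simp
  set x := N / D
  rw [hN] at h1 h2 h3 h4
  refine ⟨?_, ?_, ?_, ?_⟩
  · exact lt_of_mul_lt_mul_right h1 hD.le
  · refine lt_of_mul_lt_mul_right ?_ hD.le; linarith
  · refine lt_of_mul_lt_mul_right ?_ hD.le; nlinarith
  · refine lt_of_mul_lt_mul_right ?_ hD.le; nlinarith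

lemma phi_facts {α : ℝ} (hα : 1 < α) (hα' : α < 9 / 4) (h2 : α ≠ 2) :
    0.44 < PhiLevel α ∧ PhiLevel α < 1 / 2 ∧ 6 * (α * (7 * PhiLevel α - 3)) < 7 * PhiLevel α ∧
      6 * (α * (7 * PhiLevel α - 3)) < (3 - α) * (7 * PhiLevel α) := by
  unfold PhiLevel
  split_ifs with c1 c2 c3
  · apply phi_aux <;> nlinarith
  · apply phi_aux <;> nlinarith
  · push Not at c2
    have : 2 < α := lt_of_le_of_ne c2 (Ne.symm h2)
    apply phi_aux <;> nlinarith
  · push Not at c3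
    apply phi_aux <;> nlinarith

lemma phi_two : PhiLevel 2 = 13 / 28 := by
  unfold PhiLevel; norm_num

lemma fam_all {α : ℝ} (hα : 1 < α) (hα' : α < 9 / 4) (ϑ : ℝ) (h0 : 0.44 ≤ ϑ) (h1 : ϑ < PhiLevel α) : FamEx α ϑ := by
  by_cases h2 : α = 2
  · subst h2
    rw [phi_two] at h1
    exact fam_two ϑ (by linarith) h1.le
  obtain ⟨p1, p2, p3, p4⟩ := phi_facts hα hα' h2
  set Φ := PhiLevel α
  obtain ⟨σ, hσ0, hσ, hσ', hσm⟩ : ∃ σ : ℝ, 0 < σ ∧ σ ≤ 1 / 6 ∧ 6 * σ ≤ 3 - α ∧ α * (7 * Φ - 3) < σ * (7 * Φ) := by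
    rcases le_total α 2 with h | h
    · exact ⟨1 / 6, by norm_num, le_rfl, by linarith, by linarith⟩
    · exact ⟨(3 - α) / 6, by linarith, by linarith, by linarith, by linarith⟩
  have α0 : 0 < α := by linarith
  set s := 7 * ((ϑ + Φ) / 2) with hs
  have s1 : s < 7 * Φ := by rw [hs]; linarith
  have s2 : 7 * ϑ < s := by rw [hs]; linarith
  have hg : 0 < σ * (s / α) - (s - 3) := by
    have : 0 < σ * s - α * (s - 3) := by nlinarith
    have e : σ * (s / α) - (s - 3) = (σ * s - α * (s - 3)) / α := by field_simp
    rw [e]; positivity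
  set κ := min ((7 / 2 - s) / 5) ((σ * (s / α) - (s - 3)) / 5) with hκ
  have k1 : κ ≤ (7 / 2 - s) / 5 := min_le_left _ _
  have k2 : κ ≤ (σ * (s / α) - (s - 3)) / 5 := min_le_right _ _
  have k0 : 0 < κ := lt_min (by linarith) (by linarith)
  exact fam_gen hα hα' h2 hσ0 hσ hσ' k0 (by linarith) (by linarith) (by linarith) s2

lemma final_all {α : ℝ} (hα : 1 < α) (hα' : α < 9 / 4) (ϑ : ℝ) (h1 : ϑ < PhiLevel α) :
    ∀ n₀ : ℕ, ∃ p : ℕ, n₀ < p ∧ p.Prime ∧ (p : ℝ) ^ ϑ ≤ (PSdivisor α (p - 1) : ℝ) := by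
  have hΦ : 0.44 < PhiLevel α := by
    by_cases h2 : α = 2
    · subst h2; rw [phi_two]; norm_num
    · exact (phi_facts hα hα' h2).1
  intro n₀
  have hm : (0.44:ℝ) ≤ max ϑ 0.44 := le_max_right _ _
  obtain ⟨p, hp1, hp2, hp3⟩ := final_of_fam (α := α) (ϑ := max ϑ 0.44) (by linarith) (fam_all hα hα' _ hm (max_lt h1 hΦ)) n₀
  refine ⟨p, hp1, hp2, le_trans ?_ hp3⟩
  exact Real.rpow_le_rpow_of_exponent_le (by exact_mod_cast hp2.one_lt.le) (le_max_left _ _)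

end PS
end

theorem infinitely_many_primes_with_large_PS_divisor
    (α : ℝ) (hα : 1 < α) (hα' : α < 9 / 4)
    (ϑ : ℝ) (hϑ : 0 < ϑ) (hϑ' : ϑ < PhiLevel α) :
    ∀ n₀ : ℕ, ∃ p : ℕ, n₀ < p ∧ p.Prime ∧ (p : ℝ) ^ ϑ ≤ (PSdivisor α (p - 1) : ℝ) := by
  exact PS.final_all hα hα' ϑ hϑ'
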